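/- There is a constant C (depending only on b, c_+, c_- and the fixed cutoff functions) such that for every integer ℓ≥1, every p∈(1,2], and every nonempty U⊂(0,∞), ‖ sup_{u∈U} sup_{j∈ℤ} |A_{j,ℓ}^u f| ‖_{L^p(ℝ²)} ≤ C θ_{p,ℓ} 𝒦_p(U,2^{-ℓ}) ‖f‖_{L^p(ℝ²)} for all Schwartz functions f on ℝ². -/

import Mathlib

open MeasureTheory Filter Set Topology
open scoped ENNReal NNReal Topology Classical

noncomputable section

/-- The homogeneous curve of degree `b`: `γ_b(t) = c₊ t^b` for `t > 0`,
`γ_b(t) = c₋ (-t)^b` for `t < 0`, `γ_b(0) = 0`. -/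
def curve (b cp cm t : ℝ) : ℝ :=
  if 0 < t then cp * t ^ b else if t < 0 then cm * (-t) ^ b else 0

/-- The maximal function along the curve `(t, u γ_b(t))`. -/
def Mu (b cp cm u : ℝ) (f : ℝ × ℝ → ℝ) (x : ℝ × ℝ) : ℝ :=
  ⨆ R : {R : ℝ // 0 < R},
    ((R : ℝ))⁻¹ * ∫ t in (0:ℝ)..(R : ℝ), |f (x - (t, u * curve b cp cm t))|

/-- The maximal function `𝓜^U f = sup_{u ∈ U} M^{(u)} f`. -/
def calM (b cp cm : ℝ) (U : Set ℝ) (f : ℝ × ℝ → ℝ) (x : ℝ × ℝ) : ℝ :=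
  ⨆ u : U, Mu b cp cm (u : ℝ) f x

/-- The Hilbert transform along the curve `(t, u γ_b(t))` (principal value). -/
def Hu (b cp cm u : ℝ) (f : ℝ × ℝ → ℝ) (x : ℝ × ℝ) : ℝ :=
  limUnder (𝓝[>] (0:ℝ)) fun ε : ℝ =>
    ∫ t in {t : ℝ | ε < |t| ∧ |t| < ε⁻¹}, f (x - (t, u * curve b cp cm t)) / t

/-- The maximal function `𝓗^U f = sup_{u ∈ U} |H^{(u)} f|`, valued in `ℝ≥0∞`. -/
def calH (b cp cm : ℝ) (U : Set ℝ) (f : ℝ × ℝ → ℝ) (x : ℝ × ℝ) : ℝ≥0∞ :=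
  ⨆ u : U, ENNReal.ofReal |Hu b cp cm (u : ℝ) f x|

/-- The `L^p` norm of an `ℝ≥0∞`-valued function on `ℝ²`. -/
def lpN (g : ℝ × ℝ → ℝ≥0∞) (p : ℝ) : ℝ≥0∞ :=
  (∫⁻ x : ℝ × ℝ, g x ^ p) ^ (1 / p)

def eN (p : ℝ) : ℝ≥0∞ := ENNReal.ofReal p

/-- `U^r = r⁻¹ U ∩ [1,2] = {ρ ∈ [1,2] : rρ ∈ U}`. -/
def UrSet (U : Set ℝ) (r : ℝ) : Set ℝ := {ρ : ℝ | ρ ∈ Icc (1:ℝ) 2 ∧ r * ρ ∈ U}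

/-- `N(A,δ)`: minimal number of intervals of length `δ` needed to cover `A`. -/
def covN (A : Set ℝ) (δ : ℝ) : ℕ :=
  sInf {n : ℕ | ∃ F : Finset ℝ, F.card = n ∧ A ⊆ ⋃ a ∈ F, Icc a (a + δ)}

/-- `𝒦_p(U,δ) = δ^{1-1/p} sup_{r>0} N(U^r,δ)^{1/p}`. -/
def Kp (U : Set ℝ) (δ p : ℝ) : ℝ :=
  δ ^ (1 - 1 / p) * ⨆ r : {r : ℝ // 0 < r}, ((covN (UrSet U (r : ℝ)) δ : ℝ)) ^ (1 / p)

/-- `p_cr(U) = 1 + limsup_{δ→0+} sup_{r>0} log N(U^r,δ) / log(1/δ)`. -/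
def pcr (U : Set ℝ) : ℝ :=
  1 + limsup (fun δ : ℝ =>
      (⨆ r : {r : ℝ // 0 < r}, Real.log (covN (UrSet U (r : ℝ)) δ)) / Real.log δ⁻¹)
    (𝓝[>] (0:ℝ))

/-- `𝔑(U) = 1 + #{n ∈ ℤ : [2ⁿ, 2ⁿ⁺¹] ∩ U ≠ ∅}`. -/
def frakN (U : Set ℝ) : ℕ∞ :=
  1 + Set.encard {n : ℤ | (Icc ((2:ℝ) ^ n) ((2:ℝ) ^ (n + 1)) ∩ U).Nonempty}

/-- `√(log 𝔑(U))`, valued in `ℝ≥0∞` (equal to `∞` if `𝔑(U) = ∞`). -/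
def sqrtLogN (U : Set ℝ) : ℝ≥0∞ :=
  if frakN U = ⊤ then ⊤
  else ENNReal.ofReal (Real.sqrt (Real.log ((frakN U).toNat : ℝ)))

/-- The `L^p → L^p` operator norm of `𝓜^U` (smallest admissible constant, possibly `∞`). -/
def opNormM (b cp cm : ℝ) (U : Set ℝ) (p : ℝ) : ℝ≥0∞ :=
  sInf {C : ℝ≥0∞ | ∀ f : SchwartzMap (ℝ × ℝ) ℝ,
    eLpNorm (calM b cp cm U ⇑f) (eN p) volume ≤ C * eLpNorm ⇑f (eN p) volume}

/-- The `L^p → L^p` operator norm of `𝓗^U` (smallest admissible constant, possibly `∞`). -/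
def opNormH (b cp cm : ℝ) (U : Set ℝ) (p : ℝ) : ℝ≥0∞ :=
  sInf {C : ℝ≥0∞ | ∀ f : SchwartzMap (ℝ × ℝ) ℝ,
    lpN (calH b cp cm U ⇑f) p ≤ C * eLpNorm ⇑f (eN p) volume}

/-- `θ_{p,ℓ}`. -/
def theta (p : ℝ) (l : ℕ) : ℝ :=
  if (l : ℝ) ≤ (p - 1)⁻¹ then (p - 1) ^ (3 - 10 / p) else (l : ℝ) ^ (7 * (2 / p - 1))

/-- `Σ_{ℓ≥1} θ_{p,ℓ} 𝒦_p(U, 2^{-ℓ})`, valued in `ℝ≥0∞`. -/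
def KpSum (U : Set ℝ) (p : ℝ) : ℝ≥0∞ :=
  ∑' l : ℕ, ENNReal.ofReal (theta p (l + 1) * Kp U ((2:ℝ) ^ (-((l : ℝ) + 1))) p)

/-- The Fourier transform on `ℝ²`. -/
def FT (f : ℝ × ℝ → ℂ) (ξ : ℝ × ℝ) : ℂ :=
  ∫ x : ℝ × ℝ,
    Complex.exp ((((-(2 * Real.pi * (x.1 * ξ.1 + x.2 * ξ.2))) : ℝ) : ℂ) * Complex.I) * f x

/-- The inverse Fourier transform on `ℝ²`. -/
def FTinv (g : ℝ × ℝ → ℂ) (x : ℝ × ℝ) : ℂ :=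
  ∫ ξ : ℝ × ℝ,
    Complex.exp (((2 * Real.pi * (x.1 * ξ.1 + x.2 * ξ.2) : ℝ) : ℂ) * Complex.I) * g ξ

/-- `τ̂₀(ξ) = ∫ e^{-2πi(ξ₁t + ξ₂γ_b(t))} χ₊(t) dt`. -/
def tauHat (b cp cm : ℝ) (χp : ℝ → ℝ) (ξ : ℝ × ℝ) : ℂ :=
  ∫ t : ℝ,
    Complex.exp ((((-(2 * Real.pi * (ξ.1 * t + ξ.2 * curve b cp cm t))) : ℝ) : ℂ) * Complex.I)
      * ((χp t : ℝ) : ℂ)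

/-- `σ̂(ξ) = ∫ e^{-2πi(ξ₁t + ξ₂γ_b(t))} χ(t) dt/t` for a cutoff `χ`. -/
def sigmaHat (b cp cm : ℝ) (χ : ℝ → ℝ) (ξ : ℝ × ℝ) : ℂ :=
  ∫ t : ℝ,
    Complex.exp ((((-(2 * Real.pi * (ξ.1 * t + ξ.2 * curve b cp cm t))) : ℝ) : ℂ) * Complex.I)
      * ((χ t / t : ℝ) : ℂ)

/-- `ρ̂₀(ξ) = (1-η₀(ξ)) ς₋(ξ₁/(c₊ξ₂)) τ̂₀(ξ)`. -/
def rhoHat (b cp cm : ℝ) (χp : ℝ → ℝ) (η : ℝ × ℝ → ℝ) (ςm : ℝ → ℝ) (ξ : ℝ × ℝ) : ℂ :=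
  (((1 - η ξ) * ςm (ξ.1 / (cp * ξ.2)) : ℝ) : ℂ) * tauHat b cp cm χp ξ

/-- `μ̂_{0,±}`; `sgn = true` is the `+` sign. -/
def muHat (b cp cm : ℝ) (χp : ℝ → ℝ) (η : ℝ × ℝ → ℝ) (ςp ςm : ℝ → ℝ) (sgn : Bool)
    (ξ : ℝ × ℝ) : ℂ :=
  if sgn then
    (((1 - η ξ) * ςm (ξ.1 / (cp * ξ.2)) : ℝ) : ℂ) * sigmaHat b cp cm χp ξ
  else
    (((1 - η ξ) * ςp (ξ.1 / (cm * ξ.2)) : ℝ) : ℂ) * sigmaHat b cp cm (fun t => χp (-t)) ξ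

/-- `ζ_ℓ(ξ) = ζ₀(2^{-ℓ}ξ) - ζ₀(2^{1-ℓ}ξ)`. -/
def zl (ζ : ℝ × ℝ → ℝ) (l : ℕ) (ξ : ℝ × ℝ) : ℝ :=
  ζ ((2:ℝ) ^ (-(l : ℝ)) • ξ) - ζ ((2:ℝ) ^ (1 - (l : ℝ)) • ξ)

/-- The anisotropic dilation `ξ ↦ (2^{-j}ξ₁, 2^{-jb} u ξ₂)`. -/
def dil (b : ℝ) (j : ℤ) (u : ℝ) (ξ : ℝ × ℝ) : ℝ × ℝ :=
  ((2:ℝ) ^ (-(j : ℝ)) * ξ.1, (2:ℝ) ^ (-((j : ℝ) * b)) * (u * ξ.2))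

/-- `A_{j,ℓ}^u`, defined via `(A_{j,ℓ}^u f)^(ξ) = ζ_ℓ(...) ρ̂₀(...) f̂(ξ)`. -/
def Ajl (b cp cm : ℝ) (χp : ℝ → ℝ) (η : ℝ × ℝ → ℝ) (ςm : ℝ → ℝ) (ζ : ℝ × ℝ → ℝ)
    (j : ℤ) (l : ℕ) (u : ℝ) (f : ℝ × ℝ → ℝ) : ℝ × ℝ → ℂ :=
  FTinv fun ξ =>
    ((zl ζ l (dil b j u ξ) : ℝ) : ℂ) * rhoHat b cp cm χp η ςm (dil b j u ξ)
      * FT (fun x => ((f x : ℝ) : ℂ)) ξ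

/-- `T_{j,ℓ,±}^u`, defined via `(T_{j,ℓ,±}^u f)^(ξ) = ζ_ℓ(...) μ̂_{0,±}(...) f̂(ξ)`. -/
def Tjl (b cp cm : ℝ) (χp : ℝ → ℝ) (η : ℝ × ℝ → ℝ) (ςp ςm : ℝ → ℝ) (ζ : ℝ × ℝ → ℝ)
    (sgn : Bool) (j : ℤ) (l : ℕ) (u : ℝ) (f : ℝ × ℝ → ℝ) : ℝ × ℝ → ℂ :=
  FTinv fun ξ =>
    ((zl ζ l (dil b j u ξ) : ℝ) : ℂ) * muHat b cp cm χp η ςp ςm sgn (dil b j u ξ)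
      * FT (fun x => ((f x : ℝ) : ℂ)) ξ

/-- `φ̂₀(ξ) = η₀(ξ)τ̂₀(ξ) + (1-η₀(ξ))(1-ς₋(ξ₁/(c₊ξ₂)))τ̂₀(ξ)` (maximal-function version). -/
def phiHatTau (b cp cm : ℝ) (χp : ℝ → ℝ) (η : ℝ × ℝ → ℝ) (ςm : ℝ → ℝ) (ξ : ℝ × ℝ) : ℂ :=
  ((η ξ + (1 - η ξ) * (1 - ςm (ξ.1 / (cp * ξ.2))) : ℝ) : ℂ) * tauHat b cp cm χp ξ

/-- `A_{j,0}^u`, defined via `(A_{j,0}^u f)^(ξ) = φ̂₀(2^{-j}ξ₁, 2^{-jb}uξ₂) f̂(ξ)`. -/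
def Aj0 (b cp cm : ℝ) (χp : ℝ → ℝ) (η : ℝ × ℝ → ℝ) (ςm : ℝ → ℝ)
    (j : ℤ) (u : ℝ) (f : ℝ × ℝ → ℝ) : ℝ × ℝ → ℂ :=
  FTinv fun ξ => phiHatTau b cp cm χp η ςm (dil b j u ξ) * FT (fun x => ((f x : ℝ) : ℂ)) ξ

/-- `φ̂₀(ξ)` (Hilbert-transform version, built from `σ̂_±`). -/
def phiHatSigma (b cp cm : ℝ) (χp : ℝ → ℝ) (η : ℝ × ℝ → ℝ) (ςp ςm : ℝ → ℝ)
    (ξ : ℝ × ℝ) : ℂ :=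
  ((η ξ : ℝ) : ℂ) * (sigmaHat b cp cm χp ξ + sigmaHat b cp cm (fun t => χp (-t)) ξ)
    + (((1 - η ξ) * (1 - ςm (ξ.1 / (cp * ξ.2))) : ℝ) : ℂ) * sigmaHat b cp cm χp ξ
    + (((1 - η ξ) * (1 - ςp (ξ.1 / (cm * ξ.2))) : ℝ) : ℂ)
        * sigmaHat b cp cm (fun t => χp (-t)) ξ

/-- `S^{(u)}`, defined via `(S^{(u)} f)^(ξ) = Σ_j φ̂₀(2^{-j}ξ₁, 2^{-jb}uξ₂) f̂(ξ)`. -/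
def Sop (b cp cm : ℝ) (χp : ℝ → ℝ) (η : ℝ × ℝ → ℝ) (ςp ςm : ℝ → ℝ)
    (u : ℝ) (f : ℝ × ℝ → ℝ) : ℝ × ℝ → ℂ :=
  FTinv fun ξ =>
    (∑' j : ℤ, phiHatSigma b cp cm χp η ςp ςm (dil b j u ξ)) * FT (fun x => ((f x : ℝ) : ℂ)) ξ

/-- The convolution `τ_j^u * f`. -/
def tauConv (b cp cm : ℝ) (χp : ℝ → ℝ) (j : ℤ) (u : ℝ) (f : ℝ × ℝ → ℝ) (x : ℝ × ℝ) : ℝ :=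
  ∫ t : ℝ, f (x - (t, u * curve b cp cm t)) * ((2:ℝ) ^ j * χp ((2:ℝ) ^ j * t))

/-- The `ℓ^p(ℕ)` norm of a sequence. -/
def wNorm (w : ℕ → ℂ) (p : ℝ) : ℝ≥0∞ :=
  (∑' i : ℕ, ENNReal.ofReal (‖w i‖ ^ p)) ^ (1 / p)

/-- The auxiliary maximal operator `𝔐_R[f,w]`. -/
def MfrakR (b cp cm : ℝ) (χp : ℝ → ℝ) (s : ℤ → ℕ → ℝ) (R : ℕ)
    (f : ℝ × ℝ → ℝ) (w : ℤ → ℕ → ℂ) (x : ℝ × ℝ) : ℝ≥0∞ :=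
  ⨆ (j : ℤ) (_ : -(R:ℤ) ≤ j ∧ j ≤ R) (n : ℤ) (_ : -(R:ℤ) ≤ n ∧ n ≤ R) (i : ℕ),
    ENNReal.ofReal
      (‖w n i‖ * |tauConv b cp cm χp j ((2:ℝ) ^ (b * (n : ℝ)) * s n i) f x|)

/-- `B_p(R)`: the best constant in `‖𝔐_R[f,w]‖_p ≤ C (sup_n ‖w_n‖_{ℓ^p}) ‖f‖_p`. -/
def BpR (b cp cm : ℝ) (χp : ℝ → ℝ) (s : ℤ → ℕ → ℝ) (p : ℝ) (R : ℕ) : ℝ≥0∞ :=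
  ⨆ (f : SchwartzMap (ℝ × ℝ) ℝ) (w : ℤ → ℕ → ℂ)
    (_ : eLpNorm ⇑f (eN p) volume ≤ 1) (_ : ∀ n : ℤ, wNorm (w n) p ≤ 1),
    lpN (MfrakR b cp cm χp s R ⇑f w) p

/-- `ℓ^q` norm (over an index type) of an `ℝ≥0∞`-valued family, `q ∈ (0,∞]`. -/
def lqS {ι : Type*} (q : ℝ≥0∞) (g : ι → ℝ≥0∞) : ℝ≥0∞ :=
  if q = ⊤ then ⨆ i, g i else (∑' i, g i ^ q.toReal) ^ (1 / q.toReal)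

/-- The quotient `p/q`, with the convention `p/∞ = 0`. -/
def pqr (p : ℝ) (q : ℝ≥0∞) : ℝ := if q = ⊤ then 0 else p / q.toReal

/-- The centred maximal function over intervals with dyadic radii. -/
def maxFn (f : ℝ → ℝ≥0∞) (x : ℝ) : ℝ≥0∞ :=
  ⨆ m : ℤ, ENNReal.ofReal ((2:ℝ) ^ (-m)) * ∫⁻ y in Metric.closedBall x ((2:ℝ) ^ m), f y

theorem volume_maxFn_le (f : ℝ → ℝ≥0∞) (t : ℝ) (ht : 0 < t) :
    ENNReal.ofReal t * volume {x | ENNReal.ofReal t < maxFn f x} ≤ 10 * ∫⁻ x, f x := by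
  by_cases hf : ∫⁻ x, f x = ∞
  · simp [hf]
  set E := {x | ENNReal.ofReal t < maxFn f x}
  have h1 : ∀ x : ℝ, ∃ m : ℤ, x ∈ E → ENNReal.ofReal t * ENNReal.ofReal ((2:ℝ) ^ m) ≤
      ∫⁻ y in Metric.closedBall x ((2:ℝ) ^ m), f y := by
    intro x
    by_cases hx : x ∈ E
    · have hx' : ENNReal.ofReal t < maxFn f x := hx
      obtain ⟨m, hm⟩ := lt_iSup_iff.1 hx'
      refine ⟨m, fun _ => ?_⟩
      calc ENNReal.ofReal t * ENNReal.ofReal ((2:ℝ) ^ m)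
          ≤ (ENNReal.ofReal ((2:ℝ) ^ (-m)) * ∫⁻ y in Metric.closedBall x ((2:ℝ) ^ m), f y)
            * ENNReal.ofReal ((2:ℝ) ^ m) := by gcongr
        _ = (ENNReal.ofReal ((2:ℝ) ^ (-m)) * ENNReal.ofReal ((2:ℝ) ^ m)) *
            ∫⁻ y in Metric.closedBall x ((2:ℝ) ^ m), f y := by ring
        _ = _ := by
          rw [← ENNReal.ofReal_mul (by positivity), ← zpow_add₀ (by norm_num)]
          simp
    · exact ⟨0, fun h => absurd h hx⟩
  choose m hm using h1
  have hbd : ∀ x ∈ E, (2:ℝ) ^ (m x) ≤ (∫⁻ x, f x).toReal / t := by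
    intro x hx
    have := (hm x hx).trans (setLIntegral_le_lintegral _ _)
    rw [← ENNReal.ofReal_mul ht.le] at this
    rw [le_div_iff₀ ht, mul_comm]
    exact (ENNReal.ofReal_le_iff_le_toReal hf).1 this
  obtain ⟨u, hu, hdisj, hcov⟩ := Vitali.exists_disjoint_subfamily_covering_enlargement_closedBall
    E id (fun x => (2:ℝ) ^ (m x)) _ hbd 5 (by norm_num)
  have hcount : u.Countable := hdisj.countable_of_nonempty_interior fun x _ => by
    rw [interior_closedBall _ (by positivity)]
    exact Metric.nonempty_ball.2 (by positivity)
  have hEsub : E ⊆ ⋃ b ∈ u, Metric.closedBall b (5 * (2:ℝ) ^ (m b)) := by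
    intro x hx
    obtain ⟨b, hb, hs⟩ := hcov x hx
    exact mem_biUnion hb (hs (Metric.mem_closedBall_self (by positivity)))
  calc ENNReal.ofReal t * volume E
      ≤ ENNReal.ofReal t * ∑' b : u, volume (Metric.closedBall (b:ℝ) (5 * (2:ℝ) ^ (m b))) := by
        gcongr
        exact (measure_mono hEsub).trans (measure_biUnion_le _ hcount _)
    _ = ∑' b : u, 10 * (ENNReal.ofReal t * ENNReal.ofReal ((2:ℝ) ^ (m b))) := by
        rw [← ENNReal.tsum_mul_left]
        congr 1; ext b
        rw [Real.volume_closedBall, show 2 * (5 * (2:ℝ) ^ (m b)) = 10 * 2 ^ (m b) by ring,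
          ENNReal.ofReal_mul (by norm_num)]
        simp; ring
    _ ≤ ∑' b : u, 10 * ∫⁻ y in Metric.closedBall (b:ℝ) ((2:ℝ) ^ (m b)), f y := by
        gcongr with b
        exact hm b (hu b.2)
    _ = 10 * ∫⁻ y in ⋃ b ∈ u, Metric.closedBall b ((2:ℝ) ^ (m b)), f y := by
        have hdisj' : u.PairwiseDisjoint fun a => Metric.closedBall a ((2:ℝ) ^ (m a)) := hdisj
        rw [ENNReal.tsum_mul_left, lintegral_biUnion hcount
          (fun b _ => Metric.isClosed_closedBall.measurableSet) hdisj']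
    _ ≤ 10 * ∫⁻ x, f x := mul_le_mul_right (setLIntegral_le_lintegral _ _) _

theorem measurable_maxFn {f : ℝ → ℝ≥0∞} (hf : Measurable f) : Measurable (maxFn f) := by
  refine Measurable.iSup fun m => Measurable.const_mul ?_ _
  have : (fun x => ∫⁻ y in Metric.closedBall x ((2:ℝ) ^ m), f y) =
      fun x => ∫⁻ y, (Metric.closedBall (0:ℝ) ((2:ℝ) ^ m)).indicator (fun _ => 1) (y - x) * f y := by
    ext x
    rw [← lintegral_indicator Metric.isClosed_closedBall.measurableSet]
    congr 1; ext y
    simp [indicator, Real.dist_eq]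
  rw [this]
  refine Measurable.lintegral_prod_right' (f := fun z : ℝ × ℝ =>
    (Metric.closedBall (0:ℝ) ((2:ℝ) ^ m)).indicator (fun _ => (1:ℝ≥0∞)) (z.2 - z.1) * f z.2) ?_
  exact ((measurable_const.indicator Metric.isClosed_closedBall.measurableSet).comp
    (measurable_snd.sub measurable_fst)).mul (hf.comp measurable_snd)

/-- `∫₀^u t^{a-1} dt = u^a / a` for extended nonnegative `u`. -/
theorem lintegral_rpow_sub_one_lt (a : ℝ) (ha : 0 < a) (u : ℝ≥0∞) :
    ∫⁻ t in Ioi (0:ℝ), (if ENNReal.ofReal t < u then ENNReal.ofReal (t ^ (a - 1)) else 0)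
      = u ^ a / ENNReal.ofReal a := by
  have key : ∀ v : ℝ, 0 ≤ v →
      ∫⁻ t in Ioo (0:ℝ) v, ENNReal.ofReal (t ^ (a - 1)) = ENNReal.ofReal v ^ a / ENNReal.ofReal a := by
    intro v hv
    have hi : IntervalIntegrable (fun t : ℝ => t ^ (a - 1)) volume 0 v :=
      intervalIntegral.intervalIntegrable_rpow' (by linarith)
    rw [setLIntegral_congr Ioo_ae_eq_Ioc, ← ofReal_integral_eq_lintegral_ofReal]
    · rw [← intervalIntegral.integral_of_le hv, integral_rpow (Or.inl (by linarith))]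
      rw [ENNReal.ofReal_rpow_of_nonneg hv ha.le, ← ENNReal.ofReal_div_of_pos ha]
      simp [Real.zero_rpow ha.ne']
    · exact (intervalIntegrable_iff_integrableOn_Ioc_of_le hv).1 hi
    · filter_upwards [ae_restrict_mem measurableSet_Ioc] with t ht
      exact Real.rpow_nonneg ht.1.le _
  induction u with
  | top =>
    simp only [ENNReal.ofReal_lt_top, if_true]
    rw [ENNReal.top_rpow_of_pos ha, ENNReal.top_div_of_ne_top ENNReal.ofReal_ne_top]
    refine ENNReal.eq_top_of_forall_nnreal_le fun r => ?_
    obtain ⟨v, hv0, hv⟩ : ∃ v : ℝ, 0 ≤ v ∧ (r:ℝ) * a ≤ v ^ a := by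
      refine ⟨(r * a) ^ (a⁻¹), by positivity, ?_⟩
      rw [← Real.rpow_mul (by positivity), inv_mul_cancel₀ ha.ne', Real.rpow_one]
    calc (r:ℝ≥0∞) ≤ ENNReal.ofReal v ^ a / ENNReal.ofReal a := by
          rw [ENNReal.ofReal_rpow_of_nonneg hv0 ha.le, ← ENNReal.ofReal_div_of_pos ha]
          rw [← ENNReal.ofReal_coe_nnreal]
          apply ENNReal.ofReal_le_ofReal
          rwa [le_div_iff₀ ha]
      _ = _ := (key v hv0).symm
      _ ≤ _ := lintegral_mono_set Ioo_subset_Ioi_self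
  | coe r =>
    rw [← ENNReal.ofReal_coe_nnreal, ← key r r.2]
    rw [← lintegral_indicator measurableSet_Ioi, ← lintegral_indicator measurableSet_Ioo]
    congr 1; ext t
    simp only [indicator, mem_Ioi, mem_Ioo]
    by_cases h : 0 < t
    · simp only [h, true_and, if_true]
      have h3 : ENNReal.ofReal t < (r:ℝ≥0∞) ↔ t < r := by
        rw [← ENNReal.ofReal_coe_nnreal, ENNReal.ofReal_lt_ofReal_iff_of_nonneg h.le]
      rw [ENNReal.ofReal_coe_nnreal]
      simp only [h3]
    · simp [h]

theorem maxFn_add_le (f g : ℝ → ℝ≥0∞) (hf : Measurable f) (x : ℝ) :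
    maxFn (fun y => f y + g y) x ≤ maxFn f x + maxFn g x := by
  refine iSup_le fun m => ?_
  rw [lintegral_add_left hf, mul_add]
  exact add_le_add (le_iSup (fun m : ℤ => ENNReal.ofReal ((2:ℝ) ^ (-m)) *
    ∫⁻ y in Metric.closedBall x ((2:ℝ) ^ m), f y) m) (le_iSup (fun m : ℤ =>
    ENNReal.ofReal ((2:ℝ) ^ (-m)) * ∫⁻ y in Metric.closedBall x ((2:ℝ) ^ m), g y) m)

theorem maxFn_mono {f g : ℝ → ℝ≥0∞} (h : ∀ y, f y ≤ g y) (x : ℝ) : maxFn f x ≤ maxFn g x := by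
  unfold maxFn
  gcongr with m
  exact h _

theorem maxFn_const_le (c : ℝ≥0∞) (x : ℝ) : maxFn (fun _ => c) x ≤ 2 * c := by
  refine iSup_le fun m => ?_
  rw [setLIntegral_const, Real.volume_closedBall, mul_left_comm, ← ENNReal.ofReal_mul (by positivity),
    mul_left_comm, ← zpow_add₀ (by norm_num)]
  simp [mul_comm]

theorem ofReal_mul_volume_maxFn_le (f : ℝ → ℝ≥0∞) (hf : Measurable f) (t : ℝ) (ht : 0 < t) :
    ENNReal.ofReal t * volume {x | ENNReal.ofReal t < maxFn f x} ≤
      20 * ∫⁻ x, (if ENNReal.ofReal t < 4 * f x then f x else 0) := by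
  set g : ℝ → ℝ≥0∞ := fun x => if ENNReal.ofReal t < 4 * f x then f x else 0
  have hg : Measurable g := Measurable.ite (measurableSet_lt measurable_const (hf.const_mul _)) hf
    measurable_const
  have h4 : ∀ x, f x ≤ g x + ENNReal.ofReal (t / 4) := by
    intro x
    simp only [g]
    split_ifs with h
    · exact le_self_add
    · rw [not_lt] at h
      rw [zero_add, ENNReal.ofReal_div_of_pos (by norm_num)]
      rw [ENNReal.le_div_iff_mul_le (by simp) (by simp), mul_comm]
      simpa using h
  have h5 : {x | ENNReal.ofReal t < maxFn f x} ⊆ {x | ENNReal.ofReal (t/2) < maxFn g x} := by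
    intro x hx
    simp only [Set.mem_ofPred_eq] at hx ⊢
    by_contra! hc
    have : maxFn f x ≤ ENNReal.ofReal t := calc
      maxFn f x ≤ maxFn (fun y => g y + ENNReal.ofReal (t/4)) x := maxFn_mono h4 x
      _ ≤ maxFn g x + maxFn (fun _ => ENNReal.ofReal (t/4)) x := maxFn_add_le _ _ hg x
      _ ≤ ENNReal.ofReal (t/2) + 2 * ENNReal.ofReal (t/4) := add_le_add hc (maxFn_const_le _ _)
      _ = ENNReal.ofReal t := by
        rw [show (2:ℝ≥0∞) = ENNReal.ofReal 2 by simp, ← ENNReal.ofReal_mul (by norm_num),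
          ← ENNReal.ofReal_add (by positivity) (by positivity)]
        congr 1; ring
    exact absurd hx (not_lt.2 this)
  calc ENNReal.ofReal t * volume {x | ENNReal.ofReal t < maxFn f x}
      ≤ ENNReal.ofReal t * volume {x | ENNReal.ofReal (t/2) < maxFn g x} := by gcongr
    _ = 2 * (ENNReal.ofReal (t/2) * volume {x | ENNReal.ofReal (t/2) < maxFn g x}) := by
        rw [← mul_assoc, show (2:ℝ≥0∞) = ENNReal.ofReal 2 by simp,
          ← ENNReal.ofReal_mul (by norm_num)]
        congr 2; ring
    _ ≤ 2 * (10 * ∫⁻ x, g x) := 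
        mul_le_mul' le_rfl (volume_maxFn_le g (t/2) (by positivity))
    _ = _ := by rw [← mul_assoc]; norm_num

theorem ENNReal.mul_rpow_sub_one (y : ℝ≥0∞) (p : ℝ) (hp : 1 < p) : y * y ^ (p - 1) = y ^ p := by
  have h : p = 1 + (p - 1) := by ring
  conv_rhs => rw [h, ENNReal.rpow_add_of_nonneg _ _ zero_le_one (by linarith), ENNReal.rpow_one]

/-- The Hardy–Littlewood maximal theorem. -/
theorem lintegral_maxFn_rpow_le (f : ℝ → ℝ≥0∞) (hf : Measurable f) (p : ℝ) (hp : 1 < p)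
    (hp2 : p ≤ 2) :
    ∫⁻ x, maxFn f x ^ p ≤ 160 / ENNReal.ofReal (p - 1) * ∫⁻ x, f x ^ p := by
  have hp0 : 0 < p := by linarith
  have hM := measurable_maxFn hf
  have hpos : ENNReal.ofReal p ≠ 0 := by simpa using hp0
  have hms : ∀ (t : ℝ) (h : ℝ → ℝ≥0∞), Measurable h → MeasurableSet {x | ENNReal.ofReal t < h x} :=
    fun t h hh => measurableSet_lt measurable_const hh
  have e1 : ∀ u : ℝ≥0∞, u ^ p = ENNReal.ofReal p * ∫⁻ t in Ioi (0:ℝ),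
      (if ENNReal.ofReal t < u then ENNReal.ofReal (t ^ (p - 1)) else 0) := by
    intro u
    rw [lintegral_rpow_sub_one_lt p hp0, ENNReal.mul_div_cancel hpos ENNReal.ofReal_ne_top]
  have mset : ∀ (h : ℝ → ℝ≥0∞), Measurable h → MeasurableSet {z : ℝ × ℝ | ENNReal.ofReal z.2 < h z.1} :=
    fun h hh => measurableSet_lt (ENNReal.measurable_ofReal.comp measurable_snd)
      (hh.comp measurable_fst)
  calc ∫⁻ x, maxFn f x ^ p
      = ENNReal.ofReal p * ∫⁻ x, ∫⁻ t in Ioi (0:ℝ),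
        (if ENNReal.ofReal t < maxFn f x then ENNReal.ofReal (t ^ (p - 1)) else 0) := by
        simp_rw [e1]
        rw [lintegral_const_mul']
        exact ENNReal.ofReal_ne_top
    _ = ENNReal.ofReal p * ∫⁻ t in Ioi (0:ℝ), ∫⁻ x,
        (if ENNReal.ofReal t < maxFn f x then ENNReal.ofReal (t ^ (p - 1)) else 0) := by
        rw [lintegral_lintegral_swap]
        refine Measurable.aemeasurable ?_
        exact Measurable.ite (mset _ hM) (by fun_prop) measurable_const
    _ ≤ ENNReal.ofReal p * ∫⁻ t in Ioi (0:ℝ), 20 * ∫⁻ x, f x *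
        (if ENNReal.ofReal t < 4 * f x then ENNReal.ofReal (t ^ (p - 1 - 1)) else 0) := by
        refine mul_le_mul_right ?_ _
        refine setLIntegral_mono' (measurableSet_Ioi (a := (0:ℝ))) fun t ht => ?_
        have ht : 0 < t := ht
        calc ∫⁻ x, (if ENNReal.ofReal t < maxFn f x then ENNReal.ofReal (t ^ (p - 1)) else 0)
            = ENNReal.ofReal (t ^ (p - 1)) * volume {x | ENNReal.ofReal t < maxFn f x} := by
              rw [← setLIntegral_const, ← lintegral_indicator (hms t _ hM)]
              congr 1; ext x; simp only [indicator, Set.mem_ofPred_eq]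
          _ = ENNReal.ofReal (t ^ (p - 1 - 1)) * (ENNReal.ofReal t *
                volume {x | ENNReal.ofReal t < maxFn f x}) := by
              rw [← mul_assoc, ← ENNReal.ofReal_mul (by positivity), ← Real.rpow_add_one ht.ne']
              simp
          _ ≤ ENNReal.ofReal (t ^ (p - 1 - 1)) *
                (20 * ∫⁻ x, (if ENNReal.ofReal t < 4 * f x then f x else 0)) := by
              exact mul_le_mul_right (ofReal_mul_volume_maxFn_le f hf t ht) _
          _ = _ := by
              rw [mul_left_comm, ← lintegral_const_mul' _ _ ENNReal.ofReal_ne_top]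
              congr 2; ext x
              split_ifs <;> simp [mul_comm]
    _ = ENNReal.ofReal p * (20 * ∫⁻ x, f x * ((4 * f x) ^ (p - 1) / ENNReal.ofReal (p - 1))) := by
        congr 1
        rw [lintegral_const_mul' _ _ (by simp), lintegral_lintegral_swap]
        · congr 2; ext x
          rw [← lintegral_rpow_sub_one_lt (p - 1) (by linarith), lintegral_const_mul]
          exact Measurable.ite (measurableSet_lt (f := fun t : ℝ => ENNReal.ofReal t)
            (g := fun _ : ℝ => 4 * f x) (by fun_prop) measurable_const) (by fun_prop) measurable_const
        · refine Measurable.aemeasurable ?_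
          refine (hf.comp measurable_snd).mul (Measurable.ite ?_ (by fun_prop) measurable_const)
          exact measurableSet_lt (ENNReal.measurable_ofReal.comp measurable_fst)
            ((hf.comp measurable_snd).const_mul _)
    _ ≤ 2 * (20 * ∫⁻ x, (4 / ENNReal.ofReal (p - 1)) * f x ^ p) := by
        gcongr ?_ * (20 * ?_)
        · exact ENNReal.ofReal_le_of_le_toReal (by simpa using hp2)
        · refine lintegral_mono fun x => ?_
          rw [ENNReal.mul_rpow_of_nonneg _ _ (by linarith), ← ENNReal.mul_rpow_sub_one (f x) p hp,
            div_eq_mul_inv, div_eq_mul_inv]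
          calc f x * (4 ^ (p - 1) * f x ^ (p - 1) * (ENNReal.ofReal (p - 1))⁻¹)
              = (4 ^ (p - 1) * (ENNReal.ofReal (p - 1))⁻¹) * (f x * f x ^ (p - 1)) := by ring
            _ ≤ _ := by
              gcongr
              conv_rhs => rw [← ENNReal.rpow_one 4]
              exact ENNReal.rpow_le_rpow_of_exponent_le (by norm_num) (by linarith)
    _ = _ := by
        rw [lintegral_const_mul _ (by fun_prop), ← mul_assoc, ← mul_assoc, ← mul_div_assoc]
        norm_num

theorem lintegral_comp_sub_mul (F : ℝ → ℝ≥0∞) (x a : ℝ) (ha : a ≠ 0) :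
    ∫⁻ z, F (x - a * z) = ENNReal.ofReal |a⁻¹| * ∫⁻ z, F z := by
  have h := (Homeomorph.mulLeft₀ a ha).measurableEmbedding.lintegral_map (μ := volume)
    (fun y => F (x - y))
  have h2 : Measure.map (Homeomorph.mulLeft₀ a ha) volume = ENNReal.ofReal |a⁻¹| • volume := by
    exact Real.map_volume_mul_left ha
  rw [h2, lintegral_smul_measure, lintegral_sub_left_eq_self] at h
  simpa using h.symm

theorem mul_lintegral_closedBall_le_maxFn (f : ℝ → ℝ≥0∞) (x r : ℝ) (hr : 0 < r) :
    ∫⁻ y in Metric.closedBall x r, f y ≤ ENNReal.ofReal (2 * r) * maxFn f x := by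
  obtain ⟨m, hm1, hm2⟩ := exists_mem_Ioc_zpow hr (one_lt_two)
  have h0 : (2:ℝ) ^ (m + 1) ≤ 2 * r := by
    rw [zpow_add_one₀ two_ne_zero]; linarith
  calc ∫⁻ y in Metric.closedBall x r, f y
      ≤ ∫⁻ y in Metric.closedBall x ((2:ℝ) ^ (m + 1)), f y :=
        lintegral_mono_set (Metric.closedBall_subset_closedBall hm2)
    _ = ENNReal.ofReal ((2:ℝ) ^ (m + 1)) * (ENNReal.ofReal ((2:ℝ) ^ (-(m + 1))) *
          ∫⁻ y in Metric.closedBall x ((2:ℝ) ^ (m + 1)), f y) := by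
        rw [← mul_assoc, ← ENNReal.ofReal_mul (by positivity), ← zpow_add₀ two_ne_zero]
        simp
    _ ≤ _ := mul_le_mul' (ENNReal.ofReal_le_ofReal h0) (le_iSup (fun m : ℤ =>
          ENNReal.ofReal ((2:ℝ) ^ (-m)) * ∫⁻ y in Metric.closedBall x ((2:ℝ) ^ m), f y) (m + 1))

theorem setLIntegral_comp_sub_mul_le (f : ℝ → ℝ≥0∞) (x a R : ℝ) (ha : 0 < a) (hR : 0 < R) :
    ∫⁻ z in Icc (-R) R, f (x - a * z) ≤ ENNReal.ofReal (2 * R) * maxFn f x := by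
  have h1 : ∫⁻ z in Icc (-R) R, f (x - a * z) =
      ∫⁻ z, (Metric.closedBall x (a * R)).indicator f (x - a * z) := by
    rw [← lintegral_indicator measurableSet_Icc]
    congr 1; ext z
    simp only [indicator, Metric.mem_closedBall, Real.dist_eq, mem_Icc]
    have : |x - a * z - x| ≤ a * R ↔ -R ≤ z ∧ z ≤ R := by
      rw [show x - a * z - x = -(a * z) by ring, abs_neg, abs_mul, abs_of_pos ha,
        mul_le_mul_iff_right₀ ha, abs_le]
    simp only [this]
  rw [h1, lintegral_comp_sub_mul _ _ _ ha.ne', lintegral_indicator Metric.isClosed_closedBall.measurableSet]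
  calc _ ≤ ENNReal.ofReal |a⁻¹| * (ENNReal.ofReal (2 * (a * R)) * maxFn f x) :=
        mul_le_mul_right (mul_lintegral_closedBall_le_maxFn f x _ (by positivity)) _
    _ = _ := by
        rw [← mul_assoc, ← ENNReal.ofReal_mul (by positivity), abs_of_pos (by positivity)]
        congr 2; field_simp

theorem measurable_maxFn_param {α : Type*} [MeasurableSpace α] {g : α × ℝ → ℝ≥0∞}
    (hg : Measurable g) : Measurable fun z : α × ℝ => maxFn (fun t => g (z.1, t)) z.2 := by
  refine Measurable.iSup fun m => Measurable.const_mul ?_ _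
  have : (fun z : α × ℝ => ∫⁻ y in Metric.closedBall z.2 ((2:ℝ) ^ m), g (z.1, y)) =
      fun z => ∫⁻ y, (Metric.closedBall (0:ℝ) ((2:ℝ) ^ m)).indicator (fun _ => 1) (y - z.2) *
        g (z.1, y) := by
    ext z
    rw [← lintegral_indicator Metric.isClosed_closedBall.measurableSet]
    congr 1; ext y
    simp [indicator, Real.dist_eq]
  rw [this]
  refine Measurable.lintegral_prod_right' (f := fun z : (α × ℝ) × ℝ =>
    (Metric.closedBall (0:ℝ) ((2:ℝ) ^ m)).indicator (fun _ => (1:ℝ≥0∞)) (z.2 - z.1.2) *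
      g (z.1.1, z.2)) ?_
  refine ((measurable_const.indicator Metric.isClosed_closedBall.measurableSet).comp
    (measurable_snd.sub (measurable_snd.comp measurable_fst))).mul (hg.comp ?_)
  fun_prop

/-- The maximal function in the second variable. -/
def maxSnd (g : ℝ × ℝ → ℝ≥0∞) (x : ℝ × ℝ) : ℝ≥0∞ := maxFn (fun t => g (x.1, t)) x.2

/-- The strong maximal function, as an iterated one-dimensional maximal function. -/
def strongMax (g : ℝ × ℝ → ℝ≥0∞) (x : ℝ × ℝ) : ℝ≥0∞ := maxFn (fun s => maxSnd g (s, x.2)) x.1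

theorem measurable_maxSnd {g : ℝ × ℝ → ℝ≥0∞} (hg : Measurable g) : Measurable (maxSnd g) :=
  measurable_maxFn_param hg

theorem measurable_strongMax {g : ℝ × ℝ → ℝ≥0∞} (hg : Measurable g) : Measurable (strongMax g) := by
  have h0 : Measurable fun z : ℝ × ℝ => maxSnd g (z.2, z.1) :=
    (measurable_maxSnd hg).comp measurable_swap
  have h : Measurable fun z : ℝ × ℝ => maxFn (fun t => maxSnd g (t, z.1)) z.2 :=
    measurable_maxFn_param h0
  have h2 : strongMax g = (fun z : ℝ × ℝ => maxFn (fun t => maxSnd g (t, z.1)) z.2) ∘ Prod.swap := by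
    ext z; rfl
  rw [h2]
  exact h.comp measurable_swap

theorem lintegral_maxSnd_rpow_le (g : ℝ × ℝ → ℝ≥0∞) (hg : Measurable g) (p : ℝ) (hp : 1 < p)
    (hp2 : p ≤ 2) :
    ∫⁻ x, maxSnd g x ^ p ≤ 160 / ENNReal.ofReal (p - 1) * ∫⁻ x, g x ^ p := by
  rw [Measure.volume_eq_prod, lintegral_prod _ (by have := measurable_maxSnd hg; fun_prop),
    lintegral_prod _ (by fun_prop), ← lintegral_const_mul' _ _ (by
      apply (ENNReal.div_lt_top (by simp) (by simpa using hp)).ne)]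
  exact lintegral_mono fun x => lintegral_maxFn_rpow_le _ (by fun_prop) p hp hp2

theorem lintegral_strongMax_rpow_le (g : ℝ × ℝ → ℝ≥0∞) (hg : Measurable g) (p : ℝ) (hp : 1 < p)
    (hp2 : p ≤ 2) :
    ∫⁻ x, strongMax g x ^ p ≤ (160 / ENNReal.ofReal (p - 1)) ^ 2 * ∫⁻ x, g x ^ p := by
  have hm := measurable_maxSnd hg
  rw [sq, mul_assoc]
  refine le_trans ?_ (mul_le_mul_right (lintegral_maxSnd_rpow_le g hg p hp hp2) _)
  rw [Measure.volume_eq_prod, lintegral_prod_symm _ (by have := measurable_strongMax hg; fun_prop),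
    lintegral_prod_symm _ (by fun_prop), ← lintegral_const_mul' _ _ (by
      apply (ENNReal.div_lt_top (by simp) (by simpa using hp)).ne)]
  exact lintegral_mono fun x => lintegral_maxFn_rpow_le _ (by fun_prop) p hp hp2

theorem lintegral_box_le_strongMax (g : ℝ × ℝ → ℝ≥0∞) (hg : Measurable g) (x : ℝ × ℝ)
    (a e R R' : ℝ) (ha : 0 < a) (he : 0 < e) (hR : 0 < R) (hR' : 0 < R') :
    ∫⁻ z in Icc (-R) R ×ˢ Icc (-R') R', g (x.1 - a * z.1, x.2 - e * z.2) ≤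
      ENNReal.ofReal (4 * R * R') * strongMax g x := by
  rw [Measure.volume_eq_prod, ← Measure.prod_restrict, lintegral_prod _ (by fun_prop)]
  calc _ ≤ ∫⁻ z in Icc (-R) R, ENNReal.ofReal (2 * R') * maxSnd g (x.1 - a * z, x.2) :=
        lintegral_mono fun z => setLIntegral_comp_sub_mul_le (fun t => g (x.1 - a * z, t)) x.2 e R' he hR'
    _ = ENNReal.ofReal (2 * R') * ∫⁻ z in Icc (-R) R, maxSnd g (x.1 - a * z, x.2) :=
        lintegral_const_mul' _ _ ENNReal.ofReal_ne_top
    _ ≤ ENNReal.ofReal (2 * R') * (ENNReal.ofReal (2 * R) * strongMax g x) :=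
        mul_le_mul_right (setLIntegral_comp_sub_mul_le (fun s => maxSnd g (s, x.2)) x.1 a R ha hR) _
    _ = _ := by
        rw [← mul_assoc, ← ENNReal.ofReal_mul (by positivity)]
        congr 2; ring

theorem inv_one_add_sq_le_tsum (s : ℝ) : ENNReal.ofReal (1 / (1 + s ^ 2)) ≤
    ∑' m : ℕ, ENNReal.ofReal (4 * (1/4) ^ m) * (Icc (-(2:ℝ) ^ m) ((2:ℝ) ^ m)).indicator 1 s := by
  have h : ∃ m : ℕ, |s| ≤ 2 ^ m ∧ 1 / (1 + s ^ 2) ≤ 4 * (1/4:ℝ) ^ m := by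
    by_cases hs : |s| ≤ 1
    · refine ⟨0, by simpa using hs, ?_⟩
      rw [div_le_iff₀ (by positivity)]
      nlinarith [sq_nonneg s]
    · obtain ⟨n, hn1, hn2⟩ := exists_nat_pow_near (not_le.1 hs).le one_lt_two
      refine ⟨n + 1, hn2.le, ?_⟩
      have h1 : (4:ℝ) ^ n ≤ s ^ 2 := by
        rw [← sq_abs, show (4:ℝ) = 2 ^ 2 by norm_num, ← pow_mul, mul_comm, pow_mul]
        gcongr
      have h2 : 4 * (1/4:ℝ) ^ (n + 1) = 1 / 4 ^ n := by rw [one_div_pow, pow_succ]; field_simp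
      rw [h2]
      exact one_div_le_one_div_of_le (by positivity) (by linarith)
  obtain ⟨m, hm1, hm2⟩ := h
  refine le_trans ?_ (ENNReal.le_tsum m)
  rw [indicator_of_mem (by simpa [abs_le] using hm1)]
  simpa using ENNReal.ofReal_le_ofReal hm2

theorem lintegral_inv_one_add_sq_le_maxFn (f : ℝ → ℝ≥0∞) (hf : Measurable f) (x a : ℝ)
    (ha : 0 < a) :
    ∫⁻ z, ENNReal.ofReal (1 / (1 + z ^ 2)) * f (x - a * z) ≤ 16 * maxFn f x := by
  calc _ ≤ ∫⁻ z, ∑' m : ℕ, ENNReal.ofReal (4 * (1/4) ^ m) *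
        (Icc (-(2:ℝ) ^ m) ((2:ℝ) ^ m)).indicator (fun z => f (x - a * z)) z := by
        refine lintegral_mono fun z => ?_
        refine (mul_le_mul_left (inv_one_add_sq_le_tsum z) _).trans_eq ?_
        rw [← ENNReal.tsum_mul_right]
        congr 1; ext m
        by_cases h : z ∈ Icc (-(2:ℝ) ^ m) ((2:ℝ) ^ m) <;> simp [h]
    _ = ∑' m : ℕ, ENNReal.ofReal (4 * (1/4) ^ m) * ∫⁻ z in Icc (-(2:ℝ) ^ m) ((2:ℝ) ^ m),
          f (x - a * z) := by
        rw [lintegral_tsum]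
        · congr 1; ext m
          rw [lintegral_const_mul' _ _ ENNReal.ofReal_ne_top, lintegral_indicator measurableSet_Icc]
        · intro m
          exact ((Measurable.indicator (by fun_prop) measurableSet_Icc).const_mul _).aemeasurable
    _ ≤ ∑' m : ℕ, ENNReal.ofReal (8 * (1/2) ^ m) * maxFn f x := by
        refine ENNReal.tsum_le_tsum fun m => ?_
        refine (mul_le_mul_right (setLIntegral_comp_sub_mul_le f x a (2 ^ m) ha
          (by positivity)) _).trans_eq ?_
        rw [← mul_assoc, ← ENNReal.ofReal_mul (by positivity)]
        congr 2
        rw [show (4:ℝ) * (1/4) ^ m * (2 * 2 ^ m) = 8 * ((1/4) ^ m * 2 ^ m) by ring, ← mul_pow]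
        norm_num
    _ = 16 * maxFn f x := by
        rw [ENNReal.tsum_mul_right, ← ENNReal.ofReal_tsum_of_nonneg (fun m => by positivity)
          (summable_geometric_two.mul_left 8), tsum_mul_left, tsum_geometric_two]
        norm_num

theorem exp_neg_le_two_div (s : ℝ) (hs : 0 ≤ s) : Real.exp (-s) ≤ 2 * (1 / (1 + s ^ 2)) := by
  have := Real.quadratic_le_exp_of_nonneg hs
  rw [Real.exp_neg, mul_one_div, inv_le_comm₀ (Real.exp_pos _) (by positivity), inv_div]
  nlinarith

theorem lintegral_exp_le_maxFn (f : ℝ → ℝ≥0∞) (hf : Measurable f) (x a : ℝ) (ha : 0 < a) :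
    ∫⁻ s in Ioi (0:ℝ), ENNReal.ofReal (Real.exp (-s)) * f (x - a * s) ≤ 32 * maxFn f x := by
  calc _ ≤ ∫⁻ s in Ioi (0:ℝ), 2 * (ENNReal.ofReal (1 / (1 + s ^ 2)) * f (x - a * s)) := by
        refine setLIntegral_mono' (measurableSet_Ioi (a := (0:ℝ))) fun s hs => ?_
        rw [← mul_assoc]
        refine mul_le_mul_left ?_ _
        rw [show (2:ℝ≥0∞) = ENNReal.ofReal 2 by simp, ← ENNReal.ofReal_mul (by norm_num)]
        exact ENNReal.ofReal_le_ofReal (exp_neg_le_two_div s (le_of_lt hs))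
    _ ≤ ∫⁻ s, 2 * (ENNReal.ofReal (1 / (1 + s ^ 2)) * f (x - a * s)) := setLIntegral_le_lintegral _ _
    _ = 2 * ∫⁻ s, (ENNReal.ofReal (1 / (1 + s ^ 2)) * f (x - a * s)) :=
        lintegral_const_mul' _ _ (by simp)
    _ ≤ 2 * (16 * maxFn f x) := mul_le_mul_right (lintegral_inv_one_add_sq_le_maxFn f hf x a ha) _
    _ = _ := by rw [← mul_assoc]; norm_num

theorem mul_sub_le_rpow_sub_rpow {q r c M : ℝ} (hq0 : 0 ≤ q) (hq : q ≤ 1) (hr : 0 ≤ r) (hrc : r ≤ c)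
    (hc : 0 < c) (hcM : c ≤ M) : q * M ^ (q - 1) * (c - r) ≤ c ^ q - r ^ q := by
  have h1 : (r / c) ^ q ≤ 1 + q * (r / c - 1) := by
    have := rpow_one_add_le_one_add_mul_self (s := r / c - 1) (p := q)
      (by have : 0 ≤ r / c := by positivity
          linarith) hq0 hq
    simpa using this
  have h2 : r ^ q = c ^ q * (r / c) ^ q := by
    rw [← Real.mul_rpow hc.le (by positivity), mul_div_cancel₀ _ hc.ne']
  have h3 : M ^ (q - 1) ≤ c ^ (q - 1) := Real.rpow_le_rpow_of_nonpos hc hcM (by linarith)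
  have h4 : c ^ q = c ^ (q - 1) * c := by rw [← Real.rpow_add_one hc.ne']; simp
  calc q * M ^ (q - 1) * (c - r) ≤ q * c ^ (q - 1) * (c - r) := by
        have : 0 ≤ c - r := by linarith
        gcongr
    _ = c ^ q - c ^ q * (1 + q * (r / c - 1)) := by rw [h4]; field_simp; ring
    _ ≤ _ := by
        rw [h2]
        have : 0 ≤ c ^ q := by positivity
        nlinarith

theorem sq_sub_le_rpow_taylor {p A r M : ℝ} (hp : 1 < p) (hp2 : p ≤ 2) (hA : 0 ≤ A) (hr : 0 ≤ r)
    (hAM : A ≤ M) (hrM : r ≤ M) :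
    (p - 1) / 2 * M ^ (p - 2) * (A - r) ^ 2 ≤ A ^ p - r ^ p - p * r ^ (p - 1) * (A - r) := by
  set h : ℝ → ℝ := fun x => x ^ p - (p - 1) / 2 * M ^ (p - 2) * x ^ 2
  set h' : ℝ → ℝ := fun x => p * x ^ (p - 1) - (p - 1) * M ^ (p - 2) * x
  have hd : ∀ x, HasDerivAt h (h' x) x := by
    intro x
    have h1 := Real.hasDerivAt_rpow_const (x := x) (p := p) (Or.inr hp.le)
    have h2 := ((hasDerivAt_pow 2 x).const_mul ((p - 1) / 2 * M ^ (p - 2)))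
    refine (h1.sub h2).congr_deriv ?_
    simp only [h']; ring
  have hmono : ∀ x y, 0 ≤ x → x < y → y ≤ M → h' x ≤ h' y := by
    intro x y hx hxy hy
    have := mul_sub_le_rpow_sub_rpow (q := p - 1) (by linarith) (by linarith) hx hxy.le
      (hx.trans_lt hxy) hy
    simp only [h']
    rw [show p - 1 - 1 = p - 2 by ring] at this
    have h0 : 0 ≤ y ^ (p - 1) - x ^ (p - 1) := sub_nonneg.2
      (Real.rpow_le_rpow hx hxy.le (by linarith))
    nlinarith
  have hexp : A ^ p - r ^ p - p * r ^ (p - 1) * (A - r) - (p - 1) / 2 * M ^ (p - 2) * (A - r) ^ 2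
      = h A - h r - h' r * (A - r) := by simp only [h, h']; ring
  have hcont : Continuous h := continuous_iff_continuousAt.2 fun x => (hd x).continuousAt
  rw [← sub_nonneg, hexp]
  rcases lt_trichotomy A r with hlt | heq | hlt
  · obtain ⟨c, hc, hce⟩ := exists_hasDerivAt_eq_slope h h' hlt hcont.continuousOn fun x _ => hd x
    rw [eq_div_iff (by linarith)] at hce
    have := hmono c r (hA.trans hc.1.le) hc.2 hrM
    nlinarith
  · simp [heq]
  · obtain ⟨c, hc, hce⟩ := exists_hasDerivAt_eq_slope h h' hlt hcont.continuousOn fun x _ => hd x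
    rw [eq_div_iff (by linarith)] at hce
    have := hmono r c hr hc.1 (hc.2.le.trans hAM)
    nlinarith

section Bregman

variable {E : Type*} [NormedAddCommGroup E] [InnerProductSpace ℝ E]

/-- The Bregman divergence of the function `‖·‖^p`. -/
def bregman (p : ℝ) (a b : E) : ℝ :=
  ‖a‖ ^ p - ‖b‖ ^ p - p * ‖b‖ ^ (p - 2) * inner ℝ b (a - b)

theorem norm_sub_sq_le_bregman {p M : ℝ} (hp : 1 < p) (hp2 : p ≤ 2) (a b : E) (ha : ‖a‖ ≤ M)
    (hb : ‖b‖ ≤ M) (hM : 0 < M) :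
    (p - 1) / 2 * ‖a - b‖ ^ 2 ≤ M ^ (2 - p) * bregman p a b := by
  have key : (p - 1) / 2 * M ^ (p - 2) * ‖a - b‖ ^ 2 ≤ bregman p a b := by
    have hM2 : M ^ (p - 2) * M ^ (2 - p) = 1 := by rw [← Real.rpow_add hM]; simp
    by_cases hb0 : b = 0
    · subst hb0
      have hA := sq_sub_le_rpow_taylor hp hp2 (norm_nonneg a) le_rfl ha hM.le
      simp only [bregman, sub_zero, norm_zero, inner_zero_left, mul_zero] at hA ⊢
      rw [Real.zero_rpow (by linarith : p - 1 ≠ 0)] at hA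
      linarith
    · have hr : 0 < ‖b‖ := norm_pos_iff.2 hb0
      have h1 := sq_sub_le_rpow_taylor hp hp2 (norm_nonneg a) hr.le ha hb
      have h2 : M ^ (p - 2) ≤ ‖b‖ ^ (p - 2) := Real.rpow_le_rpow_of_nonpos hr hb (by linarith)
      have h3 : inner ℝ b (a - b) = (‖a‖ ^ 2 - ‖b‖ ^ 2 - ‖a - b‖ ^ 2) / 2 := by
        have := norm_add_sq_real b (a - b)
        rw [add_sub_cancel] at this
        linarith
      have h4 : (‖a‖ - ‖b‖) ^ 2 ≤ ‖a - b‖ ^ 2 := by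
        rw [← sq_abs (‖a‖ - ‖b‖)]
        gcongr
        exact abs_norm_sub_norm_le a b
      have h5 : ‖b‖ ^ (p - 1) = ‖b‖ ^ (p - 2) * ‖b‖ := by
        rw [← Real.rpow_add_one hr.ne']; ring_nf
      have h0 : 0 < M ^ (p - 2) := by positivity
      have h6 : 0 ≤ p / 2 * ‖b‖ ^ (p - 2) - (p - 1) / 2 * M ^ (p - 2) := by nlinarith
      simp only [bregman, h3]
      rw [h5] at h1
      nlinarith [mul_le_mul_of_nonneg_left h4 h6]
  calc (p - 1) / 2 * ‖a - b‖ ^ 2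
      = M ^ (2 - p) * ((p - 1) / 2 * M ^ (p - 2) * ‖a - b‖ ^ 2) := by
        have hM2 : M ^ (p - 2) * M ^ (2 - p) = 1 := by rw [← Real.rpow_add hM]; simp
        linear_combination -(p - 1) / 2 * ‖a - b‖ ^ 2 * hM2
    _ ≤ _ := by gcongr

theorem bregman_nonneg {p : ℝ} (hp : 1 < p) (hp2 : p ≤ 2) (a b : E) : 0 ≤ bregman p a b := by
  have hM : 0 < ‖a‖ + ‖b‖ + 1 := by positivity
  have := norm_sub_sq_le_bregman (M := ‖a‖ + ‖b‖ + 1) hp hp2 a b (by linarith [norm_nonneg b])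
    (by linarith [norm_nonneg a]) hM
  have h2 : 0 ≤ (‖a‖ + ‖b‖ + 1) ^ (2 - p) * bregman p a b :=
    le_trans (mul_nonneg (by linarith) (by positivity)) this
  exact nonneg_of_mul_nonneg_right h2 (by positivity)

end Bregman

/-- The density of the exponential law. -/
def expDensity (s : ℝ) : ℝ≥0∞ := (Ioi (0:ℝ)).indicator (fun s => ENNReal.ofReal (Real.exp (-s))) s

theorem measurable_expDensity : Measurable expDensity :=
  Measurable.indicator (by fun_prop) measurableSet_Ioi

/-- The exponential law. -/
def expLaw : Measure ℝ := volume.withDensity expDensity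

theorem lintegral_expLaw (F : ℝ → ℝ≥0∞) (hF : Measurable F) :
    ∫⁻ s, F s ∂expLaw = ∫⁻ s, expDensity s * F s := by
  rw [expLaw, lintegral_withDensity_eq_lintegral_mul _ measurable_expDensity hF]
  rfl

theorem lintegral_expLaw_eq_setLIntegral (F : ℝ → ℝ≥0∞) (hF : Measurable F) :
    ∫⁻ s, F s ∂expLaw = ∫⁻ s in Ioi (0:ℝ), ENNReal.ofReal (Real.exp (-s)) * F s := by
  rw [lintegral_expLaw F hF, ← lintegral_indicator measurableSet_Ioi]
  congr 1; ext s
  by_cases h : s ∈ Ioi (0:ℝ) <;> simp [expDensity, indicator, h]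

instance : IsProbabilityMeasure expLaw := by
  constructor
  have := lintegral_expLaw_eq_setLIntegral (fun _ => 1) measurable_const
  rw [lintegral_one] at this
  rw [this]
  simp only [mul_one]
  rw [← ofReal_integral_eq_lintegral_ofReal (integrableOn_exp_neg_Ioi 0)
    (ae_of_all _ fun s => (Real.exp_pos _).le), integral_exp_neg_Ioi_zero]
  simp

theorem integral_expLaw {E : Type*} [NormedAddCommGroup E] [NormedSpace ℝ E] (F : ℝ → E) :
    ∫ s, F s ∂expLaw = ∫ s in Ioi (0:ℝ), Real.exp (-s) • F s := by
  rw [expLaw, integral_withDensity_eq_integral_toReal_smul measurable_expDensity,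
    ← integral_indicator measurableSet_Ioi]
  · congr 1; ext s
    by_cases h : s ∈ Ioi (0:ℝ)
    · simp [expDensity, h, indicator, ENNReal.toReal_ofReal (Real.exp_pos _).le]
    · simp [expDensity, h, indicator]
  · refine ae_of_all _ fun s => ?_
    by_cases h : s ∈ Ioi (0:ℝ) <;> simp [expDensity, indicator, h]

theorem expDensity_convolution (v : ℝ) :
    expDensity (2 * v) + ∫⁻ s, expDensity s * expDensity (2 * (v - s)) = expDensity v := by
  by_cases hv : 0 < v
  · have h1 : ∀ s, expDensity s * expDensity (2 * (v - s)) =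
        (Ioo 0 v).indicator (fun s => ENNReal.ofReal (Real.exp (-(2 * v)) * Real.exp s)) s := by
      intro s
      by_cases h : s ∈ Ioo 0 v
      · have h2 : 0 < 2 * (v - s) := by linarith [h.2]
        rw [indicator_of_mem h, expDensity, expDensity, indicator_of_mem (mem_Ioi.2 h.1),
          indicator_of_mem (mem_Ioi.2 h2), ← ENNReal.ofReal_mul (Real.exp_pos _).le, ← Real.exp_add,
          ← Real.exp_add]
        congr 2; ring
      · rw [indicator_of_notMem h]
        rw [mem_Ioo, not_and_or] at h
        rcases h with h | h
        · simp [expDensity, h]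
        · simp [expDensity, h]
    simp_rw [h1]
    rw [lintegral_indicator measurableSet_Ioo, setLIntegral_congr Ioo_ae_eq_Ioc,
      ← ofReal_integral_eq_lintegral_ofReal, ← intervalIntegral.integral_of_le hv.le,
      intervalIntegral.integral_const_mul, integral_exp, expDensity, expDensity,
      indicator_of_mem (mem_Ioi.2 (by linarith)), indicator_of_mem (mem_Ioi.2 hv),
      ← ENNReal.ofReal_add (Real.exp_pos _).le]
    · congr 1
      rw [mul_sub, ← Real.exp_add, Real.exp_zero]
      ring_nf
    · have : Real.exp 0 ≤ Real.exp v := Real.exp_le_exp.2 hv.le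
      exact mul_nonneg (Real.exp_pos _).le (by linarith)
    · exact (Continuous.integrableOn_Icc (by fun_prop)).mono_set Ioc_subset_Icc_self
    · exact ae_of_all _ fun s => by positivity
  · have h1 : ∀ s, expDensity s * expDensity (2 * (v - s)) = 0 := by
      intro s
      by_cases h : 0 < s
      · have : ¬ 0 < 2 * (v - s) := by linarith
        simp [expDensity, indicator, this]
      · simp [expDensity, h]
    simp_rw [h1]
    have : ¬ 0 < 2 * v := by linarith
    simp [expDensity, hv]

theorem lintegral_expLaw_halves (F : ℝ → ℝ≥0∞) (hF : Measurable F) :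
    2 * ∫⁻ s, F s ∂expLaw = ∫⁻ r, F (r / 2) ∂expLaw + ∫⁻ s, ∫⁻ r, F (s + r / 2) ∂expLaw ∂expLaw := by
  have hsub : ∀ (s : ℝ) (G : ℝ → ℝ≥0∞), ∫⁻ r, G r = 2 * ∫⁻ v, G (2 * (v - s)) := by
    intro s G
    have := lintegral_comp_sub_mul G (-(2 * s)) (-2) (by norm_num)
    rw [show (fun v => G (2 * (v - s))) = fun v => G (-(2 * s) - -2 * v) by ext v; ring_nf, this,
      ← mul_assoc]
    rw [show (2:ℝ≥0∞) = ENNReal.ofReal 2 by simp, ← ENNReal.ofReal_mul (by norm_num)]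
    norm_num
  have hm := measurable_expDensity
  rw [lintegral_expLaw _ (by fun_prop), lintegral_expLaw _ (by fun_prop), lintegral_expLaw]
  swap
  · exact Measurable.lintegral_prod_right' (f := fun z : ℝ × ℝ => F (z.1 + z.2 / 2)) (by fun_prop)
  have h2 : ∀ s, ∫⁻ r, F (s + r / 2) ∂expLaw = 2 * ∫⁻ v, expDensity (2 * (v - s)) * F v := by
    intro s
    rw [lintegral_expLaw _ (by fun_prop), hsub s]
    congr 2; ext v; congr 2; ring
  simp_rw [h2]
  rw [hsub 0 (fun s => expDensity s * F (s / 2))]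
  simp_rw [mul_left_comm _ (2:ℝ≥0∞) _]
  rw [lintegral_const_mul' _ _ (by simp), ← mul_add]
  congr 1
  have h3 : ∀ s, expDensity s * ∫⁻ v, expDensity (2 * (v - s)) * F v =
      ∫⁻ v, expDensity s * (expDensity (2 * (v - s)) * F v) := fun s =>
    (lintegral_const_mul' _ _ (by simp only [expDensity, indicator]; split_ifs <;> simp)).symm
  simp_rw [h3]
  rw [lintegral_lintegral_swap (by fun_prop), ← lintegral_add_left (by fun_prop)]
  congr 1; ext v
  rw [← expDensity_convolution v, add_mul, ← lintegral_mul_const _ (by fun_prop)]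
  simp only [sub_zero, mul_assoc]
  congr 3
  ring

theorem expLaw_eq : expLaw = (2:ℝ≥0∞)⁻¹ • Measure.map (fun r => r / 2) expLaw +
    (2:ℝ≥0∞)⁻¹ • Measure.map (fun z : ℝ × ℝ => z.1 + z.2 / 2) (expLaw.prod expLaw) := by
  refine Measure.ext_of_lintegral _ fun F hF => ?_
  rw [lintegral_add_measure, lintegral_smul_measure, lintegral_smul_measure,
    lintegral_map hF (by fun_prop), lintegral_map hF (by fun_prop), lintegral_prod _ (by fun_prop),
    smul_eq_mul, smul_eq_mul, ← mul_add, ← lintegral_expLaw_halves F hF, ← mul_assoc]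
  rw [ENNReal.inv_mul_cancel (by simp) (by simp), one_mul]

theorem integrable_expLaw_comp {E : Type*} [NormedAddCommGroup E] {f : ℝ → E} (hf : StronglyMeasurable f) {B : ℝ}
    (hB : ∀ t, ‖f t‖ ≤ B) (t a : ℝ) : Integrable (fun s => f (t - a * s)) expLaw :=
  Integrable.of_bound (hf.comp_measurable (by fun_prop)).aestronglyMeasurable B
    (ae_of_all _ fun s => hB _)

section ExpAvg

variable {E : Type*} [NormedAddCommGroup E] [NormedSpace ℝ E]

/-- The one-sided exponential average of `f` at scale `a`. -/
def expAvg (a : ℝ) (f : ℝ → E) (t : ℝ) : E := ∫ s, f (t - a * s) ∂expLaw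

theorem norm_expAvg_le (a : ℝ) (f : ℝ → E) (B : ℝ) (hB : ∀ t, ‖f t‖ ≤ B) (t : ℝ) :
    ‖expAvg a f t‖ ≤ B := by
  have := norm_integral_le_of_norm_le_const (μ := expLaw) (f := fun s => f (t - a * s)) (C := B)
    (ae_of_all _ fun s => hB _)
  simpa [expAvg] using this

theorem stronglyMeasurable_expAvg (a : ℝ) {f : ℝ → E} (hf : StronglyMeasurable f) :
    StronglyMeasurable (expAvg a f) := by
  refine StronglyMeasurable.integral_prod_right (f := fun t s => f (t - a * s)) ?_
  exact hf.comp_measurable (by fun_prop)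

theorem expAvg_eq_halves (a : ℝ) {f : ℝ → E} (hf : StronglyMeasurable f) {B : ℝ}
    (hB : ∀ t, ‖f t‖ ≤ B) (t : ℝ) :
    expAvg a f t = (1/2:ℝ) • expAvg (a / 2) f t + (1/2:ℝ) • expAvg a (expAvg (a / 2) f) t := by
  have hitg : ∀ (μ : Measure ℝ) [IsFiniteMeasure μ], Integrable (fun s => f (t - a * s)) μ :=
    fun μ _ => Integrable.of_bound (hf.comp_measurable (by fun_prop)).aestronglyMeasurable B
      (ae_of_all _ fun s => hB _)
  conv_lhs => rw [expAvg, expLaw_eq]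
  have i1 := (hitg (Measure.map (fun r => r / 2) expLaw)).smul_measure (c := (2:ℝ≥0∞)⁻¹) (by simp)
  have i2 := (hitg (Measure.map (fun z : ℝ × ℝ => z.1 + z.2 / 2)
    (expLaw.prod expLaw))).smul_measure (c := (2:ℝ≥0∞)⁻¹) (by simp)
  rw [integral_add_measure i1 i2, integral_smul_measure, integral_smul_measure, integral_map,
    integral_map, integral_prod]
  · simp only [ENNReal.toReal_inv, ENNReal.toReal_ofNat, one_div, expAvg]
    congr 4
    · ext s; congr 1; ring
    · ext s; congr 1; ext r; congr 1; ring
  · exact Integrable.of_bound (hf.comp_measurable (by fun_prop)).aestronglyMeasurable B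
      (ae_of_all _ fun s => hB _)
  · fun_prop
  · exact (hf.comp_measurable (by fun_prop)).aestronglyMeasurable
  · fun_prop
  · exact (hf.comp_measurable (by fun_prop)).aestronglyMeasurable

end ExpAvg

section LittlewoodPaley

variable {E : Type*} [NormedAddCommGroup E] [InnerProductSpace ℝ E]

theorem ofReal_norm_rpow {E : Type*} [NormedAddCommGroup E] (x : E) {p : ℝ} (hp : 0 ≤ p) : ENNReal.ofReal (‖x‖ ^ p) = ‖x‖ₑ ^ p := by
  rw [← ENNReal.ofReal_rpow_of_nonneg (norm_nonneg _) hp, ofReal_norm]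

theorem bregman_tangent_le [CompleteSpace E] {p : ℝ} (hp : 1 < p) (hp2 : p ≤ 2) {f : ℝ → E}
    (hf : StronglyMeasurable f) {B : ℝ} (hB : ∀ t, ‖f t‖ ≤ B) (a t : ℝ) (v : E) :
    ‖v‖ ^ p + p * ‖v‖ ^ (p - 2) * inner ℝ v (expAvg a f t - v) ≤
      ∫ s, ‖f (t - a * s)‖ ^ p ∂expLaw := by
  have hi := integrable_expLaw_comp hf hB t a
  have hi2 : Integrable (fun s => ‖f (t - a * s)‖ ^ p) expLaw := by
    refine Integrable.of_bound (C := B ^ p) ?_ (ae_of_all _ fun s => ?_)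
    · exact ((hf.comp_measurable (by fun_prop)).norm.measurable.pow_const p).aestronglyMeasurable
    · rw [Real.norm_of_nonneg (by positivity)]
      exact Real.rpow_le_rpow (norm_nonneg _) (hB _) (by linarith)
  have hi3 : Integrable (fun s => f (t - a * s) - v) expLaw := hi.sub (integrable_const v)
  have h1 : ∫ s, (‖v‖ ^ p + p * ‖v‖ ^ (p - 2) * inner ℝ v (f (t - a * s) - v)) ∂expLaw =
      ‖v‖ ^ p + p * ‖v‖ ^ (p - 2) * inner ℝ v (expAvg a f t - v) := by
    rw [integral_add (integrable_const _) ((hi3.const_inner v).const_mul _), integral_const_mul,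
      integral_inner hi3, integral_sub hi (integrable_const v)]
    simp [expAvg]
  rw [← h1]
  refine integral_mono ((integrable_const _).add ((hi3.const_inner v).const_mul _)) hi2 fun s => ?_
  have := bregman_nonneg hp hp2 (f (t - a * s)) v
  simp only [bregman] at this
  linarith

theorem lintegral_expLaw_translate (F : ℝ → ℝ≥0∞) (hF : Measurable F) (a : ℝ) :
    ∫⁻ t, ∫⁻ s, F (t - a * s) ∂expLaw = ∫⁻ t, F t := by
  rw [lintegral_lintegral_swap (by fun_prop)]
  simp_rw [lintegral_sub_right_eq_self F]
  simp

theorem ofReal_integral_norm_rpow {E : Type*} [NormedAddCommGroup E] {p : ℝ} (hp : 1 < p) {f : ℝ → E}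
    (hf : StronglyMeasurable f) {B : ℝ} (hB : ∀ t, ‖f t‖ ≤ B) (a t : ℝ) :
    ENNReal.ofReal (∫ s, ‖f (t - a * s)‖ ^ p ∂expLaw) = ∫⁻ s, ‖f (t - a * s)‖ₑ ^ p ∂expLaw := by
  rw [ofReal_integral_eq_lintegral_ofReal]
  · congr 1; ext s; rw [ofReal_norm_rpow _ (by linarith)]
  · refine Integrable.of_bound (C := B ^ p) ?_ (ae_of_all _ fun s => ?_)
    · exact ((hf.comp_measurable (by fun_prop)).norm.measurable.pow_const p).aestronglyMeasurable
    · rw [Real.norm_of_nonneg (by positivity)]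
      exact Real.rpow_le_rpow (norm_nonneg _) (hB _) (by linarith)
  · exact ae_of_all _ fun s => by positivity

theorem lintegral_expAvg_rpow_le [CompleteSpace E] {p : ℝ} (hp : 1 < p) (hp2 : p ≤ 2) {f : ℝ → E}
    (hf : StronglyMeasurable f) {B : ℝ} (hB : ∀ t, ‖f t‖ ≤ B) (a : ℝ) :
    ∫⁻ t, ‖expAvg a f t‖ₑ ^ p ≤ ∫⁻ t, ‖f t‖ₑ ^ p := by
  rw [← lintegral_expLaw_translate (fun t => ‖f t‖ₑ ^ p) (by have := hf.enorm; fun_prop) a]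
  refine lintegral_mono fun t => ?_
  rw [← ofReal_integral_norm_rpow hp hf hB, ← ofReal_norm_rpow _ (by linarith)]
  refine ENNReal.ofReal_le_ofReal ?_
  simpa using bregman_tangent_le hp hp2 hf hB a t (expAvg a f t)

theorem bregman_expAvg_le [CompleteSpace E] {p : ℝ} (hp : 1 < p) (hp2 : p ≤ 2) {f : ℝ → E}
    (hf : StronglyMeasurable f) {B : ℝ} (hB : ∀ t, ‖f t‖ ≤ B) (a t : ℝ) :
    bregman p (expAvg (a / 2) f t) (expAvg a f t) + 2 * ‖expAvg a f t‖ ^ p ≤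
      ‖expAvg (a / 2) f t‖ ^ p + ∫ s, ‖expAvg (a / 2) f (t - a * s)‖ ^ p ∂expLaw := by
  have h1 := bregman_tangent_le hp hp2 (stronglyMeasurable_expAvg (a / 2) hf)
    (norm_expAvg_le (a / 2) f B hB) a t (expAvg a f t)
  have h2 := expAvg_eq_halves a hf hB t
  set v := expAvg a f t
  set u := expAvg (a / 2) f t
  set w := expAvg a (expAvg (a / 2) f) t
  have h3 : w - v = -(u - v) := by
    have : v + v = u + w := by
      conv_lhs => rw [h2]
      module
    rw [neg_sub, sub_eq_sub_iff_add_eq_add, add_comm w u, ← this]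
  rw [h3, inner_neg_right] at h1
  simp only [bregman]
  linarith

theorem lintegral_bregman_add_le [CompleteSpace E] {p : ℝ} (hp : 1 < p) (hp2 : p ≤ 2) {f : ℝ → E}
    (hf : StronglyMeasurable f) {B : ℝ} (hB : ∀ t, ‖f t‖ ≤ B) (a : ℝ) :
    (∫⁻ t, ENNReal.ofReal (bregman p (expAvg (a / 2) f t) (expAvg a f t))) +
      2 * ∫⁻ t, ‖expAvg a f t‖ₑ ^ p ≤ 2 * ∫⁻ t, ‖expAvg (a / 2) f t‖ₑ ^ p := by
  have hu := stronglyMeasurable_expAvg (a / 2) hf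
  have hv := stronglyMeasurable_expAvg a hf
  have hum := hu.enorm
  have hvm := hv.enorm
  calc _ = ∫⁻ t, (ENNReal.ofReal (bregman p (expAvg (a / 2) f t) (expAvg a f t)) +
          2 * ‖expAvg a f t‖ₑ ^ p) := by
        rw [lintegral_add_right _ (by fun_prop), lintegral_const_mul _ (by fun_prop)]
    _ ≤ ∫⁻ t, (‖expAvg (a / 2) f t‖ₑ ^ p +
          ∫⁻ s, ‖expAvg (a / 2) f (t - a * s)‖ₑ ^ p ∂expLaw) := by
        refine lintegral_mono fun t => ?_
        rw [← ofReal_integral_norm_rpow hp hu (norm_expAvg_le (a / 2) f B hB),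
          ← ofReal_norm_rpow _ (by linarith), ← ofReal_norm_rpow _ (by linarith),
          ← ENNReal.ofReal_add (by positivity) (integral_nonneg fun s => by positivity),
          show (2:ℝ≥0∞) = ENNReal.ofReal 2 by simp, ← ENNReal.ofReal_mul (by norm_num),
          ← ENNReal.ofReal_add (bregman_nonneg hp hp2 _ _) (by positivity)]
        exact ENNReal.ofReal_le_ofReal (bregman_expAvg_le hp hp2 hf hB a t)
    _ = _ := by
        rw [lintegral_add_left (by fun_prop), lintegral_expLaw_translate
          (fun t => ‖expAvg (a / 2) f t‖ₑ ^ p) (by fun_prop), two_mul]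

theorem sum_lintegral_bregman_le [CompleteSpace E] {p : ℝ} (hp : 1 < p) (hp2 : p ≤ 2) {f : ℝ → E}
    (hf : StronglyMeasurable f) {B : ℝ} (hB : ∀ t, ‖f t‖ ≤ B) (a : ℝ) (n : ℕ) :
    ∑ i ∈ Finset.range n, (∫⁻ t, ENNReal.ofReal
      (bregman p (expAvg (a / 2 ^ (i + 1)) f t) (expAvg (a / 2 ^ i) f t))) ≤
      2 * ∫⁻ t, ‖expAvg (a / 2 ^ n) f t‖ₑ ^ p := by
  induction n with
  | zero => simp
  | succ n ih =>
    rw [Finset.sum_range_succ, add_comm]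
    refine (add_le_add_right ih _).trans ?_
    have := lintegral_bregman_add_le hp hp2 hf hB (a / 2 ^ n)
    rwa [div_div, ← pow_succ] at this

theorem enorm_expAvg_le_maxFn {f : ℝ → E} (hf : StronglyMeasurable f) {a : ℝ} (ha : 0 < a) (t : ℝ) :
    ‖expAvg a f t‖ₑ ≤ 32 * maxFn (fun s => ‖f s‖ₑ) t := by
  have hm := hf.enorm
  refine (enorm_integral_le_lintegral_enorm _).trans ?_
  rw [lintegral_expLaw_eq_setLIntegral (fun s => ‖f (t - a * s)‖ₑ) (by fun_prop)]
  exact lintegral_exp_le_maxFn (fun s => ‖f s‖ₑ) hm t a ha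

theorem maxFn_enorm_ne_top {E : Type*} [NormedAddCommGroup E] {f : ℝ → E} {B : ℝ} (hB : ∀ t, ‖f t‖ ≤ B) (t : ℝ) :
    32 * maxFn (fun s => ‖f s‖ₑ) t ≠ ∞ := by
  refine ENNReal.mul_ne_top (by simp) (ne_top_of_le_ne_top ?_ ((maxFn_mono (g := fun _ =>
    ENNReal.ofReal B) (fun s => ?_) t).trans (maxFn_const_le _ t)))
  · exact ENNReal.mul_ne_top (by simp) (by simp)
  · rw [← ofReal_norm]; exact ENNReal.ofReal_le_ofReal (hB s)

theorem enorm_expAvg_sub_sq_le {p : ℝ} (hp : 1 < p) (hp2 : p ≤ 2) {f : ℝ → E}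
    (hf : StronglyMeasurable f) {B : ℝ} (hB : ∀ t, ‖f t‖ ≤ B) {a a' : ℝ} (ha : 0 < a)
    (ha' : 0 < a') (t : ℝ) :
    ‖expAvg a' f t - expAvg a f t‖ₑ ^ 2 ≤ ENNReal.ofReal (bregman p (expAvg a' f t) (expAvg a f t)) *
      (2 / ENNReal.ofReal (p - 1)) * (32 * maxFn (fun s => ‖f s‖ₑ) t) ^ (2 - p) := by
  have hu := enorm_expAvg_le_maxFn hf ha' t
  have hv := enorm_expAvg_le_maxFn hf ha t
  have htop := maxFn_enorm_ne_top hB t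
  set M := 32 * maxFn (fun s => ‖f s‖ₑ) t
  by_cases h0 : M = 0
  · rw [h0, nonpos_iff_eq_zero, enorm_eq_zero] at hu hv
    simp [hu, hv]
  · have hM : 0 < M.toReal := ENNReal.toReal_pos h0 htop
    have hu' : ‖expAvg a' f t‖ ≤ M.toReal := by
      rw [← toReal_enorm]; exact ENNReal.toReal_mono htop hu
    have hv' : ‖expAvg a f t‖ ≤ M.toReal := by
      rw [← toReal_enorm]; exact ENNReal.toReal_mono htop hv
    have := norm_sub_sq_le_bregman hp hp2 _ _ hu' hv' hM
    have hb := bregman_nonneg hp hp2 (expAvg a' f t) (expAvg a f t)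
    rw [← ENNReal.ofReal_toReal htop, ENNReal.ofReal_rpow_of_pos hM,
      show (2:ℝ≥0∞) = ENNReal.ofReal 2 by simp, ← ENNReal.ofReal_div_of_pos (by linarith),
      ← ENNReal.ofReal_mul hb, ← ENNReal.ofReal_mul (mul_nonneg hb (by
        have : 0 < p - 1 := by linarith
        positivity)), ← ofReal_norm, ← ENNReal.ofReal_pow (norm_nonneg _)]
    refine ENNReal.ofReal_le_ofReal ?_
    have hp0 : 0 < p - 1 := by linarith
    calc _ = 2 / (p - 1) * ((p - 1) / 2 * ‖expAvg a' f t - expAvg a f t‖ ^ 2) := by field_simp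
      _ ≤ 2 / (p - 1) * (M.toReal ^ (2 - p) * bregman p (expAvg a' f t) (expAvg a f t)) := by gcongr
      _ = _ := by ring

/-- The Littlewood–Paley inequality for exponential averages. -/
theorem lintegral_squareFunction_le [CompleteSpace E] {p : ℝ} (hp : 1 < p) (hp2 : p ≤ 2) {f : ℝ → E}
    (hf : StronglyMeasurable f) {B : ℝ} (hB : ∀ t, ‖f t‖ ≤ B) {a : ℝ} (ha : 0 < a) (n : ℕ) :
    ∫⁻ t, (∑ i ∈ Finset.range n, ‖expAvg (a / 2 ^ (i + 1)) f t - expAvg (a / 2 ^ i) f t‖ₑ ^ 2)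
      ^ (p / 2) ≤ 163840 / ENNReal.ofReal (p - 1) * ∫⁻ t, ‖f t‖ₑ ^ p := by
  have hm := hf.enorm
  have hMm : Measurable (maxFn fun s => ‖f s‖ₑ) := measurable_maxFn hm
  have hbm : ∀ i : ℕ, Measurable fun t => ENNReal.ofReal
      (bregman p (expAvg (a / 2 ^ (i + 1)) f t) (expAvg (a / 2 ^ i) f t)) := by
    intro i
    have h1 := stronglyMeasurable_expAvg (a / 2 ^ (i + 1)) hf
    have h2 := stronglyMeasurable_expAvg (a / 2 ^ i) hf
    have h3 := h1.norm.measurable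
    have h4 := h2.norm.measurable
    have h5 : Measurable fun t => inner ℝ (expAvg (a / 2 ^ i) f t)
        (expAvg (a / 2 ^ (i + 1)) f t - expAvg (a / 2 ^ i) f t) :=
      (StronglyMeasurable.inner h2 (h1.sub h2)).measurable
    simp only [bregman]
    fun_prop
  set D := (ENNReal.ofReal (p - 1))⁻¹
  set Mx := fun t => 32 * maxFn (fun s => ‖f s‖ₑ) t
  set S := fun t => ∑ i ∈ Finset.range n, ENNReal.ofReal
      (bregman p (expAvg (a / 2 ^ (i + 1)) f t) (expAvg (a / 2 ^ i) f t))
  have hS : ∫⁻ t, S t * (2 * D) ≤ 163840 * D * ∫⁻ t, ‖f t‖ₑ ^ p := by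
    rw [lintegral_mul_const _ (by fun_prop), lintegral_finsetSum _ (fun i _ => hbm i)]
    calc _ ≤ (2 * ∫⁻ t, ‖f t‖ₑ ^ p) * (2 * D) := by
          refine mul_le_mul_left ((sum_lintegral_bregman_le hp hp2 hf hB a n).trans ?_) _
          exact mul_le_mul_right (lintegral_expAvg_rpow_le hp hp2 hf hB _) _
      _ = 4 * D * ∫⁻ t, ‖f t‖ₑ ^ p := by ring
      _ ≤ _ := by gcongr; norm_num
  have hM : ∫⁻ t, Mx t ^ p ≤ 163840 * D * ∫⁻ t, ‖f t‖ₑ ^ p := by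
    simp only [Mx, ENNReal.mul_rpow_of_nonneg _ _ (show 0 ≤ p by linarith)]
    rw [lintegral_const_mul _ (by fun_prop)]
    refine (mul_le_mul_right (lintegral_maxFn_rpow_le _ hm p hp hp2) _).trans ?_
    rw [← mul_assoc, div_eq_mul_inv, ← mul_assoc]
    gcongr
    calc (32:ℝ≥0∞) ^ p * 160 ≤ 32 ^ (2:ℝ) * 160 := by
          gcongr
          norm_num
      _ ≤ 163840 := by rw [ENNReal.rpow_ofNat]; norm_num
  calc _ ≤ ∫⁻ t, (S t * (2 * D)) ^ (p / 2) * (Mx t ^ p) ^ (1 - p / 2) := by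
        refine lintegral_mono fun t => ?_
        calc _ ≤ (S t * (2 * D) * Mx t ^ (2 - p)) ^ (p / 2) := by
              refine ENNReal.rpow_le_rpow ?_ (by linarith)
              simp only [S]
              rw [Finset.sum_mul, Finset.sum_mul]
              refine Finset.sum_le_sum fun i _ => ?_
              exact enorm_expAvg_sub_sq_le hp hp2 hf hB (by positivity) (by positivity) t
          _ = _ := by
              rw [ENNReal.mul_rpow_of_nonneg _ _ (by linarith), ← ENNReal.rpow_mul,
                ← ENNReal.rpow_mul]
              congr 2; ring
    _ ≤ (∫⁻ t, S t * (2 * D)) ^ (p / 2) * (∫⁻ t, Mx t ^ p) ^ (1 - p / 2) :=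
        ENNReal.lintegral_mul_norm_pow_le (by fun_prop) (by fun_prop) (by linarith) (by linarith)
          (by ring)
    _ ≤ (163840 * D * ∫⁻ t, ‖f t‖ₑ ^ p) ^ (p / 2) *
          (163840 * D * ∫⁻ t, ‖f t‖ₑ ^ p) ^ (1 - p / 2) := by
        refine mul_le_mul' (ENNReal.rpow_le_rpow hS (by linarith))
          (ENNReal.rpow_le_rpow hM (by linarith))
    _ = _ := by
        rw [← ENNReal.rpow_add_of_nonneg _ _ (by linarith) (by linarith),
          div_eq_mul_inv _ (ENNReal.ofReal (p - 1))]
        rw [show p / 2 + (1 - p / 2) = 1 by ring, ENNReal.rpow_one]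

end LittlewoodPaley

section ProductLittlewoodPaley

/-- The difference of two consecutive dyadic exponential averages. -/
def expDiff {E : Type*} [NormedAddCommGroup E] [NormedSpace ℝ E] (a : ℝ) (f : ℝ → E) (t : ℝ) : E :=
  expAvg (a / 2) f t - expAvg a f t

/-- `expDiff` in the first variable. -/
def expDiffFst (a : ℝ) (g : ℝ × ℝ → ℝ) (x : ℝ × ℝ) : ℝ := expDiff a (fun t => g (t, x.2)) x.1

/-- `expDiff` in the second variable. -/
def expDiffSnd (a : ℝ) (g : ℝ × ℝ → ℝ) (x : ℝ × ℝ) : ℝ := expDiff a (fun t => g (x.1, t)) x.2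

theorem measurable_expDiffFst (a : ℝ) {g : ℝ × ℝ → ℝ} (hg : Measurable g) :
    Measurable (expDiffFst a g) := by
  have h : ∀ c : ℝ, Measurable fun x : ℝ × ℝ => expAvg c (fun t => g (t, x.2)) x.1 := by
    intro c
    refine (StronglyMeasurable.integral_prod_right' (ν := expLaw)
      (f := fun z : (ℝ × ℝ) × ℝ => g (z.1.1 - c * z.2, z.1.2)) ?_).measurable
    exact (hg.comp (by fun_prop)).stronglyMeasurable
  exact (h (a / 2)).sub (h a)

theorem measurable_expDiffSnd (a : ℝ) {g : ℝ × ℝ → ℝ} (hg : Measurable g) :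
    Measurable (expDiffSnd a g) := by
  have h : ∀ c : ℝ, Measurable fun x : ℝ × ℝ => expAvg c (fun t => g (x.1, t)) x.2 := by
    intro c
    refine (StronglyMeasurable.integral_prod_right' (ν := expLaw)
      (f := fun z : (ℝ × ℝ) × ℝ => g (z.1.1, z.1.2 - c * z.2)) ?_).measurable
    exact (hg.comp (by fun_prop)).stronglyMeasurable
  exact (h (a / 2)).sub (h a)

theorem norm_expDiff_le {E : Type*} [NormedAddCommGroup E] [InnerProductSpace ℝ E] (a : ℝ)
    {f : ℝ → E} {B : ℝ} (hB : ∀ t, ‖f t‖ ≤ B) (t : ℝ) :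
    ‖expDiff a f t‖ ≤ 2 * B := by
  have h1 := norm_expAvg_le (a / 2) f B hB t
  have h2 := norm_expAvg_le a f B hB t
  have h3 := norm_sub_le (expAvg (a / 2) f t) (expAvg a f t)
  rw [expDiff]; linarith

theorem expDiff_euclidean_apply {n : ℕ} (a : ℝ) {f : ℝ → EuclideanSpace ℝ (Fin n)}
    (hf : StronglyMeasurable f) {B : ℝ} (hB : ∀ t, ‖f t‖ ≤ B) (t : ℝ) (k : Fin n) :
    expDiff a f t k = expDiff a (fun s => f s k) t := by
  have h : ∀ c, expAvg c f t k = expAvg c (fun s => f s k) t := fun c =>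
    ((EuclideanSpace.proj (𝕜 := ℝ) k).integral_comp_comm (integrable_expLaw_comp hf hB t c)).symm
  simp only [expDiff, PiLp.sub_apply, h]

theorem EuclideanSpace.enorm_sq_eq_sum {n : ℕ} (v : EuclideanSpace ℝ (Fin n)) :
    ‖v‖ₑ ^ 2 = ∑ k, ‖v k‖ₑ ^ 2 := by
  rw [← ofReal_norm, ← ENNReal.ofReal_pow (norm_nonneg _), EuclideanSpace.norm_sq_eq,
    ENNReal.ofReal_sum_of_nonneg (fun _ _ => by positivity)]
  exact Finset.sum_congr rfl fun k _ => by
    rw [ENNReal.ofReal_pow (norm_nonneg _), ofReal_norm]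

theorem enorm_rpow_eq_sq_rpow {E : Type*} [NormedAddCommGroup E] (v : E) (p : ℝ) :
    ‖v‖ₑ ^ p = (‖v‖ₑ ^ 2) ^ (p / 2) := by
  rw [← ENNReal.rpow_natCast, ← ENNReal.rpow_mul]
  congr 1; push_cast; ring

theorem lintegral_prodSquareFunction_le {p : ℝ} (hp : 1 < p) (hp2 : p ≤ 2) {g : ℝ × ℝ → ℝ}
    (hg : Measurable g) {B : ℝ} (hB : ∀ x, ‖g x‖ ≤ B) {a a' : ℝ} (ha : 0 < a) (ha' : 0 < a')
    (n : ℕ) :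
    ∫⁻ x, (∑ i ∈ Finset.range n, ∑ k ∈ Finset.range n,
        ‖expDiffFst (a / 2 ^ i) (expDiffSnd (a' / 2 ^ k) g) x‖ₑ ^ 2) ^ (p / 2) ≤
      (163840 / ENNReal.ofReal (p - 1)) ^ 2 * ∫⁻ x, ‖g x‖ₑ ^ p := by
  set D := 163840 / ENNReal.ofReal (p - 1) with hD
  have h2m : ∀ k : ℕ, Measurable (expDiffSnd (a' / 2 ^ k) g) := fun k =>
    measurable_expDiffSnd _ hg
  have hm : ∀ i k : ℕ, Measurable (expDiffFst (a / 2 ^ i) (expDiffSnd (a' / 2 ^ k) g)) :=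
    fun i k => measurable_expDiffFst _ (h2m k)
  rw [Measure.volume_eq_prod, lintegral_prod_symm _ (by fun_prop)]
  calc _ ≤ ∫⁻ y, D * ∫⁻ t, (∑ k ∈ Finset.range n, ‖expDiffSnd (a' / 2 ^ k) g (t, y)‖ₑ ^ 2) ^ (p / 2) := by
        refine lintegral_mono fun y => ?_
        set f : ℝ → EuclideanSpace ℝ (Fin n) := fun t =>
          WithLp.toLp 2 fun k : Fin n => expDiffSnd (a' / 2 ^ (k:ℕ)) g (t, y) with hfdef
        have hf : StronglyMeasurable f := by
          refine Measurable.stronglyMeasurable ?_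
          refine (WithLp.measurable_toLp 2 _).comp (measurable_pi_lambda _ fun k => ?_)
          exact (h2m k).comp (by fun_prop)
        have hfB : ∀ t, ‖f t‖ ≤ √(n * (2 * B) ^ 2) := by
          intro t
          rw [EuclideanSpace.norm_eq]
          refine Real.sqrt_le_sqrt ?_
          calc _ ≤ ∑ k : Fin n, (2 * B) ^ 2 := Finset.sum_le_sum fun k _ => by
                refine pow_le_pow_left₀ (norm_nonneg _) ?_ 2
                exact norm_expDiff_le _ (fun s => hB (t, s)) y
            _ = _ := by simp
        have key := lintegral_squareFunction_le hp hp2 hf hfB ha n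
        calc _ = _ := ?_
          _ ≤ _ := key
          _ = _ := ?_
        · congr 1; ext t; congr 1
          refine Finset.sum_congr rfl fun i _ => ?_
          have : expAvg (a / 2 ^ (i + 1)) f t - expAvg (a / 2 ^ i) f t = expDiff (a / 2 ^ i) f t := by
            rw [expDiff, pow_succ, ← div_div]
          rw [this, EuclideanSpace.enorm_sq_eq_sum, Finset.sum_range]
          refine Finset.sum_congr rfl fun k _ => ?_
          rw [expDiff_euclidean_apply _ hf hfB]
          rfl
        · congr 2; ext t
          rw [enorm_rpow_eq_sq_rpow, EuclideanSpace.enorm_sq_eq_sum, Finset.sum_range]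
    _ = D * ∫⁻ t, ∫⁻ y, (∑ k ∈ Finset.range n, ‖expDiffSnd (a' / 2 ^ k) g (t, y)‖ₑ ^ 2) ^ (p / 2) := by
        rw [lintegral_const_mul, lintegral_lintegral_swap]
        · fun_prop
        · refine Measurable.lintegral_prod_left' (f := fun z : ℝ × ℝ =>
            (∑ k ∈ Finset.range n, ‖expDiffSnd (a' / 2 ^ k) g z‖ₑ ^ 2) ^ (p / 2)) ?_
          fun_prop
    _ ≤ D * ∫⁻ t, D * ∫⁻ y, ‖g (t, y)‖ₑ ^ p := by
        refine mul_le_mul_right (lintegral_mono fun t => ?_) _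
        have key := lintegral_squareFunction_le (E := ℝ) hp hp2 (f := fun y => g (t, y))
          (hg.comp (by fun_prop)).stronglyMeasurable (fun y => hB (t, y)) ha' n
        calc _ = _ := ?_
          _ ≤ _ := key
        congr 1; ext y; congr 1
        refine Finset.sum_congr rfl fun i _ => ?_
        rw [expDiffSnd, expDiff, div_div _ _ (2:ℝ), ← pow_succ]
    _ = _ := by
        rw [lintegral_const_mul _ ?_, lintegral_prod _ (by fun_prop), ← mul_assoc, sq]
        exact Measurable.lintegral_prod_right' (f := fun z : ℝ × ℝ => ‖g z‖ₑ ^ p) (by fun_prop)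

end ProductLittlewoodPaley

section Thick

theorem lintegral_prod_eq_mul_comp_mul {F : ℝ × ℝ → ℝ≥0∞} (hF : Measurable F) {c d : ℝ}
    (hc : 0 < c) (hd : 0 < d) :
    ∫⁻ z, F z = ENNReal.ofReal (c * d) * ∫⁻ z : ℝ × ℝ, F (c * z.1, d * z.2) := by
  rw [Measure.volume_eq_prod, lintegral_prod _ (by fun_prop), lintegral_prod _ (by fun_prop)]
  have h1 : ∀ (k : ℝ) (_ : 0 < k) (G : ℝ → ℝ≥0∞), ∫⁻ s, G s = ENNReal.ofReal k * ∫⁻ s, G (k * s) := by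
    intro k hk G
    have := lintegral_comp_sub_mul G 0 (-k) (by linarith)
    simp only [zero_sub, neg_mul, neg_neg] at this
    rw [this, ← mul_assoc, ← ENNReal.ofReal_mul hk.le, inv_neg, abs_neg,
      abs_of_pos (inv_pos.2 hk), mul_inv_cancel₀ hk.ne']
    simp
  rw [h1 c hc, ENNReal.ofReal_mul hc.le, mul_assoc,
    ← lintegral_const_mul' (ENNReal.ofReal d) _ (by simp)]
  exact congrArg _ (lintegral_congr fun s => h1 d hd _)

theorem lintegral_translate (g : ℝ × ℝ → ℝ≥0∞) (c d : ℝ) :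
    ∫⁻ x : ℝ × ℝ, g (x.1 - c, x.2 - d) = ∫⁻ x, g x :=
  lintegral_sub_right_eq_self (μ := (volume : Measure (ℝ × ℝ))) g (c, d)

/-- The `ε`-neighbourhood of the graph of `γ` above `[r, s]`. -/
def thickSet (γ : ℝ → ℝ) (r s ε : ℝ) : Set (ℝ × ℝ) := {z | z.1 ∈ Icc r s ∧ |z.2 - γ z.1| ≤ ε}

theorem measurableSet_thickSet {γ : ℝ → ℝ} (hγ : Measurable γ) (r s ε : ℝ) :
    MeasurableSet (thickSet γ r s ε) :=
  (measurableSet_Icc.preimage measurable_fst).inter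
    (measurableSet_le (f := fun z : ℝ × ℝ => |z.2 - γ z.1|) (g := fun _ => ε) (by fun_prop)
      measurable_const)

/-- The average of `g` over the dilated `ε`-neighbourhood of a curve. -/
def thick (γ : ℝ → ℝ) (r s ε a e : ℝ) (g : ℝ × ℝ → ℝ≥0∞) (x : ℝ × ℝ) : ℝ≥0∞ :=
  ∫⁻ z in thickSet γ r s ε, ENNReal.ofReal ε⁻¹ * g (x.1 - a * z.1, x.2 - e * z.2)

theorem measurable_thick {γ : ℝ → ℝ} (r s ε a e : ℝ) {g : ℝ × ℝ → ℝ≥0∞} (hg : Measurable g) :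
    Measurable (thick γ r s ε a e g) :=
  Measurable.lintegral_prod_right' (ν := volume.restrict (thickSet γ r s ε))
    (f := fun w : (ℝ × ℝ) × (ℝ × ℝ) => ENNReal.ofReal ε⁻¹ *
      g (w.1.1 - a * w.2.1, w.1.2 - e * w.2.2)) (by fun_prop)

theorem thick_mono {γ : ℝ → ℝ} {r s ε a e : ℝ} {g h : ℝ × ℝ → ℝ≥0∞} (hgh : ∀ x, g x ≤ h x)
    (x : ℝ × ℝ) : thick γ r s ε a e g x ≤ thick γ r s ε a e h x :=
  lintegral_mono fun _ => mul_le_mul_right (hgh _) _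

theorem thick_thickness_mono {γ : ℝ → ℝ} {r s ε ε' a e : ℝ} (hε : 0 < ε) (h : ε ≤ ε')
    (g : ℝ × ℝ → ℝ≥0∞) (x : ℝ × ℝ) :
    thick γ r s ε a e g x ≤ ENNReal.ofReal (ε' / ε) * thick γ r s ε' a e g x := by
  have hε' : 0 < ε' := hε.trans_le h
  rw [thick, thick, ← lintegral_const_mul' _ _ (by simp)]
  refine (lintegral_mono_set (t := thickSet γ r s ε') fun z hz => ⟨hz.1, hz.2.trans h⟩).trans
    (lintegral_mono fun z => ?_)
  rw [← mul_assoc, ← ENNReal.ofReal_mul (by positivity)]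
  refine mul_le_mul_left (ENNReal.ofReal_le_ofReal (le_of_eq ?_)) _
  field_simp

theorem thick_le_strongMax {γ : ℝ → ℝ} {r s ε a e R Γ : ℝ} (hε : 0 < ε) (ha : 0 < a) (he : 0 < e)
    (hR : 0 < R) (hΓ : 0 ≤ Γ) (hsub : Icc r s ⊆ Icc (-R) R) (hγ : ∀ t ∈ Icc r s, |γ t| ≤ Γ)
    {g : ℝ × ℝ → ℝ≥0∞} (hg : Measurable g) (x : ℝ × ℝ) :
    thick γ r s ε a e g x ≤ ENNReal.ofReal (ε⁻¹ * (4 * R * (ε + Γ))) * strongMax g x := by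
  rw [thick, lintegral_const_mul _ (by fun_prop), ENNReal.ofReal_mul (by positivity), mul_assoc]
  refine mul_le_mul_right ((lintegral_mono_set ?_).trans
    (lintegral_box_le_strongMax g hg x a e R (ε + Γ) ha he hR (by linarith))) _
  rintro z ⟨h1, h2⟩
  refine ⟨hsub h1, abs_le.1 ?_⟩
  calc |z.2| = |(z.2 - γ z.1) + γ z.1| := by ring_nf
    _ ≤ _ := (abs_add_le _ _).trans (add_le_add h2 (hγ _ h1))

theorem lintegral_thick {γ : ℝ → ℝ} (hγ : Measurable γ) {r s ε : ℝ} (a e : ℝ) (hε : 0 < ε)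
    {g : ℝ × ℝ → ℝ≥0∞} (hg : Measurable g) :
    ∫⁻ x, thick γ r s ε a e g x = ENNReal.ofReal (2 * (s - r)) * ∫⁻ x, g x := by
  simp only [thick]
  rw [lintegral_lintegral_swap (by fun_prop)]
  have h1 : ∀ z : ℝ × ℝ, ∫⁻ x : ℝ × ℝ, ENNReal.ofReal ε⁻¹ * g (x.1 - a * z.1, x.2 - e * z.2) =
      ENNReal.ofReal ε⁻¹ * ∫⁻ x, g x := fun z => by
    rw [lintegral_const_mul _ (by fun_prop), lintegral_translate]
  simp_rw [h1]
  rw [setLIntegral_const, mul_right_comm]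
  congr 1
  rw [Measure.volume_eq_prod, Measure.prod_apply (measurableSet_thickSet hγ r s ε)]
  have h2 : ∀ t, volume (Prod.mk t ⁻¹' thickSet γ r s ε) =
      (Icc r s).indicator (fun _ => ENNReal.ofReal (2 * ε)) t := by
    intro t
    by_cases ht : t ∈ Icc r s
    · rw [indicator_of_mem ht]
      have : Prod.mk t ⁻¹' thickSet γ r s ε = Icc (γ t - ε) (γ t + ε) := by
        ext y
        refine ⟨fun h => ?_, fun h => ⟨ht, abs_le.2 ⟨by linarith [h.1], by linarith [h.2]⟩⟩⟩
        have h3 := abs_le.1 h.2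
        exact ⟨by linarith [h3.1], by linarith [h3.2]⟩
      rw [this, Real.volume_Icc]; congr 1; ring
    · rw [indicator_of_notMem ht]
      have : Prod.mk t ⁻¹' thickSet γ r s ε = ∅ := by
        ext y
        exact ⟨fun h => (ht h.1).elim, fun h => h.elim⟩
      rw [this, measure_empty]
  simp_rw [h2]
  rw [lintegral_indicator measurableSet_Icc, setLIntegral_const, Real.volume_Icc, ← mul_assoc,
    ← ENNReal.ofReal_mul (by positivity), ← ENNReal.ofReal_mul (by positivity)]
  congr 1
  field_simp

theorem thick_scale {γ : ℝ → ℝ} (hγ : Measurable γ) {r s ε a e c d : ℝ} (hc : 0 < c) (hd : 0 < d)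
    (hγc : ∀ t ∈ Icc r s, γ (c * t) = d * γ t) {g : ℝ × ℝ → ℝ≥0∞} (hg : Measurable g) (x : ℝ × ℝ) :
    thick γ (c * r) (c * s) ε a e g x =
      ENNReal.ofReal c * thick γ r s (ε / d) (a * c) (e * d) g x := by
  rw [thick, ← lintegral_indicator (measurableSet_thickSet hγ _ _ _),
    lintegral_prod_eq_mul_comp_mul
      (Measurable.indicator (by fun_prop) (measurableSet_thickSet hγ _ _ _)) hc hd,
    thick, ← lintegral_indicator (measurableSet_thickSet hγ _ _ _),
    ENNReal.ofReal_mul hc.le, mul_assoc,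
    ← lintegral_const_mul' (ENNReal.ofReal d) _ (by simp)]
  congr 2; ext z
  have hiff : ((c * z.1, d * z.2) ∈ thickSet γ (c * r) (c * s) ε) ↔ z ∈ thickSet γ r s (ε / d) := by
    have h1 : c * z.1 ∈ Icc (c * r) (c * s) ↔ z.1 ∈ Icc r s := by
      simp only [mem_Icc, mul_le_mul_iff_right₀ hc]
    simp only [thickSet, Set.mem_ofPred_eq, h1]
    refine and_congr_right fun hz => ?_
    rw [hγc _ hz, ← mul_sub, abs_mul, abs_of_pos hd, le_div_iff₀' hd]
  by_cases hz : z ∈ thickSet γ r s (ε / d)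
  · rw [indicator_of_mem (hiff.2 hz), indicator_of_mem hz, ← mul_assoc,
      ← ENNReal.ofReal_mul hd.le]
    congr 2
    · rw [inv_div]; ring
    · rw [mul_assoc, mul_assoc]
  · rw [indicator_of_notMem (fun h => hz (hiff.1 h)), indicator_of_notMem hz, mul_zero]

theorem thick_le_add {γ : ℝ → ℝ} {r m s ε a e : ℝ} (g : ℝ × ℝ → ℝ≥0∞) (x : ℝ × ℝ) :
    thick γ r s ε a e g x ≤ thick γ r m ε a e g x + thick γ m s ε a e g x := by
  refine (lintegral_mono_set (t := thickSet γ r m ε ∪ thickSet γ m s ε) fun z hz => ?_).trans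
    (lintegral_union_le _ _ _)
  rcases le_total z.1 m with h | h
  · exact Or.inl ⟨⟨hz.1.1, h⟩, hz.2⟩
  · exact Or.inr ⟨⟨h, hz.1.2⟩, hz.2⟩

/-- The model curve `t ↦ c t ^ b`. -/
def powCurve (c b t : ℝ) : ℝ := c * t ^ b

theorem measurable_powCurve (c b : ℝ) : Measurable (powCurve c b) := by
  unfold powCurve; fun_prop

theorem powCurve_mul (c b : ℝ) {k t : ℝ} (hk : 0 ≤ k) (ht : 0 ≤ t) :
    powCurve c b (k * t) = k ^ b * powCurve c b t := by
  rw [powCurve, powCurve, Real.mul_rpow hk ht]; ring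

/-- A positive sequence which at least doubles at each step. -/
structure Lacunary (u : ℤ → ℝ) : Prop where
  pos : ∀ n, 0 < u n
  two_mul_le : ∀ n, 2 * u n ≤ u (n + 1)

/-- The maximal function over thickened dilates of a curve. -/
def thickMax (c b r s ε : ℝ) (u : ℤ → ℝ) (g : ℝ × ℝ → ℝ≥0∞) (x : ℝ × ℝ) : ℝ≥0∞ :=
  ⨆ (j : ℤ) (n : ℤ), thick (powCurve c b) r s ε ((2:ℝ) ^ j) (u n * ((2:ℝ) ^ j) ^ b) g x

theorem measurable_thickMax (c b r s ε : ℝ) (u : ℤ → ℝ) {g : ℝ × ℝ → ℝ≥0∞} (hg : Measurable g) :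
    Measurable (thickMax c b r s ε u g) :=
  Measurable.iSup fun _ => Measurable.iSup fun _ => measurable_thick _ _ _ _ _ hg

theorem thick_le_thickMax (c b r s ε : ℝ) (u : ℤ → ℝ) (g : ℝ × ℝ → ℝ≥0∞) (x : ℝ × ℝ) (j n : ℤ) :
    thick (powCurve c b) r s ε ((2:ℝ) ^ j) (u n * ((2:ℝ) ^ j) ^ b) g x ≤
      thickMax c b r s ε u g x :=
  le_iSup₂ (f := fun j n : ℤ =>
    thick (powCurve c b) r s ε ((2:ℝ) ^ j) (u n * ((2:ℝ) ^ j) ^ b) g x) j n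

theorem thickMax_scale (c b ε : ℝ) {u : ℤ → ℝ} {g : ℝ × ℝ → ℝ≥0∞}
    (hg : Measurable g) (i : ℤ) (x : ℝ × ℝ) :
    thickMax c b ((2:ℝ) ^ i * 1) ((2:ℝ) ^ i * 2) ε u g x ≤
      ENNReal.ofReal ((2:ℝ) ^ i) * thickMax c b 1 2 (ε / ((2:ℝ) ^ i) ^ b) u g x := by
  refine iSup₂_le fun j n => ?_
  rw [thick_scale (measurable_powCurve c b) (c := (2:ℝ) ^ i) (d := ((2:ℝ) ^ i) ^ b) (by positivity)
    (by positivity) (fun t ht => powCurve_mul c b (by positivity) (by linarith [ht.1])) hg]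
  refine mul_le_mul_right ?_ _
  rw [← zpow_add₀ two_ne_zero, mul_assoc, ← Real.mul_rpow (by positivity) (by positivity),
    ← zpow_add₀ two_ne_zero]
  exact thick_le_thickMax c b 1 2 _ u g x (j + i) n

/-- The `L^p` bound for maximal functions over curves thickened by at least `2 ^ (-l)`. -/
def ThickBound (c b : ℝ) (l : ℕ) (p : ℝ) (B : ℝ≥0∞) : Prop :=
  ∀ u, Lacunary u → ∀ ε : ℝ, (2:ℝ)⁻¹ ^ l ≤ ε → ∀ g : ℝ × ℝ → ℝ≥0∞, Measurable g →
    ∫⁻ x, thickMax c b 1 2 ε u g x ^ p ≤ B * ∫⁻ x, g x ^ p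

theorem thickMax_wide_le (c b ε : ℝ) {u : ℤ → ℝ} {g : ℝ × ℝ → ℝ≥0∞}
    (hg : Measurable g) (x : ℝ × ℝ) :
    thickMax c b (1/4) 4 ε u g x ≤ ∑ i : Fin 4,
      2 * thickMax c b 1 2 (ε / ((2:ℝ) ^ ((i : ℤ) - 2)) ^ b) u g x := by
  have h1 : thickMax c b (1/4) 4 ε u g x ≤ ∑ i : Fin 4,
      thickMax c b ((2:ℝ) ^ ((i : ℤ) - 2) * 1) ((2:ℝ) ^ ((i : ℤ) - 2) * 2) ε u g x := by
    refine iSup₂_le fun j n => ?_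
    refine (thick_le_add (m := 1/2) g x).trans ?_
    rw [Fin.sum_univ_four, add_assoc, add_assoc]
    have e0 : ((0 : Fin 4) : ℤ) = 0 := rfl
    have e1 : ((1 : Fin 4) : ℤ) = 1 := rfl
    have e2 : ((2 : Fin 4) : ℤ) = 2 := rfl
    have e3 : ((3 : Fin 4) : ℤ) = 3 := rfl
    simp only [e0, e1, e2, e3]
    norm_num
    refine add_le_add ?_ ((thick_le_add (m := 1) g x).trans (add_le_add ?_
      ((thick_le_add (m := 2) g x).trans (add_le_add ?_ ?_))))
    all_goals exact thick_le_thickMax c b _ _ ε u g x j n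
  refine h1.trans (Finset.sum_le_sum fun i _ => (thickMax_scale c b ε hg _ x).trans ?_)
  refine mul_le_mul_left ?_ _
  rw [show (2:ℝ≥0∞) = ENNReal.ofReal 2 by simp]
  refine ENNReal.ofReal_le_ofReal ?_
  calc (2:ℝ) ^ ((i:ℤ) - 2) ≤ 2 ^ (1:ℤ) := zpow_le_zpow_right₀ (by norm_num) (by have := i.2; omega)
    _ = 2 := by norm_num

theorem ThickBound.wide {c b p : ℝ} {l : ℕ} {B : ℝ≥0∞} (hB : ThickBound c b l p B) (hp : 1 ≤ p)
    (hp2 : p ≤ 2) (hb : 0 ≤ b) {u : ℤ → ℝ} (hu : Lacunary u) {ε : ℝ} (hε : 2 ^ b * (2:ℝ)⁻¹ ^ l ≤ ε)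
    {g : ℝ × ℝ → ℝ≥0∞} (hg : Measurable g) :
    ∫⁻ x, thickMax c b (1/4) 4 ε u g x ^ p ≤ 64 * B * ∫⁻ x, g x ^ p := by
  have hm : ∀ ε', Measurable (thickMax c b 1 2 ε' u g) := fun ε' =>
    measurable_thickMax c b 1 2 ε' u hg
  have hpos : 0 < ε := lt_of_lt_of_le (by positivity) hε
  calc _ ≤ ∫⁻ x, ∑ i : Fin 4, 16 * thickMax c b 1 2 (ε / ((2:ℝ) ^ ((i : ℤ) - 2)) ^ b) u g x ^ p := by
        refine lintegral_mono fun x => ?_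
        refine (ENNReal.rpow_le_rpow (thickMax_wide_le c b ε hg x) (by linarith)).trans ?_
        refine (ENNReal.rpow_sum_le_const_mul_sum_rpow _ _ hp).trans ?_
        rw [← Finset.mul_sum, Finset.card_univ, Fintype.card_fin, ← mul_one (16 : ℝ≥0∞)]
        simp_rw [ENNReal.mul_rpow_of_nonneg _ _ (show (0:ℝ) ≤ p by linarith)]
        rw [← Finset.mul_sum, ← mul_assoc, mul_one]
        refine mul_le_mul_left ?_ _
        calc ((4:ℕ):ℝ≥0∞) ^ (p - 1) * 2 ^ p ≤ ((4:ℕ):ℝ≥0∞) ^ (1:ℝ) * 2 ^ (2:ℝ) := by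
              refine mul_le_mul' (ENNReal.rpow_le_rpow_of_exponent_le (by norm_num) (by linarith))
                (ENNReal.rpow_le_rpow_of_exponent_le (by norm_num) hp2)
          _ = 16 := by norm_num
    _ = ∑ i : Fin 4, 16 * ∫⁻ x, thickMax c b 1 2 (ε / ((2:ℝ) ^ ((i : ℤ) - 2)) ^ b) u g x ^ p := by
        rw [lintegral_finsetSum _ (fun i _ => by have := hm (ε / ((2:ℝ) ^ ((i : ℤ) - 2)) ^ b); fun_prop)]
        exact Finset.sum_congr rfl fun i _ => lintegral_const_mul' _ _ (by simp)
    _ ≤ ∑ i : Fin 4, 16 * (B * ∫⁻ x, g x ^ p) := by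
        refine Finset.sum_le_sum fun i _ => mul_le_mul_right (hB u hu _ ?_ g hg) _
        rw [le_div_iff₀ (by positivity)]
        refine le_trans ?_ hε
        rw [mul_comm]
        refine mul_le_mul_of_nonneg_right (Real.rpow_le_rpow (by positivity) ?_ hb) (by positivity)
        calc (2:ℝ) ^ ((i:ℤ) - 2) ≤ 2 ^ (1:ℤ) :=
              zpow_le_zpow_right₀ (by norm_num) (by have := i.2; omega)
          _ = 2 := by norm_num
    _ = _ := by
        rw [Finset.sum_const, Finset.card_univ, Fintype.card_fin, nsmul_eq_mul]
        rw [← mul_assoc, ← mul_assoc]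
        norm_num

end Thick

section Reproducing

theorem expAvg_add_deriv {g g' : ℝ → ℝ} (hg : ∀ t, HasDerivAt g (g' t) t) (hc : Continuous g')
    {B : ℝ} (hB : ∀ t, |g t| ≤ B) (hB' : ∀ t, |g' t| ≤ B) (a t : ℝ) :
    expAvg a (fun s => g s + a * g' s) t = g t := by
  have hgc : Continuous g := continuous_iff_continuousAt.2 fun t => (hg t).continuousAt
  rw [expAvg, integral_expLaw]
  have hd : ∀ s ∈ Ici (0:ℝ), HasDerivAt (fun s => -(Real.exp (-s) * g (t - a * s)))
      (Real.exp (-s) • (g (t - a * s) + a * g' (t - a * s))) s := by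
    intro s _
    have h1 : HasDerivAt (fun s : ℝ => Real.exp (-s)) (-Real.exp (-s)) s := by
      simpa using (hasDerivAt_neg s).exp
    have h2 : HasDerivAt (fun s : ℝ => t - a * s) (-a) s := by
      simpa using ((hasDerivAt_id s).const_mul a).const_sub t
    have h3 := (h1.mul ((hg (t - a * s)).comp s h2)).neg
    refine h3.congr_deriv ?_
    simp only [smul_eq_mul, Function.comp]; ring
  have hitg : IntegrableOn (fun s => Real.exp (-s) • (g (t - a * s) + a * g' (t - a * s)))
      (Ioi (0:ℝ)) := by
    refine Integrable.mono' ((integrableOn_exp_neg_Ioi 0).mul_const (B + |a| * B))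
      (by fun_prop) (ae_of_all _ fun s => ?_)
    rw [norm_smul, Real.norm_eq_abs, abs_of_pos (Real.exp_pos _)]
    refine mul_le_mul_of_nonneg_left ((norm_add_le _ _).trans (add_le_add (hB _) ?_))
      (Real.exp_pos _).le
    rw [norm_mul]
    exact mul_le_mul_of_nonneg_left (hB' _) (norm_nonneg _)
  have hlim : Tendsto (fun s => -(Real.exp (-s) * g (t - a * s))) atTop (𝓝 0) := by
    refine squeeze_zero_norm (a := fun s => Real.exp (-s) * B) (fun s => ?_) ?_
    · rw [norm_neg, norm_mul, Real.norm_eq_abs, abs_of_pos (Real.exp_pos _)]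
      exact mul_le_mul_of_nonneg_left (hB _) (Real.exp_pos _).le
    · have h := (Real.tendsto_exp_neg_atTop_nhds_zero).mul_const B
      rwa [zero_mul] at h
  rw [integral_Ioi_of_hasDerivAt_of_tendsto' hd hitg hlim]
  simp

theorem expDiff_add_deriv {f f' f'' : ℝ → ℝ} (hf : ∀ t, HasDerivAt f (f' t) t)
    (hf' : ∀ t, HasDerivAt f' (f'' t) t) (hc : Continuous f'') {B : ℝ} (hB : ∀ t, |f t| ≤ B)
    (hB' : ∀ t, |f' t| ≤ B) (hB'' : ∀ t, |f'' t| ≤ B) (a t : ℝ) :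
    expDiff a (fun s => f s + 3 / 2 * a * f' s + 1 / 2 * a ^ 2 * f'' s) t = a / 2 * f' t := by
  have hfc : Continuous f' := continuous_iff_continuousAt.2 fun t => (hf' t).continuousAt
  have key : ∀ c : ℝ, ∀ t, |f t + c * f' t| ≤ (1 + |c|) * B ∧ |f' t + c * f'' t| ≤ (1 + |c|) * B := by
    intro c t
    constructor
    · calc _ ≤ |f t| + |c| * |f' t| := by rw [← abs_mul]; exact abs_add_le _ _
        _ ≤ B + |c| * B := add_le_add (hB t) (mul_le_mul_of_nonneg_left (hB' t) (abs_nonneg _))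
        _ = _ := by ring
    · calc _ ≤ |f' t| + |c| * |f'' t| := by rw [← abs_mul]; exact abs_add_le _ _
        _ ≤ B + |c| * B := add_le_add (hB' t) (mul_le_mul_of_nonneg_left (hB'' t) (abs_nonneg _))
        _ = _ := by ring
  have h1 := expAvg_add_deriv (g := fun s => f s + a * f' s) (g' := fun s => f' s + a * f'' s)
    (fun t => (hf t).add ((hf' t).const_mul a)) (by fun_prop) (fun t => (key a t).1)
    (fun t => (key a t).2) (a / 2) t
  have h2 := expAvg_add_deriv (g := fun s => f s + a / 2 * f' s)
    (g' := fun s => f' s + a / 2 * f'' s)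
    (fun t => (hf t).add ((hf' t).const_mul (a / 2))) (by fun_prop) (fun t => (key (a / 2) t).1)
    (fun t => (key (a / 2) t).2) a t
  rw [show (fun s => f s + a * f' s + a / 2 * (f' s + a * f'' s)) =
    fun s => f s + 3 / 2 * a * f' s + 1 / 2 * a ^ 2 * f'' s by ext s; ring] at h1
  rw [show (fun s => f s + a / 2 * f' s + a * (f' s + a / 2 * f'' s)) =
    fun s => f s + 3 / 2 * a * f' s + 1 / 2 * a ^ 2 * f'' s by ext s; ring] at h2
  rw [expDiff, h1, h2]; ring

end Reproducing

section Transfer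

variable {g H : ℝ × ℝ → ℝ}

theorem integrable_prod_translate (hH : Integrable H) (hHm : Measurable H) (c d : ℝ) :
    Integrable (fun w : (ℝ × ℝ) × ℝ => H (w.1.1 - c * w.2, w.1.2 - d * w.2))
      (volume.prod expLaw) := by
  refine ⟨(hHm.comp (by fun_prop)).aestronglyMeasurable, ?_⟩
  have hm : Measurable fun w : (ℝ × ℝ) × ℝ => ‖H (w.1.1 - c * w.2, w.1.2 - d * w.2)‖ₑ :=
    (hHm.comp (by fun_prop)).enorm
  rw [HasFiniteIntegral, lintegral_prod_symm _ hm.aemeasurable]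
  simp only
  have : ∀ y : ℝ, ∫⁻ x : ℝ × ℝ, ‖H (x.1 - c * y, x.2 - d * y)‖ₑ = ∫⁻ x, ‖H x‖ₑ := fun y =>
    lintegral_translate (fun x => ‖H x‖ₑ) _ _
  simp_rw [this]
  have h2 : ∫⁻ x, ‖H x‖ₑ < ∞ := hH.2
  simpa using h2

theorem integral_mul_expAvg_transfer (hg : Measurable g) {B : ℝ} (hB : ∀ x, ‖g x‖ ≤ B)
    (hH : Integrable H) (hHm : Measurable H) (a e c d : ℝ) (x : ℝ × ℝ) :
    ∫ z : ℝ × ℝ, g (x.1 - a * z.1, x.2 - e * z.2) * ∫ s, H (z.1 - c * s, z.2 - d * s) ∂expLaw =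
      ∫ z : ℝ × ℝ, (∫ s, g (x.1 - a * z.1 - a * c * s, x.2 - e * z.2 - e * d * s) ∂expLaw) * H z := by
  have i1 : Integrable (fun w : (ℝ × ℝ) × ℝ => g (x.1 - a * w.1.1, x.2 - e * w.1.2) *
      H (w.1.1 - c * w.2, w.1.2 - d * w.2)) (volume.prod expLaw) :=
    (integrable_prod_translate hH hHm c d).bdd_mul (c := B)
      (hg.comp (by fun_prop)).aestronglyMeasurable (ae_of_all _ fun w => hB _)
  have i2 : Integrable (fun w : (ℝ × ℝ) × ℝ =>
      g (x.1 - a * w.1.1 - a * c * w.2, x.2 - e * w.1.2 - e * d * w.2) * H w.1)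
      (volume.prod expLaw) := by
    have := (integrable_prod_translate hH hHm 0 0).bdd_mul (c := B)
      (f := fun w : (ℝ × ℝ) × ℝ =>
        g (x.1 - a * w.1.1 - a * c * w.2, x.2 - e * w.1.2 - e * d * w.2))
      (hg.comp (by fun_prop)).aestronglyMeasurable (ae_of_all _ fun w => hB _)
    simpa using this
  simp_rw [← integral_const_mul, ← integral_mul_const]
  rw [integral_integral_swap i1, integral_integral_swap (f := fun (z : ℝ × ℝ) (s : ℝ) =>
    g (x.1 - a * z.1 - a * c * s, x.2 - e * z.2 - e * d * s) * H z) i2]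
  refine integral_congr_ae (ae_of_all _ fun s => ?_)
  simp only
  rw [← integral_sub_right_eq_self (μ := (volume : Measure (ℝ × ℝ))) (fun z : ℝ × ℝ =>
    g (x.1 - a * z.1 - a * c * s, x.2 - e * z.2 - e * d * s) * H z) (c * s, d * s)]
  refine integral_congr_ae (ae_of_all _ fun z => ?_)
  simp only [Prod.fst_sub, Prod.snd_sub]
  congr 3 <;> ring

theorem integrable_expAvg_prod (hH : Integrable H) (hHm : Measurable H) (c d : ℝ) :
    Integrable fun z : ℝ × ℝ => ∫ s, H (z.1 - c * s, z.2 - d * s) ∂expLaw :=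
  (integrable_prod_translate hH hHm c d).integral_prod_left

theorem integral_mul_expDiffFst (hg : Measurable g) {B : ℝ} (hB : ∀ x, ‖g x‖ ≤ B)
    (hH : Integrable H) (hHm : Measurable H) (a e c : ℝ) (x : ℝ × ℝ) :
    ∫ z : ℝ × ℝ, g (x.1 - a * z.1, x.2 - e * z.2) * expDiffFst c H z =
      ∫ z : ℝ × ℝ, expDiffFst (a * c) g (x.1 - a * z.1, x.2 - e * z.2) * H z := by
  have hgm : AEStronglyMeasurable (fun z : ℝ × ℝ => g (x.1 - a * z.1, x.2 - e * z.2)) volume :=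
    (hg.comp (by fun_prop)).aestronglyMeasurable
  have e1 : ∀ c (z : ℝ × ℝ), expAvg c (fun t => H (t, z.2)) z.1 = ∫ s, H (z.1 - c * s, z.2 - 0 * s) ∂expLaw := by
    intro c z; simp [expAvg]
  have e2 : ∀ c' (z : ℝ × ℝ), expAvg c' (fun t => g (t, z.2)) z.1 =
      ∫ s, g (z.1 - c' * s, z.2 - e * 0 * s) ∂expLaw := by
    intro c z; simp [expAvg]
  have j1 : ∀ c', Integrable fun z : ℝ × ℝ => g (x.1 - a * z.1, x.2 - e * z.2) *
      expAvg c' (fun t => H (t, z.2)) z.1 := by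
    intro c'
    simp_rw [e1]
    exact (integrable_expAvg_prod hH hHm c' 0).bdd_mul hgm (ae_of_all _ fun z => hB _)
  have j2 : ∀ c', Integrable fun z : ℝ × ℝ =>
      expAvg c' (fun t => g (t, x.2 - e * z.2)) (x.1 - a * z.1) * H z := by
    intro c'
    refine hH.bdd_mul (c := B) ?_ (ae_of_all _ fun z => norm_expAvg_le _ _ _ (fun t => hB _) _)
    refine (StronglyMeasurable.integral_prod_right' (ν := expLaw)
      (f := fun w : (ℝ × ℝ) × ℝ => g (x.1 - a * w.1.1 - c' * w.2, x.2 - e * w.1.2))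
      ?_).aestronglyMeasurable
    exact (hg.comp (by fun_prop)).stronglyMeasurable
  have h : ∀ c', ∫ z : ℝ × ℝ, g (x.1 - a * z.1, x.2 - e * z.2) * expAvg c' (fun t => H (t, z.2)) z.1 =
      ∫ z : ℝ × ℝ, expAvg (a * c') (fun t => g (t, x.2 - e * z.2)) (x.1 - a * z.1) * H z := by
    intro c'
    simp_rw [e1, integral_mul_expAvg_transfer hg hB hH hHm]
    simp [expAvg]
  simp only [expDiffFst, expDiff, mul_sub, sub_mul]
  rw [integral_sub (j1 _) (j1 _), integral_sub (j2 _) (j2 _), h, h, mul_div_assoc]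

theorem integral_mul_expDiffSnd (hg : Measurable g) {B : ℝ} (hB : ∀ x, ‖g x‖ ≤ B)
    (hH : Integrable H) (hHm : Measurable H) (a e c : ℝ) (x : ℝ × ℝ) :
    ∫ z : ℝ × ℝ, g (x.1 - a * z.1, x.2 - e * z.2) * expDiffSnd c H z =
      ∫ z : ℝ × ℝ, expDiffSnd (e * c) g (x.1 - a * z.1, x.2 - e * z.2) * H z := by
  have hgm : AEStronglyMeasurable (fun z : ℝ × ℝ => g (x.1 - a * z.1, x.2 - e * z.2)) volume :=
    (hg.comp (by fun_prop)).aestronglyMeasurable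
  have e1 : ∀ c (z : ℝ × ℝ), expAvg c (fun t => H (z.1, t)) z.2 =
      ∫ s, H (z.1 - 0 * s, z.2 - c * s) ∂expLaw := by
    intro c z; simp [expAvg]
  have j1 : ∀ c', Integrable fun z : ℝ × ℝ => g (x.1 - a * z.1, x.2 - e * z.2) *
      expAvg c' (fun t => H (z.1, t)) z.2 := by
    intro c'
    simp_rw [e1]
    exact (integrable_expAvg_prod hH hHm 0 c').bdd_mul hgm (ae_of_all _ fun z => hB _)
  have j2 : ∀ c', Integrable fun z : ℝ × ℝ =>
      expAvg c' (fun t => g (x.1 - a * z.1, t)) (x.2 - e * z.2) * H z := by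
    intro c'
    refine hH.bdd_mul (c := B) ?_ (ae_of_all _ fun z => norm_expAvg_le _ _ _ (fun t => hB _) _)
    refine (StronglyMeasurable.integral_prod_right' (ν := expLaw)
      (f := fun w : (ℝ × ℝ) × ℝ => g (x.1 - a * w.1.1, x.2 - e * w.1.2 - c' * w.2))
      ?_).aestronglyMeasurable
    exact (hg.comp (by fun_prop)).stronglyMeasurable
  have h : ∀ c', ∫ z : ℝ × ℝ, g (x.1 - a * z.1, x.2 - e * z.2) * expAvg c' (fun t => H (z.1, t)) z.2 =
      ∫ z : ℝ × ℝ, expAvg (e * c') (fun t => g (x.1 - a * z.1, t)) (x.2 - e * z.2) * H z := by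
    intro c'
    simp_rw [e1, integral_mul_expAvg_transfer hg hB hH hHm]
    simp [expAvg]
  simp only [expDiffSnd, expDiff, mul_sub, sub_mul]
  rw [integral_sub (j1 _) (j1 _), integral_sub (j2 _) (j2 _), h, h, mul_div_assoc]

theorem integrable_expDiffFst (hH : Integrable H) (hHm : Measurable H) (c : ℝ) :
    Integrable (expDiffFst c H) := by
  have h : ∀ c', Integrable fun z : ℝ × ℝ => expAvg c' (fun t => H (t, z.2)) z.1 := by
    intro c'
    have := integrable_expAvg_prod hH hHm c' 0
    simpa [expAvg] using this
  exact (h (c / 2)).sub (h c)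

theorem norm_expDiffSnd_le (c : ℝ) {B : ℝ} (hB : ∀ x, ‖g x‖ ≤ B) (x : ℝ × ℝ) :
    ‖expDiffSnd c g x‖ ≤ 2 * B := norm_expDiff_le _ (fun _ => hB _) _

theorem integral_mul_expDiff_expDiff (hg : Measurable g) {B : ℝ} (hB : ∀ x, ‖g x‖ ≤ B)
    (hH : Integrable H) (hHm : Measurable H) (a e c d : ℝ) (x : ℝ × ℝ) :
    ∫ z : ℝ × ℝ, g (x.1 - a * z.1, x.2 - e * z.2) * expDiffSnd d (expDiffFst c H) z =
      ∫ z : ℝ × ℝ, expDiffFst (a * c) (expDiffSnd (e * d) g) (x.1 - a * z.1, x.2 - e * z.2) * H z := by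
  rw [integral_mul_expDiffSnd hg hB (integrable_expDiffFst hH hHm c) (measurable_expDiffFst c hHm),
    integral_mul_expDiffFst (measurable_expDiffSnd _ hg) (norm_expDiffSnd_le _ hB) hH hHm]

end Transfer

section CurveBump

/-- Smooth cutoffs adapted to the curve `t ↦ c t ^ b` above `[1, 2]`, together with a compactly
supported second primitive of a difference of two dilated bumps. -/
structure CurveBump (c b : ℝ) where
  v : ℝ → ℝ
  G : ℝ → ℝ
  φ : ℝ → ℝ
  Ψ : ℝ → ℝ
  v_smooth : ContDiff ℝ (⊤ : ℕ∞) v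
  G_smooth : ContDiff ℝ (⊤ : ℕ∞) G
  Ψ_smooth : ContDiff ℝ (⊤ : ℕ∞) Ψ
  φ_cont : Continuous φ
  v_supp : ∀ t ∉ Icc (1 / 2 : ℝ) (5 / 2), v t = 0
  G_eq : ∀ t ∈ Icc (1 / 2 : ℝ) (5 / 2), G t = powCurve c b t
  mul_nonneg : ∀ t, 0 ≤ v t * deriv G t
  one_le_mul : ∀ t ∈ Icc (1 : ℝ) 2, 1 ≤ v t * deriv G t
  φ_nonneg : ∀ t, 0 ≤ φ t
  one_le_φ : ∀ t, |t| ≤ 1 → 1 ≤ φ t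
  φ_supp : ∀ t, 2 ≤ |t| → φ t = 0
  Ψ_supp : ∀ t, 2 ≤ |t| → Ψ t = 0
  deriv_deriv_Ψ : ∀ t, deriv (deriv Ψ) t = 2 * φ (2 * t) - φ t

theorem exists_curve_cutoff {c b : ℝ} (hc : c ≠ 0) (hb : 1 < b) :
    ∃ v G : ℝ → ℝ, ContDiff ℝ (⊤ : ℕ∞) v ∧ ContDiff ℝ (⊤ : ℕ∞) G ∧
      (∀ t ∉ Icc (1 / 2 : ℝ) (5 / 2), v t = 0) ∧
      (∀ t ∈ Icc (1 / 2 : ℝ) (5 / 2), G t = powCurve c b t) ∧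
      (∀ t, 0 ≤ v t * deriv G t) ∧ ∀ t ∈ Icc (1 : ℝ) 2, 1 ≤ v t * deriv G t := by
  let w : ContDiffBump (3 / 2 : ℝ) := ⟨1 / 2, 1, by norm_num, by norm_num⟩
  let β : ContDiffBump (3 / 2 : ℝ) := ⟨9 / 8, 5 / 4, by norm_num, by norm_num⟩
  have hw1 : ∀ t ∈ Icc (1 : ℝ) 2, w t = 1 := fun t ht => w.one_of_mem_closedBall (by
    rw [Metric.mem_closedBall, Real.dist_eq, abs_le]
    exact ⟨by linarith [ht.1], by linarith [ht.2]⟩)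
  have hw0 : ∀ t ∉ Icc (1 / 2 : ℝ) (5 / 2), w t = 0 := fun t ht => w.zero_of_le_dist (by
    rw [Real.dist_eq]
    by_contra! h
    have h' := abs_lt.1 h
    exact ht ⟨by linarith [h'.1], by linarith [h'.2]⟩)
  have hβ1 : ∀ t ∈ Icc (3 / 8 : ℝ) (21 / 8), β t = 1 := fun t ht => β.one_of_mem_closedBall (by
    rw [Metric.mem_closedBall, Real.dist_eq, abs_le]
    exact ⟨by linarith [ht.1], by linarith [ht.2]⟩)
  have hρ : ∀ t, 0 < 1 + β t * (t - 1) := by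
    intro t
    rcases le_or_gt t (1 / 4) with h | h
    · have : β t = 0 := β.zero_of_le_dist (by
        rw [Real.dist_eq, abs_of_nonpos (by linarith)]
        change (5 / 4 : ℝ) ≤ _
        linarith)
      rw [this]; norm_num
    · nlinarith [β.nonneg (x := t), β.le_one (x := t)]
  have hG : ∀ t ∈ Ioo (3 / 8 : ℝ) (21 / 8),
      HasDerivAt (fun t => c * (1 + β t * (t - 1)) ^ b) (c * (b * t ^ (b - 1))) t := by
    intro t ht
    have h1 := (Real.hasDerivAt_rpow_const (x := t) (p := b) (Or.inl (by linarith [ht.1]))).const_mul c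
    refine h1.congr_of_eventuallyEq ?_
    filter_upwards [Ioo_mem_nhds ht.1 ht.2] with s hs
    rw [hβ1 s ⟨hs.1.le, hs.2.le⟩]; ring_nf
  have hcb : c * b ≠ 0 := mul_ne_zero hc (by linarith)
  have key : ∀ t ∈ Icc (1 / 2 : ℝ) (5 / 2),
      w t / (c * b) * deriv (fun t => c * (1 + β t * (t - 1)) ^ b) t = w t * t ^ (b - 1) := by
    intro t ht
    rw [(hG t ⟨by linarith [ht.1], by linarith [ht.2]⟩).deriv]
    field_simp
  refine ⟨fun t => w t / (c * b), fun t => c * (1 + β t * (t - 1)) ^ b, w.contDiff.div_const _, ?_,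
    fun t ht => by simp [hw0 t ht], fun t ht => ?_, fun t => ?_, fun t ht => ?_⟩
  · exact contDiff_const.mul (ContDiff.rpow_const_of_ne
      (contDiff_const.add (β.contDiff.mul (contDiff_id.sub contDiff_const))) fun t => (hρ t).ne')
  · simp only
    rw [hβ1 t ⟨by linarith [ht.1], by linarith [ht.2]⟩, powCurve]; ring_nf
  · by_cases ht : t ∈ Icc (1 / 2 : ℝ) (5 / 2)
    · simp only [key t ht]
      exact mul_nonneg w.nonneg (Real.rpow_nonneg (by linarith [ht.1]) _)
    · simp [hw0 t ht]
  · simp only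
    rw [key t ⟨by linarith [ht.1], by linarith [ht.2]⟩, hw1 t ht, one_mul]
    exact Real.one_le_rpow ht.1 (by linarith)

theorem exists_second_primitive :
    ∃ φ Ψ : ℝ → ℝ, Continuous φ ∧ ContDiff ℝ (⊤ : ℕ∞) Ψ ∧ (∀ t, 0 ≤ φ t) ∧
      (∀ t, |t| ≤ 1 → 1 ≤ φ t) ∧ (∀ t, 2 ≤ |t| → φ t = 0) ∧ (∀ t, 2 ≤ |t| → Ψ t = 0) ∧
      ∀ t, deriv (deriv Ψ) t = 2 * φ (2 * t) - φ t := by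
  let φ : ContDiffBump (0 : ℝ) := ⟨1, 2, by norm_num, by norm_num⟩
  have hφc : Continuous φ := φ.continuous
  have hφ0 : ∀ t, 2 ≤ |t| → φ t = 0 := fun t ht => φ.zero_of_le_dist (by simpa using ht)
  set F : ℝ → ℝ := fun t => ∫ s in (0:ℝ)..t, φ s with hF
  have hFd : ∀ t, HasDerivAt F (φ t) t := fun t =>
    intervalIntegral.integral_hasDerivAt_right (hφc.intervalIntegrable _ _)
      (hφc.stronglyMeasurableAtFilter _ _) hφc.continuousAt
  have hFc : Continuous F := continuous_iff_continuousAt.2 fun t => (hFd t).continuousAt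
  set P : ℝ → ℝ := fun t => ∫ s in (0:ℝ)..t, F s with hP
  have hPd : ∀ t, HasDerivAt P (F t) t := fun t =>
    intervalIntegral.integral_hasDerivAt_right (hFc.intervalIntegrable _ _)
      (hFc.stronglyMeasurableAtFilter _ _) hFc.continuousAt
  have hFodd : ∀ t, F (-t) = -F t := by
    intro t
    have h := intervalIntegral.integral_comp_neg (f := φ) (a := 0) (b := t)
    simp only [φ.neg, neg_zero] at h
    rw [hF]; simp only
    rw [h, intervalIntegral.integral_symm]
  have hPeven : ∀ t, P (-t) = P t := by
    intro t
    have h := intervalIntegral.integral_comp_neg (f := F) (a := 0) (b := t)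
    simp only [hFodd, neg_zero, intervalIntegral.integral_neg] at h
    rw [hP]; simp only
    rw [intervalIntegral.integral_symm, ← h, neg_neg]
  have hF2 : ∀ t, 2 ≤ t → F t = F 2 := by
    intro t ht
    have h := intervalIntegral.integral_add_adjacent_intervals
      (hφc.intervalIntegrable (μ := volume) 0 2) (hφc.intervalIntegrable 2 t)
    have h0 : ∫ s in (2:ℝ)..t, φ s = 0 := by
      rw [intervalIntegral.integral_congr (g := fun _ => 0) (fun s hs => ?_)]
      · simp
      · rw [uIcc_of_le ht] at hs
        exact hφ0 s (hs.1.trans (le_abs_self _))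
    rw [h0, add_zero] at h
    exact h.symm
  have hP2 : ∀ t, 2 ≤ t → P t = P 2 + F 2 * (t - 2) := by
    intro t ht
    have h := intervalIntegral.integral_add_adjacent_intervals
      (hFc.intervalIntegrable (μ := volume) 0 2) (hFc.intervalIntegrable 2 t)
    have h0 : ∫ s in (2:ℝ)..t, F s = F 2 * (t - 2) := by
      rw [intervalIntegral.integral_congr (g := fun _ => F 2) (fun s hs => ?_)]
      · rw [intervalIntegral.integral_const, smul_eq_mul]; ring
      · rw [uIcc_of_le ht] at hs
        exact hF2 s hs.1
    rw [h0] at h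
    exact h.symm
  set Ψ : ℝ → ℝ := fun t => P (2 * t) / 2 - P t + (P 2 / 2 - F 2) with hΨ
  have hlin : ∀ t : ℝ, HasDerivAt (fun t => 2 * t) 2 t := fun t => by
    simpa using (hasDerivAt_id t).const_mul (2:ℝ)
  have hΨd : ∀ t, HasDerivAt Ψ (F (2 * t) - F t) t := by
    intro t
    refine ((((hPd (2 * t)).comp t (hlin t)).div_const 2).sub (hPd t)).add_const (P 2 / 2 - F 2)
      |>.congr_deriv ?_
    ring
  have hΨd2 : ∀ t, HasDerivAt (fun t => F (2 * t) - F t) (2 * φ (2 * t) - φ t) t := by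
    intro t
    refine (((hFd (2 * t)).comp t (hlin t)).sub (hFd t)).congr_deriv ?_
    ring
  have e1 : deriv Ψ = fun t => F (2 * t) - F t := funext fun t => (hΨd t).deriv
  have e2 : deriv (deriv Ψ) = fun t => 2 * φ (2 * t) - φ t := by
    rw [e1]; exact funext fun t => (hΨd2 t).deriv
  have hpos : ∀ t, 2 ≤ t → Ψ t = 0 := by
    intro t ht
    simp only [hΨ]
    rw [hP2 t ht, hP2 (2 * t) (by linarith)]; ring
  refine ⟨φ, Ψ, hφc, ?_, fun t => φ.nonneg, fun t ht => ?_, hφ0, fun t ht => ?_,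
    fun t => congrFun e2 t⟩
  · rw [contDiff_infty_iff_deriv]
    refine ⟨fun t => (hΨd t).differentiableAt, ?_⟩
    rw [contDiff_infty_iff_deriv]
    refine ⟨fun t => by rw [e1]; exact (hΨd2 t).differentiableAt, ?_⟩
    rw [e2]
    have := φ.contDiff (n := (⊤ : ℕ∞))
    exact (contDiff_const.mul (this.comp (contDiff_const.mul contDiff_id))).sub this
  · exact (φ.one_of_mem_closedBall (by simpa using ht)).ge
  · rcases le_abs.1 ht with h | h
    · exact hpos t h
    · have : Ψ t = Ψ (-t) := by simp only [hΨ, mul_neg, hPeven]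
      rw [this, hpos _ h]

theorem nonempty_curveBump {c b : ℝ} (hc : c ≠ 0) (hb : 1 < b) : Nonempty (CurveBump c b) := by
  obtain ⟨v, G, h1, h2, h3, h4, h5, h6⟩ := exists_curve_cutoff hc hb
  obtain ⟨φ, Ψ, k1, k2, k3, k4, k5, k6, k7⟩ := exists_second_primitive
  exact ⟨⟨v, G, φ, Ψ, h1, h2, k2, k1, h3, h4, h5, h6, k3, k4, k5, k6, k7⟩⟩

end CurveBump

theorem iterate_deriv_eq_zero {f : ℝ → ℝ} {U : Set ℝ} (hU : IsOpen U) (hf : ∀ t ∈ U, f t = 0)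
    (i : ℕ) : ∀ t ∈ U, deriv^[i] f t = 0 := by
  induction i with
  | zero => exact hf
  | succ i ih =>
    intro t ht
    rw [Function.iterate_succ_apply']
    have : deriv^[i] f =ᶠ[𝓝 t] fun _ => 0 := by
      filter_upwards [hU.mem_nhds ht] with s hs using ih s hs
    rw [this.deriv_eq, deriv_const]

theorem ContDiff.hasDerivAt_iterate {f : ℝ → ℝ} (hf : ContDiff ℝ (⊤ : ℕ∞) f) (i : ℕ) (t : ℝ) :
    HasDerivAt (deriv^[i] f) (deriv^[i + 1] f t) t := by
  rw [Function.iterate_succ_apply']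
  exact ((hf.iterate_deriv i).differentiable (by simp) t).hasDerivAt

theorem ContDiff.continuous_iterate {f : ℝ → ℝ} (hf : ContDiff ℝ (⊤ : ℕ∞) f) (i : ℕ) :
    Continuous (deriv^[i] f) := (hf.iterate_deriv i).continuous

theorem exists_abs_le_of_zero_off_Icc {f : ℝ → ℝ} (hf : Continuous f) {r s : ℝ}
    (h0 : ∀ t ∉ Icc r s, f t = 0) : ∃ B, ∀ t, |f t| ≤ B :=
  hf.bounded_above_of_compact_support (HasCompactSupport.intro isCompact_Icc h0)

theorem expDiff_of_zero_off_Icc {f f' f'' : ℝ → ℝ} (hf : ∀ t, HasDerivAt f (f' t) t)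
    (hf' : ∀ t, HasDerivAt f' (f'' t) t) (hc : Continuous f'') {r s : ℝ}
    (h0 : ∀ t ∉ Icc r s, f t = 0 ∧ f' t = 0 ∧ f'' t = 0) (a t : ℝ) :
    expDiff a (fun s => f s + 3 / 2 * a * f' s + 1 / 2 * a ^ 2 * f'' s) t = a / 2 * f' t := by
  obtain ⟨B, hB⟩ := exists_abs_le_of_zero_off_Icc
    (continuous_iff_continuousAt.2 fun t => (hf t).continuousAt) fun t ht => (h0 t ht).1
  obtain ⟨B', hB'⟩ := exists_abs_le_of_zero_off_Icc
    (continuous_iff_continuousAt.2 fun t => (hf' t).continuousAt) fun t ht => (h0 t ht).2.1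
  obtain ⟨B'', hB''⟩ := exists_abs_le_of_zero_off_Icc hc fun t ht => (h0 t ht).2.2
  exact expDiff_add_deriv hf hf' hc (B := max B (max B' B''))
    (fun t => (hB t).trans (le_max_left _ _))
    (fun t => (hB' t).trans ((le_max_left _ _).trans (le_max_right _ _)))
    (fun t => (hB'' t).trans ((le_max_right _ _).trans (le_max_right _ _))) a t

namespace CurveBump

variable {c b : ℝ} (D : CurveBump c b)

/-- The `i`-th derivative of `Ψ + (3/2) μ Ψ' + (1/2) μ² Ψ''`. -/
def Θ (i : ℕ) (μ y : ℝ) : ℝ :=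
  deriv^[i] D.Ψ y + 3 / 2 * μ * deriv^[i + 1] D.Ψ y + 1 / 2 * μ ^ 2 * deriv^[i + 2] D.Ψ y

/-- The profile of the kernel whose mixed differences reproduce the telescoping kernels. -/
def profile (ε μ t y : ℝ) : ℝ :=
  D.v t * D.Θ 0 μ y + 3 / 2 * (ε * deriv^[1] D.v t * D.Θ 0 μ y -
    D.v t * deriv^[1] D.G t * D.Θ 1 μ y) +
  1 / 2 * (ε ^ 2 * deriv^[2] D.v t * D.Θ 0 μ y - 2 * ε * deriv^[1] D.v t * deriv^[1] D.G t * D.Θ 1 μ y -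
    ε * D.v t * deriv^[2] D.G t * D.Θ 1 μ y + D.v t * deriv^[1] D.G t ^ 2 * D.Θ 2 μ y)

/-- The rescaled vertical distance to the curve. -/
def vert (ε : ℝ) (z : ℝ × ℝ) : ℝ := (z.2 - D.G z.1) / ε

/-- A smooth thickening of the curve. -/
def kernel (ε : ℝ) (z : ℝ × ℝ) : ℝ := D.v z.1 * deriv D.G z.1 * (ε⁻¹ * D.φ (D.vert ε z))

theorem hasDerivAt_Θ (i : ℕ) (μ y : ℝ) : HasDerivAt (D.Θ i μ) (D.Θ (i + 1) μ y) y :=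
  ((D.Ψ_smooth.hasDerivAt_iterate i y).add
    ((D.Ψ_smooth.hasDerivAt_iterate (i + 1) y).const_mul _)).add
    ((D.Ψ_smooth.hasDerivAt_iterate (i + 2) y).const_mul _)

theorem iterate_Ψ_eq_zero (i : ℕ) {y : ℝ} (hy : 2 < |y|) : deriv^[i] D.Ψ y = 0 :=
  iterate_deriv_eq_zero (U := {y | 2 < |y|}) (isOpen_lt continuous_const continuous_abs)
    (fun t ht => D.Ψ_supp t (le_of_lt ht)) i y hy

theorem iterate_v_eq_zero (i : ℕ) {t : ℝ} (ht : t ∉ Icc (1 / 2 : ℝ) (5 / 2)) :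
    deriv^[i] D.v t = 0 :=
  iterate_deriv_eq_zero (U := (Icc (1 / 2 : ℝ) (5 / 2))ᶜ) isClosed_Icc.isOpen_compl D.v_supp i t ht

theorem Θ_eq_zero (i : ℕ) (μ : ℝ) {y : ℝ} (hy : 2 < |y|) : D.Θ i μ y = 0 := by
  simp [Θ, D.iterate_Ψ_eq_zero _ hy]

theorem continuous_vert (ε : ℝ) : Continuous (D.vert ε) := by
  have := D.G_smooth.continuous
  unfold vert; fun_prop

theorem expDiffFst_profile {ε : ℝ} (hε : ε ≠ 0) (μ : ℝ) (z : ℝ × ℝ) :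
    expDiffFst ε (fun z => D.profile ε μ z.1 (D.vert ε z)) z =
      1 / 2 * (ε * deriv^[1] D.v z.1 * D.Θ 0 μ (D.vert ε z) -
        D.v z.1 * deriv^[1] D.G z.1 * D.Θ 1 μ (D.vert ε z)) := by
  have hy : ∀ t, HasDerivAt (fun t => (z.2 - D.G t) / ε) (-deriv^[1] D.G t / ε) t := fun t =>
    ((D.G_smooth.hasDerivAt_iterate 0 t).const_sub z.2).div_const ε
  have hΘ : ∀ i t, HasDerivAt (fun t => D.Θ i μ ((z.2 - D.G t) / ε))
      (D.Θ (i + 1) μ ((z.2 - D.G t) / ε) * (-deriv^[1] D.G t / ε)) t := fun i t =>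
    (D.hasDerivAt_Θ i μ _).comp t (hy t)
  have hΘc : ∀ i, Continuous fun t => D.Θ i μ ((z.2 - D.G t) / ε) := fun i =>
    continuous_iff_continuousAt.2 fun t => (hΘ i t).continuousAt
  have hv : ∀ i t, HasDerivAt (deriv^[i] D.v) (deriv^[i + 1] D.v t) t :=
    D.v_smooth.hasDerivAt_iterate
  have hG : ∀ i t, HasDerivAt (deriv^[i] D.G) (deriv^[i + 1] D.G t) t :=
    D.G_smooth.hasDerivAt_iterate
  have hvc := D.v_smooth.continuous_iterate
  have hGc := D.G_smooth.continuous_iterate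
  have h := expDiff_of_zero_off_Icc
    (f := fun t => deriv^[0] D.v t * D.Θ 0 μ ((z.2 - D.G t) / ε))
    (f' := fun t => deriv^[1] D.v t * D.Θ 0 μ ((z.2 - D.G t) / ε) -
      ε⁻¹ * (deriv^[0] D.v t * deriv^[1] D.G t * D.Θ 1 μ ((z.2 - D.G t) / ε)))
    (f'' := fun t => deriv^[2] D.v t * D.Θ 0 μ ((z.2 - D.G t) / ε) +
      deriv^[1] D.v t * (D.Θ 1 μ ((z.2 - D.G t) / ε) * (-deriv^[1] D.G t / ε)) -
      ε⁻¹ * ((deriv^[1] D.v t * deriv^[1] D.G t + deriv^[0] D.v t * deriv^[2] D.G t) *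
        D.Θ 1 μ ((z.2 - D.G t) / ε) +
        deriv^[0] D.v t * deriv^[1] D.G t * (D.Θ 2 μ ((z.2 - D.G t) / ε) * (-deriv^[1] D.G t / ε))))
    (r := 1 / 2) (s := 5 / 2)
    (fun t => ((hv 0 t).mul (hΘ 0 t)).congr_deriv (by simp only [zero_add]; ring))
    (fun t => ((hv 1 t).mul (hΘ 0 t)).sub ((((hv 0 t).mul (hG 1 t)).mul (hΘ 1 t)).const_mul _))
    (by
      have a0 := hvc 0
      have a1 := hvc 1
      have a2 := hvc 2
      have b1 := hGc 1
      have b2 := hGc 2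
      have c0 := hΘc 0
      have c1 := hΘc 1
      have c2 := hΘc 2
      fun_prop)
    (fun t ht => by
      simp only [D.iterate_v_eq_zero _ ht]
      simp) ε z.1
  rw [expDiffFst]
  simp only [vert, profile]
  refine Eq.trans (congrFun (congrArg (expDiff ε) (funext fun t => ?_)) z.1) (h.trans ?_)
  · simp only [Function.iterate_zero, id]
    field_simp
    ring
  · simp only [Function.iterate_zero, id]
    field_simp

theorem expDiffSnd_expDiffFst_profile {ε μ : ℝ} (hε : 0 < ε) (z : ℝ × ℝ) :
    expDiffSnd (μ * ε) (expDiffFst ε fun z => D.profile ε μ z.1 (D.vert ε z)) z =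
      μ / 4 * (ε * deriv^[1] D.v z.1 * deriv^[1] D.Ψ (D.vert ε z) -
        D.v z.1 * deriv^[1] D.G z.1 * deriv^[2] D.Ψ (D.vert ε z)) := by
  have hy : ∀ t, HasDerivAt (fun t => (t - D.G z.1) / ε) (1 / ε) t := fun t =>
    ((hasDerivAt_id t).sub_const _).div_const ε
  have hΨ : ∀ i t, HasDerivAt (fun t => deriv^[i] D.Ψ ((t - D.G z.1) / ε))
      (deriv^[i + 1] D.Ψ ((t - D.G z.1) / ε) * (1 / ε)) t := fun i t =>
    (D.Ψ_smooth.hasDerivAt_iterate i _).comp t (hy t)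
  have hΨc : ∀ i, Continuous fun t => deriv^[i] D.Ψ ((t - D.G z.1) / ε) := fun i =>
    continuous_iff_continuousAt.2 fun t => (hΨ i t).continuousAt
  set A := 1 / 2 * ε * deriv^[1] D.v z.1
  set A' := 1 / 2 * (D.v z.1 * deriv^[1] D.G z.1)
  have h := expDiff_of_zero_off_Icc
    (f := fun t => A * deriv^[0] D.Ψ ((t - D.G z.1) / ε) - A' * deriv^[1] D.Ψ ((t - D.G z.1) / ε))
    (f' := fun t => A * (deriv^[1] D.Ψ ((t - D.G z.1) / ε) * (1 / ε)) -
      A' * (deriv^[2] D.Ψ ((t - D.G z.1) / ε) * (1 / ε)))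
    (f'' := fun t => A * (deriv^[2] D.Ψ ((t - D.G z.1) / ε) * (1 / ε) * (1 / ε)) -
      A' * (deriv^[3] D.Ψ ((t - D.G z.1) / ε) * (1 / ε) * (1 / ε)))
    (r := D.G z.1 - 2 * ε) (s := D.G z.1 + 2 * ε)
    (fun t => ((hΨ 0 t).const_mul A).sub ((hΨ 1 t).const_mul A'))
    (fun t => (((hΨ 1 t).mul_const (1 / ε)).const_mul A).sub
      (((hΨ 2 t).mul_const (1 / ε)).const_mul A'))
    (by
      have c2 := hΨc 2
      have c3 := hΨc 3
      fun_prop)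
    (fun t ht => by
      have hlt : 2 < |(t - D.G z.1) / ε| := by
        rw [abs_div, abs_of_pos hε, lt_div_iff₀ hε]
        by_contra! h'
        have h'' := abs_le.1 h'
        exact ht ⟨by linarith [h''.1], by linarith [h''.2]⟩
      simp only [D.iterate_Ψ_eq_zero _ hlt]
      simp) (μ * ε) z.2
  rw [expDiffSnd]
  simp only [D.expDiffFst_profile hε.ne']
  simp only [vert]
  refine Eq.trans (congrFun (congrArg (expDiff (μ * ε)) (funext fun t => ?_)) z.2) (h.trans ?_)
  · simp only [Θ, zero_add, A, A']
    field_simp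
    ring
  · simp only [A, A']
    field_simp
    ring

theorem kernel_half_sub_kernel {ε μ : ℝ} (hε : 0 < ε) (hμ : 0 < μ) (z : ℝ × ℝ) :
    D.kernel (2⁻¹ * ε) z - D.kernel ε z = deriv^[1] D.v z.1 * deriv^[1] D.Ψ (D.vert ε z) -
      4 / (μ * ε) * expDiffSnd (μ * ε)
        (expDiffFst ε fun z => D.profile ε μ z.1 (D.vert ε z)) z := by
  rw [D.expDiffSnd_expDiffFst_profile hε]
  have h1 : D.vert (2⁻¹ * ε) z = 2 * D.vert ε z := by simp only [vert]; field_simp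
  have h2 : deriv^[2] D.Ψ (D.vert ε z) = 2 * D.φ (2 * D.vert ε z) - D.φ (D.vert ε z) :=
    D.deriv_deriv_Ψ _
  have h3 : deriv^[1] D.G z.1 = deriv D.G z.1 := rfl
  rw [kernel, kernel, h1, h2, h3]
  field_simp
  ring

theorem exists_abs_profile_le : ∃ C, 1 ≤ C ∧ ∀ ε ∈ Icc (0:ℝ) 1, ∀ μ ∈ Icc (0:ℝ) 1, ∀ t y,
    |D.profile ε μ t y| ≤ C := by
  have hc : Continuous fun w : ℝ × ℝ × ℝ × ℝ => D.profile w.1 w.2.1 w.2.2.1 w.2.2.2 := by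
    have a0 := D.v_smooth.continuous
    have a1 := D.v_smooth.continuous_iterate 1
    have a2 := D.v_smooth.continuous_iterate 2
    have b1 := D.G_smooth.continuous_iterate 1
    have b2 := D.G_smooth.continuous_iterate 2
    have c0 := D.Ψ_smooth.continuous_iterate 0
    have c1 := D.Ψ_smooth.continuous_iterate 1
    have c2 := D.Ψ_smooth.continuous_iterate 2
    have c3 := D.Ψ_smooth.continuous_iterate 3
    have c4 := D.Ψ_smooth.continuous_iterate 4
    simp only [profile, Θ]
    norm_num only
    fun_prop
  obtain ⟨C, hC⟩ := ((isCompact_Icc (a := (0:ℝ)) (b := 1)).prod ((isCompact_Icc (a := (0:ℝ)) (b := 1)).prod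
    ((isCompact_Icc (a := (1/2:ℝ)) (b := 5/2)).prod
      (isCompact_Icc (a := (-2:ℝ)) (b := 2))))).exists_bound_of_continuousOn hc.continuousOn
  refine ⟨max 1 C, le_max_left _ _, fun ε hε μ hμ t y => ?_⟩
  by_cases ht : t ∈ Icc (1/2:ℝ) (5/2)
  · by_cases hy : |y| ≤ 2
    · exact (hC (ε, μ, t, y) ⟨hε, hμ, ht, abs_le.1 hy⟩).trans (le_max_right _ _)
    · have : D.profile ε μ t y = 0 := by simp [profile, D.Θ_eq_zero _ _ (not_le.1 hy)]
      simp [this]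
  · have h0 : D.v t = 0 := D.v_supp t ht
    have : D.profile ε μ t y = 0 := by simp only [profile, D.iterate_v_eq_zero _ ht, h0]; simp
    simp [this]

theorem profile_eq_zero {ε μ t y : ℝ} (h : ¬ (t ∈ Icc (1/2:ℝ) (5/2) ∧ |y| ≤ 2)) :
    D.profile ε μ t y = 0 := by
  by_cases ht : t ∈ Icc (1/2:ℝ) (5/2)
  · simp [profile, D.Θ_eq_zero _ _ (not_le.1 fun hy => h ⟨ht, hy⟩)]
  · have h0 : D.v t = 0 := D.v_supp t ht
    simp only [profile, D.iterate_v_eq_zero _ ht, h0]; simp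

theorem continuous_profile_vert (ε μ : ℝ) :
    Continuous fun z : ℝ × ℝ => D.profile ε μ z.1 (D.vert ε z) := by
  have a0 := D.v_smooth.continuous
  have a1 := D.v_smooth.continuous_iterate 1
  have a2 := D.v_smooth.continuous_iterate 2
  have b1 := D.G_smooth.continuous_iterate 1
  have b2 := D.G_smooth.continuous_iterate 2
  have c : ∀ i, Continuous (D.Θ i μ) := fun i =>
    continuous_iff_continuousAt.2 fun y => (D.hasDerivAt_Θ i μ y).continuousAt
  have c0 := c 0
  have c1 := c 1
  have c2 := c 2
  have d := D.continuous_vert ε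
  unfold profile; fun_prop

theorem exists_abs_G_le : ∃ Γ, 0 ≤ Γ ∧ ∀ t ∈ Icc (1/2:ℝ) (5/2), |D.G t| ≤ Γ := by
  obtain ⟨Γ, hΓ⟩ := (isCompact_Icc (a := (1/2:ℝ)) (b := 5/2)).exists_bound_of_continuousOn
    D.G_smooth.continuous.continuousOn
  exact ⟨max 0 Γ, le_max_left _ _, fun t ht => (hΓ t ht).trans (le_max_right _ _)⟩

theorem abs_snd_le {Γ : ℝ} (hΓ : ∀ t ∈ Icc (1/2:ℝ) (5/2), |D.G t| ≤ Γ) {ε : ℝ} (hε : 0 < ε)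
    {z : ℝ × ℝ} (hz : z.1 ∈ Icc (1/2:ℝ) (5/2)) (hy : |D.vert ε z| ≤ 2) : |z.2| ≤ 2 * ε + Γ := by
  rw [vert, abs_div, abs_of_pos hε, div_le_iff₀ hε] at hy
  calc |z.2| = |(z.2 - D.G z.1) + D.G z.1| := by ring_nf
    _ ≤ _ := (abs_add_le _ _).trans (add_le_add hy (hΓ _ hz))

theorem hasCompactSupport_of_vert {ε : ℝ} (hε : 0 < ε) {K : ℝ × ℝ → ℝ}
    (hK : ∀ z, ¬ (z.1 ∈ Icc (1/2:ℝ) (5/2) ∧ |D.vert ε z| ≤ 2) → K z = 0) : HasCompactSupport K := by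
  obtain ⟨Γ, -, hΓ⟩ := D.exists_abs_G_le
  refine HasCompactSupport.intro ((isCompact_Icc (a := (1/2:ℝ)) (b := 5/2)).prod
    (isCompact_Icc (a := -(2 * ε + Γ)) (b := 2 * ε + Γ))) fun z hz => hK z fun h => hz ?_
  exact ⟨h.1, abs_le.1 (D.abs_snd_le hΓ hε h.1 h.2)⟩

end CurveBump

section KernelBounds

theorem lintegral_mul_enorm_le_strongMax {g : ℝ × ℝ → ℝ≥0∞} (hg : Measurable g) {K : ℝ × ℝ → ℝ}
    {C R R' a e : ℝ} (hC : 0 ≤ C) (ha : 0 < a) (he : 0 < e) (hR : 0 < R) (hR' : 0 < R')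
    (hK : ∀ z, |K z| ≤ C) (hK0 : ∀ z ∉ Icc (-R) R ×ˢ Icc (-R') R', K z = 0) (x : ℝ × ℝ) :
    ∫⁻ z : ℝ × ℝ, g (x.1 - a * z.1, x.2 - e * z.2) * ‖K z‖ₑ ≤
      ENNReal.ofReal (C * (4 * R * R')) * strongMax g x := by
  rw [ENNReal.ofReal_mul hC, mul_assoc]
  refine le_trans ?_ (mul_le_mul_right (lintegral_box_le_strongMax g hg x a e R R' ha he hR hR') _)
  rw [← lintegral_const_mul _ (by fun_prop),
    ← lintegral_indicator (measurableSet_Icc.prod measurableSet_Icc)]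
  refine lintegral_mono fun z => ?_
  by_cases hz : z ∈ Icc (-R) R ×ˢ Icc (-R') R'
  · rw [indicator_of_mem hz, mul_comm]
    refine mul_le_mul_left ?_ _
    rw [← ofReal_norm]
    exact ENNReal.ofReal_le_ofReal (hK z)
  · simp [hK0 z hz]

variable {c b : ℝ} (D : CurveBump c b)

theorem CurveBump.exists_kernel_bounds : ∃ C, 1 ≤ C ∧
    ∀ g : ℝ × ℝ → ℝ≥0∞, Measurable g → ∀ a e, 0 < a → 0 < e → ∀ x : ℝ × ℝ,
      (∫⁻ z : ℝ × ℝ, g (x.1 - a * z.1, x.2 - e * z.2) * ‖D.kernel 1 z‖ₑ ≤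
        ENNReal.ofReal C * strongMax g x) ∧
      ∀ ε, 0 < ε → ε ≤ 1 →
        (∫⁻ z : ℝ × ℝ, g (x.1 - a * z.1, x.2 - e * z.2) *
          ‖deriv^[1] D.v z.1 * deriv^[1] D.Ψ (D.vert ε z)‖ₑ ≤ ENNReal.ofReal C * strongMax g x) ∧
        ∀ μ ∈ Icc (1 / 2 : ℝ) 1, ∫⁻ z : ℝ × ℝ, g (x.1 - a * z.1, x.2 - e * z.2) *
          ‖4 / (μ * ε) * D.profile ε μ z.1 (D.vert ε z)‖ₑ ≤
            ENNReal.ofReal C * thick (powCurve c b) (1 / 4) 4 (2 * ε) a e g x := by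
  obtain ⟨Γ, hΓ0, hΓ⟩ := D.exists_abs_G_le
  obtain ⟨C0, hC0, hC⟩ := D.exists_abs_profile_le
  have hvd : ∀ t ∉ Icc (1/2:ℝ) (5/2), deriv^[1] D.v t = 0 := fun t ht => D.iterate_v_eq_zero 1 ht
  obtain ⟨V, hV⟩ := exists_abs_le_of_zero_off_Icc (D.v_smooth.continuous_iterate 1) hvd
  have hΨd : ∀ t ∉ Icc (-2:ℝ) 2, deriv^[1] D.Ψ t = 0 := fun t ht => D.iterate_Ψ_eq_zero 1 (by
    by_contra! h; exact ht (abs_le.1 h))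
  obtain ⟨V', hV'⟩ := exists_abs_le_of_zero_off_Icc (D.Ψ_smooth.continuous_iterate 1) hΨd
  have hφ0 : ∀ t ∉ Icc (-2:ℝ) 2, D.φ t = 0 := fun t ht => D.φ_supp t (by
    by_contra! h; exact ht (abs_le.1 h.le))
  obtain ⟨P, hP⟩ := exists_abs_le_of_zero_off_Icc D.φ_cont hφ0
  have hvG0 : ∀ t ∉ Icc (1/2:ℝ) (5/2), D.v t * deriv D.G t = 0 := fun t ht => by
    rw [D.v_supp t ht, zero_mul]
  obtain ⟨W, hW⟩ := exists_abs_le_of_zero_off_Icc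
    (D.v_smooth.continuous.mul (D.G_smooth.continuous_iterate 1)) hvG0
  have hV0 : 0 ≤ V := (abs_nonneg _).trans (hV 0)
  have hV0' : 0 ≤ V' := (abs_nonneg _).trans (hV' 0)
  have hP0 : 0 ≤ P := (abs_nonneg _).trans (hP 0)
  have hW0 : 0 ≤ W := (abs_nonneg _).trans (hW 0)
  have hbox : ∀ {ε : ℝ}, 0 < ε → ε ≤ 1 → ∀ z ∉ Icc (-3:ℝ) 3 ×ˢ Icc (-(2 + Γ)) (2 + Γ),
      ¬ (z.1 ∈ Icc (1/2:ℝ) (5/2) ∧ D.vert ε z ∈ Icc (-2:ℝ) 2) := by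
    rintro ε hε hε1 z hz ⟨h1, h2⟩
    have := D.abs_snd_le hΓ hε h1 (abs_le.2 h2)
    exact hz ⟨⟨by linarith [h1.1], by linarith [h1.2]⟩, abs_le.1 (by linarith)⟩
  set C := 1 + W * P * (4 * 3 * (2 + Γ)) + V * V' * (4 * 3 * (2 + Γ)) + 16 * C0
  have hp1 : 0 ≤ W * P * (4 * 3 * (2 + Γ)) := by positivity
  have hp2 : 0 ≤ V * V' * (4 * 3 * (2 + Γ)) := by positivity
  refine ⟨C, by simp only [C]; linarith, fun g hg a e ha he x => ⟨?_, fun ε hε hε1 =>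
    ⟨?_, fun μ hμ => ?_⟩⟩⟩
  · refine (lintegral_mul_enorm_le_strongMax hg (C := W * P) (by positivity) ha he three_pos
      (show 0 < 2 + Γ by linarith) (fun z => ?_) (fun z hz => ?_) x).trans
        (mul_le_mul_left (ENNReal.ofReal_le_ofReal (by simp only [C]; linarith)) _)
    · rw [CurveBump.kernel, abs_mul, inv_one, one_mul]
      exact mul_le_mul (hW _) (hP _) (abs_nonneg _) hW0
    · by_cases h : z.1 ∈ Icc (1/2:ℝ) (5/2)
      · rw [CurveBump.kernel, hφ0 _ fun h' => hbox one_pos le_rfl z hz ⟨h, h'⟩]; simp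
      · rw [CurveBump.kernel, hvG0 _ h, zero_mul]
  · refine (lintegral_mul_enorm_le_strongMax hg (C := V * V') (by positivity) ha he three_pos
      (show 0 < 2 + Γ by linarith) (fun z => ?_) (fun z hz => ?_) x).trans
        (mul_le_mul_left (ENNReal.ofReal_le_ofReal (by simp only [C]; linarith)) _)
    · rw [abs_mul]
      exact mul_le_mul (hV _) (hV' _) (abs_nonneg _) hV0
    · by_cases h : z.1 ∈ Icc (1/2:ℝ) (5/2)
      · rw [hΨd _ fun h' => hbox hε hε1 z hz ⟨h, h'⟩, mul_zero]
      · rw [hvd _ h, zero_mul]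
  · rw [thick, ← lintegral_const_mul' _ _ (by simp),
      ← lintegral_indicator (measurableSet_thickSet (measurable_powCurve c b) _ _ _)]
    refine lintegral_mono fun z => ?_
    by_cases hz : z.1 ∈ Icc (1/2:ℝ) (5/2) ∧ |D.vert ε z| ≤ 2
    · have hmem : z ∈ thickSet (powCurve c b) (1/4) 4 (2 * ε) := by
        refine ⟨⟨by linarith [hz.1.1], by linarith [hz.1.2]⟩, ?_⟩
        rw [← D.G_eq _ hz.1]
        have h2 := hz.2
        rwa [CurveBump.vert, abs_div, abs_of_pos hε, div_le_iff₀ hε] at h2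
      rw [indicator_of_mem hmem, ← mul_assoc, mul_comm, ← ENNReal.ofReal_mul (by positivity)]
      refine mul_le_mul_left ?_ _
      rw [← ofReal_norm]
      refine ENNReal.ofReal_le_ofReal ?_
      have hμ0 : 0 < μ := by linarith [hμ.1]
      rw [Real.norm_eq_abs, abs_mul, abs_of_pos (by positivity)]
      calc 4 / (μ * ε) * |D.profile ε μ z.1 (D.vert ε z)| ≤ 8 / ε * C0 := by
            refine mul_le_mul ?_ (hC ε ⟨hε.le, hε1⟩ μ ⟨hμ0.le, hμ.2⟩ _ _) (abs_nonneg _)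
              (by positivity)
            rw [div_le_div_iff₀ (by positivity) hε]
            nlinarith [hμ.1]
        _ = 16 * C0 * (2 * ε)⁻¹ := by field_simp; norm_num
        _ ≤ C * (2 * ε)⁻¹ := mul_le_mul_of_nonneg_right (by simp only [C]; linarith) (by positivity)
    · rw [D.profile_eq_zero hz]; simp

theorem CurveBump.continuous_kernel (ε : ℝ) : Continuous (D.kernel ε) := by
  have a := D.v_smooth.continuous
  have a' : Continuous (deriv D.G) := D.G_smooth.continuous_iterate 1
  have b := D.φ_cont
  have d := D.continuous_vert ε
  unfold CurveBump.kernel; fun_prop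

theorem CurveBump.integrable_kernel {ε : ℝ} (hε : 0 < ε) : Integrable (D.kernel ε) :=
  (D.continuous_kernel ε).integrable_of_hasCompactSupport (D.hasCompactSupport_of_vert hε fun z hz => by
    by_cases h : z.1 ∈ Icc (1/2:ℝ) (5/2)
    · rw [CurveBump.kernel, D.φ_supp _ (le_of_lt (not_le.1 fun h' => hz ⟨h, h'⟩))]; simp
    · rw [CurveBump.kernel, D.v_supp _ h]; simp)

/-- Smoothing a bounded function along a curve, telescoped over dyadic thicknesses. -/
theorem exists_thick_le_sum (hc : c ≠ 0) (hb : 1 < b) : ∃ C, 1 ≤ C ∧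
    ∀ (g : ℝ × ℝ → ℝ) (B : ℝ), Measurable g → (∀ x, 0 ≤ g x) → (∀ x, ‖g x‖ ≤ B) →
    ∀ (a e : ℝ), 0 < a → 0 < e → ∀ μ : ℕ → ℝ, (∀ i, μ i ∈ Icc (1 / 2 : ℝ) 1) →
    ∀ (k : ℕ) (x : ℝ × ℝ),
      thick (powCurve c b) 1 2 (2⁻¹ ^ k) a e (fun y => ‖g y‖ₑ) x ≤
        ENNReal.ofReal C * ((k + 1) * strongMax (fun y => ‖g y‖ₑ) x + ∑ i ∈ Finset.range k,
          thick (powCurve c b) (1 / 4) 4 (2 * 2⁻¹ ^ i) a e (fun y =>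
            ‖expDiffFst (a * 2⁻¹ ^ i) (expDiffSnd (e * (μ i * 2⁻¹ ^ i)) g) y‖ₑ) x) := by
  obtain ⟨D⟩ := nonempty_curveBump hc hb
  obtain ⟨C, hC1, hC⟩ := D.exists_kernel_bounds
  refine ⟨C, hC1, fun g B hg hg0 hB a e ha he μ hμ k x => ?_⟩
  set h : ℝ × ℝ → ℝ := fun z => g (x.1 - a * z.1, x.2 - e * z.2) with hh
  have hhm : Measurable h := hg.comp (by fun_prop)
  have hitg : ∀ {K : ℝ × ℝ → ℝ}, Integrable K → Integrable fun z => h z * K z := fun hK =>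
    hK.bdd_mul (c := B) hhm.aestronglyMeasurable (ae_of_all _ fun z => hB _)
  have hge : Measurable fun y => ‖g y‖ₑ := hg.enorm
  set I : ℕ → ℝ := fun i => ∫ z, h z * D.kernel (2⁻¹ ^ i) z with hI
  have hpow : ∀ i : ℕ, (0:ℝ) < 2⁻¹ ^ i ∧ (2:ℝ)⁻¹ ^ i ≤ 1 := fun i =>
    ⟨by positivity, pow_le_one₀ (by norm_num) (by norm_num)⟩
  have hkint : ∀ i : ℕ, Integrable fun z => h z * D.kernel (2⁻¹ ^ i) z := fun i =>
    hitg (D.integrable_kernel (hpow i).1)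
  have h1 : thick (powCurve c b) 1 2 (2⁻¹ ^ k) a e (fun y => ‖g y‖ₑ) x ≤ ENNReal.ofReal (I k) := by
    have hknn : ∀ z, 0 ≤ D.kernel (2⁻¹ ^ k) z := fun z =>
      mul_nonneg (D.mul_nonneg _) (mul_nonneg (inv_nonneg.2 (hpow k).1.le) (D.φ_nonneg _))
    rw [hI, ofReal_integral_eq_lintegral_ofReal (hkint k)
      (ae_of_all _ fun z => mul_nonneg (hg0 _) (hknn z)), thick,
      ← lintegral_indicator (measurableSet_thickSet (measurable_powCurve c b) _ _ _)]
    refine lintegral_mono fun z => ?_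
    by_cases hz : z ∈ thickSet (powCurve c b) 1 2 (2⁻¹ ^ k)
    · rw [indicator_of_mem hz, ← ofReal_norm, Real.norm_of_nonneg (hg0 _), mul_comm,
        ← ENNReal.ofReal_mul (hg0 _)]
      refine ENNReal.ofReal_le_ofReal (mul_le_mul_of_nonneg_left ?_ (hg0 _))
      have hy : |D.vert (2⁻¹ ^ k) z| ≤ 1 := by
        rw [CurveBump.vert, abs_div, abs_of_pos (hpow k).1, div_le_one (hpow k).1,
          D.G_eq _ ⟨by linarith [hz.1.1], by linarith [hz.1.2]⟩]
        exact hz.2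
      calc _ = 1 * (((2:ℝ)⁻¹ ^ k)⁻¹ * 1) := by ring
        _ ≤ _ := mul_le_mul (D.one_le_mul _ hz.1) (mul_le_mul_of_nonneg_left (D.one_le_φ _ hy)
          (inv_nonneg.2 (hpow k).1.le)) (by have := (hpow k).1; positivity) (D.mul_nonneg _)
    · rw [indicator_of_notMem hz]; exact zero_le
  have h0 : ‖I 0‖ₑ ≤ ENNReal.ofReal C * strongMax (fun y => ‖g y‖ₑ) x := by
    refine (enorm_integral_le_lintegral_enorm _).trans ?_
    simp_rw [enorm_mul, pow_zero]
    exact (hC _ hge a e ha he x).1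
  have hstep : ∀ i, ‖I (i + 1) - I i‖ₑ ≤ ENNReal.ofReal C * (strongMax (fun y => ‖g y‖ₑ) x +
      thick (powCurve c b) (1 / 4) 4 (2 * 2⁻¹ ^ i) a e (fun y =>
            ‖expDiffFst (a * 2⁻¹ ^ i) (expDiffSnd (e * (μ i * 2⁻¹ ^ i)) g) y‖ₑ) x) := by
    intro i
    obtain ⟨hε, hε1⟩ := hpow i
    set ε : ℝ := 2⁻¹ ^ i
    have hμ0 : 0 < μ i := by linarith [(hμ i).1]
    set H : ℝ × ℝ → ℝ := fun z => D.profile ε (μ i) z.1 (D.vert ε z) with hH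
    have hHc : Continuous H := D.continuous_profile_vert ε (μ i)
    have hHi : Integrable H := hHc.integrable_of_hasCompactSupport
      (D.hasCompactSupport_of_vert hε fun z hz => D.profile_eq_zero hz)
    set L : ℝ × ℝ → ℝ := fun z => deriv^[1] D.v z.1 * deriv^[1] D.Ψ (D.vert ε z) with hL
    have hLc : Continuous L := by
      have a1 := D.v_smooth.continuous_iterate 1
      have a2 := D.Ψ_smooth.continuous_iterate 1
      have a3 := D.continuous_vert ε
      rw [hL]; fun_prop
    have hLi : Integrable L := hLc.integrable_of_hasCompactSupport
      (D.hasCompactSupport_of_vert hε fun z hz => by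
        by_cases h : z.1 ∈ Icc (1/2:ℝ) (5/2)
        · rw [hL]; simp only
          rw [D.iterate_Ψ_eq_zero 1 (not_le.1 fun h' => hz ⟨h, h'⟩), mul_zero]
        · rw [hL]; simp only
          rw [D.iterate_v_eq_zero 1 h, zero_mul])
    set DD := fun z : ℝ × ℝ => 4 / (μ i * ε) * expDiffSnd (μ i * ε) (expDiffFst ε H) z
    have hk : ∀ z, D.kernel (2⁻¹ ^ (i + 1)) z - D.kernel ε z = L z - DD z := by
      intro z
      rw [pow_succ', D.kernel_half_sub_kernel hε hμ0]
    have e1 : I (i + 1) - I i = ∫ z, (h z * L z - h z * DD z) := by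
      rw [hI]; simp only
      rw [← integral_sub (hkint _) (hkint _)]
      refine integral_congr_ae (ae_of_all _ fun z => ?_)
      simp only
      rw [← mul_sub, ← mul_sub, ← hk]
    have e2 : Integrable fun z => h z * DD z := by
      have := (hkint i).sub ((hkint (i + 1)).sub (hitg hLi))
      refine this.congr (ae_of_all _ fun z => ?_)
      simp only [Pi.sub_apply]
      have := hk z
      linear_combination (-h z) * this
    have e3 : ∫ z, h z * DD z = ∫ z : ℝ × ℝ, expDiffFst (a * ε) (expDiffSnd (e * (μ i * ε)) g)
        (x.1 - a * z.1, x.2 - e * z.2) * (4 / (μ i * ε) * H z) := by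
      have := integral_mul_expDiff_expDiff hg hB hHi hHc.measurable a e ε (μ i * ε) x
      have l : ∀ z, h z * DD z = 4 / (μ i * ε) * (h z * expDiffSnd (μ i * ε) (expDiffFst ε H) z) :=
        fun z => by simp only [DD]; ring
      simp_rw [l]
      rw [integral_const_mul, hh, this, ← integral_const_mul]
      refine integral_congr_ae (ae_of_all _ fun z => ?_)
      simp only; ring
    rw [e1, integral_sub (hitg hLi) e2, mul_add]
    refine enorm_sub_le.trans (add_le_add ?_ ?_)
    · refine (enorm_integral_le_lintegral_enorm _).trans ?_
      simp_rw [enorm_mul (h _)]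
      exact ((hC _ hge a e ha he x).2 ε hε hε1).1
    · rw [e3]
      refine (enorm_integral_le_lintegral_enorm _).trans ?_
      have hm : Measurable fun y =>
          ‖expDiffFst (a * ε) (expDiffSnd (e * (μ i * ε)) g) y‖ₑ :=
        (measurable_expDiffFst _ (measurable_expDiffSnd _ hg)).enorm
      simp_rw [enorm_mul (expDiffFst _ _ _)]
      exact ((hC _ hm a e ha he x).2 ε hε hε1).2 (μ i) (hμ i)
  have h2 : ∀ k, ENNReal.ofReal (I k) ≤ ENNReal.ofReal C * ((k + 1) * strongMax (fun y => ‖g y‖ₑ) x +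
      ∑ i ∈ Finset.range k, thick (powCurve c b) (1 / 4) 4 (2 * 2⁻¹ ^ i) a e (fun y =>
            ‖expDiffFst (a * 2⁻¹ ^ i) (expDiffSnd (e * (μ i * 2⁻¹ ^ i)) g) y‖ₑ) x) := by
    intro k
    induction k with
    | zero => simpa using (Real.ofReal_le_enorm _).trans h0
    | succ k ih =>
      calc ENNReal.ofReal (I (k + 1)) = ENNReal.ofReal (I k + (I (k + 1) - I k)) := by ring_nf
        _ ≤ ENNReal.ofReal (I k) + ENNReal.ofReal (I (k + 1) - I k) := ENNReal.ofReal_add_le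
        _ ≤ _ := add_le_add ih ((Real.ofReal_le_enorm _).trans (hstep k))
        _ = _ := by rw [← mul_add, Finset.sum_range_succ]; push_cast; ring
  exact h1.trans (h2 k)

end KernelBounds

section VectorValued

theorem lintegral_iSup_rpow_le {α ι : Type*} [Countable ι] [MeasurableSpace α] {μ : Measure α}
    {f : ι → α → ℝ≥0∞} (hf : ∀ i, Measurable (f i)) {p : ℝ} (hp : 0 < p) {A : ℝ≥0∞}
    (h : ∀ s : Finset ι, ∫⁻ x, (⨆ i ∈ s, f i x) ^ p ∂μ ≤ A) :
    ∫⁻ x, (⨆ i, f i x) ^ p ∂μ ≤ A := by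
  have e : ∀ x, (⨆ i, f i x) ^ p = ⨆ s : Finset ι, (⨆ i ∈ s, f i x) ^ p := fun x => by
    rw [iSup_eq_iSup_finset]
    exact (ENNReal.orderIsoRpow p hp).map_iSup _
  simp_rw [e]
  rw [lintegral_iSup_directed (fun s => ?_) fun s t => ⟨s ∪ t, ?_, ?_⟩]
  · exact iSup_le h
  · exact ((Measurable.biSup _ s.countable_toSet fun i _ => hf i).pow_const _).aemeasurable
  · exact fun x => ENNReal.rpow_le_rpow
      (biSup_mono fun i hi => Finset.mem_union_left _ hi) hp.le
  · exact fun x => ENNReal.rpow_le_rpow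
      (biSup_mono fun i hi => Finset.mem_union_right _ hi) hp.le

theorem lintegral_mul_rpow_half_le {α : Type*} [MeasurableSpace α] {μ : Measure α}
    {F G : α → ℝ≥0∞} (hF : Measurable F) (hG : Measurable G) {p : ℝ} (hp : 0 < p) (hp2 : p < 2) :
    ∫⁻ x, F x ^ (p / 2) * G x ^ (p / 2) ∂μ ≤
      (∫⁻ x, F x ^ (p / (2 - p)) ∂μ) ^ ((2 - p) / 2) * (∫⁻ x, G x ∂μ) ^ (p / 2) := by
  have hconj : Real.HolderConjugate (2 / (2 - p)) (2 / p) := by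
    rw [Real.holderConjugate_iff]
    constructor
    · rw [lt_div_iff₀ (by linarith)]; linarith
    · have : 2 - p ≠ 0 := by linarith
      field_simp; ring
  have h := ENNReal.lintegral_mul_le_Lp_mul_Lq μ hconj (hF.pow_const (p / 2)).aemeasurable
    (hG.pow_const (p / 2)).aemeasurable
  refine h.trans (le_of_eq ?_)
  have h2 : 2 - p ≠ 0 := by linarith
  congr 1
  · congr 1
    · refine lintegral_congr fun x => ?_
      rw [← ENNReal.rpow_mul]; congr 1; field_simp
    · rw [one_div_div]
  · congr 1
    · refine lintegral_congr fun x => ?_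
      rw [← ENNReal.rpow_mul]
      rw [show p / 2 * (2 / p) = 1 by field_simp, ENNReal.rpow_one]
    · rw [one_div_div]

theorem thick_sq_le {γ : ℝ → ℝ} {r s ε a e : ℝ} {g Q : ℝ × ℝ → ℝ≥0∞}
    (hg : Measurable g) (hQ : Measurable Q) (hgQ : ∀ x, g x ^ (2:ℝ) ≤ Q x) (hQt : ∀ x, Q x ≠ ∞)
    (κ : ℝ) (x : ℝ × ℝ) :
    thick γ r s ε a e g x ≤ thick γ r s ε a e (fun y => Q y ^ κ) x ^ (1 / 2 : ℝ) *
      thick γ r s ε a e (fun y => g y ^ (2:ℝ) * Q y ^ (-κ)) x ^ (1 / 2 : ℝ) := by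
  set k := ENNReal.ofReal ε⁻¹
  have h := ENNReal.lintegral_mul_le_Lp_mul_Lq (volume.restrict (thickSet γ r s ε))
    (p := 2) (q := 2) (Real.holderConjugate_iff.2 ⟨by norm_num, by norm_num⟩)
    (f := fun z : ℝ × ℝ => (k * Q (x.1 - a * z.1, x.2 - e * z.2) ^ κ) ^ (1 / 2 : ℝ))
    (g := fun z : ℝ × ℝ => (k * (g (x.1 - a * z.1, x.2 - e * z.2) ^ (2:ℝ) *
      Q (x.1 - a * z.1, x.2 - e * z.2) ^ (-κ))) ^ (1 / 2 : ℝ))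
    (by fun_prop) (by fun_prop)
  have hsq : ∀ y : ℝ≥0∞, (y ^ (1 / 2 : ℝ)) ^ (2 : ℝ) = y := fun y => by
    rw [← ENNReal.rpow_mul]; norm_num
  simp only [hsq] at h
  refine le_trans (lintegral_mono fun z => ?_) h
  simp only [Pi.mul_apply]
  set y : ℝ × ℝ := (x.1 - a * z.1, x.2 - e * z.2)
  rw [← ENNReal.mul_rpow_of_nonneg _ _ (by norm_num)]
  by_cases h0 : Q y = 0
  · have : g y = 0 := by
      have h1 := hgQ y
      rw [h0, nonpos_iff_eq_zero, ENNReal.rpow_eq_zero_iff] at h1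
      rcases h1 with h1 | h1
      · exact h1.1
      · linarith [h1.2]
    rw [this]; simp
  · have : k * Q y ^ κ * (k * (g y ^ (2:ℝ) * Q y ^ (-κ))) = (k * g y) ^ (2:ℝ) := by
      have e1 : Q y ^ κ * Q y ^ (-κ) = 1 := by
        rw [← ENNReal.rpow_add _ _ h0 (hQt y)]; simp
      calc _ = k * k * g y ^ (2:ℝ) * (Q y ^ κ * Q y ^ (-κ)) := by ring
        _ = _ := by
          rw [e1, mul_one, ENNReal.mul_rpow_of_nonneg _ _ (by norm_num)]
          congr 1
          rw [show (2:ℝ) = ((2:ℕ):ℝ) by norm_num, ENNReal.rpow_natCast, sq]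
    rw [this, ← ENNReal.rpow_mul, show (2:ℝ) * (1 / 2) = 1 by norm_num, ENNReal.rpow_one]

/-- A vector-valued extension of the maximal bound, at the price of halving the exponent. -/
theorem ThickBound.vectorValued {c b p : ℝ} {l : ℕ} {B : ℝ≥0∞}
    (hB : ThickBound c b l (p / (2 - p)) B) (hp : 1 < p) (hp2 : p ≤ 4 / 3)
    (hb : 0 ≤ b) {u : ℤ → ℝ} (hu : Lacunary u) {ε : ℝ} (hε : 2 ^ b * (2:ℝ)⁻¹ ^ l ≤ ε)
    (s : Finset (ℤ × ℤ)) {G : ℤ × ℤ → ℝ × ℝ → ℝ≥0∞} (hG : ∀ w, Measurable (G w))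
    (hGt : ∀ w x, G w x ≠ ∞) :
    ∫⁻ x, (⨆ w ∈ s, thick (powCurve c b) (1 / 4) 4 ε ((2:ℝ) ^ w.1) (u w.2 * ((2:ℝ) ^ w.1) ^ b)
      (G w) x) ^ p ≤
      8 * max 1 (64 * B) ^ (1 / 2 : ℝ) * ∫⁻ x, (∑ w ∈ s, G w x ^ (2:ℝ)) ^ (p / 2) := by
  have hεp : 0 < ε := lt_of_lt_of_le (by positivity) hε
  set Q : ℝ × ℝ → ℝ≥0∞ := fun x => ∑ w ∈ s, G w x ^ (2:ℝ) with hQ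
  have hQm : Measurable Q := Finset.measurable_fun_sum _ fun w _ => (hG w).pow_const _
  have hQt : ∀ x, Q x ≠ ∞ := fun x => by
    exact (ENNReal.sum_lt_top.2 fun w _ =>
      (ENNReal.rpow_lt_top_of_nonneg (by norm_num) (hGt w x))).ne
  set κ : ℝ := (2 - p) / 2 with hκ
  have hκ0 : 0 < κ := by simp only [hκ]; linarith
  set T : ℤ × ℤ → (ℝ × ℝ → ℝ≥0∞) → ℝ × ℝ → ℝ≥0∞ := fun w g =>
    thick (powCurve c b) (1 / 4) 4 ε ((2:ℝ) ^ w.1) (u w.2 * ((2:ℝ) ^ w.1) ^ b) g with hT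
  set M := thickMax c b (1 / 4) 4 ε u fun y => Q y ^ κ
  set R : ℝ × ℝ → ℝ≥0∞ := fun x => ∑ w ∈ s, T w (fun y => G w y ^ (2:ℝ) * Q y ^ (-κ)) x with hR
  have hGQ : ∀ w, Measurable fun y => G w y ^ (2:ℝ) * Q y ^ (-κ) := fun w =>
    ((hG w).pow_const _).mul (hQm.pow_const _)
  have hRm : Measurable R := Finset.measurable_fun_sum _ fun w _ => measurable_thick _ _ _ _ _ (hGQ w)
  have hMm : Measurable M := measurable_thickMax _ _ _ _ _ _ (hQm.pow_const _)
  have hpt : ∀ x, (⨆ w ∈ s, T w (G w) x) ^ p ≤ M x ^ (p / 2) * R x ^ (p / 2) := by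
    intro x
    have h1 : (⨆ w ∈ s, T w (G w) x) ≤ M x ^ (1 / 2 : ℝ) * R x ^ (1 / 2 : ℝ) := by
      refine iSup₂_le fun w hw => (thick_sq_le (hG w) hQm (fun y =>
        Finset.single_le_sum (f := fun w => G w y ^ (2:ℝ)) (fun _ _ => zero_le) hw)
          hQt κ x).trans ?_
      refine mul_le_mul' (ENNReal.rpow_le_rpow (thick_le_thickMax c b _ _ ε u _ x w.1 w.2)
        (by norm_num)) (ENNReal.rpow_le_rpow ?_ (by norm_num))
      exact Finset.single_le_sum (f := fun w => T w (fun y => G w y ^ (2:ℝ) * Q y ^ (-κ)) x)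
        (fun _ _ => zero_le) hw
    refine (ENNReal.rpow_le_rpow h1 (by linarith)).trans (le_of_eq ?_)
    rw [ENNReal.mul_rpow_of_nonneg _ _ (by linarith), ← ENNReal.rpow_mul, ← ENNReal.rpow_mul]
    congr 2 <;> ring
  have h2p : (2 - p) ≠ 0 := by linarith
  have hMq : ∫⁻ x, M x ^ (p / (2 - p)) ≤ 64 * B * ∫⁻ x, Q x ^ (p / 2) := by
    refine (hB.wide ?_ ?_ hb hu hε (hQm.pow_const κ)).trans (le_of_eq ?_)
    · rw [le_div_iff₀ (by linarith)]; linarith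
    · rw [div_le_iff₀ (by linarith)]; linarith
    · congr 1
      refine lintegral_congr fun x => ?_
      rw [← ENNReal.rpow_mul]
      congr 1; rw [hκ]; field_simp
  have hRi : ∫⁻ x, R x ≤ 8 * ∫⁻ x, Q x ^ (p / 2) := by
    rw [lintegral_finsetSum _ fun w _ => measurable_thick _ _ _ _ _ (hGQ w)]
    change ∑ w ∈ s, ∫⁻ x, thick _ _ _ _ _ _ (fun y => G w y ^ (2:ℝ) * Q y ^ (-κ)) x ≤ _
    rw [Finset.sum_congr rfl fun w _ => lintegral_thick (measurable_powCurve c b) _ _ hεp (hGQ w),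
      ← Finset.mul_sum, ← lintegral_finsetSum _ fun w _ => hGQ w]
    refine mul_le_mul' ?_ (lintegral_mono fun x => ?_)
    · rw [show (8:ℝ≥0∞) = ENNReal.ofReal 8 by simp]
      exact ENNReal.ofReal_le_ofReal (by norm_num)
    · rw [← Finset.sum_mul]
      change Q x * Q x ^ (-κ) ≤ _
      by_cases h0 : Q x = 0
      · rw [h0, zero_mul]; exact zero_le
      · nth_rewrite 1 [← ENNReal.rpow_one (Q x)]
        rw [← ENNReal.rpow_add _ _ h0 (hQt x)]
        refine le_of_eq (congrArg _ ?_)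
        rw [hκ]; ring
  set X := ∫⁻ x, Q x ^ (p / 2)
  calc ∫⁻ x, (⨆ w ∈ s, T w (G w) x) ^ p ≤ ∫⁻ x, M x ^ (p / 2) * R x ^ (p / 2) := lintegral_mono hpt
    _ ≤ _ := lintegral_mul_rpow_half_le hMm hRm (by linarith) (by linarith)
    _ ≤ (max 1 (64 * B) * X) ^ ((2 - p) / 2) * (8 * X) ^ (p / 2) := by
        refine mul_le_mul' (ENNReal.rpow_le_rpow (hMq.trans (mul_le_mul_left (le_max_right _ _) _))
          hκ0.le) (ENNReal.rpow_le_rpow hRi (by linarith))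
    _ = max 1 (64 * B) ^ ((2 - p) / 2) * 8 ^ (p / 2) * X := by
        rw [ENNReal.mul_rpow_of_nonneg _ _ hκ0.le, ENNReal.mul_rpow_of_nonneg _ _ (by linarith)]
        have : X ^ ((2 - p) / 2) * X ^ (p / 2) = X := by
          rw [← ENNReal.rpow_add_of_nonneg _ _ hκ0.le (by linarith)]
          rw [show (2 - p) / 2 + p / 2 = 1 by ring, ENNReal.rpow_one]
        rw [mul_mul_mul_comm, this]
    _ ≤ _ := by
        rw [mul_comm (8 : ℝ≥0∞)]
        refine mul_le_mul_left (mul_le_mul' (ENNReal.rpow_le_rpow_of_exponent_le (le_max_left _ _)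
          (by linarith)) ?_) _
        calc (8:ℝ≥0∞) ^ (p / 2) ≤ 8 ^ (1:ℝ) :=
              ENNReal.rpow_le_rpow_of_exponent_le (by norm_num) (by linarith)
          _ = 8 := ENNReal.rpow_one _

theorem lintegral_dyadicSquareFunction_le {p : ℝ} (hp : 1 < p) (hp2 : p ≤ 2) {g : ℝ × ℝ → ℝ}
    (hg : Measurable g) {B : ℝ} (hB : ∀ x, ‖g x‖ ≤ B) (t : Finset (ℤ × ℤ)) :
    ∫⁻ x, (∑ w ∈ t, ‖expDiffFst ((2:ℝ) ^ w.1) (expDiffSnd ((2:ℝ) ^ w.2) g) x‖ₑ ^ (2:ℝ)) ^ (p / 2) ≤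
      (163840 / ENNReal.ofReal (p - 1)) ^ 2 * ∫⁻ x, ‖g x‖ₑ ^ p := by
  obtain ⟨N, hN⟩ : ∃ N : ℕ, ∀ w ∈ t, |w.1| ≤ N ∧ |w.2| ≤ N := by
    refine ⟨∑ w ∈ t, (w.1.natAbs + w.2.natAbs), fun w hw => ?_⟩
    have := Finset.single_le_sum (f := fun w : ℤ × ℤ => w.1.natAbs + w.2.natAbs)
      (fun _ _ => Nat.zero_le _) hw
    constructor <;> · rw [Int.abs_eq_natAbs]; exact_mod_cast le_trans (by omega) this
  refine le_trans (lintegral_mono fun x => ENNReal.rpow_le_rpow ?_ (by linarith))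
    (lintegral_prodSquareFunction_le hp hp2 hg hB (a := (2:ℝ) ^ N) (a' := (2:ℝ) ^ N)
      (by positivity) (by positivity) (2 * N + 1))
  rw [← Finset.sum_product']
  have hz : ∀ m : ℤ, |m| ≤ N → (2:ℝ) ^ N / 2 ^ ((N - m).toNat) = (2:ℝ) ^ m := fun m hm => by
    have h1 : ((N - m).toNat : ℤ) = N - m := Int.toNat_of_nonneg (by linarith [le_abs_self m])
    rw [← zpow_natCast (2:ℝ) N, ← zpow_natCast (2:ℝ) (N - m).toNat, h1,
      ← zpow_sub₀ (by norm_num)]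
    congr 1; ring
  set φ : ℤ × ℤ → ℕ × ℕ := fun w => ((N - w.1).toNat, (N - w.2).toNat) with hφ
  have hinj : Set.InjOn φ t := by
    intro v hv w hw h
    have h1 := hN v hv
    have h2 := hN w hw
    simp only [abs_le] at h1 h2
    simp only [hφ, Prod.mk.injEq] at h
    ext <;> omega
  set F : ℕ × ℕ → ℝ≥0∞ := fun v =>
    ‖expDiffFst ((2:ℝ) ^ N / 2 ^ v.1) (expDiffSnd ((2:ℝ) ^ N / 2 ^ v.2) g) x‖ₑ ^ 2
  calc _ = ∑ w ∈ t, F (φ w) := Finset.sum_congr rfl fun w hw => by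
        simp only [F, hφ]
        rw [hz _ (hN w hw).1, hz _ (hN w hw).2, ENNReal.rpow_two]
    _ = ∑ v ∈ t.image φ, F v := (Finset.sum_image hinj).symm
    _ ≤ ∑ v ∈ Finset.range (2 * N + 1) ×ˢ Finset.range (2 * N + 1), F v := by
        refine Finset.sum_le_sum_of_subset fun v hv => ?_
        obtain ⟨w, hw, rfl⟩ := Finset.mem_image.1 hv
        have h1 := hN w hw
        simp only [abs_le] at h1
        simp only [hφ, Finset.mem_product, Finset.mem_range]
        omega
    _ = _ := rfl

end VectorValued

section Recursion

theorem Lacunary.two_mul_le_of_lt {u : ℤ → ℝ} (hu : Lacunary u) {m n : ℤ} (h : m < n) :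
    2 * u m ≤ u n := by
  refine (hu.two_mul_le m).trans ?_
  have hmono : Monotone u := monotone_int_of_le_succ fun n => by
    linarith [hu.two_mul_le n, hu.pos n]
  exact hmono (by omega)

theorem ofReal_div_sub_one_sq {p : ℝ} (hp : 1 < p) {N : ℝ} (hN : 0 ≤ N) :
    (ENNReal.ofReal N / ENNReal.ofReal (p - 1)) ^ 2 = ENNReal.ofReal ((N / (p - 1)) ^ 2) := by
  rw [← ENNReal.ofReal_div_of_pos (by linarith), ENNReal.ofReal_pow (by
    have : 0 < p - 1 := by linarith
    positivity)]

theorem rpow_le_sq_of_one_le {C p : ℝ} (hC : 1 ≤ C) (hp2 : p ≤ 2) :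
    ENNReal.ofReal C ^ p ≤ ENNReal.ofReal (C ^ 2) := by
  calc ENNReal.ofReal C ^ p ≤ ENNReal.ofReal C ^ (2:ℝ) :=
        ENNReal.rpow_le_rpow_of_exponent_le (by simpa using hC) hp2
    _ = _ := by rw [ENNReal.rpow_two, ENNReal.ofReal_pow (by linarith)]

theorem lintegral_iSup_thick_wide_le {c b p : ℝ} {l : ℕ} {B : ℝ} (hb : 1 < b)
    (hB : ThickBound c b l (p / (2 - p)) (ENNReal.ofReal B)) (hB1 : 1 ≤ B) (hp : 1 < p)
    (hp2 : p ≤ 4 / 3) {u : ℤ → ℝ} (hu : Lacunary u) {i : ℕ} (hi : i ≤ l) (s : Finset (ℤ × ℤ))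
    {g : ℝ × ℝ → ℝ} {M : ℝ} (hg : Measurable g) (hM : ∀ x, ‖g x‖ ≤ M)
    {m : ℤ × ℤ → ℤ} (hm : ∀ w, u w.2 * ((2:ℝ) ^ w.1) ^ b * 2⁻¹ ^ i ∈
      Ico ((2:ℝ) ^ m w) ((2:ℝ) ^ (m w + 1))) :
    ∫⁻ x, (⨆ w ∈ s, thick (powCurve c b) (1 / 4) 4 (2 * 2⁻¹ ^ i) ((2:ℝ) ^ w.1)
      (u w.2 * ((2:ℝ) ^ w.1) ^ b) (fun y => ‖expDiffFst ((2:ℝ) ^ (w.1 - i))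
        (expDiffSnd ((2:ℝ) ^ m w) g) y‖ₑ) x) ^ p ≤
      ENNReal.ofReal ((2 ^ b / 2) ^ 2 * (64 * B ^ (1 / 2 : ℝ)) * (163840 / (p - 1)) ^ 2) *
        ∫⁻ x, ‖g x‖ₑ ^ p := by
  have hb1 : (1:ℝ) ≤ 2 ^ b / 2 := by
    rw [le_div_iff₀ (by norm_num), one_mul]
    calc (2:ℝ) = 2 ^ (1:ℝ) := (Real.rpow_one 2).symm
      _ ≤ _ := Real.rpow_le_rpow_of_exponent_le (by norm_num) hb.le
  set G : ℤ × ℤ → ℝ × ℝ → ℝ≥0∞ := fun w y =>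
    ‖expDiffFst ((2:ℝ) ^ (w.1 - i)) (expDiffSnd ((2:ℝ) ^ m w) g) y‖ₑ with hG
  have hGm : ∀ w, Measurable (G w) := fun w =>
    (measurable_expDiffFst _ (measurable_expDiffSnd _ hg)).enorm
  set ε : ℝ := 2 ^ b * 2⁻¹ ^ i with hε
  set A : ℤ × ℤ → ℝ × ℝ → ℝ≥0∞ := fun w => thick (powCurve c b) (1 / 4) 4 ε ((2:ℝ) ^ w.1)
    (u w.2 * ((2:ℝ) ^ w.1) ^ b) (G w)
  have h1 : ∀ x, (⨆ w ∈ s, thick (powCurve c b) (1 / 4) 4 (2 * 2⁻¹ ^ i) ((2:ℝ) ^ w.1)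
      (u w.2 * ((2:ℝ) ^ w.1) ^ b) (G w) x) ^ p ≤
      ENNReal.ofReal ((2 ^ b / 2) ^ 2) * (⨆ w ∈ s, A w x) ^ p := by
    intro x
    refine le_trans ?_ (mul_le_mul_left (rpow_le_sq_of_one_le (p := p) hb1 (by linarith)) _)
    rw [← ENNReal.mul_rpow_of_nonneg _ _ (by linarith)]
    refine ENNReal.rpow_le_rpow (iSup₂_le fun w hw => ?_) (by linarith)
    refine (thick_thickness_mono (ε' := ε) (by positivity) ?_ _ _).trans ?_
    · rw [hε]
      have : (2:ℝ) ≤ 2 ^ b := by linarith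
      gcongr
    · refine mul_le_mul' (ENNReal.ofReal_le_ofReal (le_of_eq ?_)) (le_iSup₂_of_le w hw le_rfl)
      rw [hε]; field_simp
  have hinj : Set.InjOn (fun w : ℤ × ℤ => (w.1 - (i:ℤ), m w)) s := by
    rintro ⟨j, n⟩ - ⟨j', n'⟩ - h
    simp only [Prod.mk.injEq, sub_left_inj] at h
    obtain ⟨rfl, h2⟩ := h
    have key : ∀ n n' : ℤ, n < n' → m (j, n) < m (j, n') := fun n n' hn => by
      have h3 := (hm (j, n)).1
      have h4 := (hm (j, n')).2
      have h5 := hu.two_mul_le_of_lt hn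
      have h6 : (0:ℝ) < ((2:ℝ) ^ j) ^ b * 2⁻¹ ^ i := by positivity
      have h7 : (2:ℝ) ^ (m (j, n) + 1) < 2 ^ (m (j, n') + 1) := by
        rw [zpow_add₀ (by norm_num), zpow_one]
        refine lt_of_le_of_lt ?_ h4
        simp only at h3 ⊢
        nlinarith [mul_le_mul_of_nonneg_right h5 h6.le]
      have := (zpow_lt_zpow_iff_right₀ (by norm_num : (1:ℝ) < 2)).1 h7
      omega
    rcases lt_trichotomy n n' with h | h | h
    · exact absurd h2 (key _ _ h).ne
    · rw [h]
    · exact absurd h2 (key _ _ h).ne'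
  have h2 := hB.vectorValued hp hp2 (by linarith) hu (ε := ε)
    (mul_le_mul_of_nonneg_left (pow_le_pow_of_le_one (by norm_num) (by norm_num) hi)
      (by positivity)) s hGm (fun w x => by simp [hG])
  have h3 := lintegral_dyadicSquareFunction_le hp (by linarith) hg hM
    (s.image fun w : ℤ × ℤ => (w.1 - (i:ℤ), m w))
  simp_rw [Finset.sum_image hinj] at h3
  have h4 : max 1 (64 * ENNReal.ofReal B) ^ (1 / 2 : ℝ) = ENNReal.ofReal (8 * B ^ (1 / 2 : ℝ)) := by
    rw [max_eq_right, show (64:ℝ≥0∞) = ENNReal.ofReal 64 by simp,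
      ← ENNReal.ofReal_mul (by norm_num), ENNReal.ofReal_rpow_of_nonneg (by positivity)
        (by norm_num), Real.mul_rpow (by norm_num) (by linarith)]
    · congr 2
      rw [← Real.sqrt_eq_rpow, show (64:ℝ) = 8 ^ 2 by norm_num, Real.sqrt_sq (by norm_num)]
    · calc (1:ℝ≥0∞) ≤ 64 * 1 := by norm_num
        _ ≤ _ := mul_le_mul_right (by simpa using hB1) _
  calc _ ≤ ∫⁻ x, ENNReal.ofReal ((2 ^ b / 2) ^ 2) * (⨆ w ∈ s, A w x) ^ p := lintegral_mono h1
    _ = ENNReal.ofReal ((2 ^ b / 2) ^ 2) * ∫⁻ x, (⨆ w ∈ s, A w x) ^ p :=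
        lintegral_const_mul' _ _ (by simp)
    _ ≤ ENNReal.ofReal ((2 ^ b / 2) ^ 2) * (8 * max 1 (64 * ENNReal.ofReal B) ^ (1 / 2 : ℝ) *
          ((163840 / ENNReal.ofReal (p - 1)) ^ 2 * ∫⁻ x, ‖g x‖ₑ ^ p)) :=
        mul_le_mul_right (h2.trans (mul_le_mul_right h3 _)) _
    _ = _ := by
        rw [h4, show (163840:ℝ≥0∞) = ENNReal.ofReal 163840 by simp,
          ofReal_div_sub_one_sq hp (by norm_num), show (8:ℝ≥0∞) = ENNReal.ofReal 8 by simp,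
          ← ENNReal.ofReal_mul (by norm_num), ← mul_assoc, ← mul_assoc,
          ← ENNReal.ofReal_mul (by positivity), ← ENNReal.ofReal_mul (by positivity)]
        congr 2; ring

theorem add_sum_rpow_le {k : ℕ} (A S : ℝ≥0∞) (Y : ℕ → ℝ≥0∞) {p : ℝ} (hp : 1 ≤ p)
    (hp2 : p ≤ 4 / 3) (hA : A = (k + 1) * S) :
    (A + ∑ i ∈ Finset.range k, Y i) ^ p ≤ 2 * ((k + 1 : ℝ≥0∞) ^ (4 / 3 : ℝ) * S ^ p +
      (k + 1 : ℝ≥0∞) ^ (1 / 3 : ℝ) * ∑ i ∈ Finset.range k, Y i ^ p) := by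
  have hk : (1:ℝ≥0∞) ≤ k + 1 := le_add_self
  refine (ENNReal.rpow_add_le_mul_rpow_add_rpow _ _ hp).trans (mul_le_mul' ?_ (add_le_add ?_ ?_))
  · calc (2:ℝ≥0∞) ^ (p - 1) ≤ 2 ^ (1:ℝ) :=
          ENNReal.rpow_le_rpow_of_exponent_le (by norm_num) (by linarith)
      _ = 2 := ENNReal.rpow_one _
  · rw [hA, ENNReal.mul_rpow_of_nonneg _ _ (by linarith)]
    exact mul_le_mul_left (ENNReal.rpow_le_rpow_of_exponent_le hk hp2) _
  · refine (ENNReal.rpow_sum_le_const_mul_sum_rpow _ _ hp).trans (mul_le_mul_left ?_ _)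
    rw [Finset.card_range]
    calc (k:ℝ≥0∞) ^ (p - 1) ≤ (k + 1 : ℝ≥0∞) ^ (p - 1) :=
          ENNReal.rpow_le_rpow le_self_add (by linarith)
      _ ≤ _ := ENNReal.rpow_le_rpow_of_exponent_le hk (by linarith)

theorem exists_lintegral_iSup_thick_le {c b : ℝ} (hc : c ≠ 0) (hb : 1 < b) : ∃ K : ℝ, 1 ≤ K ∧
    ∀ (l k : ℕ) (p B : ℝ), 1 < p → p ≤ 4 / 3 → 1 ≤ B → k ≤ l →
    ThickBound c b l (p / (2 - p)) (ENNReal.ofReal B) →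
    ∀ u, Lacunary u → ∀ (s : Finset (ℤ × ℤ)) (g : ℝ × ℝ → ℝ) (M : ℝ), Measurable g →
    (∀ x, 0 ≤ g x) → (∀ x, ‖g x‖ ≤ M) →
    ∫⁻ x, (⨆ w ∈ s, thick (powCurve c b) 1 2 (2⁻¹ ^ k) ((2:ℝ) ^ w.1)
      (u w.2 * ((2:ℝ) ^ w.1) ^ b) (fun y => ‖g y‖ₑ) x) ^ p ≤
      ENNReal.ofReal (K * (l + 1) ^ (4 / 3 : ℝ) / (p - 1) ^ 2 * B ^ (1 / 2 : ℝ)) *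
        ∫⁻ x, ‖g x‖ₑ ^ p := by
  obtain ⟨C, hC1, hC⟩ := exists_thick_le_sum hc hb
  set D : ℝ := 160 ^ 2 + (2 ^ b / 2) ^ 2 * 64 * 163840 ^ 2 with hD
  have hD1 : 1 ≤ D := by
    have : 0 ≤ ((2:ℝ) ^ b / 2) ^ 2 * 64 * 163840 ^ 2 := by positivity
    rw [hD]; linarith
  refine ⟨C ^ 2 * 2 * D, by nlinarith [one_le_pow₀ hC1 (n := 2)], ?_⟩
  intro l k p B hp hp2 hB1 hkl hB u hu s g M hg hg0 hM
  set S := strongMax fun y => ‖g y‖ₑ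
  have hSm : Measurable S := measurable_strongMax hg.enorm
  have hpos : ∀ w : ℤ × ℤ, 0 < u w.2 * ((2:ℝ) ^ w.1) ^ b := fun w =>
    mul_pos (hu.pos _) (by positivity)
  have hex : ∀ (i : ℕ) (w : ℤ × ℤ), ∃ m : ℤ, u w.2 * ((2:ℝ) ^ w.1) ^ b * 2⁻¹ ^ i ∈
      Ico ((2:ℝ) ^ m) ((2:ℝ) ^ (m + 1)) := fun i w =>
    exists_mem_Ico_zpow (mul_pos (hpos w) (by positivity)) (by norm_num)
  choose m hm using hex
  set X : ℕ → ℤ × ℤ → ℝ × ℝ → ℝ≥0∞ := fun i w =>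
    thick (powCurve c b) (1 / 4) 4 (2 * 2⁻¹ ^ i) ((2:ℝ) ^ w.1)
      (u w.2 * ((2:ℝ) ^ w.1) ^ b) (fun y => ‖expDiffFst ((2:ℝ) ^ (w.1 - i))
        (expDiffSnd ((2:ℝ) ^ m i w) g) y‖ₑ)
  have hXm : ∀ i w, Measurable (X i w) := fun i w =>
    measurable_thick _ _ _ _ _ (measurable_expDiffFst _ (measurable_expDiffSnd _ hg)).enorm
  set Y : ℕ → ℝ × ℝ → ℝ≥0∞ := fun i x => ⨆ w ∈ s, X i w x
  have hYm : ∀ i, Measurable (Y i) := fun i =>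
    Measurable.biSup _ s.countable_toSet fun w _ => hXm i w
  have hpt : ∀ x, (⨆ w ∈ s, thick (powCurve c b) 1 2 (2⁻¹ ^ k) ((2:ℝ) ^ w.1)
      (u w.2 * ((2:ℝ) ^ w.1) ^ b) (fun y => ‖g y‖ₑ) x) ^ p ≤
      ENNReal.ofReal (C ^ 2) * (2 * ((k + 1 : ℝ≥0∞) ^ (4 / 3 : ℝ) * S x ^ p +
      (k + 1 : ℝ≥0∞) ^ (1 / 3 : ℝ) * ∑ i ∈ Finset.range k, Y i x ^ p)) := by
    intro x
    refine le_trans ?_ (mul_le_mul' (rpow_le_sq_of_one_le (p := p) hC1 (by linarith))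
      (add_sum_rpow_le _ (S x) (fun i => Y i x) hp.le hp2 rfl))
    rw [← ENNReal.mul_rpow_of_nonneg _ _ (by linarith)]
    refine ENNReal.rpow_le_rpow (iSup₂_le fun w hw => ?_) (by linarith)
    have he := hpos w
    have hμ : ∀ i : ℕ, (2:ℝ) ^ m i w / (u w.2 * ((2:ℝ) ^ w.1) ^ b * 2⁻¹ ^ i) ∈
        Icc (1 / 2 : ℝ) 1 := fun i => by
      have h := hm i w
      have h0 : 0 < u w.2 * ((2:ℝ) ^ w.1) ^ b * 2⁻¹ ^ i := mul_pos he (by positivity)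
      constructor
      · rw [div_le_div_iff₀ (by norm_num) h0]
        have := h.2
        rw [zpow_add₀ (by norm_num), zpow_one] at this
        linarith
      · rw [div_le_one h0]; exact h.1
    refine (hC g M hg hg0 hM ((2:ℝ) ^ w.1) _ (by positivity) he _ hμ k x).trans ?_
    refine mul_le_mul_right (add_le_add_right (Finset.sum_le_sum fun i _ => ?_) _) _
    refine le_trans (le_of_eq ?_) (le_iSup₂ (f := fun w _ => X i w x) w hw)
    have h1 : (2:ℝ) ^ w.1 * 2⁻¹ ^ i = 2 ^ (w.1 - i) := by
      rw [zpow_sub₀ (by norm_num), zpow_natCast, inv_pow]; rfl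
    have h2 : u w.2 * ((2:ℝ) ^ w.1) ^ b *
        ((2:ℝ) ^ m i w / (u w.2 * ((2:ℝ) ^ w.1) ^ b * 2⁻¹ ^ i) * 2⁻¹ ^ i) = 2 ^ m i w := by
      have := (hu.pos w.2).ne'
      field_simp
    rw [h1, h2]
  set I := ∫⁻ x, ‖g x‖ₑ ^ p
  have hS : ∫⁻ x, S x ^ p ≤ ENNReal.ofReal ((160 / (p - 1)) ^ 2) * I := by
    have := lintegral_strongMax_rpow_le _ hg.enorm p hp (by linarith)
    rwa [show (160:ℝ≥0∞) = ENNReal.ofReal 160 by simp,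
      ofReal_div_sub_one_sq hp (by norm_num)] at this
  set E := ENNReal.ofReal ((2 ^ b / 2) ^ 2 * (64 * B ^ (1 / 2 : ℝ)) * (163840 / (p - 1)) ^ 2)
  have hY : ∀ i ∈ Finset.range k, ∫⁻ x, Y i x ^ p ≤ E * I := fun i hi =>
    lintegral_iSup_thick_wide_le hb hB hB1 hp hp2 hu
      (by have := Finset.mem_range.1 hi; omega) s hg hM (hm i)
  have hk0 : (k + 1 : ℝ≥0∞) ≠ ∞ := by simp
  have hp0 : 0 < p - 1 := by linarith
  calc _ ≤ ∫⁻ x, ENNReal.ofReal (C ^ 2) * (2 * ((k + 1 : ℝ≥0∞) ^ (4 / 3 : ℝ) * S x ^ p +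
        (k + 1 : ℝ≥0∞) ^ (1 / 3 : ℝ) * ∑ i ∈ Finset.range k, Y i x ^ p)) := lintegral_mono hpt
    _ = ENNReal.ofReal (C ^ 2) * (2 * ((k + 1 : ℝ≥0∞) ^ (4 / 3 : ℝ) * ∫⁻ x, S x ^ p) +
        2 * ((k + 1 : ℝ≥0∞) ^ (1 / 3 : ℝ) * ∑ i ∈ Finset.range k, ∫⁻ x, Y i x ^ p)) := by
        rw [lintegral_const_mul' _ _ (by simp), lintegral_const_mul' _ _ (by simp),
          lintegral_add_left (by fun_prop), lintegral_const_mul _ (by fun_prop),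
          lintegral_const_mul _ (by fun_prop), lintegral_finsetSum _ (by fun_prop), mul_add]
    _ ≤ ENNReal.ofReal (C ^ 2) * (2 * ((k + 1 : ℝ≥0∞) ^ (4 / 3 : ℝ) *
          (ENNReal.ofReal ((160 / (p - 1)) ^ 2) * I)) +
        2 * ((k + 1 : ℝ≥0∞) ^ (1 / 3 : ℝ) * ((k + 1) * (E * I)))) := by
        refine mul_le_mul_right (add_le_add (mul_le_mul_right (mul_le_mul_right hS _) _)
          (mul_le_mul_right (mul_le_mul_right ((Finset.sum_le_sum hY).trans ?_) _) _)) _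
        rw [Finset.sum_const, Finset.card_range, nsmul_eq_mul]
        exact mul_le_mul_left le_self_add _
    _ = ENNReal.ofReal (C ^ 2) * 2 * (k + 1 : ℝ≥0∞) ^ (4 / 3 : ℝ) *
          (ENNReal.ofReal ((160 / (p - 1)) ^ 2) + E) * I := by
        have : (k + 1 : ℝ≥0∞) ^ (1 / 3 : ℝ) * (k + 1) = (k + 1 : ℝ≥0∞) ^ (4 / 3 : ℝ) := by
          nth_rewrite 2 [← ENNReal.rpow_one (k + 1 : ℝ≥0∞)]
          rw [← ENNReal.rpow_add _ _ (by simp) hk0]; norm_num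
        rw [← this]; ring
    _ ≤ _ := by
        refine mul_le_mul_left ?_ _
        rw [show (2:ℝ≥0∞) = ENNReal.ofReal 2 by simp, show (k + 1 : ℝ≥0∞) = ENNReal.ofReal (k + 1) by
            rw [ENNReal.ofReal_add (by positivity) (by norm_num)]; simp,
          ENNReal.ofReal_rpow_of_nonneg (by positivity) (by norm_num),
          ← ENNReal.ofReal_add (by positivity) (by positivity), ← ENNReal.ofReal_mul (by positivity),
          ← ENNReal.ofReal_mul (by positivity), ← ENNReal.ofReal_mul (by positivity)]
        refine ENNReal.ofReal_le_ofReal ?_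
        have hB2 : 1 ≤ B ^ (1 / 2 : ℝ) := Real.one_le_rpow hB1 (by norm_num)
        have hkl' : ((k:ℝ) + 1) ^ (4 / 3 : ℝ) ≤ (l + 1) ^ (4 / 3 : ℝ) :=
          Real.rpow_le_rpow (by positivity) (by gcongr) (by norm_num)
        have hin : (160 / (p - 1)) ^ 2 + (2 ^ b / 2) ^ 2 * (64 * B ^ (1 / 2 : ℝ)) *
            (163840 / (p - 1)) ^ 2 ≤ D / (p - 1) ^ 2 * B ^ (1 / 2 : ℝ) := by
          have : D / (p - 1) ^ 2 * B ^ (1 / 2 : ℝ) = (160 / (p - 1)) ^ 2 * B ^ (1 / 2 : ℝ) +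
              (2 ^ b / 2) ^ 2 * (64 * B ^ (1 / 2 : ℝ)) * (163840 / (p - 1)) ^ 2 := by
            rw [hD]; field_simp
          rw [this]
          have := mul_le_mul_of_nonneg_left hB2 (show 0 ≤ (160 / (p - 1)) ^ 2 by positivity)
          linarith
        calc _ ≤ C ^ 2 * 2 * (l + 1) ^ (4 / 3 : ℝ) * (D / (p - 1) ^ 2 * B ^ (1 / 2 : ℝ)) := by
              gcongr
          _ = _ := by ring

end Recursion

section ThickBound

theorem lintegral_thickMax_rpow_le_of_bounded {c b ε p : ℝ} (hp : 0 < p) {u : ℤ → ℝ} {D : ℝ≥0∞}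
    (h : ∀ (s : Finset (ℤ × ℤ)) (g : ℝ × ℝ → ℝ) (M : ℝ), Measurable g →
      (∀ x, 0 ≤ g x) → (∀ x, ‖g x‖ ≤ M) →
      ∫⁻ x, (⨆ w ∈ s, thick (powCurve c b) 1 2 ε ((2:ℝ) ^ w.1)
        (u w.2 * ((2:ℝ) ^ w.1) ^ b) (fun y => ‖g y‖ₑ) x) ^ p ≤ D * ∫⁻ x, ‖g x‖ₑ ^ p)
    {g : ℝ × ℝ → ℝ≥0∞} (hg : Measurable g) :
    ∫⁻ x, thickMax c b 1 2 ε u g x ^ p ≤ D * ∫⁻ x, g x ^ p := by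
  set G : ℕ → ℝ × ℝ → ℝ≥0∞ := fun N x => min (g x) N with hG
  have hGm : ∀ N, Measurable (G N) := fun N => hg.min measurable_const
  have hGmono : ∀ x, Monotone fun N => G N x := fun x N N' hN =>
    min_le_min le_rfl (by exact_mod_cast hN)
  have hGsup : ∀ x, ⨆ N, G N x = g x := fun x => by
    refine le_antisymm (iSup_le fun N => min_le_left _ _) ?_
    simp only [hG]
    rw [← inf_iSup_eq, ENNReal.iSup_natCast, inf_top_eq]
  set F : ℕ × ℤ × ℤ → ℝ × ℝ → ℝ≥0∞ := fun v =>
    thick (powCurve c b) 1 2 ε ((2:ℝ) ^ v.2.1) (u v.2.2 * ((2:ℝ) ^ v.2.1) ^ b) (G v.1) with hF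
  have h1 : ∀ x, thickMax c b 1 2 ε u g x ≤ ⨆ v, F v x := fun x => by
    refine iSup₂_le fun j n => ?_
    have : thick (powCurve c b) 1 2 ε ((2:ℝ) ^ j) (u n * ((2:ℝ) ^ j) ^ b) g x =
        ⨆ N, F (N, j, n) x := by
      simp only [hF, thick]
      rw [← lintegral_iSup]
      · refine lintegral_congr fun z => ?_
        rw [← ENNReal.mul_iSup, hGsup]
      · exact fun N => by have := hGm N; fun_prop
      · exact fun N N' hN z => mul_le_mul_right (hGmono _ hN) _
    rw [this]
    exact iSup_le fun N => le_iSup (fun v => F v x) (N, j, n)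
  refine (lintegral_mono fun x => ENNReal.rpow_le_rpow (h1 x) hp.le).trans ?_
  refine lintegral_iSup_rpow_le (f := F) (fun v => measurable_thick _ _ _ _ _ (hGm v.1)) hp
    fun s => ?_
  obtain ⟨N, hN⟩ := (s.image Prod.fst).exists_nat_subset_range
  have hcoe : ∀ y, ‖(G N y).toReal‖ₑ = G N y := fun y => by
    rw [← ofReal_norm, Real.norm_of_nonneg ENNReal.toReal_nonneg, ENNReal.ofReal_toReal]
    exact (lt_of_le_of_lt (min_le_right _ _) (ENNReal.natCast_lt_top N)).ne
  have h2 := h (s.image Prod.snd) (fun y => (G N y).toReal) N (hGm N).ennreal_toReal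
    (fun _ => ENNReal.toReal_nonneg) (fun x => by
      rw [Real.norm_of_nonneg ENNReal.toReal_nonneg]
      exact ENNReal.toReal_le_of_le_ofReal (by positivity) ((min_le_right _ _).trans (by simp)))
  simp only [hcoe] at h2
  refine le_trans (lintegral_mono fun x => ENNReal.rpow_le_rpow ?_ hp.le)
    (h2.trans (mul_le_mul_right (lintegral_mono fun x =>
      ENNReal.rpow_le_rpow (min_le_left _ _) hp.le) _))
  refine iSup₂_le fun v hv => ?_
  refine le_trans (thick_mono (fun y => hGmono y ?_) x)
    (le_iSup₂ (f := fun w (_ : w ∈ s.image Prod.snd) => thick (powCurve c b) 1 2 ε ((2:ℝ) ^ w.1)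
        (u w.2 * ((2:ℝ) ^ w.1) ^ b) (G N) x) v.2 (Finset.mem_image_of_mem _ hv))
  exact (Finset.mem_range.1 (hN (Finset.mem_image_of_mem _ hv))).le

theorem abs_powCurve_le {c b R t : ℝ} (hb : 0 ≤ b) (ht : 0 ≤ t) (htR : t ≤ R) :
    |powCurve c b t| ≤ |c| * R ^ b := by
  rw [powCurve, abs_mul, abs_of_nonneg (Real.rpow_nonneg ht b)]
  exact mul_le_mul_of_nonneg_left (Real.rpow_le_rpow ht htR hb) (abs_nonneg c)

theorem lintegral_thickMax_rpow_le_of_le {c b ε δ p : ℝ} (hb : 0 ≤ b) (hp : 1 < p) (hp2 : p ≤ 2)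
    {u : ℤ → ℝ} (hu : Lacunary u) (hδ : 0 < δ) (hδ1 : δ ≤ 1) (hε : δ ≤ ε)
    {g : ℝ × ℝ → ℝ≥0∞} (hg : Measurable g) :
    ∫⁻ x, thickMax c b 1 2 ε u g x ^ p ≤
      ENNReal.ofReal ((8 * (1 + |c| * 2 ^ b) / δ) ^ 2 * (160 / (p - 1)) ^ 2) *
        ∫⁻ x, g x ^ p := by
  set Γ := |c| * 2 ^ b
  have hΓ : 0 ≤ Γ := by positivity
  have hε0 : 0 < ε := hδ.trans_le hε
  have h8 : 1 ≤ 8 * (1 + Γ) / δ := by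
    rw [le_div_iff₀ hδ]; linarith
  have h1 : ∀ x, thickMax c b 1 2 ε u g x ^ p ≤
      ENNReal.ofReal ((8 * (1 + Γ) / δ) ^ 2) * strongMax g x ^ p := by
    intro x
    refine le_trans ?_ (mul_le_mul_left (rpow_le_sq_of_one_le (p := p) h8 hp2) _)
    rw [← ENNReal.mul_rpow_of_nonneg _ _ (by linarith)]
    refine ENNReal.rpow_le_rpow (iSup₂_le fun j n => ?_) (by linarith)
    refine (thick_le_strongMax (R := 2) (Γ := Γ) hε0 (by positivity)
      (mul_pos (hu.pos n) (by positivity)) (by norm_num) hΓ (Icc_subset_Icc (by norm_num) le_rfl)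
      (fun t ht => abs_powCurve_le hb (by linarith [ht.1]) ht.2) hg x).trans
      (mul_le_mul_left (ENNReal.ofReal_le_ofReal ?_) _)
    have e : ε⁻¹ * (4 * 2 * (ε + Γ)) = 8 + 8 * Γ / ε := by field_simp; ring
    rw [e]
    have e2 : 8 * (1 + Γ) / δ = 8 / δ + 8 * Γ / δ := by ring
    rw [e2]
    have e3 : 8 ≤ 8 / δ := by rw [le_div_iff₀ hδ]; linarith
    have e4 : 8 * Γ / ε ≤ 8 * Γ / δ := by gcongr
    linarith
  refine (lintegral_mono h1).trans ?_
  rw [lintegral_const_mul' _ _ (by simp), ENNReal.ofReal_mul (by positivity), mul_assoc,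
    ← ofReal_div_sub_one_sq hp (by norm_num), show ENNReal.ofReal 160 = 160 by simp]
  exact mul_le_mul_right (lintegral_strongMax_rpow_le g hg p hp hp2) _

theorem ThickBound.exists_improvement {c b : ℝ} (hc : c ≠ 0) (hb : 1 < b) : ∃ K : ℝ,
    8 * (1 + |c| * 2 ^ b) * 160 ≤ K ∧
    ∀ (l : ℕ) (p B : ℝ), 1 < p → p ≤ 4 / 3 → 1 ≤ B →
    ThickBound c b l (p / (2 - p)) (ENNReal.ofReal B) →
    ThickBound c b l p (ENNReal.ofReal (K * (l + 1) ^ (4 / 3 : ℝ) / (p - 1) ^ 2 *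
      B ^ (1 / 2 : ℝ))) := by
  obtain ⟨K, hK1, hK⟩ := exists_lintegral_iSup_thick_le hc hb
  set V : ℝ := 8 * (1 + |c| * 2 ^ b) * 160 with hV
  have hV1 : 1 ≤ V := by
    have : 0 ≤ |c| * 2 ^ b := by positivity
    rw [hV]; linarith
  refine ⟨4 * K + V ^ 2, by nlinarith, fun l p B hp hp2 hB1 hB u hu ε hε g hg => ?_⟩
  have hε0 : 0 < ε := lt_of_lt_of_le (by positivity) hε
  have hp0 : 0 < p - 1 := by linarith
  have hB2 : 1 ≤ B ^ (1 / 2 : ℝ) := Real.one_le_rpow hB1 (by norm_num)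
  have hl2 : (1:ℝ) ≤ (l + 1) ^ (4 / 3 : ℝ) := Real.one_le_rpow (by simp) (by norm_num)
  rcases le_total 1 ε with h1 | h1
  · refine (lintegral_thickMax_rpow_le_of_le (by linarith) hp (by linarith) hu one_pos le_rfl h1
      hg).trans (mul_le_mul_left (ENNReal.ofReal_le_ofReal ?_) _)
    have e1 : (8 * (1 + |c| * 2 ^ b) / 1) ^ 2 * (160 / (p - 1)) ^ 2 = V ^ 2 * 1 / (p - 1) ^ 2 * 1 := by
      rw [hV]; field_simp
    rw [e1]
    gcongr
    linarith
  · obtain ⟨k, hk1, hk2⟩ := exists_nat_pow_near_of_lt_one hε0 h1 (by norm_num : (0:ℝ) < 2⁻¹)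
      (by norm_num)
    have hkl : k ≤ l := by
      by_contra! hlt
      have := pow_le_pow_of_le_one (by norm_num : (0:ℝ) ≤ 2⁻¹) (by norm_num) hlt
      have h3 : (0:ℝ) < 2⁻¹ ^ l := by positivity
      rw [Nat.succ_eq_add_one, pow_succ] at this
      linarith
    have h2 : ∀ x, thickMax c b 1 2 ε u g x ^ p ≤
        ENNReal.ofReal (2 ^ 2) * thickMax c b 1 2 (2⁻¹ ^ k) u g x ^ p := fun x => by
      refine le_trans ?_ (mul_le_mul_left (rpow_le_sq_of_one_le (p := p) (by norm_num)
        (by linarith)) _)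
      rw [← ENNReal.mul_rpow_of_nonneg _ _ (by linarith)]
      refine ENNReal.rpow_le_rpow (iSup₂_le fun j n => ?_) (by linarith)
      refine (thick_thickness_mono hε0 hk2 g x).trans (mul_le_mul' (ENNReal.ofReal_le_ofReal ?_)
        (thick_le_thickMax _ _ _ _ _ _ _ _ _ _))
      rw [div_le_iff₀ hε0]
      rw [pow_succ] at hk1
      linarith
    refine (lintegral_mono h2).trans ?_
    rw [lintegral_const_mul' _ _ (by simp)]
    refine (mul_le_mul_right (lintegral_thickMax_rpow_le_of_bounded (by linarith)
      (fun s g M => hK l k p B hp hp2 hB1 hkl hB u hu s g M) hg) _).trans ?_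
    rw [← mul_assoc, ← ENNReal.ofReal_mul (by positivity)]
    refine mul_le_mul_left (ENNReal.ofReal_le_ofReal ?_) _
    have e1 : 2 ^ 2 * (K * (l + 1) ^ (4 / 3 : ℝ) / (p - 1) ^ 2 * B ^ (1 / 2 : ℝ)) =
      4 * K * (l + 1) ^ (4 / 3 : ℝ) / (p - 1) ^ 2 * B ^ (1 / 2 : ℝ) := by ring
    rw [e1]
    gcongr
    nlinarith

/-- The maximal functions over thickened curves are bounded with polynomial dependence on the scale
and on the distance of the exponent to one. -/
theorem exists_thickBound {c b : ℝ} (hc : c ≠ 0) (hb : 1 < b) : ∃ A : ℝ, 1 ≤ A ∧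
    ∀ (l : ℕ) (p : ℝ), 1 < p → p ≤ 2 → ThickBound c b l p (ENNReal.ofReal
      ((A * (l + 1) ^ (4 / 3 : ℝ) / (1 - 1 / p) ^ 2 * 2 ^ (4 * l * (1 - 1 / p))) ^ 2)) := by
  obtain ⟨K, hKV, hK⟩ := ThickBound.exists_improvement hc hb
  have hK1 : 1 ≤ K := by
    have : 0 ≤ |c| * 2 ^ b := by positivity
    linarith
  refine ⟨K, hK1, fun l => ?_⟩
  have hl2 : (1:ℝ) ≤ (l + 1) ^ (4 / 3 : ℝ) := Real.one_le_rpow (by simp) (by norm_num)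
  have key : ∀ (N : ℕ) (p : ℝ), 1 < p → p ≤ 2 → (2:ℝ)⁻¹ ^ (N + 2) < 1 - 1 / p →
      ThickBound c b l p (ENNReal.ofReal
      ((K * (l + 1) ^ (4 / 3 : ℝ) / (1 - 1 / p) ^ 2 * 2 ^ (4 * l * (1 - 1 / p))) ^ 2)) := by
    intro N
    induction N with
    | zero =>
      intro p hp hp2 hx u hu ε hε g hg
      refine (lintegral_thickMax_rpow_le_of_le (by linarith) hp (by linarith) hu (by positivity)
        (pow_le_one₀ (by norm_num) (by norm_num)) hε hg).trans
          (mul_le_mul_left (ENNReal.ofReal_le_ofReal ?_) _)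
      set x := 1 - 1 / p with hxdef
      have hp0 : 0 < p - 1 := by linarith
      have hxp : x ≤ p - 1 := by
        have : x = (p - 1) / p := by rw [hxdef]; field_simp
        rw [this]; exact div_le_self hp0.le hp.le
      have hx2 : x ≤ 1 / 2 := by
        have : 1 / 2 ≤ 1 / p := one_div_le_one_div_of_le (by linarith) hp2
        linarith
      norm_num at hx
      rw [← mul_pow]
      refine pow_le_pow_left₀ (by positivity) ?_ 2
      have e1 : 8 * (1 + |c| * 2 ^ b) / 2⁻¹ ^ l * (160 / (p - 1)) =
        8 * (1 + |c| * 2 ^ b) * 160 * 1 / (p - 1) * 2 ^ l := by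
        rw [inv_pow, div_inv_eq_mul]; ring
      rw [e1]
      have e2 : (2:ℝ) ^ l ≤ 2 ^ (4 * l * x) := by
        rw [← Real.rpow_natCast]
        refine Real.rpow_le_rpow_of_exponent_le (by norm_num) ?_
        have : (0:ℝ) ≤ l := by positivity
        nlinarith
      have e3 : x ^ 2 ≤ p - 1 := by nlinarith
      gcongr
    | succ N ih =>
      intro p hp hp2 hx
      by_cases hx2 : (2:ℝ)⁻¹ ^ (N + 2) < 1 - 1 / p
      · exact ih p hp hp2 hx2
      set x := 1 - 1 / p with hxdef
      have hp0 : 0 < p - 1 := by linarith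
      have hx4 : x ≤ 1 / 4 := by
        refine (not_lt.1 hx2).trans ?_
        calc (2:ℝ)⁻¹ ^ (N + 2) ≤ 2⁻¹ ^ 2 :=
              pow_le_pow_of_le_one (by norm_num) (by norm_num) (by omega)
          _ = _ := by norm_num
      have hx0 : 0 < x := lt_trans (by positivity) hx
      have hxp : x = (p - 1) / p := by rw [hxdef]; field_simp
      have hp43 : p ≤ 4 / 3 := by
        rw [hxp, div_le_iff₀ (by linarith)] at hx4
        linarith
      have hxp1 : x ≤ p - 1 := by rw [hxp]; exact div_le_self hp0.le hp.le
      have h2p : 0 < 2 - p := by linarith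
      have hq : 1 - 1 / (p / (2 - p)) = 2 * x := by rw [hxp]; field_simp; ring
      have h1 := ih (p / (2 - p)) (by rw [lt_div_iff₀ h2p]; linarith)
        (by rw [div_le_iff₀ h2p]; linarith) (by rw [hq]; rw [pow_succ] at hx; linarith)
      rw [hq] at h1
      have hT : (1:ℝ) ≤ 2 ^ (4 * l * (2 * x)) :=
        Real.one_le_rpow (by norm_num) (by positivity)
      have hV : 1 ≤ K * (l + 1) ^ (4 / 3 : ℝ) / (2 * x) ^ 2 * 2 ^ (4 * l * (2 * x)) := by
        have e1 : 1 ≤ K * (l + 1) ^ (4 / 3 : ℝ) := by nlinarith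
        have e2 : 1 ≤ K * (l + 1) ^ (4 / 3 : ℝ) / (2 * x) ^ 2 := by
          rw [le_div_iff₀ (by positivity)]; nlinarith
        nlinarith
      have h2 := hK l p _ hp hp43 (one_le_pow₀ hV (n := 2)) h1
      intro u hu ε hε g hg
      refine (h2 u hu ε hε g hg).trans (mul_le_mul_left (ENNReal.ofReal_le_ofReal ?_) _)
      rw [← Real.sqrt_eq_rpow, Real.sqrt_sq (by linarith)]
      have hT2 : (2:ℝ) ^ (4 * l * (2 * x)) = (2 ^ (4 * l * x)) ^ 2 := by
        rw [← Real.rpow_natCast, ← Real.rpow_mul (by norm_num)]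
        congr 1; push_cast; ring
      rw [hT2]
      set L : ℝ := (l + 1) ^ (4 / 3 : ℝ)
      set T : ℝ := 2 ^ (4 * l * x)
      calc K * L / (p - 1) ^ 2 * (K * L / (2 * x) ^ 2 * T ^ 2)
          ≤ K * L / x ^ 2 * (K * L / x ^ 2 * T ^ 2) := by
            gcongr
            linarith
        _ = _ := by ring
  intro p hp hp2
  have hx : 0 < 1 - 1 / p := by
    have : 1 / p < 1 := by rw [div_lt_one (by linarith)]; exact hp
    linarith
  obtain ⟨N, hN⟩ := exists_pow_lt_of_lt_one hx (by norm_num : (2:ℝ)⁻¹ < 1)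
  exact key N p hp hp2 (lt_of_le_of_lt
    (pow_le_pow_of_le_one (by norm_num) (by norm_num) (by omega)) hN)

end ThickBound

/-- The Gaussian `e^{-π ε |ξ|²}` on the plane. -/
def gaussWeight (ε : ℝ) (ξ : ℝ × ℝ) : ℝ :=
  Real.exp (-(Real.pi * ε) * ξ.1 ^ 2) * Real.exp (-(Real.pi * ε) * ξ.2 ^ 2)

/-- The Gaussian approximate identity `ε⁻¹ e^{-π |x|²/ε}` on the plane. -/
def gaussKernel (ε : ℝ) (x : ℝ × ℝ) : ℝ :=
  (Real.sqrt (1 / ε) * Real.exp (-(Real.pi / ε) * x.1 ^ 2)) *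
    (Real.sqrt (1 / ε) * Real.exp (-(Real.pi / ε) * x.2 ^ 2))

lemma integral_char_mul_gaussian {ε : ℝ} (hε : 0 < ε) (t : ℝ) :
    ∫ x : ℝ, Complex.exp (((-(2 * Real.pi * (t * x)) : ℝ) : ℂ) * Complex.I) *
        ((Real.exp (-(Real.pi * ε) * x ^ 2) : ℝ) : ℂ) =
      ((Real.sqrt (1 / ε) * Real.exp (-(Real.pi / ε) * t ^ 2) : ℝ) : ℂ) := by
  have hπ := Real.pi_pos
  have h := fourierIntegral_gaussian (b := ((Real.pi * ε : ℝ) : ℂ))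
    (by rw [Complex.ofReal_re]; positivity) (((-(2 * Real.pi * t) : ℝ) : ℂ))
  have e1 : ((Real.pi : ℂ) / ((Real.pi * ε : ℝ) : ℂ)) ^ (1 / 2 : ℂ) =
      ((Real.sqrt (1 / ε) : ℝ) : ℂ) := by
    rw [Real.sqrt_eq_rpow, Complex.ofReal_cpow (by positivity)]
    push_cast
    congr 1
    have : (Real.pi : ℂ) ≠ 0 := by exact_mod_cast hπ.ne'
    have h2 : (ε : ℂ) ≠ 0 := by exact_mod_cast hε.ne'
    field_simp
  have e2 : Complex.exp (-(((-(2 * Real.pi * t) : ℝ) : ℂ)) ^ 2 /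
      (4 * ((Real.pi * ε : ℝ) : ℂ))) = ((Real.exp (-(Real.pi / ε) * t ^ 2) : ℝ) : ℂ) := by
    rw [Complex.ofReal_exp]
    congr 1
    have : (Real.pi : ℂ) ≠ 0 := by exact_mod_cast hπ.ne'
    have h2 : (ε : ℂ) ≠ 0 := by exact_mod_cast hε.ne'
    push_cast
    field_simp
    ring
  rw [e1, e2] at h
  rw [Complex.ofReal_mul, ← h]
  refine integral_congr_ae (ae_of_all _ fun x => ?_)
  dsimp only
  rw [Complex.ofReal_exp]
  congr 2
  · push_cast
    ring
  · push_cast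
    ring

lemma integrable_gaussWeight {ε : ℝ} (hε : 0 < ε) : Integrable (gaussWeight ε) := by
  have h := integrable_exp_neg_mul_sq (b := Real.pi * ε) (by have := Real.pi_pos; positivity)
  exact h.mul_prod h

lemma continuous_gaussWeight (ε : ℝ) : Continuous (gaussWeight ε) := by
  unfold gaussWeight; fun_prop

lemma gaussWeight_nonneg (ε : ℝ) (ξ : ℝ × ℝ) : 0 ≤ gaussWeight ε ξ := by
  unfold gaussWeight; positivity

lemma gaussKernel_nonneg (ε : ℝ) (ξ : ℝ × ℝ) : 0 ≤ gaussKernel ε ξ := by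
  unfold gaussKernel; positivity

lemma gaussKernel_neg (ε : ℝ) (x y : ℝ × ℝ) : gaussKernel ε (x - y) = gaussKernel ε (y - x) := by
  simp only [gaussKernel, Prod.fst_sub, Prod.snd_sub]
  ring_nf

lemma continuous_gaussKernel (ε : ℝ) : Continuous (gaussKernel ε) := by
  unfold gaussKernel; fun_prop

lemma lintegral_gaussKernel {ε : ℝ} (hε : 0 < ε) :
    ∫⁻ x, ENNReal.ofReal (gaussKernel ε x) = 1 := by
  have hπ := Real.pi_pos
  have h := (integrable_exp_neg_mul_sq (b := Real.pi / ε) (by positivity)).const_mul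
    (Real.sqrt (1 / ε))
  have hK : Integrable (gaussKernel ε) := h.mul_prod h
  rw [← ofReal_integral_eq_lintegral_ofReal hK
    (ae_of_all _ fun x => gaussKernel_nonneg ε x)]
  have h1 : ∫ x : ℝ, Real.sqrt (1 / ε) * Real.exp (-(Real.pi / ε) * x ^ 2) = 1 := by
    rw [integral_const_mul, integral_gaussian, ← Real.sqrt_mul (by positivity)]
    rw [show 1 / ε * (Real.pi / (Real.pi / ε)) = 1 by field_simp, Real.sqrt_one]
  have h2 : ∫ x, gaussKernel ε x = 1 := by
    refine (integral_prod_mul (μ := volume) (ν := volume)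
      (fun x : ℝ => Real.sqrt (1 / ε) * Real.exp (-(Real.pi / ε) * x ^ 2))
      (fun x : ℝ => Real.sqrt (1 / ε) * Real.exp (-(Real.pi / ε) * x ^ 2))).trans ?_
    rw [h1, one_mul]
  rw [h2, ENNReal.ofReal_one]

lemma FT_gaussWeight {ε : ℝ} (hε : 0 < ε) (x : ℝ × ℝ) :
    FT (fun ξ => ((gaussWeight ε ξ : ℝ) : ℂ)) x = ((gaussKernel ε x : ℝ) : ℂ) := by
  rw [gaussKernel, Complex.ofReal_mul, ← integral_char_mul_gaussian hε,
    ← integral_char_mul_gaussian hε]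
  refine Eq.trans ?_ (integral_prod_mul (μ := volume) (ν := volume) _ _)
  refine integral_congr_ae (ae_of_all _ fun ξ => ?_)
  dsimp only [gaussWeight]
  rw [mul_mul_mul_comm, ← Complex.exp_add, ← Complex.ofReal_mul]
  congr 2
  push_cast
  ring

lemma norm_exp_ofReal_mul_I_mul (t : ℝ) (z : ℂ) :
    ‖Complex.exp ((t : ℂ) * Complex.I) * z‖ = ‖z‖ := by
  rw [norm_mul, Complex.norm_exp_ofReal_mul_I, one_mul]

lemma norm_FT_le (g : ℝ × ℝ → ℂ) (ξ : ℝ × ℝ) : ‖FT g ξ‖ ≤ ∫ x, ‖g x‖ := by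
  refine (norm_integral_le_integral_norm _).trans (le_of_eq ?_)
  refine integral_congr_ae (ae_of_all _ fun x => ?_)
  exact norm_exp_ofReal_mul_I_mul _ _

lemma continuous_FT {g : ℝ × ℝ → ℂ} (hg : Integrable g) : Continuous (FT g) := by
  refine continuous_of_dominated (bound := fun x => ‖g x‖) (fun ξ => ?_) (fun ξ => ?_) hg.norm ?_
  · exact (Continuous.aestronglyMeasurable (by fun_prop)).mul hg.1
  · exact ae_of_all _ fun x => (norm_exp_ofReal_mul_I_mul _ _).le
  · exact ae_of_all _ fun x => by fun_prop

lemma FTinv_eq_FT_neg (g : ℝ × ℝ → ℂ) (x : ℝ × ℝ) : FTinv g x = FT g (-x) := by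
  refine integral_congr_ae (ae_of_all _ fun ξ => ?_)
  dsimp only
  congr 4
  simp only [Prod.fst_neg, Prod.snd_neg]
  ring

lemma integral_normSq_FT_mul_gaussWeight {g : ℝ × ℝ → ℂ} (hg : Integrable g) {ε : ℝ}
    (hε : 0 < ε) :
    ((∫ ξ, ‖FT g ξ‖ ^ 2 * gaussWeight ε ξ : ℝ) : ℂ) =
      ∫ z : (ℝ × ℝ) × (ℝ × ℝ), g z.1 * (starRingEnd ℂ) (g z.2) *
        ((gaussKernel ε (z.1 - z.2) : ℝ) : ℂ) := by
  have hconj : Integrable fun y => (starRingEnd ℂ) (g y) :=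
    (integrable_norm_iff (Complex.continuous_conj.comp_aestronglyMeasurable hg.1)).1
      (by simpa using hg.norm)
  have hgg : Integrable fun z : (ℝ × ℝ) × (ℝ × ℝ) => g z.1 * (starRingEnd ℂ) (g z.2) :=
    hg.mul_prod hconj
  set e : (ℝ × ℝ) → (ℝ × ℝ) × (ℝ × ℝ) → ℂ := fun ξ z =>
    Complex.exp (((-(2 * Real.pi * ((z.1 - z.2).1 * ξ.1 + (z.1 - z.2).2 * ξ.2)) : ℝ) : ℂ) *
      Complex.I) with he
  have h1 : ∀ ξ, ((‖FT g ξ‖ ^ 2 : ℝ) : ℂ) =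
      ∫ z : (ℝ × ℝ) × (ℝ × ℝ), e ξ z * (g z.1 * (starRingEnd ℂ) (g z.2)) := by
    intro ξ
    rw [Complex.ofReal_pow, ← Complex.mul_conj', FT, ← integral_conj]
    refine (integral_prod_mul (μ := volume) (ν := volume) _ _).symm.trans ?_
    refine integral_congr_ae (ae_of_all _ fun z => ?_)
    dsimp only
    rw [map_mul, ← Complex.exp_conj, map_mul, Complex.conj_ofReal, Complex.conj_I,
      mul_mul_mul_comm, ← Complex.exp_add]
    congr 2
    simp only [Prod.fst_sub, Prod.snd_sub]
    push_cast
    ring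
  have h2 : ∀ z : (ℝ × ℝ) × (ℝ × ℝ), ((gaussKernel ε (z.1 - z.2) : ℝ) : ℂ) =
      ∫ ξ, e ξ z * ((gaussWeight ε ξ : ℝ) : ℂ) := by
    intro z
    rw [← FT_gaussWeight hε, FT]
    refine integral_congr_ae (ae_of_all _ fun ξ => ?_)
    dsimp only [he]
    congr 4
    ring
  have hitg : Integrable (Function.uncurry fun (ξ : ℝ × ℝ) (z : (ℝ × ℝ) × (ℝ × ℝ)) =>
      e ξ z * (g z.1 * (starRingEnd ℂ) (g z.2)) * ((gaussWeight ε ξ : ℝ) : ℂ)) := by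
    have hb := ((integrable_gaussWeight hε).ofReal (𝕜 := ℂ)).mul_prod hgg
    refine (hb.bdd_mul (c := 1) (f := fun q : (ℝ × ℝ) × ((ℝ × ℝ) × (ℝ × ℝ)) => e q.1 q.2)
      (Continuous.aestronglyMeasurable ?_) (ae_of_all _ fun q => ?_)).congr
      (ae_of_all _ fun q => ?_)
    · simp only [he]
      fun_prop
    · exact (Complex.norm_exp_ofReal_mul_I _).le
    · simp only [Function.uncurry, Complex.coe_algebraMap]
      ring
  refine integral_ofReal.symm.trans ?_
  have h3 : ∀ ξ, (((‖FT g ξ‖ ^ 2 * gaussWeight ε ξ : ℝ)) : ℂ) =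
      ∫ z : (ℝ × ℝ) × (ℝ × ℝ), e ξ z * (g z.1 * (starRingEnd ℂ) (g z.2)) *
        ((gaussWeight ε ξ : ℝ) : ℂ) := by
    intro ξ
    rw [Complex.ofReal_mul, h1, ← integral_mul_const]
  refine (integral_congr_ae (ae_of_all _ h3)).trans ?_
  rw [integral_integral_swap hitg]
  refine integral_congr_ae (ae_of_all _ fun z => ?_)
  dsimp only
  rw [h2, ← integral_const_mul]
  refine integral_congr_ae (ae_of_all _ fun ξ => ?_)
  dsimp only
  ring

lemma ENNReal.two_mul_mul_le_sq_add_sq (a b : ℝ≥0∞) : 2 * (a * b) ≤ a ^ 2 + b ^ 2 := by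
  have key : ∀ a b : ℝ≥0∞, a ≤ b → 2 * (a * b) ≤ a ^ 2 + b ^ 2 := by
    intro a b h
    obtain ⟨c, rfl⟩ := exists_add_of_le h
    calc 2 * (a * (a + c)) ≤ 2 * (a * (a + c)) + c ^ 2 := le_self_add
      _ = a ^ 2 + (a + c) ^ 2 := by ring
  rcases le_total a b with h | h
  · exact key a b h
  · rw [mul_comm a b, add_comm]
    exact key b a h

lemma lintegral_sq_mul_gaussKernel {ε : ℝ} (hε : 0 < ε) {F : ℝ × ℝ → ℝ≥0∞}
    (hF : AEMeasurable F) :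
    ∫⁻ z : (ℝ × ℝ) × (ℝ × ℝ), F z.1 ^ 2 * ENNReal.ofReal (gaussKernel ε (z.1 - z.2)) =
      ∫⁻ x, F x ^ 2 := by
  have hm : Measurable fun z : (ℝ × ℝ) × (ℝ × ℝ) =>
      ENNReal.ofReal (gaussKernel ε (z.1 - z.2)) :=
    ((continuous_gaussKernel ε).measurable.comp (measurable_fst.sub measurable_snd)).ennreal_ofReal
  have hm2 : AEMeasurable (fun z : (ℝ × ℝ) × (ℝ × ℝ) => F z.1 ^ 2 *
      ENNReal.ofReal (gaussKernel ε (z.1 - z.2))) (volume.prod volume) := by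
    have h1 : AEMeasurable (fun z : (ℝ × ℝ) × (ℝ × ℝ) => F z.1) (volume.prod volume) := hF.comp_fst
    exact (h1.pow_const 2).mul hm.aemeasurable
  refine (lintegral_prod (μ := volume) (ν := volume) _ hm2).trans (lintegral_congr fun x => ?_)
  change ∫⁻ y, F x ^ 2 * ENNReal.ofReal (gaussKernel ε (x - y)) = F x ^ 2
  have hmx : Measurable fun y => ENNReal.ofReal (gaussKernel ε (x - y)) :=
    ((continuous_gaussKernel ε).comp (continuous_const.sub continuous_id)).measurable.ennreal_ofReal
  have h1 : ∫⁻ y, ENNReal.ofReal (gaussKernel ε (x - y)) = 1 :=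
    (lintegral_sub_left_eq_self (μ := volume)
      (fun y => ENNReal.ofReal (gaussKernel ε y)) x).trans (lintegral_gaussKernel hε)
  refine (lintegral_const_mul _ hmx).trans ?_
  rw [h1, mul_one]

lemma lintegral_FT_sq_mul_gaussWeight_le {g : ℝ × ℝ → ℂ} (hg : Integrable g) {ε : ℝ}
    (hε : 0 < ε) :
    ∫⁻ ξ, ‖FT g ξ‖ₑ ^ 2 * ENNReal.ofReal (gaussWeight ε ξ) ≤ ∫⁻ x, ‖g x‖ₑ ^ 2 := by
  have hitg : Integrable fun ξ => ‖FT g ξ‖ ^ 2 * gaussWeight ε ξ := by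
    refine (integrable_gaussWeight hε).bdd_mul (c := (∫ x, ‖g x‖) ^ 2)
      ((continuous_FT hg).norm.pow 2).aestronglyMeasurable (ae_of_all _ fun ξ => ?_)
    rw [norm_pow, norm_norm]
    gcongr
    exact norm_FT_le g ξ
  have h1 : ∫⁻ ξ, ‖FT g ξ‖ₑ ^ 2 * ENNReal.ofReal (gaussWeight ε ξ) =
      ‖((∫ ξ, ‖FT g ξ‖ ^ 2 * gaussWeight ε ξ : ℝ) : ℂ)‖ₑ := by
    have hn : ∀ ξ, 0 ≤ ‖FT g ξ‖ ^ 2 * gaussWeight ε ξ := fun ξ =>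
      mul_nonneg (by positivity) (gaussWeight_nonneg ε ξ)
    rw [← ofReal_norm, Complex.norm_real, Real.norm_of_nonneg (integral_nonneg hn),
      ofReal_integral_eq_lintegral_ofReal hitg (ae_of_all _ hn)]
    refine lintegral_congr fun ξ => ?_
    rw [ENNReal.ofReal_mul (by positivity), ENNReal.ofReal_pow (norm_nonneg _), ofReal_norm]
  rw [h1, integral_normSq_FT_mul_gaussWeight hg hε]
  refine (enorm_integral_le_lintegral_enorm _).trans ?_
  have hF : AEMeasurable fun x => ‖g x‖ₑ := hg.1.enorm
  have h2 : ∀ z : (ℝ × ℝ) × (ℝ × ℝ), 2 * ‖g z.1 * (starRingEnd ℂ) (g z.2) *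
      ((gaussKernel ε (z.1 - z.2) : ℝ) : ℂ)‖ₑ ≤
        ‖g z.1‖ₑ ^ 2 * ENNReal.ofReal (gaussKernel ε (z.1 - z.2)) +
        ‖g z.2‖ₑ ^ 2 * ENNReal.ofReal (gaussKernel ε (z.2 - z.1)) := by
    intro z
    have e1 : ‖((gaussKernel ε (z.1 - z.2) : ℝ) : ℂ)‖ₑ =
        ENNReal.ofReal (gaussKernel ε (z.1 - z.2)) := by
      rw [← ofReal_norm, Complex.norm_real, Real.norm_of_nonneg (gaussKernel_nonneg _ _)]
    have e2 : ‖(starRingEnd ℂ) (g z.2)‖ₑ = ‖g z.2‖ₑ := by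
      rw [← ofReal_norm, RCLike.norm_conj, ofReal_norm]
    rw [enorm_mul, enorm_mul, e1, e2, gaussKernel_neg ε z.2 z.1, ← add_mul, ← mul_assoc]
    exact mul_le_mul_left (ENNReal.two_mul_mul_le_sq_add_sq _ _) _
  have hswap : ∫⁻ z : (ℝ × ℝ) × (ℝ × ℝ), ‖g z.2‖ₑ ^ 2 *
      ENNReal.ofReal (gaussKernel ε (z.2 - z.1)) = ∫⁻ x, ‖g x‖ₑ ^ 2 := by
    rw [← lintegral_sq_mul_gaussKernel hε hF, Measure.volume_eq_prod, ← lintegral_prod_swap]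
    rfl
  have h3 := lintegral_mono (μ := volume) h2
  rw [lintegral_const_mul' (2 : ℝ≥0∞) _ (by simp), lintegral_add_left', hswap,
    lintegral_sq_mul_gaussKernel hε hF, ← two_mul] at h3
  · exact (ENNReal.mul_le_mul_iff_right (by simp) (by simp)).1 h3
  · rw [Measure.volume_eq_prod]
    exact (hF.comp_fst.pow_const 2).mul ((continuous_gaussKernel ε).measurable.comp
      (measurable_fst.sub measurable_snd)).ennreal_ofReal.aemeasurable

/-- Bessel's inequality for the Fourier transform on the plane. -/
theorem lintegral_FT_sq_le {g : ℝ × ℝ → ℂ} (hg : Integrable g) :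
    ∫⁻ ξ, ‖FT g ξ‖ₑ ^ 2 ≤ ∫⁻ x, ‖g x‖ₑ ^ 2 := by
  have ht : ∀ ξ, Tendsto (fun n : ℕ => ‖FT g ξ‖ₑ ^ 2 *
      ENNReal.ofReal (gaussWeight (1 / ((n : ℝ) + 1)) ξ)) atTop (𝓝 (‖FT g ξ‖ₑ ^ 2)) := by
    intro ξ
    have h0 : Tendsto (fun ε => gaussWeight ε ξ) (𝓝 0) (𝓝 (gaussWeight 0 ξ)) := by
      refine Continuous.tendsto ?_ 0
      unfold gaussWeight
      fun_prop
    have h1 : gaussWeight 0 ξ = 1 := by simp [gaussWeight]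
    rw [h1] at h0
    have h2 := ENNReal.tendsto_ofReal (h0.comp tendsto_one_div_add_atTop_nhds_zero_nat)
    rw [ENNReal.ofReal_one] at h2
    have h3 := ENNReal.Tendsto.const_mul (a := ‖FT g ξ‖ₑ ^ 2) h2 (Or.inl one_ne_zero)
    rwa [mul_one] at h3
  calc ∫⁻ ξ, ‖FT g ξ‖ₑ ^ 2 = ∫⁻ ξ, liminf (fun n : ℕ => ‖FT g ξ‖ₑ ^ 2 *
        ENNReal.ofReal (gaussWeight (1 / ((n : ℝ) + 1)) ξ)) atTop :=
        lintegral_congr fun ξ => (ht ξ).liminf_eq.symm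
    _ ≤ liminf (fun n : ℕ => ∫⁻ ξ, ‖FT g ξ‖ₑ ^ 2 *
        ENNReal.ofReal (gaussWeight (1 / ((n : ℝ) + 1)) ξ)) atTop :=
        lintegral_liminf_le fun n => ((continuous_FT hg).enorm.measurable.pow_const 2).mul
          (continuous_gaussWeight _).measurable.ennreal_ofReal
    _ ≤ liminf (fun _ : ℕ => ∫⁻ x, ‖g x‖ₑ ^ 2) atTop :=
        liminf_le_liminf (Eventually.of_forall fun n =>
          lintegral_FT_sq_mul_gaussWeight_le hg (by positivity))
    _ = ∫⁻ x, ‖g x‖ₑ ^ 2 := liminf_const _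

theorem lintegral_FTinv_sq_le {g : ℝ × ℝ → ℂ} (hg : Integrable g) :
    ∫⁻ ξ, ‖FTinv g ξ‖ₑ ^ 2 ≤ ∫⁻ x, ‖g x‖ₑ ^ 2 := by
  simp only [FTinv_eq_FT_neg]
  rw [lintegral_neg_eq_self (fun ξ => ‖FT g ξ‖ₑ ^ 2)]
  exact lintegral_FT_sq_le hg

/-- The pairing `(ξ, y) ↦ -(ξ₁y₁ + ξ₂y₂)` on the plane. -/
def negPairing : (ℝ × ℝ) →L[ℝ] (ℝ × ℝ) →L[ℝ] ℝ :=
  -((ContinuousLinearMap.mul ℝ ℝ).bilinearComp (ContinuousLinearMap.fst ℝ ℝ ℝ)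
      (ContinuousLinearMap.fst ℝ ℝ ℝ) +
    (ContinuousLinearMap.mul ℝ ℝ).bilinearComp (ContinuousLinearMap.snd ℝ ℝ ℝ)
      (ContinuousLinearMap.snd ℝ ℝ ℝ))

lemma negPairing_apply (ξ y : ℝ × ℝ) : negPairing ξ y = -(ξ.1 * y.1 + ξ.2 * y.2) := by
  simp [negPairing]

lemma FTinv_eq_fourierIntegral (a : ℝ × ℝ → ℂ) :
    FTinv a = VectorFourier.fourierIntegral Real.fourierChar volume
      negPairing.toLinearMap₁₂ a := by
  funext y
  refine integral_congr_ae (ae_of_all _ fun ξ => ?_)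
  simp only [Circle.smul_def, Real.fourierChar_apply, smul_eq_mul]
  congr 3
  rw [show negPairing.toLinearMap₁₂ ξ y = negPairing ξ y from rfl, negPairing_apply]
  push_cast
  ring

lemma exists_FTinv_decay {a : ℝ × ℝ → ℝ} (ha : ContDiff ℝ (⊤ : ℕ∞) a)
    (hs : HasCompactSupport a) :
    ∃ C : ℝ, ∀ y : ℝ × ℝ, ‖FTinv (fun ξ => ((a ξ : ℝ) : ℂ)) y‖ ≤ C ∧
      |y.1| ^ 4 * ‖FTinv (fun ξ => ((a ξ : ℝ) : ℂ)) y‖ ≤ C ∧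
      |y.2| ^ 4 * ‖FTinv (fun ξ => ((a ξ : ℝ) : ℂ)) y‖ ≤ C := by
  have hA : ContDiff ℝ (⊤ : ℕ∞) fun ξ => ((a ξ : ℝ) : ℂ) := Complex.ofRealCLM.contDiff.comp ha
  have hAs : HasCompactSupport fun ξ => ((a ξ : ℝ) : ℂ) := hs.comp_left (g := Complex.ofReal) rfl
  have hitg : ∀ k n : ℕ, (k : ℕ∞) ≤ (⊤ : ℕ∞) → (n : ℕ∞) ≤ (⊤ : ℕ∞) → Integrable
      (fun v : ℝ × ℝ => ‖v‖ ^ k * ‖iteratedFDeriv ℝ n (fun ξ => ((a ξ : ℝ) : ℂ)) v‖) volume := by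
    intro k n _ _
    refine Continuous.integrable_of_hasCompactSupport ?_ ?_
    · exact (continuous_norm.pow k).mul (hA.continuous_iteratedFDeriv (mod_cast le_top)).norm
    · exact (hAs.iteratedFDeriv n).norm.mul_left
  have key := fun (n : ℕ) (v w : ℝ × ℝ) =>
    VectorFourier.pow_mul_norm_iteratedFDeriv_fourierIntegral_le (L := negPairing)
      (μ := volume) (K := ⊤) (N := ⊤) hA hitg (k := 0) (n := n) le_top le_top v w
  simp only [norm_iteratedFDeriv_zero, ← FTinv_eq_fourierIntegral, negPairing_apply] at key
  set B : ℕ → ℝ × ℝ → ℝ := fun n v => ‖v‖ ^ n * (2 * Real.pi * ‖negPairing‖) ^ 0 *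
    (2 * ((0 : ℕ) : ℝ) + 2) ^ n * ∑ p ∈ Finset.range (0 + 1) ×ˢ Finset.range (n + 1),
      ∫ v : ℝ × ℝ, ‖v‖ ^ p.1 * ‖iteratedFDeriv ℝ p.2 (fun ξ => ((a ξ : ℝ) : ℂ)) v‖
  refine ⟨max (B 0 0) (max (B 4 (1, 0)) (B 4 (0, 1))), fun y => ⟨?_, ?_, ?_⟩⟩
  · refine le_trans ?_ (le_max_left _ _)
    refine le_trans (le_of_eq ?_) (key 0 0 y)
    rw [pow_zero, one_mul]
  · refine le_trans ?_ ((le_max_left _ _).trans (le_max_right _ _))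
    simpa only [one_mul, zero_mul, add_zero, abs_neg] using key 4 (1, 0) y
  · refine le_trans ?_ ((le_max_right _ _).trans (le_max_right _ _))
    simpa only [one_mul, zero_mul, zero_add, abs_neg] using key 4 (0, 1) y

/-- The rescaled frequency localisation `(ζ(ξ) - ζ(2ξ)) (1 - η(2^ℓ ξ)) ς(ξ₁/(c ξ₂))`. -/
def amp (c : ℝ) (η : ℝ × ℝ → ℝ) (ς : ℝ → ℝ) (ζ : ℝ × ℝ → ℝ) (l : ℕ) (ξ : ℝ × ℝ) : ℝ :=
  (ζ ξ - ζ ((2 : ℝ) • ξ)) * ((1 - η ((2 : ℝ) ^ l • ξ)) * ς (ξ.1 / (c * ξ.2)))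

lemma zl_mul_eq_amp (c : ℝ) (η : ℝ × ℝ → ℝ) (ς : ℝ → ℝ) (ζ : ℝ × ℝ → ℝ) (l : ℕ) (ξ : ℝ × ℝ) :
    zl ζ l ξ * ((1 - η ξ) * ς (ξ.1 / (c * ξ.2))) = amp c η ς ζ l (((2 : ℝ) ^ l)⁻¹ • ξ) := by
  have h2 : ((2 : ℝ) ^ l) ≠ 0 := by positivity
  rw [zl, amp, smul_smul, smul_smul, mul_inv_cancel₀ h2, one_smul, Real.rpow_sub two_pos,
    Real.rpow_neg zero_le_two, Real.rpow_natCast, Real.rpow_one, Prod.smul_fst, Prod.smul_snd,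
    smul_eq_mul, smul_eq_mul, mul_left_comm c, mul_div_mul_left _ _ (inv_ne_zero h2),
    div_eq_mul_inv 2]

lemma annulus_of_sub_ne_zero {ζ : ℝ × ℝ → ℝ}
    (hζsupp : ∀ ξ : ℝ × ℝ, (4 : ℝ) ≤ ξ.1 ^ 2 + ξ.2 ^ 2 → ζ ξ = 0)
    (hζone : ∀ ξ : ℝ × ℝ, ξ.1 ^ 2 + ξ.2 ^ 2 ≤ ((5 : ℝ) / 4) ^ 2 → ζ ξ = 1) {ξ : ℝ × ℝ}
    (h : ζ ξ - ζ ((2 : ℝ) • ξ) ≠ 0) :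
    25 / 64 < ξ.1 ^ 2 + ξ.2 ^ 2 ∧ ξ.1 ^ 2 + ξ.2 ^ 2 < 4 := by
  have e : ((2 : ℝ) • ξ).1 ^ 2 + ((2 : ℝ) • ξ).2 ^ 2 = 4 * (ξ.1 ^ 2 + ξ.2 ^ 2) := by
    simp only [Prod.smul_fst, Prod.smul_snd, smul_eq_mul]; ring
  constructor
  · by_contra! hle
    exact h (by rw [hζone ξ (by linarith), hζone _ (by rw [e]; linarith), sub_self])
  · by_contra! hle
    exact h (by rw [hζsupp ξ hle, hζsupp _ (by rw [e]; linarith), sub_self])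

lemma exists_amp_support {b c : ℝ} (hb : 1 < b) (hc : c ≠ 0) {η : ℝ × ℝ → ℝ} {ς : ℝ → ℝ}
    (hςsupp : ∀ v : ℝ, v ∉ Ioo (-(b * (4:ℝ) ^ (b-1))) (-(b * (4:ℝ)⁻¹ ^ (b-1))) → ς v = 0)
    {ζ : ℝ × ℝ → ℝ}
    (hζsupp : ∀ ξ : ℝ × ℝ, (4 : ℝ) ≤ ξ.1 ^ 2 + ξ.2 ^ 2 → ζ ξ = 0)
    (hζone : ∀ ξ : ℝ × ℝ, ξ.1 ^ 2 + ξ.2 ^ 2 ≤ ((5 : ℝ) / 4) ^ 2 → ζ ξ = 1) :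
    ∃ κ : ℝ, 0 < κ ∧ ∀ l ξ, amp c η ς ζ l ξ ≠ 0 →
      κ ≤ |ξ.1| ∧ |ξ.1| ≤ 2 ∧ κ ≤ |ξ.2| ∧ |ξ.2| ≤ 2 := by
  set V := b * (4:ℝ) ^ (b-1)
  set v₀ := b * (4:ℝ)⁻¹ ^ (b-1)
  have hV : 0 < V := by positivity
  have hv₀ : 0 < v₀ := by positivity
  have hc2 : 0 < |c| := abs_pos.2 hc
  set κ₂ := Real.sqrt (25 / 64 / (1 + V ^ 2 * c ^ 2)) with hκ₂
  have hκ₂pos : 0 < κ₂ := by positivity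
  refine ⟨min κ₂ (v₀ * |c| * κ₂), lt_min hκ₂pos (by positivity), fun l ξ h => ?_⟩
  have h1 : ζ ξ - ζ ((2 : ℝ) • ξ) ≠ 0 := left_ne_zero_of_mul h
  have h2 : ς (ξ.1 / (c * ξ.2)) ≠ 0 := right_ne_zero_of_mul (right_ne_zero_of_mul h)
  obtain ⟨h3, h4⟩ := annulus_of_sub_ne_zero hζsupp hζone h1
  have h5 : ξ.1 / (c * ξ.2) ∈ Ioo (-V) (-v₀) := by
    by_contra hn
    exact h2 (hςsupp _ hn)
  have h6 : ξ.2 ≠ 0 := by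
    intro h0
    have := h5.2
    rw [h0, mul_zero, div_zero] at this
    linarith
  set v := ξ.1 / (c * ξ.2) with hv
  have h7 : ξ.1 = v * c * ξ.2 := by
    rw [hv]; field_simp
  have h8 : v ^ 2 ≤ V ^ 2 := by nlinarith [h5.1, h5.2]
  have h9 : κ₂ ≤ |ξ.2| := by
    rw [hκ₂]
    refine Real.sqrt_le_sqrt (y := ξ.2 ^ 2) ?_ |>.trans_eq (Real.sqrt_sq_eq_abs _)
    rw [div_le_iff₀ (by positivity)]
    rw [h7] at h3
    have := mul_le_mul_of_nonneg_right h8 (show 0 ≤ c ^ 2 * ξ.2 ^ 2 by positivity)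
    nlinarith
  refine ⟨(min_le_right _ _).trans ?_, ?_, (min_le_left _ _).trans h9, ?_⟩
  · rw [h7, abs_mul, abs_mul]
    have : v₀ ≤ |v| := by rw [abs_of_neg (by linarith [h5.2])]; linarith [h5.2]
    gcongr
  · exact abs_le_of_sq_le_sq (by nlinarith [sq_nonneg ξ.2]) zero_le_two
  · exact abs_le_of_sq_le_sq (by nlinarith [sq_nonneg ξ.1]) zero_le_two

lemma contDiff_amp {c κ : ℝ} (hc : c ≠ 0) (hκ : 0 < κ) {η : ℝ × ℝ → ℝ} {ς : ℝ → ℝ}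
    {ζ : ℝ × ℝ → ℝ} {l : ℕ} (hηsm : ContDiff ℝ (⊤ : ℕ∞) η) (hςsm : ContDiff ℝ (⊤ : ℕ∞) ς)
    (hζsm : ContDiff ℝ (⊤ : ℕ∞) ζ) (hsupp : ∀ ξ, amp c η ς ζ l ξ ≠ 0 → κ ≤ |ξ.2|) :
    ContDiff ℝ (⊤ : ℕ∞) (amp c η ς ζ l) := by
  rw [contDiff_iff_contDiffAt]
  intro ξ
  by_cases h : ξ.2 = 0
  · have : amp c η ς ζ l =ᶠ[𝓝 ξ] fun _ => 0 := by
      have ho : ∀ᶠ z : ℝ × ℝ in 𝓝 ξ, |z.2| < κ :=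
        (continuous_snd.abs.tendsto ξ).eventually_lt_const (by simpa [h] using hκ)
      filter_upwards [ho] with z hz
      by_contra hne
      exact absurd (hsupp z hne) (not_le.2 hz)
    exact contDiffAt_const.congr_of_eventuallyEq this
  · have h1 : ContDiffAt ℝ (⊤ : ℕ∞) (fun z : ℝ × ℝ => ς (z.1 / (c * z.2))) ξ :=
      hςsm.contDiffAt.comp ξ (contDiffAt_fst.div (contDiffAt_const.mul contDiffAt_snd)
        (mul_ne_zero hc h))
    have h2 : ContDiff ℝ (⊤ : ℕ∞) fun z : ℝ × ℝ => η ((2 : ℝ) ^ l • z) :=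
      hηsm.comp (by fun_prop)
    have h3 : ContDiff ℝ (⊤ : ℕ∞) fun z : ℝ × ℝ => ζ ((2 : ℝ) • z) :=
      hζsm.comp (by fun_prop)
    exact (hζsm.sub h3).contDiffAt.mul ((contDiff_const.sub h2).contDiffAt.mul h1)

lemma amp_eq_of_le {c : ℝ} {η : ℝ × ℝ → ℝ} {ς : ℝ → ℝ} {ζ : ℝ × ℝ → ℝ}
    (hηsupp : ∀ ξ : ℝ × ℝ, (100:ℝ)^2 < ξ.1^2 + ξ.2^2 → η ξ = 0)
    (hζsupp : ∀ ξ : ℝ × ℝ, (4 : ℝ) ≤ ξ.1 ^ 2 + ξ.2 ^ 2 → ζ ξ = 0)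
    (hζone : ∀ ξ : ℝ × ℝ, ξ.1 ^ 2 + ξ.2 ^ 2 ≤ ((5 : ℝ) / 4) ^ 2 → ζ ξ = 1) {l : ℕ} (hl : 8 ≤ l) :
    amp c η ς ζ l = amp c η ς ζ 8 := by
  funext ξ
  by_cases h : ζ ξ - ζ ((2 : ℝ) • ξ) = 0
  · rw [amp, amp, h, zero_mul, zero_mul]
  · have h1 := (annulus_of_sub_ne_zero hζsupp hζone h).1
    have key : ∀ k : ℕ, 8 ≤ k → η ((2 : ℝ) ^ k • ξ) = 0 := by
      intro k hk
      refine hηsupp _ ?_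
      have h2 : (2 : ℝ) ^ 8 ≤ 2 ^ k := pow_le_pow_right₀ one_le_two hk
      have h3 : ((2 : ℝ) ^ 8) ^ 2 ≤ (2 ^ k) ^ 2 := by gcongr
      simp only [Prod.smul_fst, Prod.smul_snd, smul_eq_mul, mul_pow, ← mul_add]
      nlinarith
    rw [amp, amp, key l hl, key 8 le_rfl]

/-- The quantitative properties of the frequency localisations used below, uniformly in `ℓ`. -/
structure AmpBound (a : ℕ → ℝ × ℝ → ℝ) (κ C : ℝ) : Prop where
  pos : 0 < κ
  support : ∀ l ξ, a l ξ ≠ 0 → κ ≤ |ξ.1| ∧ |ξ.1| ≤ 2 ∧ κ ≤ |ξ.2| ∧ |ξ.2| ≤ 2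
  contDiff : ∀ l, ContDiff ℝ (⊤ : ℕ∞) (a l)
  le : ∀ l ξ, |a l ξ| ≤ C
  fderiv_le : ∀ l ξ, |fderiv ℝ (a l) ξ (0, 1)| ≤ C
  decay : ∀ l y, ‖FTinv (fun ξ => ((a l ξ : ℝ) : ℂ)) y‖ ≤ C ∧
    |y.1| ^ 4 * ‖FTinv (fun ξ => ((a l ξ : ℝ) : ℂ)) y‖ ≤ C ∧
    |y.2| ^ 4 * ‖FTinv (fun ξ => ((a l ξ : ℝ) : ℂ)) y‖ ≤ C

theorem exists_ampBound {b c : ℝ} (hb : 1 < b) (hc : c ≠ 0) {η : ℝ × ℝ → ℝ}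
    (hηsm : ContDiff ℝ (⊤ : ℕ∞) η)
    (hηsupp : ∀ ξ : ℝ × ℝ, (100:ℝ)^2 < ξ.1^2 + ξ.2^2 → η ξ = 0)
    {ς : ℝ → ℝ} (hςsm : ContDiff ℝ (⊤ : ℕ∞) ς)
    (hςsupp : ∀ v : ℝ, v ∉ Ioo (-(b * (4:ℝ) ^ (b-1))) (-(b * (4:ℝ)⁻¹ ^ (b-1))) → ς v = 0)
    {ζ : ℝ × ℝ → ℝ} (hζsm : ContDiff ℝ (⊤ : ℕ∞) ζ)
    (hζsupp : ∀ ξ : ℝ × ℝ, (4 : ℝ) ≤ ξ.1 ^ 2 + ξ.2 ^ 2 → ζ ξ = 0)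
    (hζone : ∀ ξ : ℝ × ℝ, ξ.1 ^ 2 + ξ.2 ^ 2 ≤ ((5 : ℝ) / 4) ^ 2 → ζ ξ = 1) :
    ∃ κ C : ℝ, AmpBound (amp c η ς ζ) κ C := by
  obtain ⟨κ, hκ, hsupp⟩ := exists_amp_support hb hc (η := η) hςsupp hζsupp hζone
  have hcd : ∀ l, ContDiff ℝ (⊤ : ℕ∞) (amp c η ς ζ l) := fun l =>
    contDiff_amp hc hκ hηsm hςsm hζsm fun ξ h => (hsupp l ξ h).2.2.1
  have hcs : ∀ l, HasCompactSupport (amp c η ς ζ l) := by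
    intro l
    refine HasCompactSupport.intro (isCompact_closedBall (0 : ℝ × ℝ) 2) fun ξ hξ => ?_
    by_contra hne
    refine hξ ?_
    rw [mem_closedBall_zero_iff, Prod.norm_def]
    exact max_le (hsupp l ξ hne).2.1 (hsupp l ξ hne).2.2.2
  have h1 : ∀ l, ∃ C, ∀ ξ, |amp c η ς ζ l ξ| ≤ C := fun l =>
    (hcs l).exists_bound_of_continuous (hcd l).continuous
  have h2 : ∀ l, ∃ C, ∀ ξ, |fderiv ℝ (amp c η ς ζ l) ξ (0, 1)| ≤ C := by
    intro l
    refine HasCompactSupport.exists_bound_of_continuous (f := fun ξ =>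
      fderiv ℝ (amp c η ς ζ l) ξ (0, 1)) ?_ ?_
    · exact (hcs l).fderiv_apply (𝕜 := ℝ) (0, 1)
    · exact ((hcd l).continuous_fderiv (by simp)).clm_apply continuous_const
  choose C₁ hC₁ using h1
  choose C₂ hC₂ using h2
  choose C₃ hC₃ using fun l => exists_FTinv_decay (hcd l) (hcs l)
  set D : ℕ → ℝ := fun l => max (C₁ l) (max (C₂ l) (C₃ l))
  have hD : ∀ l, C₁ l ≤ D l ∧ C₂ l ≤ D l ∧ C₃ l ≤ D l := fun l =>
    ⟨le_max_left _ _, (le_max_left _ _).trans (le_max_right _ _),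
      (le_max_right _ _).trans (le_max_right _ _)⟩
  have hD0 : ∀ l, 0 ≤ D l := fun l => (abs_nonneg _).trans ((hC₁ l 0).trans (hD l).1)
  set C := ∑ l ∈ Finset.range 9, D l
  have hred : ∀ l, ∃ k, D k ≤ C ∧ amp c η ς ζ l = amp c η ς ζ k := by
    intro l
    rcases lt_or_ge l 9 with h | h
    · exact ⟨l, Finset.single_le_sum (fun i _ => hD0 i) (Finset.mem_range.2 h), rfl⟩
    · exact ⟨8, Finset.single_le_sum (fun i _ => hD0 i) (Finset.mem_range.2 (by norm_num)),
        amp_eq_of_le hηsupp hζsupp hζone (by omega)⟩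
  refine ⟨κ, C, hκ, hsupp, hcd, fun l ξ => ?_, fun l ξ => ?_, fun l y => ?_⟩
  · obtain ⟨k, hk, e⟩ := hred l
    rw [e]
    exact (hC₁ k ξ).trans ((hD k).1.trans hk)
  · obtain ⟨k, hk, e⟩ := hred l
    rw [e]
    exact (hC₂ k ξ).trans ((hD k).2.1.trans hk)
  · obtain ⟨k, hk, e⟩ := hred l
    rw [e]
    have := (hD k).2.2.trans hk
    exact ⟨(hC₃ k y).1.trans this, (hC₃ k y).2.1.trans this, (hC₃ k y).2.2.trans this⟩

lemma map_diag_volume {c d : ℝ} (hc : 0 < c) (hd : 0 < d) :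
    Measure.map (fun z : ℝ × ℝ => (c * z.1, d * z.2)) volume =
      ENNReal.ofReal (c * d)⁻¹ • (volume : Measure (ℝ × ℝ)) := by
  have hm : Measurable fun z : ℝ × ℝ => (c * z.1, d * z.2) := by fun_prop
  ext s hs
  rw [Measure.map_apply hm hs, Measure.smul_apply, smul_eq_mul, ← lintegral_indicator_one hs,
    lintegral_prod_eq_mul_comp_mul (measurable_one.indicator hs) hc hd, ← mul_assoc,
    ← ENNReal.ofReal_mul (by positivity), inv_mul_cancel₀ (by positivity), ENNReal.ofReal_one,
    one_mul, ← lintegral_indicator_one (hm hs)]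
  rfl

lemma FTinv_comp_diag (g : ℝ × ℝ → ℂ) {p q : ℝ} (hp : 0 < p) (hq : 0 < q) (w : ℝ × ℝ) :
    FTinv (fun ξ => g (p * ξ.1, q * ξ.2)) w =
      (((p * q)⁻¹ : ℝ) : ℂ) * FTinv g (w.1 / p, w.2 / q) := by
  have hinj : Function.Injective fun z : ℝ × ℝ => (p * z.1, q * z.2) := by
    intro z z' h
    simp only [Prod.mk.injEq, mul_right_inj' hp.ne', mul_right_inj' hq.ne'] at h
    exact Prod.ext h.1 h.2
  have hme : MeasurableEmbedding fun z : ℝ × ℝ => (p * z.1, q * z.2) :=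
    Continuous.measurableEmbedding (by fun_prop) hinj
  have h := hme.integral_map (μ := volume) (fun ξ : ℝ × ℝ =>
    Complex.exp (((2 * Real.pi * (w.1 / p * ξ.1 + w.2 / q * ξ.2) : ℝ) : ℂ) * Complex.I) * g ξ)
  rw [map_diag_volume hp hq, integral_smul_measure,
    ENNReal.toReal_ofReal (by positivity)] at h
  rw [FTinv, FTinv, ← Complex.real_smul, h]
  refine integral_congr_ae (ae_of_all _ fun ξ => ?_)
  dsimp only
  congr 4
  field_simp

/-- The Fourier transform of the measure `χ(t) dt` on the graph of `γ`. -/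
def curveMul (γ χ : ℝ → ℝ) (ξ : ℝ × ℝ) : ℂ :=
  ∫ t : ℝ, Complex.exp (((-(2 * Real.pi * (ξ.1 * t + ξ.2 * γ t)) : ℝ) : ℂ) * Complex.I) *
    ((χ t : ℝ) : ℂ)

lemma FTinv_mul_curveMul_mul_FT {m f : ℝ × ℝ → ℂ} (hm : Integrable m) (hf : Integrable f)
    {γ χ : ℝ → ℝ} (hγ : Measurable γ) (hχ : Integrable χ) (α β : ℝ) (x : ℝ × ℝ) :
    FTinv (fun ξ => m ξ * curveMul γ χ (α * ξ.1, β * ξ.2) * FT f ξ) x =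
      ∫ q : ℝ × (ℝ × ℝ), ((χ q.1 : ℝ) : ℂ) * f q.2 *
        FTinv m (x.1 - q.2.1 - α * q.1, x.2 - q.2.2 - β * γ q.1) := by
  set e : (ℝ × ℝ) → ℝ × (ℝ × ℝ) → ℂ := fun ξ q =>
    Complex.exp (((2 * Real.pi * ((x.1 - q.2.1 - α * q.1) * ξ.1 +
      (x.2 - q.2.2 - β * γ q.1) * ξ.2) : ℝ) : ℂ) * Complex.I) with he
  have h1 : ∀ ξ, Complex.exp (((2 * Real.pi * (x.1 * ξ.1 + x.2 * ξ.2) : ℝ) : ℂ) * Complex.I) *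
      (m ξ * curveMul γ χ (α * ξ.1, β * ξ.2) * FT f ξ) =
      ∫ q : ℝ × (ℝ × ℝ), e ξ q * (m ξ * (((χ q.1 : ℝ) : ℂ) * f q.2)) := by
    intro ξ
    rw [mul_assoc (m ξ), curveMul, FT, ← integral_prod_mul, ← mul_assoc, ← integral_const_mul]
    refine integral_congr_ae (ae_of_all _ fun q => ?_)
    dsimp only [he]
    rw [mul_mul_mul_comm (Complex.exp _) (((χ q.1 : ℝ) : ℂ)), ← Complex.exp_add,
      mul_mul_mul_comm, ← Complex.exp_add]
    congr 2
    push_cast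
    ring
  have hitg : Integrable (Function.uncurry fun (ξ : ℝ × ℝ) (q : ℝ × (ℝ × ℝ)) =>
      e ξ q * (m ξ * (((χ q.1 : ℝ) : ℂ) * f q.2))) := by
    have hb := hm.mul_prod (hχ.ofReal (𝕜 := ℂ) |>.mul_prod hf)
    refine hb.bdd_mul (c := 1) (f := fun q : (ℝ × ℝ) × (ℝ × (ℝ × ℝ)) => e q.1 q.2)
      (Measurable.aestronglyMeasurable ?_) (ae_of_all _ fun q => ?_)
    · simp only [he]
      fun_prop
    · exact (Complex.norm_exp_ofReal_mul_I _).le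
  rw [FTinv, integral_congr_ae (ae_of_all _ h1), integral_integral_swap hitg]
  refine integral_congr_ae (ae_of_all _ fun q => ?_)
  dsimp only
  rw [FTinv, ← integral_const_mul]
  refine integral_congr_ae (ae_of_all _ fun ξ => ?_)
  dsimp only [he]
  ring

lemma enorm_FTinv_mul_curveMul_mul_FT_le {m f : ℝ × ℝ → ℂ} (hm : Integrable m)
    (hf : Integrable f) {γ χ : ℝ → ℝ} (hγ : Measurable γ) (hχ : Integrable χ) (α β : ℝ)
    (x : ℝ × ℝ) :
    ‖FTinv (fun ξ => m ξ * curveMul γ χ (α * ξ.1, β * ξ.2) * FT f ξ) x‖ₑ ≤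
      ∫⁻ q : ℝ × (ℝ × ℝ), ‖χ q.1‖ₑ * ‖f q.2‖ₑ *
        ‖FTinv m (x.1 - q.2.1 - α * q.1, x.2 - q.2.2 - β * γ q.1)‖ₑ := by
  rw [FTinv_mul_curveMul_mul_FT hm hf hγ hχ]
  refine (enorm_integral_le_lintegral_enorm _).trans (le_of_eq (lintegral_congr fun q => ?_))
  rw [enorm_mul, enorm_mul]
  congr 2
  rw [← ofReal_norm, Complex.norm_real, ofReal_norm]

lemma enorm_le_tsum_of_decay {z : ℂ} {C s t : ℝ} (h0 : ‖z‖ ≤ C) (h1 : |s| ^ 4 * ‖z‖ ≤ C)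
    (h2 : |t| ^ 4 * ‖z‖ ≤ C) :
    ‖z‖ₑ ≤ ∑' m : ℕ, ENNReal.ofReal (16 * C / 16 ^ m) *
      (if |s| ≤ 2 ^ m ∧ |t| ≤ 2 ^ m then 1 else 0) := by
  have hC : 0 ≤ C := (norm_nonneg z).trans h0
  have hex : ∃ m : ℕ, |s| ≤ (2:ℝ) ^ m ∧ |t| ≤ (2:ℝ) ^ m := by
    obtain ⟨m, hm⟩ := pow_unbounded_of_one_lt (max |s| |t|) one_lt_two
    exact ⟨m, (le_max_left _ _).trans hm.le, (le_max_right _ _).trans hm.le⟩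
  have hspec := Nat.find_spec hex
  set m := Nat.find hex with hm
  refine le_trans ?_ (ENNReal.le_tsum m)
  rw [if_pos hspec, mul_one, ← ofReal_norm]
  refine ENNReal.ofReal_le_ofReal ?_
  rcases Nat.eq_zero_or_pos m with h | h
  · rw [h, pow_zero, div_one]
    linarith
  · obtain ⟨k, hk⟩ : ∃ k, m = k + 1 := ⟨m - 1, by omega⟩
    have hn := Nat.find_min hex (m := k) (by omega)
    have key : ∀ r : ℝ, 2 ^ k < |r| → |r| ^ 4 * ‖z‖ ≤ C → ‖z‖ ≤ 16 * C / 16 ^ (k + 1) := by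
      intro r hr hrC
      rw [le_div_iff₀ (by positivity)]
      have h3 : ((2:ℝ) ^ k) ^ 4 ≤ |r| ^ 4 := pow_le_pow_left₀ (by positivity) hr.le 4
      rw [← pow_mul, mul_comm k 4, pow_mul] at h3
      have h4 := mul_le_mul_of_nonneg_right h3 (norm_nonneg z)
      rw [pow_succ]
      norm_num at h4
      linarith
    rw [hk]
    rcases not_and_or.1 hn with h3 | h3
    · exact key s (not_le.1 h3) h1
    · exact key t (not_le.1 h3) h2

lemma lintegral_slice_le {γ χ : ℝ → ℝ} {X Γ : ℝ}
    (hχs : ∀ t, t ∉ Ioo (1 / 2 : ℝ) 2 → χ t = 0) (hχX : ∀ t, |χ t| ≤ X)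
    (hΓ : ∀ t ∈ Icc (1 / 2 : ℝ) 2, |γ t| ≤ Γ) {α β β₀ r δ : ℝ} (hα : 0 < α) (hβ₀ : 0 < β₀)
    (hδ : δ ≤ 1) (hδr : δ ≤ r) (hβ : |β - β₀| ≤ δ * β₀) {S : Set (ℝ × ℝ)}
    (hS : ∀ t ∈ Icc (1 / 2 : ℝ) 2, ∀ z : ℝ × ℝ, |z.1 - t| ≤ r → |z.2 - γ t| ≤ (Γ + 2) * r → z ∈ S)
    (w : ℝ × ℝ) :
    ∫⁻ t, ‖χ t‖ₑ * (if |w.1 - α * t| ≤ α * r ∧ |w.2 - β * γ t| ≤ β * r then 1 else 0) ≤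
      ENNReal.ofReal (X * (2 * min r 1)) * S.indicator 1 (w.1 / α, w.2 / β₀) := by
  have hX : 0 ≤ X := (abs_nonneg _).trans (hχX 0)
  have key : ∀ t, ‖χ t‖ₑ * (if |w.1 - α * t| ≤ α * r ∧ |w.2 - β * γ t| ≤ β * r then 1 else 0) ≠ 0 →
      t ∈ Icc (1 / 2 : ℝ) 2 ∧ t ∈ Icc (w.1 / α - r) (w.1 / α + r) ∧
        (w.1 / α, w.2 / β₀) ∈ S := by
    intro t ht
    have ht1 : t ∈ Ioo (1 / 2 : ℝ) 2 := by
      by_contra h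
      exact ht (by rw [hχs t h, enorm_zero, zero_mul])
    have ht2 : |w.1 - α * t| ≤ α * r ∧ |w.2 - β * γ t| ≤ β * r := by
      by_contra h
      exact ht (by rw [if_neg h, mul_zero])
    have ht1' := Ioo_subset_Icc_self ht1
    have h1 : |w.1 / α - t| ≤ r := by
      rw [show w.1 / α - t = (w.1 - α * t) / α by field_simp, abs_div, abs_of_pos hα,
        div_le_iff₀' hα]
      exact ht2.1
    have hr : 0 ≤ r := (abs_nonneg _).trans h1
    have h2 : |w.2 / β₀ - γ t| ≤ (Γ + 2) * r := by
      rw [show w.2 / β₀ - γ t = (w.2 - β₀ * γ t) / β₀ by field_simp, abs_div, abs_of_pos hβ₀,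
        div_le_iff₀' hβ₀]
      have h3 : |(β - β₀) * γ t| ≤ δ * β₀ * Γ := by
        rw [abs_mul]
        exact mul_le_mul hβ (hΓ t ht1') (abs_nonneg _) ((abs_nonneg _).trans hβ)
      have hΓ0 : 0 ≤ Γ := (abs_nonneg _).trans (hΓ t ht1')
      have h4 : δ * β₀ * Γ ≤ r * β₀ * Γ := by gcongr
      have h5 : β ≤ 2 * β₀ := by nlinarith [(abs_le.1 hβ).2]
      have h6 : β * r ≤ 2 * β₀ * r := by gcongr
      calc |w.2 - β₀ * γ t| = |(w.2 - β * γ t) + (β - β₀) * γ t| := by ring_nf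
        _ ≤ β * r + δ * β₀ * Γ := (abs_add_le _ _).trans (add_le_add ht2.2 h3)
        _ ≤ _ := by linarith
    refine ⟨ht1', ?_, hS t ht1' _ h1 h2⟩
    have := abs_le.1 h1
    exact ⟨by linarith, by linarith⟩
  by_cases hz : (w.1 / α, w.2 / β₀) ∈ S
  · rw [indicator_of_mem hz, Pi.one_apply, mul_one]
    set I := Icc (1 / 2 : ℝ) 2 ∩ Icc (w.1 / α - r) (w.1 / α + r) with hI
    calc ∫⁻ t, ‖χ t‖ₑ * (if |w.1 - α * t| ≤ α * r ∧ |w.2 - β * γ t| ≤ β * r then 1 else 0)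
        ≤ ∫⁻ t, I.indicator (fun _ => ENNReal.ofReal X) t := by
          refine lintegral_mono fun t => ?_
          dsimp only
          by_cases h : ‖χ t‖ₑ *
            (if |w.1 - α * t| ≤ α * r ∧ |w.2 - β * γ t| ≤ β * r then (1 : ℝ≥0∞) else 0) = 0
          · rw [h]
            exact zero_le
          · rw [indicator_of_mem (show t ∈ I from ⟨(key t h).1, (key t h).2.1⟩)]
            calc _ ≤ ‖χ t‖ₑ * 1 := mul_le_mul_right (by split_ifs <;> simp) _
              _ ≤ _ := by
                rw [mul_one, ← ofReal_norm, Real.norm_eq_abs]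
                exact ENNReal.ofReal_le_ofReal (hχX t)
      _ = ENNReal.ofReal X * volume I := by
          rw [lintegral_indicator (measurableSet_Icc.inter measurableSet_Icc), setLIntegral_const]
      _ ≤ ENNReal.ofReal X * ENNReal.ofReal (2 * min r 1) := by
          refine mul_le_mul_right ?_ _
          rcases le_total r 1 with h | h
          · rw [min_eq_left h]
            refine (measure_mono inter_subset_right).trans ?_
            rw [Real.volume_Icc]
            exact ENNReal.ofReal_le_ofReal (by linarith)
          · rw [min_eq_right h]
            refine (measure_mono inter_subset_left).trans ?_
            rw [Real.volume_Icc]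
            exact ENNReal.ofReal_le_ofReal (by norm_num)
      _ = _ := (ENNReal.ofReal_mul hX).symm
  · rw [indicator_of_notMem hz, mul_zero, lintegral_eq_zero_of_ae_eq_zero]
    refine ae_of_all _ fun t => ?_
    by_contra h
    exact hz (key t h).2.2

lemma lintegral_comp_sub_div {F : ℝ × ℝ → ℝ≥0∞} (hF : Measurable F) {α β : ℝ} (hα : 0 < α)
    (hβ : 0 < β) (x : ℝ × ℝ) :
    ∫⁻ y, F y = ENNReal.ofReal (α * β) * ∫⁻ z : ℝ × ℝ, F (x.1 - α * z.1, x.2 - β * z.2) := by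
  have h1 : ∀ y : ℝ × ℝ, F (x.1 - y.1, x.2 - y.2) = F (x - y) := fun y => rfl
  rw [← lintegral_sub_left_eq_self F x, lintegral_prod_eq_mul_comp_mul (by fun_prop) hα hβ]
  rfl

lemma exists_powCurve_bounds (c : ℝ) {b : ℝ} (hb : 1 < b) :
    ∃ Γ, 0 ≤ Γ ∧ (∀ t ∈ Icc (1 / 2 : ℝ) 2, |powCurve c b t| ≤ Γ) ∧
      ∀ s ∈ Icc (1 / 4 : ℝ) 4, ∀ t ∈ Icc (1 / 4 : ℝ) 4,
        |powCurve c b s - powCurve c b t| ≤ Γ * |s - t| := by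
  have h1 : ∀ t ∈ Icc (1 / 4 : ℝ) 4,
      HasDerivWithinAt (powCurve c b) (c * (b * t ^ (b - 1))) (Icc (1 / 4 : ℝ) 4) t := by
    intro t ht
    exact ((Real.hasDerivAt_rpow_const (Or.inr hb.le)).const_mul c).hasDerivWithinAt
  have h2 : ∀ t ∈ Icc (1 / 4 : ℝ) 4, ‖c * (b * t ^ (b - 1))‖ ≤ |c| * (b * 4 ^ (b - 1)) := by
    intro t ht
    have ht0 : 0 ≤ t := by linarith [ht.1]
    rw [norm_mul, norm_mul, Real.norm_eq_abs, Real.norm_of_nonneg (by linarith : 0 ≤ b),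
      Real.norm_of_nonneg (by positivity)]
    have := Real.rpow_le_rpow ht0 ht.2 (by linarith : 0 ≤ b - 1)
    gcongr
  have hΓ : 0 ≤ |c| * (b * 4 ^ (b - 1)) := by positivity
  refine ⟨|c| * 2 ^ b + |c| * (b * 4 ^ (b - 1)), by positivity, fun t ht => ?_, fun s hs t ht => ?_⟩
  · have := abs_powCurve_le (c := c) (b := b) (by linarith) (by linarith [ht.1] : 0 ≤ t) ht.2
    linarith
  · have h := Convex.norm_image_sub_le_of_norm_hasDerivWithin_le h1 h2 (convex_Icc _ _) ht hs
    rw [Real.norm_eq_abs, Real.norm_eq_abs] at h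
    refine h.trans (mul_le_mul_of_nonneg_right ?_ (abs_nonneg _))
    have : 0 ≤ |c| * (2:ℝ) ^ b := by positivity
    linarith

lemma lintegral_thick_slice_le {γ χ : ℝ → ℝ} {X Γ : ℝ} (hγ : Measurable γ) (hχ : Measurable χ)
    (hχs : ∀ t, t ∉ Ioo (1 / 2 : ℝ) 2 → χ t = 0) (hχX : ∀ t, |χ t| ≤ X)
    (hΓ0 : 0 ≤ Γ) (hΓ : ∀ t ∈ Icc (1 / 2 : ℝ) 2, |γ t| ≤ Γ)
    (hL : ∀ s ∈ Icc (1 / 4 : ℝ) 4, ∀ t ∈ Icc (1 / 4 : ℝ) 4, |γ s - γ t| ≤ Γ * |s - t|)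
    {D : ℝ} (hD : 2 * Γ + 2 ≤ D) {α β β₀ r δ : ℝ} (hα : 0 < α) (hβ₀ : 0 < β₀) (hr : 0 < r)
    (hδ : δ ≤ 1) (hδr : δ ≤ r) (hβ : |β - β₀| ≤ δ * β₀) {g : ℝ × ℝ → ℝ≥0∞} (hg : Measurable g)
    (x : ℝ × ℝ) :
    ∫⁻ q : ℝ × (ℝ × ℝ), ‖χ q.1‖ₑ * g q.2 *
        (if |x.1 - q.2.1 - α * q.1| ≤ α * r ∧ |x.2 - q.2.2 - β * γ q.1| ≤ β * r then 1 else 0) ≤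
      ENNReal.ofReal (288 * X * D * r ^ 2 * (α * β₀)) *
        (if r ≤ 1 / 4 then thick γ (1 / 4) 4 (D * r) α β₀ g x else strongMax g x) := by
  have hX : 0 ≤ X := (abs_nonneg _).trans (hχX 0)
  have hD0 : 0 < D := by linarith
  have hmeas : Measurable fun q : ℝ × (ℝ × ℝ) =>
      (if |x.1 - q.2.1 - α * q.1| ≤ α * r ∧ |x.2 - q.2.2 - β * γ q.1| ≤ β * r
        then (1 : ℝ≥0∞) else 0) := by
    refine Measurable.ite (MeasurableSet.inter ?_ ?_) measurable_const measurable_const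
    · exact measurableSet_le (f := fun q : ℝ × (ℝ × ℝ) => |x.1 - q.2.1 - α * q.1|)
        (g := fun _ => α * r) (by fun_prop) measurable_const
    · exact measurableSet_le (f := fun q : ℝ × (ℝ × ℝ) => |x.2 - q.2.2 - β * γ q.1|)
        (g := fun _ => β * r) (by fun_prop) measurable_const
  have hF : AEMeasurable (fun q : ℝ × (ℝ × ℝ) => ‖χ q.1‖ₑ * g q.2 *
      (if |x.1 - q.2.1 - α * q.1| ≤ α * r ∧ |x.2 - q.2.2 - β * γ q.1| ≤ β * r
        then (1 : ℝ≥0∞) else 0)) (volume.prod volume) :=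
    Measurable.aemeasurable (by fun_prop)
  have main : ∀ S : Set (ℝ × ℝ), MeasurableSet S →
      (∀ t ∈ Icc (1 / 2 : ℝ) 2, ∀ z : ℝ × ℝ, |z.1 - t| ≤ r → |z.2 - γ t| ≤ (Γ + 2) * r → z ∈ S) →
      ∫⁻ q : ℝ × (ℝ × ℝ), ‖χ q.1‖ₑ * g q.2 *
        (if |x.1 - q.2.1 - α * q.1| ≤ α * r ∧ |x.2 - q.2.2 - β * γ q.1| ≤ β * r then 1 else 0) ≤
      ENNReal.ofReal (X * (2 * min r 1) * (α * β₀)) *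
        ∫⁻ z in S, g (x.1 - α * z.1, x.2 - β₀ * z.2) := by
    intro S hSm hS
    refine (lintegral_prod_symm (μ := volume) (ν := volume) _ hF).trans_le ?_
    calc ∫⁻ y : ℝ × ℝ, ∫⁻ t, ‖χ t‖ₑ * g y *
          (if |x.1 - y.1 - α * t| ≤ α * r ∧ |x.2 - y.2 - β * γ t| ≤ β * r then 1 else 0)
        ≤ ∫⁻ y : ℝ × ℝ, ENNReal.ofReal (X * (2 * min r 1)) *
            (g y * S.indicator 1 ((x.1 - y.1) / α, (x.2 - y.2) / β₀)) := by
          refine lintegral_mono fun y => ?_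
          have hsl : Measurable fun t => ‖χ t‖ₑ *
              (if |x.1 - y.1 - α * t| ≤ α * r ∧ |x.2 - y.2 - β * γ t| ≤ β * r
                then (1 : ℝ≥0∞) else 0) :=
            hχ.enorm.mul (hmeas.comp (by fun_prop : Measurable fun t : ℝ => (t, y)))
          have h := lintegral_slice_le hχs hχX hΓ hα hβ₀ hδ hδr hβ hS (x - y)
          calc _ = g y * ∫⁻ t, ‖χ t‖ₑ *
              (if |x.1 - y.1 - α * t| ≤ α * r ∧ |x.2 - y.2 - β * γ t| ≤ β * r
                then (1 : ℝ≥0∞) else 0) := by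
                rw [← lintegral_const_mul _ hsl]
                exact lintegral_congr fun t => by ring
            _ ≤ g y * (ENNReal.ofReal (X * (2 * min r 1)) *
                  S.indicator 1 ((x.1 - y.1) / α, (x.2 - y.2) / β₀)) := mul_le_mul_right h _
            _ = _ := by ring
      _ = _ := by
          have hind : Measurable fun y : ℝ × ℝ =>
              S.indicator (1 : ℝ × ℝ → ℝ≥0∞) ((x.1 - y.1) / α, (x.2 - y.2) / β₀) :=
            (measurable_one.indicator hSm).comp
              (by fun_prop : Measurable fun y : ℝ × ℝ => ((x.1 - y.1) / α, (x.2 - y.2) / β₀))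
          have hr1 : 0 ≤ min r 1 := le_min hr.le zero_le_one
          have hgm : Measurable fun y : ℝ × ℝ =>
              g y * S.indicator (1 : ℝ × ℝ → ℝ≥0∞) ((x.1 - y.1) / α, (x.2 - y.2) / β₀) :=
            hg.mul hind
          rw [lintegral_const_mul _ hgm, lintegral_comp_sub_div hgm hα hβ₀ x,
            ← mul_assoc, ← ENNReal.ofReal_mul (by positivity), ← lintegral_indicator hSm]
          refine (congrArg _ (lintegral_congr fun z => ?_))
          have e : (((x.1 - (x.1 - α * z.1)) / α, (x.2 - (x.2 - β₀ * z.2)) / β₀) : ℝ × ℝ) = z :=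
            Prod.ext (by dsimp only; field_simp; ring) (by dsimp only; field_simp; ring)
          dsimp only
          rw [e]
          by_cases hz : z ∈ S
          · rw [indicator_of_mem hz, indicator_of_mem hz, Pi.one_apply, mul_one]
          · rw [indicator_of_notMem hz, indicator_of_notMem hz, mul_zero]
  by_cases h4 : r ≤ 1 / 4
  · rw [if_pos h4]
    refine (main (thickSet γ (1 / 4) 4 (D * r)) (measurableSet_thickSet hγ _ _ _) ?_).trans ?_
    · intro t ht z h1 h2
      have h1' := abs_le.1 h1
      have hz : z.1 ∈ Icc (1 / 4 : ℝ) 4 := ⟨by linarith [ht.1], by linarith [ht.2]⟩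
      refine ⟨hz, ?_⟩
      have h3 := hL t ⟨by linarith [ht.1], by linarith [ht.2]⟩ z.1 hz
      rw [abs_sub_comm t] at h3
      calc |z.2 - γ z.1| = |(z.2 - γ t) + (γ t - γ z.1)| := by ring_nf
        _ ≤ (Γ + 2) * r + Γ * r := (abs_add_le _ _).trans
            (add_le_add h2 (h3.trans (mul_le_mul_of_nonneg_left h1 hΓ0)))
        _ = (2 * Γ + 2) * r := by ring
        _ ≤ _ := by gcongr
    · have hthick : ∫⁻ z in thickSet γ (1 / 4) 4 (D * r), g (x.1 - α * z.1, x.2 - β₀ * z.2) =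
          ENNReal.ofReal (D * r) * thick γ (1 / 4) 4 (D * r) α β₀ g x := by
        rw [thick, lintegral_const_mul _ (by fun_prop), ← mul_assoc,
          ← ENNReal.ofReal_mul (by positivity), mul_inv_cancel₀ (by positivity),
          ENNReal.ofReal_one, one_mul]
      have hr1 : 0 ≤ min r 1 := le_min hr.le zero_le_one
      rw [hthick, ← mul_assoc, ← ENNReal.ofReal_mul (by positivity)]
      refine mul_le_mul_left (ENNReal.ofReal_le_ofReal ?_) _
      calc X * (2 * min r 1) * (α * β₀) * (D * r) ≤ X * (2 * r) * (α * β₀) * (D * r) := by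
            gcongr
            exact min_le_left _ _
        _ = 2 * (X * D * r ^ 2 * (α * β₀)) := by ring
        _ ≤ 288 * (X * D * r ^ 2 * (α * β₀)) := by
            refine mul_le_mul_of_nonneg_right (by norm_num) (by positivity)
        _ = _ := by ring
  · rw [if_neg h4]
    refine (main (Icc (-(9 * r)) (9 * r) ×ˢ Icc (-(4 * D * r)) (4 * D * r))
      (measurableSet_Icc.prod measurableSet_Icc) ?_).trans ?_
    · intro t ht z h1 h2
      have h4' := not_le.1 h4
      have h1' := abs_le.1 h1
      have h2' := abs_le.1 h2
      have h3 := abs_le.1 (hΓ t ht)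
      have h5 : Γ ≤ 4 * Γ * r := by nlinarith
      have h6 : (5 * Γ + 2) * r ≤ 4 * D * r := by
        refine mul_le_mul_of_nonneg_right ?_ hr.le
        linarith
      exact ⟨⟨by linarith [ht.1], by linarith [ht.2]⟩, ⟨by linarith, by linarith⟩⟩
    · refine (mul_le_mul_right (lintegral_box_le_strongMax g hg x α β₀ (9 * r) (4 * D * r) hα hβ₀
        (by positivity) (by positivity)) _).trans ?_
      have hr1 : 0 ≤ min r 1 := le_min hr.le zero_le_one
      rw [← mul_assoc, ← ENNReal.ofReal_mul (by positivity)]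
      refine mul_le_mul_left (ENNReal.ofReal_le_ofReal ?_) _
      calc X * (2 * min r 1) * (α * β₀) * (4 * (9 * r) * (4 * D * r))
          ≤ X * (2 * 1) * (α * β₀) * (4 * (9 * r) * (4 * D * r)) := by
            gcongr
            exact min_le_right _ _
        _ = _ := by ring

/-- The cutoff of the dyadic frequency shell, as a complex function of dilated frequencies. -/
def shell (a : ℕ → ℝ × ℝ → ℝ) (l : ℕ) (α β : ℝ) (ξ : ℝ × ℝ) : ℂ :=
  ((a l (((2:ℝ) ^ l)⁻¹ * α * ξ.1, ((2:ℝ) ^ l)⁻¹ * β * ξ.2) : ℝ) : ℂ)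

lemma AmpBound.continuous_shell {a : ℕ → ℝ × ℝ → ℝ} {κ C : ℝ} (ha : AmpBound a κ C) (l : ℕ)
    (α β : ℝ) : Continuous (shell a l α β) := by
  have h := (ha.contDiff l).continuous
  unfold shell
  fun_prop

lemma AmpBound.integrable_shell {a : ℕ → ℝ × ℝ → ℝ} {κ C : ℝ} (ha : AmpBound a κ C) (l : ℕ)
    {α β : ℝ} (hα : 0 < α) (hβ : 0 < β) : Integrable (shell a l α β) := by
  refine (ha.continuous_shell l α β).integrable_of_hasCompactSupport
    (HasCompactSupport.intro (K := Icc (-(2 * 2 ^ l / α)) (2 * 2 ^ l / α) ×ˢ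
      Icc (-(2 * 2 ^ l / β)) (2 * 2 ^ l / β)) (isCompact_Icc.prod isCompact_Icc) fun ξ hξ => ?_)
  by_contra h
  have hne : a l (((2:ℝ) ^ l)⁻¹ * α * ξ.1, ((2:ℝ) ^ l)⁻¹ * β * ξ.2) ≠ 0 := fun h0 =>
    h (by rw [shell, h0, Complex.ofReal_zero])
  obtain ⟨-, h1, -, h2⟩ := ha.support l _ hne
  have key : ∀ {γ t : ℝ}, 0 < γ → |((2:ℝ) ^ l)⁻¹ * γ * t| ≤ 2 →
      t ∈ Icc (-(2 * 2 ^ l / γ)) (2 * 2 ^ l / γ) := by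
    intro γ t hγ ht
    refine abs_le.1 ?_
    rw [abs_mul, abs_of_pos (by positivity)] at ht
    rw [le_div_iff₀ hγ]
    calc |t| * γ = 2 ^ l * (((2:ℝ) ^ l)⁻¹ * γ * |t|) := by field_simp
      _ ≤ 2 ^ l * 2 := by gcongr
      _ = _ := mul_comm _ _
  exact hξ ⟨key hα h1, key hβ h2⟩

lemma AmpBound.enorm_FTinv_shell_le {a : ℕ → ℝ × ℝ → ℝ} {κ C : ℝ} (ha : AmpBound a κ C) (l : ℕ)
    {α β : ℝ} (hα : 0 < α) (hβ : 0 < β) (w : ℝ × ℝ) :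
    ‖FTinv (shell a l α β) w‖ₑ ≤ ∑' m : ℕ, ENNReal.ofReal (4 ^ l / (α * β) * (16 * C / 16 ^ m)) *
      (if |w.1| ≤ α * (2 ^ m / 2 ^ l) ∧ |w.2| ≤ β * (2 ^ m / 2 ^ l) then 1 else 0) := by
  have h := FTinv_comp_diag (fun ξ => ((a l ξ : ℝ) : ℂ)) (p := ((2:ℝ) ^ l)⁻¹ * α)
    (q := ((2:ℝ) ^ l)⁻¹ * β) (by positivity) (by positivity) w
  have hpq : (((2:ℝ) ^ l)⁻¹ * α * (((2:ℝ) ^ l)⁻¹ * β))⁻¹ = 4 ^ l / (α * β) := by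
    rw [show (4:ℝ) = 2 * 2 by norm_num, mul_pow]
    field_simp
  rw [hpq] at h
  have hd := ha.decay l (w.1 / (((2:ℝ) ^ l)⁻¹ * α), w.2 / (((2:ℝ) ^ l)⁻¹ * β))
  have h2 := enorm_le_tsum_of_decay hd.1 hd.2.1 hd.2.2
  change ‖FTinv (fun ξ : ℝ × ℝ => ((a l (((2:ℝ) ^ l)⁻¹ * α * ξ.1, ((2:ℝ) ^ l)⁻¹ * β * ξ.2) : ℝ) : ℂ)) w‖ₑ ≤ _
  rw [h, enorm_mul, ← ofReal_norm (((4 ^ l / (α * β) : ℝ)) : ℂ), Complex.norm_real,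
    Real.norm_of_nonneg (by positivity)]
  refine (mul_le_mul_right h2 _).trans (le_of_eq ?_)
  rw [← ENNReal.tsum_mul_left]
  refine tsum_congr fun m => ?_
  rw [← mul_assoc, ← ENNReal.ofReal_mul (by positivity)]
  have key : ∀ {γ t : ℝ}, 0 < γ → (|t / (((2:ℝ) ^ l)⁻¹ * γ)| ≤ 2 ^ m ↔ |t| ≤ γ * (2 ^ m / 2 ^ l)) := by
    intro γ t hγ
    rw [abs_div, abs_of_pos (show 0 < ((2:ℝ) ^ l)⁻¹ * γ by positivity), div_le_iff₀ (by positivity)]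
    rw [show (2:ℝ) ^ m * (((2:ℝ) ^ l)⁻¹ * γ) = γ * (2 ^ m / 2 ^ l) by ring]
  simp only [key hα, key hβ]

theorem AmpBound.exists_kernel_bound {a : ℕ → ℝ × ℝ → ℝ} {κ C : ℝ} (ha : AmpBound a κ C) (c : ℝ)
    {b : ℝ} (hb : 1 < b) {χ : ℝ → ℝ} {X : ℝ} (hχ : Measurable χ)
    (hχs : ∀ t, t ∉ Ioo (1 / 2 : ℝ) 2 → χ t = 0) (hχX : ∀ t, |χ t| ≤ X) :
    ∃ D A : ℝ, 2 ^ b ≤ D ∧ 0 ≤ A ∧ ∀ l : ℕ, 1 ≤ l → ∀ α β β₀ : ℝ, 0 < α → 0 < β₀ →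
      |β - β₀| ≤ ((2:ℝ) ^ l)⁻¹ * β₀ → ∀ f : ℝ × ℝ → ℂ, Measurable f → Integrable f → ∀ x,
      ‖FTinv (fun ξ => shell a l α β ξ * curveMul (powCurve c b) χ (α * ξ.1, β * ξ.2) * FT f ξ) x‖ₑ ≤
        ∑' m : ℕ, ENNReal.ofReal (A / 4 ^ m) * (if (2:ℝ) ^ m / 2 ^ l ≤ 1 / 4
          then thick (powCurve c b) (1 / 4) 4 (D * (2 ^ m / 2 ^ l)) α β₀ (fun y => ‖f y‖ₑ) x
          else strongMax (fun y => ‖f y‖ₑ) x) := by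
  obtain ⟨Γ, hΓ0, hΓ, hL⟩ := exists_powCurve_bounds c hb
  have hX : 0 ≤ X := (abs_nonneg _).trans (hχX 0)
  have hC : 0 ≤ C := (abs_nonneg _).trans (ha.le 0 0)
  have hγ := measurable_powCurve c b
  set D : ℝ := 2 ^ b + (2 * Γ + 2) with hD
  have h2b : (0:ℝ) < 2 ^ b := by positivity
  have hD0 : 0 < D := by positivity
  refine ⟨D, 9216 * (C * X * D), by linarith, by positivity, ?_⟩
  intro l hl α β β₀ hα hβ₀ hβ f hfm hf x
  have hl2 : ((2:ℝ) ^ l)⁻¹ ≤ 1 / 2 := by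
    rw [one_div]
    refine inv_anti₀ two_pos ?_
    calc (2:ℝ) = 2 ^ 1 := (pow_one _).symm
      _ ≤ 2 ^ l := pow_le_pow_right₀ one_le_two hl
  have hββ : β₀ ≤ 2 * β := by nlinarith [(abs_le.1 hβ).1]
  have hβ0 : 0 < β := by linarith
  have hχi : Integrable χ := by
    refine Measure.integrableOn_of_bounded (s := Ioo (1 / 2 : ℝ) 2) (M := X) (by simp)
      hχ.aestronglyMeasurable (ae_of_all _ hχX) |>.integrable_of_forall_notMem_eq_zero hχs
  refine (enorm_FTinv_mul_curveMul_mul_FT_le (ha.integrable_shell l hα hβ0) hf hγ hχi α β x).trans ?_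
  calc _ ≤ ∫⁻ q : ℝ × (ℝ × ℝ), ∑' m : ℕ, ENNReal.ofReal (4 ^ l / (α * β) * (16 * C / 16 ^ m)) *
        (‖χ q.1‖ₑ * ‖f q.2‖ₑ * (if |x.1 - q.2.1 - α * q.1| ≤ α * (2 ^ m / 2 ^ l) ∧
          |x.2 - q.2.2 - β * powCurve c b q.1| ≤ β * (2 ^ m / 2 ^ l) then 1 else 0)) := by
        refine lintegral_mono fun q => ?_
        dsimp only
        refine (mul_le_mul_right (ha.enorm_FTinv_shell_le l hα hβ0 _) _).trans (le_of_eq ?_)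
        rw [← ENNReal.tsum_mul_left]
        exact tsum_congr fun m => by ring
    _ = ∑' m : ℕ, ENNReal.ofReal (4 ^ l / (α * β) * (16 * C / 16 ^ m)) *
        ∫⁻ q : ℝ × (ℝ × ℝ), (‖χ q.1‖ₑ * ‖f q.2‖ₑ *
          (if |x.1 - q.2.1 - α * q.1| ≤ α * (2 ^ m / 2 ^ l) ∧
          |x.2 - q.2.2 - β * powCurve c b q.1| ≤ β * (2 ^ m / 2 ^ l) then 1 else 0)) := by
        have hmeas : ∀ m : ℕ, Measurable fun q : ℝ × (ℝ × ℝ) => ‖χ q.1‖ₑ * ‖f q.2‖ₑ *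
            (if |x.1 - q.2.1 - α * q.1| ≤ α * (2 ^ m / 2 ^ l) ∧
              |x.2 - q.2.2 - β * powCurve c b q.1| ≤ β * (2 ^ m / 2 ^ l) then (1 : ℝ≥0∞) else 0) := by
          intro m
          refine Measurable.mul (by fun_prop) ?_
          refine Measurable.ite (MeasurableSet.inter ?_ ?_) measurable_const measurable_const
          · exact measurableSet_le (f := fun q : ℝ × (ℝ × ℝ) => |x.1 - q.2.1 - α * q.1|)
              (g := fun _ => α * (2 ^ m / 2 ^ l)) (by fun_prop) measurable_const
          · exact measurableSet_le (f := fun q : ℝ × (ℝ × ℝ) => |x.2 - q.2.2 - β * powCurve c b q.1|)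
              (g := fun _ => β * (2 ^ m / 2 ^ l)) (by fun_prop) measurable_const
        rw [lintegral_tsum fun m => ((hmeas m).const_mul _).aemeasurable]
        exact tsum_congr fun m => lintegral_const_mul _ (hmeas m)
    _ ≤ _ := by
        refine ENNReal.tsum_le_tsum fun m => ?_
        have hm1 : (1:ℝ) ≤ 2 ^ m := one_le_pow₀ one_le_two
        refine (mul_le_mul_right (lintegral_thick_slice_le hγ hχ hχs hχX hΓ0 hΓ hL (D := D)
          (by linarith) (r := 2 ^ m / 2 ^ l) (δ := ((2:ℝ) ^ l)⁻¹) hα hβ₀ (by positivity)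
          (by linarith) ?_ hβ hfm.enorm x) _).trans ?_
        · rw [inv_eq_one_div]
          gcongr
        · rw [← mul_assoc, ← ENNReal.ofReal_mul (by positivity)]
          refine mul_le_mul_left (ENNReal.ofReal_le_ofReal ?_) _
          have e4 : ((2:ℝ) ^ m / 2 ^ l) ^ 2 = 4 ^ m / 4 ^ l := by
            rw [div_pow, ← pow_mul, ← pow_mul, mul_comm m, mul_comm l, pow_mul, pow_mul]
            norm_num
          have e16 : (16:ℝ) ^ m = 4 ^ m * 4 ^ m := by
            rw [← mul_pow]
            norm_num
          rw [e4, e16]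
          have e : 4 ^ l / (α * β) * (16 * C / (4 ^ m * 4 ^ m)) *
              (288 * X * D * (4 ^ m / 4 ^ l) * (α * β₀)) = 4608 * (C * X * D) / 4 ^ m * (β₀ / β) := by
            field_simp
            ring
          rw [e]
          calc _ ≤ 4608 * (C * X * D) / 4 ^ m * 2 := by
                refine mul_le_mul_of_nonneg_left ?_ (by positivity)
                rw [div_le_iff₀ hβ0]
                exact hββ
            _ = _ := by ring

lemma exists_cover_Icc_one_two {A : Set ℝ} (hA : A ⊆ Icc 1 2) {δ : ℝ} (hδ : 0 < δ) :
    ∃ F : Finset ℝ, F.card ≤ ⌊δ⁻¹⌋₊ + 1 ∧ A ⊆ ⋃ a ∈ F, Icc a (a + δ) := by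
  refine ⟨(Finset.range (⌊δ⁻¹⌋₊ + 1)).image fun k : ℕ => 1 + k * δ,
    Finset.card_image_le.trans (Finset.card_range _).le, fun t ht => ?_⟩
  have ht1 := hA ht
  have h0 : 0 ≤ (t - 1) / δ := div_nonneg (by linarith [ht1.1]) hδ.le
  have hle : (t - 1) / δ ≤ δ⁻¹ := by
    rw [div_le_iff₀ hδ, inv_mul_cancel₀ hδ.ne']
    linarith [ht1.2]
  simp only [Finset.mem_image, Finset.mem_range, iUnion_exists, biUnion_and', iUnion_iUnion_eq_right,
    mem_iUnion]
  refine ⟨⌊(t - 1) / δ⌋₊, Nat.lt_succ_of_le (Nat.floor_le_floor hle), ?_⟩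
  have h1 := Nat.floor_le h0
  have h2 := Nat.lt_floor_add_one ((t - 1) / δ)
  rw [le_div_iff₀ hδ] at h1
  rw [div_lt_iff₀ hδ] at h2
  exact ⟨by linarith, by linarith⟩

lemma covN_le {A : Set ℝ} (hA : A ⊆ Icc 1 2) {δ : ℝ} (hδ : 0 < δ) :
    covN A δ ≤ ⌊δ⁻¹⌋₊ + 1 := by
  obtain ⟨F, hF, hcov⟩ := exists_cover_Icc_one_two hA hδ
  refine le_trans ?_ hF
  unfold covN
  exact Nat.sInf_le ⟨F, rfl, hcov⟩

lemma exists_cover_card_eq_covN {A : Set ℝ} (hA : A ⊆ Icc 1 2) {δ : ℝ} (hδ : 0 < δ) :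
    ∃ F : Finset ℝ, F.card = covN A δ ∧ A ⊆ ⋃ a ∈ F, Icc a (a + δ) := by
  obtain ⟨F, -, hcov⟩ := exists_cover_Icc_one_two hA hδ
  have hne : {n : ℕ | ∃ F : Finset ℝ, F.card = n ∧ A ⊆ ⋃ a ∈ F, Icc a (a + δ)}.Nonempty :=
    ⟨F.card, F, rfl, hcov⟩
  exact Nat.sInf_mem hne

lemma UrSet_subset (U : Set ℝ) (r : ℝ) : UrSet U r ⊆ Icc 1 2 := fun _ h => h.1

lemma exists_lacunary_net {U : Set ℝ} (hU : U ⊆ Ioi (0:ℝ)) {δ : ℝ} (hδ : 0 < δ) {N : ℕ}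
    (hN : ∀ r : ℝ, 0 < r → covN (UrSet U r) δ ≤ N) :
    ∃ w : Fin N × Bool → ℤ → ℝ, (∀ i, Lacunary (w i)) ∧
      ∀ u ∈ U, ∃ i n, |u - w i n| ≤ δ * w i n := by
  have hs : ∀ n : ℤ, ∃ s : Fin N → ℝ, (∀ i, s i ∈ Icc (1:ℝ) 2) ∧
      ∀ ρ ∈ UrSet U ((2:ℝ) ^ n), ∃ i, |ρ - s i| ≤ δ * s i := by
    intro n
    obtain ⟨F, hF, hcov⟩ := exists_cover_card_eq_covN (UrSet_subset U ((2:ℝ) ^ n)) hδ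
    have hcard : F.card ≤ N := hF.trans_le (hN _ (by positivity))
    have hemb : ∃ e : F → Fin N, Function.Injective e :=
      ⟨fun a => Fin.castLE hcard (F.equivFin a), fun a a' h =>
        F.equivFin.injective (Fin.castLE_injective hcard h)⟩
    obtain ⟨e, he⟩ := hemb
    refine ⟨fun i => if h : ∃ a : F, e a = i then min (max (h.choose : ℝ) 1) 2 else 1,
      fun i => ?_, fun ρ hρ => ?_⟩
    · dsimp only
      split_ifs with h
      · exact ⟨le_min (le_max_right _ _) one_le_two, min_le_right _ _⟩
      · exact ⟨le_rfl, one_le_two⟩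
    · have h1 := hcov hρ
      simp only [mem_iUnion] at h1
      obtain ⟨a, haF, ha⟩ := h1
      refine ⟨e ⟨a, haF⟩, ?_⟩
      have hex : ∃ a' : F, e a' = e ⟨a, haF⟩ := ⟨_, rfl⟩
      have hch : hex.choose = ⟨a, haF⟩ := he hex.choose_spec
      dsimp only
      rw [dif_pos hex, hch]
      dsimp only
      have hρ1 := hρ.1
      have hm : max a 1 ≤ ρ := max_le ha.1 hρ1.1
      rw [min_eq_left (hm.trans hρ1.2), abs_of_nonneg (by linarith)]
      have := le_max_left a 1
      have := le_max_right a 1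
      nlinarith [ha.2]
  choose s hs1 hs2 using hs
  refine ⟨fun i n => (2:ℝ) ^ (2 * n + (if i.2 then 1 else 0)) *
    s (2 * n + (if i.2 then 1 else 0)) i.1, fun i => ⟨fun n => ?_, fun n => ?_⟩, fun u hu => ?_⟩
  · have := (hs1 (2 * n + (if i.2 then 1 else 0)) i.1).1
    positivity
  · dsimp only
    generalize (if i.2 then (1:ℤ) else 0) = e
    have h1 := (hs1 (2 * n + e) i.1).2
    have h2 := (hs1 (2 * (n + 1) + e) i.1).1
    rw [show 2 * (n + 1) + e = (2 * n + e) + 2 by ring] at h2 ⊢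
    rw [zpow_add₀ two_ne_zero (2 * n + e) 2]
    have h3 : (0:ℝ) < 2 ^ (2 * n + e) := by positivity
    generalize (2:ℝ) ^ (2 * n + e) = r at h3 ⊢
    rw [zpow_ofNat]
    nlinarith
  · have hu0 : 0 < u := hU hu
    obtain ⟨n, hn1, hn2⟩ := exists_mem_Ico_zpow hu0 one_lt_two
    have h2n : (0:ℝ) < 2 ^ n := by positivity
    have hρ : u / 2 ^ n ∈ UrSet U ((2:ℝ) ^ n) := by
      refine ⟨⟨(one_le_div h2n).2 hn1, (div_le_iff₀ h2n).2 ?_⟩, ?_⟩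
      · rw [zpow_add_one₀ two_ne_zero] at hn2
        linarith
      · rwa [mul_div_cancel₀ _ h2n.ne']
    obtain ⟨i, hi⟩ := hs2 n _ hρ
    have hfin : |u - 2 ^ n * s n i| ≤ δ * (2 ^ n * s n i) := by
      rw [show u - 2 ^ n * s n i = 2 ^ n * (u / 2 ^ n - s n i) by field_simp, abs_mul,
        abs_of_pos h2n]
      calc _ ≤ 2 ^ n * (δ * s n i) := by gcongr
        _ = _ := by ring
    rcases Int.even_or_odd' n with ⟨k, hk | hk⟩
    · refine ⟨(i, false), k, ?_⟩
      simpa [← hk] using hfin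
    · refine ⟨(i, true), k, ?_⟩
      simpa [← hk] using hfin

/-- The frequency-localized averaging operator along the dilated curve. -/
def curveOp (a : ℕ → ℝ × ℝ → ℝ) (c b : ℝ) (χ : ℝ → ℝ) (l : ℕ) (j : ℤ) (u : ℝ) (f : ℝ × ℝ → ℂ) :
    ℝ × ℝ → ℂ :=
  FTinv fun ξ => shell a l (2 ^ j) (u * ((2:ℝ) ^ j) ^ b) ξ *
    curveMul (powCurve c b) χ ((2:ℝ) ^ j * ξ.1, u * ((2:ℝ) ^ j) ^ b * ξ.2) * FT f ξ

/-- The maximal function of the operators `curveOp`. -/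
def curveMax (a : ℕ → ℝ × ℝ → ℝ) (c b : ℝ) (χ : ℝ → ℝ) (l : ℕ) (U : Set ℝ) (f : ℝ × ℝ → ℂ)
    (x : ℝ × ℝ) : ℝ≥0∞ :=
  ⨆ (u : U) (j : ℤ), ‖curveOp a c b χ l j u f x‖ₑ

lemma tsum_ofReal_inv_two_pow : ∑' m : ℕ, ENNReal.ofReal (1 / 2 ^ m) = 2 := by
  have h : ∀ m : ℕ, ENNReal.ofReal (1 / 2 ^ m) = 2⁻¹ ^ m := by
    intro m
    rw [one_div, ← inv_pow, ENNReal.ofReal_pow (by positivity), ENNReal.ofReal_inv_of_pos two_pos]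
    simp
  simp_rw [h]
  exact ENNReal.tsum_geometric_two

lemma tsum_ofReal_div_four_pow_mul_rpow_le {A p : ℝ} (hA : 0 ≤ A) (hp : 1 ≤ p) (hp2 : p ≤ 2)
    (T : ℕ → ℝ≥0∞) :
    (∑' m : ℕ, ENNReal.ofReal (A / 4 ^ m) * T m) ^ p ≤
      ENNReal.ofReal ((2 * A + 1) ^ 2) * ∑' m : ℕ, ENNReal.ofReal (1 / 2 ^ m) * T m ^ p := by
  set S : ℝ≥0∞ := ⨆ m : ℕ, ENNReal.ofReal (1 / 2 ^ m) * T m with hS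
  have h1 : ∑' m : ℕ, ENNReal.ofReal (A / 4 ^ m) * T m ≤ ENNReal.ofReal (2 * A + 1) * S := by
    calc ∑' m : ℕ, ENNReal.ofReal (A / 4 ^ m) * T m
        ≤ ∑' m : ℕ, ENNReal.ofReal A * (ENNReal.ofReal (1 / 2 ^ m) * S) := by
          refine ENNReal.tsum_le_tsum fun m => ?_
          have e : A / 4 ^ m = A * (1 / 2 ^ m) * (1 / 2 ^ m) := by
            rw [show (4:ℝ) = 2 * 2 by norm_num, mul_pow]
            field_simp
          rw [e, ENNReal.ofReal_mul (by positivity), ENNReal.ofReal_mul hA, mul_assoc, mul_assoc]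
          exact mul_le_mul_right (mul_le_mul_right (le_iSup
            (fun m : ℕ => ENNReal.ofReal (1 / 2 ^ m) * T m) m) _) _
      _ = ENNReal.ofReal (2 * A) * S := by
          rw [ENNReal.tsum_mul_left, ENNReal.tsum_mul_right, tsum_ofReal_inv_two_pow,
            ENNReal.ofReal_mul two_pos.le, ENNReal.ofReal_ofNat]
          ring
      _ ≤ _ := mul_le_mul_left (ENNReal.ofReal_le_ofReal (by linarith)) _
  refine (ENNReal.rpow_le_rpow h1 (by linarith)).trans ?_
  rw [ENNReal.mul_rpow_of_nonneg _ _ (by linarith)]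
  refine mul_le_mul' (rpow_le_sq_of_one_le (by linarith) hp2) ?_
  have hmono := (ENNReal.orderIsoRpow p (by linarith)).map_iSup
    (fun m : ℕ => ENNReal.ofReal (1 / 2 ^ m) * T m)
  simp only [ENNReal.orderIsoRpow_apply] at hmono
  rw [hS, hmono]
  refine iSup_le fun m => le_trans ?_ (ENNReal.le_tsum m)
  rw [ENNReal.mul_rpow_of_nonneg _ _ (by linarith)]
  refine mul_le_mul_left ?_ _
  have hle : ENNReal.ofReal (1 / 2 ^ m) ≤ 1 := by
    rw [ENNReal.ofReal_le_one, div_le_one (by positivity)]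
    exact one_le_pow₀ one_le_two
  exact ENNReal.rpow_le_self_of_le_one hle hp

theorem AmpBound.lintegral_curveMax_rpow_le {a : ℕ → ℝ × ℝ → ℝ} {κ C : ℝ} (ha : AmpBound a κ C)
    (c : ℝ) {b : ℝ} (hb : 1 < b) {χ : ℝ → ℝ} {X : ℝ} (hχ : Measurable χ)
    (hχs : ∀ t, t ∉ Ioo (1 / 2 : ℝ) 2 → χ t = 0) (hχX : ∀ t, |χ t| ≤ X) :
    ∃ A : ℝ, 0 ≤ A ∧ ∀ l : ℕ, 1 ≤ l → ∀ p : ℝ, 1 < p → p ≤ 2 → ∀ B, ThickBound c b l p B →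
      ∀ U : Set ℝ, U ⊆ Ioi (0:ℝ) → ∀ N : ℕ,
      (∀ r : ℝ, 0 < r → covN (UrSet U r) ((2:ℝ) ^ l)⁻¹ ≤ N) →
      ∀ f : ℝ × ℝ → ℂ, Measurable f → Integrable f →
      ∫⁻ x, curveMax a c b χ l U f x ^ p ≤
        ENNReal.ofReal A * N * (64 * B + (160 / ENNReal.ofReal (p - 1)) ^ 2) *
          ∫⁻ x, ‖f x‖ₑ ^ p := by
  obtain ⟨D, A, hD, hA, hker⟩ := ha.exists_kernel_bound c hb hχ hχs hχX
  refine ⟨4 * (2 * A + 1) ^ 2, by positivity, ?_⟩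
  intro l hl p hp hp2 B hB U hU N hN f hfm hf
  obtain ⟨w, hw, hwU⟩ := exists_lacunary_net hU (by positivity) hN
  set g : ℝ × ℝ → ℝ≥0∞ := fun y => ‖f y‖ₑ with hg
  have hgm : Measurable g := hfm.enorm
  set T : Fin N × Bool → ℕ → ℝ × ℝ → ℝ≥0∞ := fun i m x =>
    if (2:ℝ) ^ m / 2 ^ l ≤ 1 / 4 then thickMax c b (1 / 4) 4 (D * (2 ^ m / 2 ^ l)) (w i) g x
    else strongMax g x with hT
  have hTm : ∀ i m, Measurable (T i m) := by
    intro i m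
    by_cases h : (2:ℝ) ^ m / 2 ^ l ≤ 1 / 4
    · simp only [hT, if_pos h]
      exact measurable_thickMax _ _ _ _ _ _ hgm
    · simp only [hT, if_neg h]
      exact measurable_strongMax hgm
  have hTp : ∀ i m, ∫⁻ x, T i m x ^ p ≤
      (64 * B + (160 / ENNReal.ofReal (p - 1)) ^ 2) * ∫⁻ x, g x ^ p := by
    intro i m
    rw [add_mul]
    by_cases h : (2:ℝ) ^ m / 2 ^ l ≤ 1 / 4
    · simp only [hT, if_pos h]
      refine le_add_right (hB.wide hp.le hp2 (by linarith) (hw i) ?_ hgm)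
      rw [inv_pow, inv_eq_one_div]
      have : (1:ℝ) ≤ 2 ^ m := one_le_pow₀ one_le_two
      have hD0 : 0 ≤ D := le_trans (by positivity) hD
      gcongr
    · simp only [hT, if_neg h]
      exact le_add_left (lintegral_strongMax_rpow_le g hgm p hp hp2)
  have hpt : ∀ x, curveMax a c b χ l U f x ^ p ≤ ENNReal.ofReal ((2 * A + 1) ^ 2) *
      ∑ i : Fin N × Bool, ∑' m : ℕ, ENNReal.ofReal (1 / 2 ^ m) * T i m x ^ p := by
    intro x
    have hrp : curveMax a c b χ l U f x ^ p =
        ⨆ (u : U) (j : ℤ), ‖curveOp a c b χ l j u f x‖ₑ ^ p := by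
      have h1 : ∀ {ι : Type} (F : ι → ℝ≥0∞), (⨆ i, F i) ^ p = ⨆ i, F i ^ p := fun F =>
        (ENNReal.orderIsoRpow p (by linarith)).map_iSup F
      simp only [curveMax, h1]
    rw [hrp]
    refine iSup₂_le fun u j => ?_
    obtain ⟨i, n, hin⟩ := hwU u u.2
    have hpow : (0:ℝ) < ((2:ℝ) ^ j) ^ b := by positivity
    have hk := hker l hl ((2:ℝ) ^ j) (u * ((2:ℝ) ^ j) ^ b) (w i n * ((2:ℝ) ^ j) ^ b)
      (by positivity) (mul_pos ((hw i).pos n) hpow) (by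
        rw [← sub_mul, abs_mul, abs_of_pos hpow, ← mul_assoc]
        exact mul_le_mul_of_nonneg_right hin hpow.le) f hfm hf x
    have hle : ‖curveOp a c b χ l j u f x‖ₑ ≤ ∑' m : ℕ, ENNReal.ofReal (A / 4 ^ m) * T i m x := by
      refine hk.trans (ENNReal.tsum_le_tsum fun m => mul_le_mul_right ?_ _)
      simp only [hT]
      split_ifs
      · exact thick_le_thickMax _ _ _ _ _ _ _ _ _ _
      · exact le_rfl
    refine (ENNReal.rpow_le_rpow hle (by linarith)).trans
      ((tsum_ofReal_div_four_pow_mul_rpow_le hA hp.le hp2 _).trans (mul_le_mul_right ?_ _))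
    exact Finset.single_le_sum (f := fun i => ∑' m : ℕ, ENNReal.ofReal (1 / 2 ^ m) * T i m x ^ p)
      (fun _ _ => zero_le) (Finset.mem_univ i)
  have hTpm : ∀ i m, Measurable fun x => ENNReal.ofReal (1 / 2 ^ m) * T i m x ^ p := fun i m =>
    ((hTm i m).pow_const p).const_mul _
  calc ∫⁻ x, curveMax a c b χ l U f x ^ p
      ≤ ∫⁻ x, ENNReal.ofReal ((2 * A + 1) ^ 2) *
        ∑ i : Fin N × Bool, ∑' m : ℕ, ENNReal.ofReal (1 / 2 ^ m) * T i m x ^ p := lintegral_mono hpt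
    _ = ENNReal.ofReal ((2 * A + 1) ^ 2) *
        ∑ i : Fin N × Bool, ∑' m : ℕ, ENNReal.ofReal (1 / 2 ^ m) * ∫⁻ x, T i m x ^ p := by
        rw [lintegral_const_mul' _ _ (by simp), lintegral_finsetSum _ fun i _ =>
          Measurable.tsum (hTpm i)]
        refine congrArg _ (Finset.sum_congr rfl fun i _ => ?_)
        rw [lintegral_tsum fun m => (hTpm i m).aemeasurable]
        exact tsum_congr fun m => lintegral_const_mul' _ _ (by simp)
    _ ≤ ENNReal.ofReal ((2 * A + 1) ^ 2) *
        ∑ i : Fin N × Bool, ∑' m : ℕ, ENNReal.ofReal (1 / 2 ^ m) *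
          ((64 * B + (160 / ENNReal.ofReal (p - 1)) ^ 2) * ∫⁻ x, g x ^ p) :=
        mul_le_mul_right (Finset.sum_le_sum fun i _ => ENNReal.tsum_le_tsum fun m =>
          mul_le_mul_right (hTp i m) _) _
    _ = _ := by
        simp_rw [ENNReal.tsum_mul_right, tsum_ofReal_inv_two_pow]
        rw [Finset.sum_const, Finset.card_univ, Fintype.card_prod, Fintype.card_fin,
          Fintype.card_bool, nsmul_eq_mul, ENNReal.ofReal_mul (by norm_num), ENNReal.ofReal_ofNat]
        push_cast
        ring

theorem norm_integral_exp_mul_le {φ φ₁ φ₂ A A₁ : ℝ → ℝ} {r s lam K₀ K₁ : ℝ} (hrs : r ≤ s)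
    (hlam : 0 < lam) (hφ : ∀ t ∈ Icc r s, HasDerivAt φ (φ₁ t) t)
    (hφ₁ : ∀ t ∈ Icc r s, HasDerivAt φ₁ (φ₂ t) t) (hφ₂ : ContinuousOn φ₂ (Icc r s))
    (hle : ∀ t ∈ Icc r s, lam ≤ φ₂ t) (hA : ∀ t ∈ Icc r s, HasDerivAt A (A₁ t) t)
    (hA₁ : ContinuousOn A₁ (Icc r s)) (hAr : A r = 0) (hAs : A s = 0)
    (hK₀ : ∀ t ∈ Icc r s, |A t| ≤ K₀) (hK₁ : ∀ t ∈ Icc r s, |A₁ t| ≤ K₁) :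
    ‖∫ t in r..s, Complex.exp ((φ t : ℂ) * Complex.I) * (A t : ℂ)‖ ≤
      (2 * Real.pi * K₀ + (s - r) * K₁) / √lam := by
  have hu : uIcc r s = Icc r s := uIcc_of_le hrs
  have hsq : 0 < √lam := Real.sqrt_pos.2 hlam
  have hsq2 : √lam * √lam = lam := Real.mul_self_sqrt hlam.le
  have hD : ∀ t, 0 < φ₁ t ^ 2 + lam := fun t => by positivity
  set q : ℝ → ℝ := fun t => φ₁ t * A t / (φ₁ t ^ 2 + lam) with hq
  set q₁ : ℝ → ℝ := fun t => φ₂ t * (lam - φ₁ t ^ 2) / (φ₁ t ^ 2 + lam) ^ 2 * A t +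
    φ₁ t / (φ₁ t ^ 2 + lam) * A₁ t with hq₁
  have hqd : ∀ t ∈ Icc r s, HasDerivAt q (q₁ t) t := by
    intro t ht
    have h := ((hφ₁ t ht).mul (hA t ht)).div (((hφ₁ t ht).pow 2).add_const lam) (hD t).ne'
    refine h.congr_deriv ?_
    have := (hD t).ne'
    simp only [hq₁, Pi.mul_apply, Pi.pow_apply]
    field_simp
    push_cast
    ring
  set E : ℝ → ℂ := fun t => Complex.exp ((φ t : ℂ) * Complex.I) with hE
  have hEd : ∀ t ∈ Icc r s, HasDerivAt E (E t * ((φ₁ t : ℂ) * Complex.I)) t := by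
    intro t ht
    exact ((hφ t ht).ofReal_comp.mul_const Complex.I).cexp
  have hEn : ∀ t, ‖E t‖ = 1 := fun t => Complex.norm_exp_ofReal_mul_I _
  have hcφ : ContinuousOn φ (Icc r s) := fun t ht => (hφ t ht).continuousAt.continuousWithinAt
  have hcφ₁ : ContinuousOn φ₁ (Icc r s) := fun t ht => (hφ₁ t ht).continuousAt.continuousWithinAt
  have hcA : ContinuousOn A (Icc r s) := fun t ht => (hA t ht).continuousAt.continuousWithinAt
  have hcE : ContinuousOn E (Icc r s) := fun t ht => (hEd t ht).continuousAt.continuousWithinAt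
  have hcq : ContinuousOn q (Icc r s) := fun t ht => (hqd t ht).continuousAt.continuousWithinAt
  have hcq₁ : ContinuousOn q₁ (Icc r s) := by
    refine ContinuousOn.add (ContinuousOn.mul (ContinuousOn.div ?_ ?_ fun t _ => ?_) hcA)
      (ContinuousOn.mul (ContinuousOn.div hcφ₁ ?_ fun t _ => (hD t).ne') hA₁)
    · exact hφ₂.mul (continuousOn_const.sub (hcφ₁.pow 2))
    · exact ((hcφ₁.pow 2).add continuousOn_const).pow 2
    · exact (pow_pos (hD t) 2).ne'
    · exact (hcφ₁.pow 2).add continuousOn_const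
  set G₁ : ℝ → ℂ := fun t => E t * ((φ₁ t : ℂ) * Complex.I) * ((q t : ℂ) * -Complex.I) +
    E t * ((q₁ t : ℂ) * -Complex.I) with hG₁
  have hGd : ∀ t ∈ uIcc r s, HasDerivAt (fun t => E t * ((q t : ℂ) * -Complex.I)) (G₁ t) t := by
    intro t ht
    rw [hu] at ht
    exact (hEd t ht).mul ((hqd t ht).ofReal_comp.mul_const _)
  have hcG₁ : ContinuousOn G₁ (uIcc r s) := by
    rw [hu]
    have h1 : ContinuousOn (fun t => (q t : ℂ)) (Icc r s) :=
      Complex.continuous_ofReal.comp_continuousOn hcq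
    have h2 : ContinuousOn (fun t => (q₁ t : ℂ)) (Icc r s) :=
      Complex.continuous_ofReal.comp_continuousOn hcq₁
    have h3 : ContinuousOn (fun t => (φ₁ t : ℂ)) (Icc r s) :=
      Complex.continuous_ofReal.comp_continuousOn hcφ₁
    exact ((hcE.mul (h3.mul continuousOn_const)).mul (h1.mul continuousOn_const)).add
      (hcE.mul (h2.mul continuousOn_const))
  have hG0 : ∫ t in r..s, G₁ t = 0 := by
    rw [intervalIntegral.integral_eq_sub_of_hasDerivAt hGd hcG₁.intervalIntegrable]
    simp [hq, hAr, hAs]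
  have hcEA : ContinuousOn (fun t => E t * (A t : ℂ)) (uIcc r s) := by
    rw [hu]
    exact hcE.mul (Complex.continuous_ofReal.comp_continuousOn hcA)
  set H₁ : ℝ → ℝ := fun t => 2 * K₀ * (φ₂ t / (φ₁ t ^ 2 + lam)) + K₁ / √lam with hH₁
  have hHd : ∀ t ∈ uIcc r s, HasDerivAt
      (fun t => 2 * K₀ * (Real.arctan (φ₁ t / √lam) / √lam) + K₁ / √lam * t) (H₁ t) t := by
    intro t ht
    rw [hu] at ht
    have h1 := (((hφ₁ t ht).div_const (√lam)).arctan.div_const (√lam)).const_mul (2 * K₀)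
    refine (h1.add ((hasDerivAt_id t).const_mul (K₁ / √lam))).congr_deriv ?_
    have e : 1 + (φ₁ t / √lam) ^ 2 = (φ₁ t ^ 2 + lam) / lam := by
      rw [div_pow, Real.sq_sqrt hlam.le]
      field_simp
      ring
    have := (hD t).ne'
    rw [e, hH₁, mul_one]
    dsimp only
    congr 2
    rw [one_div_div, div_mul_div_comm, div_div, mul_assoc, hsq2, mul_comm lam (φ₂ t),
      mul_div_mul_right _ _ hlam.ne']
  have hcH₁ : ContinuousOn H₁ (uIcc r s) := by
    rw [hu]
    exact (continuousOn_const.mul (hφ₂.div ((hcφ₁.pow 2).add continuousOn_const)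
      fun t _ => (hD t).ne')).add continuousOn_const
  have hpt : ∀ t ∈ Icc r s, ‖E t * (A t : ℂ) - G₁ t‖ ≤ H₁ t := by
    intro t ht
    have hDt := hD t
    have e : E t * (A t : ℂ) - G₁ t = E t * ((lam / (φ₁ t ^ 2 + lam) * A t : ℝ) +
        ((q₁ t : ℝ) : ℂ) * Complex.I) := by
      have e1 : lam / (φ₁ t ^ 2 + lam) * A t = A t - φ₁ t * q t := by
        simp only [hq]
        field_simp
        ring
      rw [e1, hG₁]
      push_cast
      ring_nf
      rw [Complex.I_sq]
      ring
    rw [e, norm_mul, hEn, one_mul]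
    have hφp : 0 < φ₂ t := hlam.trans_le (hle t ht)
    refine (norm_add_le _ _).trans ?_
    rw [norm_mul, Complex.norm_I, mul_one, Complex.norm_real, Complex.norm_real, Real.norm_eq_abs,
      Real.norm_eq_abs]
    have h1 : |lam / (φ₁ t ^ 2 + lam) * A t| ≤ φ₂ t / (φ₁ t ^ 2 + lam) * K₀ := by
      rw [abs_mul, abs_of_pos (by positivity)]
      exact mul_le_mul (by gcongr; exact hle t ht) (hK₀ t ht) (abs_nonneg _) (by positivity)
    have h2 : |φ₂ t * (lam - φ₁ t ^ 2) / (φ₁ t ^ 2 + lam) ^ 2 * A t| ≤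
        φ₂ t / (φ₁ t ^ 2 + lam) * K₀ := by
      rw [abs_mul]
      refine mul_le_mul ?_ (hK₀ t ht) (abs_nonneg _) (by positivity)
      have h4 : |lam - φ₁ t ^ 2| ≤ φ₁ t ^ 2 + lam := abs_le.2
        ⟨by nlinarith [sq_nonneg (φ₁ t)], by nlinarith [sq_nonneg (φ₁ t)]⟩
      rw [abs_div, abs_mul, abs_of_pos hφp, abs_of_pos (pow_pos hDt 2),
        div_le_div_iff₀ (by positivity) hDt]
      calc φ₂ t * |lam - φ₁ t ^ 2| * (φ₁ t ^ 2 + lam)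
          ≤ φ₂ t * (φ₁ t ^ 2 + lam) * (φ₁ t ^ 2 + lam) := by gcongr
        _ = _ := by ring
    have h3 : |φ₁ t / (φ₁ t ^ 2 + lam) * A₁ t| ≤ 1 / √lam * K₁ := by
      rw [abs_mul]
      refine mul_le_mul ?_ (hK₁ t ht) (abs_nonneg _) (by positivity)
      rw [abs_div, abs_of_pos hDt, div_le_div_iff₀ hDt hsq]
      nlinarith [sq_nonneg (|φ₁ t| - √lam), sq_abs (φ₁ t), mul_nonneg (abs_nonneg (φ₁ t)) hsq.le]
    calc _ ≤ φ₂ t / (φ₁ t ^ 2 + lam) * K₀ + (φ₂ t / (φ₁ t ^ 2 + lam) * K₀ + 1 / √lam * K₁) :=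
          add_le_add h1 ((abs_add_le _ _).trans (add_le_add h2 h3))
      _ = H₁ t := by simp only [hH₁]; ring
  have hfin : ∫ t in r..s, E t * (A t : ℂ) = ∫ t in r..s, (E t * (A t : ℂ) - G₁ t) := by
    rw [intervalIntegral.integral_sub hcEA.intervalIntegrable hcG₁.intervalIntegrable, hG0,
      sub_zero]
  rw [hfin]
  have h1 := intervalIntegral.norm_integral_le_of_norm_le (μ := volume) hrs
    (ae_of_all _ fun t ht => hpt t (Ioc_subset_Icc_self ht)) hcH₁.intervalIntegrable
  refine h1.trans ?_
  rw [intervalIntegral.integral_eq_sub_of_hasDerivAt hHd hcH₁.intervalIntegrable]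
  have hK0 : 0 ≤ K₀ := (abs_nonneg _).trans (hK₀ r ⟨le_rfl, hrs⟩)
  have ha1 := Real.arctan_lt_pi_div_two (φ₁ s / √lam)
  have ha2 := Real.neg_pi_div_two_lt_arctan (φ₁ r / √lam)
  have ha3 : Real.arctan (φ₁ s / √lam) - Real.arctan (φ₁ r / √lam) ≤ Real.pi := by linarith
  calc _ = (2 * K₀ * (Real.arctan (φ₁ s / √lam) - Real.arctan (φ₁ r / √lam)) + (s - r) * K₁) / √lam := by
        ring
    _ ≤ (2 * K₀ * Real.pi + (s - r) * K₁) / √lam := by gcongr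
    _ = _ := by ring

theorem norm_integral_exp_mul_le_of_abs {φ φ₁ φ₂ A A₁ : ℝ → ℝ} {r s lam K₀ K₁ : ℝ} (hrs : r ≤ s)
    (hlam : 0 < lam) (hφ : ∀ t ∈ Icc r s, HasDerivAt φ (φ₁ t) t)
    (hφ₁ : ∀ t ∈ Icc r s, HasDerivAt φ₁ (φ₂ t) t) (hφ₂ : ContinuousOn φ₂ (Icc r s))
    (hle : (∀ t ∈ Icc r s, lam ≤ φ₂ t) ∨ ∀ t ∈ Icc r s, lam ≤ -φ₂ t)
    (hA : ∀ t ∈ Icc r s, HasDerivAt A (A₁ t) t)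
    (hA₁ : ContinuousOn A₁ (Icc r s)) (hAr : A r = 0) (hAs : A s = 0)
    (hK₀ : ∀ t ∈ Icc r s, |A t| ≤ K₀) (hK₁ : ∀ t ∈ Icc r s, |A₁ t| ≤ K₁) :
    ‖∫ t in r..s, Complex.exp ((φ t : ℂ) * Complex.I) * (A t : ℂ)‖ ≤
      (2 * Real.pi * K₀ + (s - r) * K₁) / √lam := by
  rcases hle with hle | hle
  · exact norm_integral_exp_mul_le hrs hlam hφ hφ₁ hφ₂ hle hA hA₁ hAr hAs hK₀ hK₁
  · have h := norm_integral_exp_mul_le (φ := fun t => -φ t) (φ₁ := fun t => -φ₁ t)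
      (φ₂ := fun t => -φ₂ t) hrs hlam (fun t ht => (hφ t ht).neg) (fun t ht => (hφ₁ t ht).neg)
      hφ₂.neg hle hA hA₁ hAr hAs hK₀ hK₁
    refine le_trans (le_of_eq ?_) h
    rw [← Complex.norm_conj, intervalIntegral.integral_of_le hrs, intervalIntegral.integral_of_le hrs,
      ← integral_conj]
    congr 1
    refine integral_congr_ae (ae_of_all _ fun t => ?_)
    dsimp only
    rw [map_mul, ← Complex.exp_conj, map_mul, Complex.conj_ofReal, Complex.conj_ofReal,
      Complex.conj_I, Complex.ofReal_neg, neg_mul, mul_neg]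

lemma contDiff_powCurve (c : ℝ) {b : ℝ} (hb : 1 < b) : ContDiff ℝ 1 (powCurve c b) :=
  contDiff_const.mul (Real.contDiff_rpow_const_of_le (by exact_mod_cast hb.le))

lemma integrable_of_support_Ioo {χ : ℝ → ℝ} (hχ : Continuous χ) {r s : ℝ}
    (hχs : ∀ t, t ∉ Ioo r s → χ t = 0) : Integrable χ :=
  hχ.integrable_of_hasCompactSupport (HasCompactSupport.intro (K := Icc r s) isCompact_Icc
    fun t ht => hχs t fun h => ht (Ioo_subset_Icc_self h))

lemma measurable_curveMul_integrand {γ χ : ℝ → ℝ} (hγ : Continuous γ) (hχ : Continuous χ)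
    (ξ : ℝ × ℝ) : Continuous fun t : ℝ =>
      Complex.exp (((-(2 * Real.pi * (ξ.1 * t + ξ.2 * γ t)) : ℝ) : ℂ) * Complex.I) *
        ((χ t : ℝ) : ℂ) := by
  fun_prop

lemma continuous_curveMul {γ χ : ℝ → ℝ} (hγ : Continuous γ) (hχ : Continuous χ)
    (hχi : Integrable χ) : Continuous (curveMul γ χ) := by
  refine continuous_of_dominated (bound := fun t => |χ t|)
    (fun ξ => (measurable_curveMul_integrand hγ hχ ξ).aestronglyMeasurable)
    (fun ξ => ae_of_all _ fun t => ?_) hχi.abs (ae_of_all _ fun t => by fun_prop)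
  rw [norm_mul, Complex.norm_exp_ofReal_mul_I, one_mul, Complex.norm_real, Real.norm_eq_abs]

lemma hasDerivAt_curveMul_snd {γ χ : ℝ → ℝ} (hγ : Continuous γ) (hχ : Continuous χ)
    (hχi : Integrable χ) (hχγ : Integrable fun t => γ t * χ t) (x v : ℝ) :
    HasDerivAt (fun v => curveMul γ χ (x, v))
      (-(2 * Real.pi * Complex.I) * curveMul γ (fun t => γ t * χ t) (x, v)) v := by
  have h := hasDerivAt_integral_of_dominated_loc_of_deriv_le (μ := volume) (𝕜 := ℝ)
    (F := fun (v t : ℝ) => Complex.exp (((-(2 * Real.pi * (x * t + v * γ t)) : ℝ) : ℂ) *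
      Complex.I) * ((χ t : ℝ) : ℂ))
    (F' := fun (v t : ℝ) => -(2 * Real.pi * Complex.I) * (Complex.exp
      (((-(2 * Real.pi * (x * t + v * γ t)) : ℝ) : ℂ) * Complex.I) * ((γ t * χ t : ℝ) : ℂ)))
    (bound := fun t => 2 * Real.pi * |γ t * χ t|) (x₀ := v) (s := univ) univ_mem
    (Eventually.of_forall fun v =>
      (measurable_curveMul_integrand hγ hχ (x, v)).aestronglyMeasurable) ?_ ?_ ?_ ?_ ?_
  · refine h.2.congr_deriv ?_
    rw [integral_const_mul]
    rfl
  · refine hχi.ofReal.bdd_mul (c := 1) (by fun_prop) (ae_of_all _ fun t => ?_)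
    rw [Complex.norm_exp_ofReal_mul_I]
  · refine Continuous.aestronglyMeasurable ?_
    fun_prop
  · refine ae_of_all _ fun t v _ => le_of_eq ?_
    rw [norm_mul, norm_mul, Complex.norm_exp_ofReal_mul_I, one_mul, Complex.norm_real,
      Real.norm_eq_abs, norm_neg, norm_mul, norm_mul, Complex.norm_I, mul_one, Complex.norm_real,
      Real.norm_eq_abs, abs_of_pos Real.pi_pos, Complex.norm_ofNat]
  · exact hχγ.abs.const_mul _
  · refine ae_of_all _ fun t v _ => ?_
    have h1 : HasDerivAt (fun v : ℝ => -(2 * Real.pi * (x * t + v * γ t)))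
        (-(2 * Real.pi * γ t)) v := by
      have := (((hasDerivAt_id v).mul_const (γ t)).const_add (x * t)).const_mul (2 * Real.pi)
      exact this.neg.congr_deriv (by ring)
    refine ((h1.ofReal_comp.mul_const Complex.I).cexp.mul_const ((χ t : ℝ) : ℂ)).congr_deriv ?_
    push_cast
    ring

lemma exists_curveMul_decay {c b : ℝ} (hc : c ≠ 0) (hb : 1 < b) {A : ℝ → ℝ} (hA : ContDiff ℝ 1 A)
    (hAs : ∀ t, t ∉ Ioo (1 / 2 : ℝ) 2 → A t = 0) :
    ∃ K, 0 ≤ K ∧ ∀ ξ : ℝ × ℝ, ξ.2 ≠ 0 → ‖curveMul (powCurve c b) A ξ‖ ≤ K / √|ξ.2| := by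
  have hπ := Real.pi_pos
  have hA' : Continuous (deriv A) := hA.continuous_deriv le_rfl
  obtain ⟨K₀, hK₀⟩ := (isCompact_Icc (a := (1/2:ℝ)) (b := 2)).exists_bound_of_continuousOn
    hA.continuous.continuousOn
  obtain ⟨K₁, hK₁⟩ := (isCompact_Icc (a := (1/2:ℝ)) (b := 2)).exists_bound_of_continuousOn
    hA'.continuousOn
  have hmem : (1/2:ℝ) ∈ Icc (1/2:ℝ) 2 := ⟨le_rfl, by norm_num⟩
  have hK₀0 : 0 ≤ K₀ := (norm_nonneg _).trans (hK₀ _ hmem)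
  have hK₁0 : 0 ≤ K₁ := (norm_nonneg _).trans (hK₁ _ hmem)
  have hcb : 0 < |c| * (b * (b - 1)) := mul_pos (abs_pos.2 hc) (mul_pos (by linarith) (by linarith))
  set ν : ℝ := 2 * Real.pi * (|c| * (b * (b - 1))) * ((1 / 2) ^ b / 4) with hν
  have hνpos : 0 < ν := by positivity
  have hlow : ∀ t ∈ Icc (1/2:ℝ) 2, (1 / 2 : ℝ) ^ b / 4 ≤ t ^ (b - 2) := by
    intro t ht
    have ht0 : 0 < t := by linarith [ht.1]
    rw [Real.rpow_sub ht0, Real.rpow_two]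
    have h1 : (1 / 2 : ℝ) ^ b ≤ t ^ b := Real.rpow_le_rpow (by norm_num) ht.1 (by linarith)
    have h2 : t ^ 2 ≤ 4 := by nlinarith [ht.1, ht.2]
    exact div_le_div₀ (by positivity) h1 (by positivity) h2
  refine ⟨(2 * Real.pi * K₀ + (2 - 1 / 2) * K₁) / √ν, by positivity, fun ξ hξ => ?_⟩
  have hlam : 0 < ν * |ξ.2| := mul_pos hνpos (abs_pos.2 hξ)
  have hrw : curveMul (powCurve c b) A ξ = ∫ t in (1/2:ℝ)..2,
      Complex.exp (((-(2 * Real.pi * (ξ.1 * t + ξ.2 * powCurve c b t)) : ℝ) : ℂ) * Complex.I) *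
        ((A t : ℝ) : ℂ) := by
    rw [intervalIntegral.integral_of_le (by norm_num)]
    refine (setIntegral_eq_integral_of_forall_compl_eq_zero fun t ht => ?_).symm
    rw [hAs t fun h => ht (Ioo_subset_Ioc_self h), Complex.ofReal_zero, mul_zero]
  rw [hrw]
  set d : ℝ := -(2 * Real.pi * ξ.2 * c * (b * (b - 1))) with hd
  have hdabs : |d| = 2 * Real.pi * (|c| * (b * (b - 1))) * |ξ.2| := by
    rw [hd, abs_neg, abs_mul, abs_mul, abs_mul, abs_of_pos (by positivity : 0 < 2 * Real.pi),
      abs_of_pos (mul_pos (by linarith) (by linarith) : 0 < b * (b - 1))]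
    ring
  have h := norm_integral_exp_mul_le_of_abs (r := 1 / 2) (s := 2) (lam := ν * |ξ.2|)
    (φ := fun t => -(2 * Real.pi * (ξ.1 * t + ξ.2 * powCurve c b t)))
    (φ₁ := fun t => -(2 * Real.pi * (ξ.1 + ξ.2 * (c * (b * t ^ (b - 1))))))
    (φ₂ := fun t => d * t ^ (b - 2)) (A := A) (A₁ := deriv A) (K₀ := K₀) (K₁ := K₁)
    (by norm_num) hlam ?_ ?_ ?_ ?_ (fun t _ => (hA.differentiable one_ne_zero t).hasDerivAt)
    hA'.continuousOn (hAs _ fun h => lt_irrefl _ h.1) (hAs _ fun h => lt_irrefl _ h.2) hK₀ hK₁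
  · refine h.trans (le_of_eq ?_)
    rw [Real.sqrt_mul hνpos.le, div_div]
  · intro t ht
    have h1 : HasDerivAt (powCurve c b) (c * (b * t ^ (b - 1))) t :=
      (Real.hasDerivAt_rpow_const (Or.inr hb.le)).const_mul c
    exact ((((hasDerivAt_id t).const_mul ξ.1).add (h1.const_mul ξ.2)).const_mul
      (2 * Real.pi)).neg.congr_deriv (by ring)
  · intro t ht
    have ht0 : t ≠ 0 := by linarith [ht.1]
    have h1 : HasDerivAt (fun t : ℝ => t ^ (b - 1)) ((b - 1) * t ^ (b - 1 - 1)) t :=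
      Real.hasDerivAt_rpow_const (Or.inl ht0)
    refine (((((h1.const_mul b).const_mul c).const_mul ξ.2).const_add ξ.1).const_mul
      (2 * Real.pi)).neg.congr_deriv ?_
    rw [hd, show b - 1 - 1 = b - 2 by ring]
    ring
  · refine continuousOn_const.mul fun t ht => ?_
    exact (Real.continuousAt_rpow_const t _ (Or.inl (by linarith [ht.1]))).continuousWithinAt
  · have key : ∀ t ∈ Icc (1/2:ℝ) 2, ν * |ξ.2| ≤ |d| * t ^ (b - 2) := fun t ht => by
      rw [hdabs, hν]
      calc _ = 2 * Real.pi * (|c| * (b * (b - 1))) * |ξ.2| * ((1 / 2) ^ b / 4) := by ring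
        _ ≤ _ := mul_le_mul_of_nonneg_left (hlow t ht) (by positivity)
    rcases le_total 0 d with hd0 | hd0
    · left
      intro t ht
      simpa only [abs_of_nonneg hd0] using key t ht
    · right
      intro t ht
      simpa only [abs_of_nonpos hd0, neg_mul] using key t ht

/-- A multiplier `m` localized to the dyadic shell of radius `2 ^ l`, whose radial derivative in
the second variable is `d`, with the decay of the Fourier transform of a curved measure. -/
structure ShellMult (m d : ℝ × ℝ → ℂ) (κ C : ℝ) (l : ℕ) : Prop where
  pos : 0 < κ
  continuous : Continuous m
  continuous_deriv : Continuous d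
  support : ∀ z, m z ≠ 0 → κ * 2 ^ l ≤ |z.1| ∧ |z.1| ≤ 2 * 2 ^ l ∧
    κ * 2 ^ l ≤ |z.2| ∧ |z.2| ≤ 2 * 2 ^ l
  support_deriv : ∀ z, d z ≠ 0 → κ * 2 ^ l ≤ |z.1| ∧ |z.1| ≤ 2 * 2 ^ l ∧
    κ * 2 ^ l ≤ |z.2| ∧ |z.2| ≤ 2 * 2 ^ l
  norm_sq_le : ∀ z, ‖m z‖ ^ 2 ≤ C * (2 ^ l)⁻¹
  norm_sq_deriv_le : ∀ z, ‖d z‖ ^ 2 ≤ C * 2 ^ l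
  hasDerivAt : ∀ x y v, v ≠ 0 → HasDerivAt (fun v => m (x, v * y)) (d (x, v * y) / v) v

/-- The symbol of `curveOp` at unit scale. -/
def curveSymbol (a : ℕ → ℝ × ℝ → ℝ) (c b : ℝ) (χ : ℝ → ℝ) (l : ℕ) (z : ℝ × ℝ) : ℂ :=
  ((a l (((2:ℝ) ^ l)⁻¹ * z.1, ((2:ℝ) ^ l)⁻¹ * z.2) : ℝ) : ℂ) * curveMul (powCurve c b) χ z

/-- The radial derivative of `curveSymbol` in the second variable. -/
def curveSymbolDeriv (a : ℕ → ℝ × ℝ → ℝ) (c b : ℝ) (χ : ℝ → ℝ) (l : ℕ) (z : ℝ × ℝ) : ℂ :=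
  z.2 * (((((2:ℝ) ^ l)⁻¹ * fderiv ℝ (a l) (((2:ℝ) ^ l)⁻¹ * z.1, ((2:ℝ) ^ l)⁻¹ * z.2) (0, 1) : ℝ) :
      ℂ) * curveMul (powCurve c b) χ z +
    ((a l (((2:ℝ) ^ l)⁻¹ * z.1, ((2:ℝ) ^ l)⁻¹ * z.2) : ℝ) : ℂ) *
      (-(2 * Real.pi * Complex.I) * curveMul (powCurve c b) (fun t => powCurve c b t * χ t) z))

lemma AmpBound.support_fderiv {a : ℕ → ℝ × ℝ → ℝ} {κ C : ℝ} (ha : AmpBound a κ C) (l : ℕ)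
    {ξ : ℝ × ℝ} (h : fderiv ℝ (a l) ξ (0, 1) ≠ 0) :
    κ ≤ |ξ.1| ∧ |ξ.1| ≤ 2 ∧ κ ≤ |ξ.2| ∧ |ξ.2| ≤ 2 := by
  have hcl : IsClosed {ξ : ℝ × ℝ | κ ≤ |ξ.1| ∧ |ξ.1| ≤ 2 ∧ κ ≤ |ξ.2| ∧ |ξ.2| ≤ 2} := by
    have h1 : Continuous fun ξ : ℝ × ℝ => |ξ.1| := by fun_prop
    have h2 : Continuous fun ξ : ℝ × ℝ => |ξ.2| := by fun_prop
    exact (isClosed_le continuous_const h1).inter ((isClosed_le h1 continuous_const).inter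
      ((isClosed_le continuous_const h2).inter (isClosed_le h2 continuous_const)))
  refine closure_minimal (fun ξ hξ => ha.support l ξ hξ) hcl
    (support_fderiv_subset ℝ (f := a l) fun h0 => h ?_)
  rw [h0]
  rfl

theorem AmpBound.exists_shellMult {a : ℕ → ℝ × ℝ → ℝ} {κ C : ℝ} (ha : AmpBound a κ C) {c b : ℝ}
    (hc : c ≠ 0) (hb : 1 < b) {χ : ℝ → ℝ} (hχ : ContDiff ℝ 1 χ)
    (hχs : ∀ t, t ∉ Ioo (1 / 2 : ℝ) 2 → χ t = 0) :
    ∃ C', 0 ≤ C' ∧ ∀ l, ShellMult (curveSymbol a c b χ l) (curveSymbolDeriv a c b χ l) κ C' l := by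
  have hγ := contDiff_powCurve c hb
  have hχ' : ContDiff ℝ 1 fun t => powCurve c b t * χ t := hγ.mul hχ
  have hχs' : ∀ t, t ∉ Ioo (1 / 2 : ℝ) 2 → powCurve c b t * χ t = 0 := fun t ht => by
    rw [hχs t ht, mul_zero]
  obtain ⟨K, hK, hKd⟩ := exists_curveMul_decay hc hb hχ hχs
  obtain ⟨K', hK', hKd'⟩ := exists_curveMul_decay hc hb hχ' hχs'
  have hχi := integrable_of_support_Ioo hχ.continuous hχs
  have hχi' := integrable_of_support_Ioo hχ'.continuous hχs'
  have hcm := continuous_curveMul hγ.continuous hχ.continuous hχi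
  have hcm' := continuous_curveMul hγ.continuous hχ'.continuous hχi'
  have hκ := ha.pos
  have hC0 : 0 ≤ C := (abs_nonneg _).trans (ha.le 0 0)
  have hπ := Real.pi_pos
  have hfd : ∀ l, Continuous fun ξ => fderiv ℝ (a l) ξ (0, 1) := fun l =>
    ((ha.contDiff l).continuous_fderiv (by simp)).clm_apply continuous_const
  have hsup : ∀ (l : ℕ) (t : ℝ), κ ≤ |((2:ℝ) ^ l)⁻¹ * t| ∧ |((2:ℝ) ^ l)⁻¹ * t| ≤ 2 →
      κ * 2 ^ l ≤ |t| ∧ |t| ≤ 2 * 2 ^ l := by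
    intro l t h
    have h2 : (0:ℝ) < 2 ^ l := by positivity
    rw [abs_mul, abs_of_pos (inv_pos.2 h2), inv_mul_eq_div, le_div_iff₀ h2, div_le_iff₀ h2] at h
    exact h
  have hsupp : ∀ (l : ℕ) (z : ℝ × ℝ), a l (((2:ℝ) ^ l)⁻¹ * z.1, ((2:ℝ) ^ l)⁻¹ * z.2) ≠ 0 ∨
      fderiv ℝ (a l) (((2:ℝ) ^ l)⁻¹ * z.1, ((2:ℝ) ^ l)⁻¹ * z.2) (0, 1) ≠ 0 →
      κ * 2 ^ l ≤ |z.1| ∧ |z.1| ≤ 2 * 2 ^ l ∧ κ * 2 ^ l ≤ |z.2| ∧ |z.2| ≤ 2 * 2 ^ l := by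
    intro l z h
    have h' := h.elim (ha.support l _) (ha.support_fderiv l)
    obtain ⟨h1, h2⟩ := hsup l z.1 ⟨h'.1, h'.2.1⟩
    exact ⟨h1, h2, hsup l z.2 h'.2.2⟩
  have hdec : ∀ (l : ℕ) (z : ℝ × ℝ), κ * 2 ^ l ≤ |z.2| →
      ‖curveMul (powCurve c b) χ z‖ ≤ K / √(κ * 2 ^ l) ∧
      ‖curveMul (powCurve c b) (fun t => powCurve c b t * χ t) z‖ ≤ K' / √(κ * 2 ^ l) := by
    intro l z hz
    have hpos : 0 < κ * 2 ^ l := by positivity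
    have hz0 : z.2 ≠ 0 := abs_pos.1 (hpos.trans_le hz)
    have hs : √(κ * 2 ^ l) ≤ √|z.2| := Real.sqrt_le_sqrt hz
    have hs0 : 0 < √(κ * 2 ^ l) := Real.sqrt_pos.2 hpos
    exact ⟨(hKd z hz0).trans (by gcongr), (hKd' z hz0).trans (by gcongr)⟩
  have hCm : 0 ≤ (C * K) ^ 2 / κ := by positivity
  have hCd : 0 ≤ (2 * (C * K + C * (2 * Real.pi * K'))) ^ 2 / κ := by positivity
  refine ⟨(C * K) ^ 2 / κ + (2 * (C * K + C * (2 * Real.pi * K'))) ^ 2 / κ, by positivity,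
    fun l => ?_⟩
  have h2l : (0:ℝ) < 2 ^ l := by positivity
  have hs0 : 0 < √(κ * 2 ^ l) := Real.sqrt_pos.2 (by positivity)
  have hs2 : √(κ * 2 ^ l) ^ 2 = κ * 2 ^ l := Real.sq_sqrt (by positivity)
  have hal := (ha.contDiff l).continuous
  have hfdl := hfd l
  have hsm : ∀ z, curveSymbol a c b χ l z ≠ 0 → κ * 2 ^ l ≤ |z.1| ∧ |z.1| ≤ 2 * 2 ^ l ∧
      κ * 2 ^ l ≤ |z.2| ∧ |z.2| ≤ 2 * 2 ^ l := fun z hz => hsupp l z <| Or.inl fun h => hz <| by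
    rw [curveSymbol, h, Complex.ofReal_zero, zero_mul]
  have hsd : ∀ z, curveSymbolDeriv a c b χ l z ≠ 0 → κ * 2 ^ l ≤ |z.1| ∧ |z.1| ≤ 2 * 2 ^ l ∧
      κ * 2 ^ l ≤ |z.2| ∧ |z.2| ≤ 2 * 2 ^ l := fun z hz => hsupp l z <| by
    by_contra! h
    exact hz (by rw [curveSymbolDeriv, h.1, h.2]; simp)
  refine ⟨hκ, ?_, ?_, hsm, hsd, fun z => ?_, fun z => ?_, fun x y v hv => ?_⟩
  · unfold curveSymbol
    fun_prop
  · have h1 : Continuous fun z : ℝ × ℝ =>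
        fderiv ℝ (a l) (((2:ℝ) ^ l)⁻¹ * z.1, ((2:ℝ) ^ l)⁻¹ * z.2) (0, 1) :=
      hfdl.comp (by fun_prop : Continuous fun z : ℝ × ℝ =>
        (((2:ℝ) ^ l)⁻¹ * z.1, ((2:ℝ) ^ l)⁻¹ * z.2))
    unfold curveSymbolDeriv
    fun_prop
  · by_cases hz : curveSymbol a c b χ l z = 0
    · rw [hz, norm_zero, zero_pow two_ne_zero]
      exact mul_nonneg (add_nonneg hCm hCd) (inv_pos.2 h2l).le
    · have hd := (hdec l z (hsm z hz).2.2.1).1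
      have h1 : ‖curveSymbol a c b χ l z‖ ≤ C * (K / √(κ * 2 ^ l)) := by
        rw [curveSymbol, norm_mul, Complex.norm_real, Real.norm_eq_abs]
        exact mul_le_mul (ha.le l _) hd (norm_nonneg _) hC0
      calc ‖curveSymbol a c b χ l z‖ ^ 2 ≤ (C * (K / √(κ * 2 ^ l))) ^ 2 := by gcongr
        _ = (C * K) ^ 2 / κ * (2 ^ l)⁻¹ := by
          rw [← mul_div_assoc, div_pow, hs2, div_mul_eq_div_div, div_eq_mul_inv _ ((2:ℝ) ^ l)]
        _ ≤ _ := by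
          gcongr
          linarith
  · by_cases hz : curveSymbolDeriv a c b χ l z = 0
    · rw [hz, norm_zero, zero_pow two_ne_zero]
      exact mul_nonneg (add_nonneg hCm hCd) h2l.le
    · obtain ⟨-, -, h3, h4⟩ := hsd z hz
      obtain ⟨hd, hd'⟩ := hdec l z h3
      have hinv : ((2:ℝ) ^ l)⁻¹ ≤ 1 := inv_le_one_of_one_le₀ (one_le_pow₀ one_le_two)
      have h1 : ‖curveSymbolDeriv a c b χ l z‖ ≤ 2 * 2 ^ l *
          (1 * C * (K / √(κ * 2 ^ l)) + C * (2 * Real.pi * (K' / √(κ * 2 ^ l)))) := by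
        rw [curveSymbolDeriv, norm_mul, Complex.norm_real, Real.norm_eq_abs]
        refine mul_le_mul h4 ((norm_add_le _ _).trans (add_le_add ?_ ?_)) (norm_nonneg _)
          (by positivity)
        · rw [norm_mul, Complex.norm_real, Real.norm_eq_abs, abs_mul, abs_of_pos (inv_pos.2 h2l)]
          exact mul_le_mul (mul_le_mul hinv (ha.fderiv_le l _) (abs_nonneg _) zero_le_one) hd
            (norm_nonneg _) (by positivity)
        · rw [norm_mul, Complex.norm_real, Real.norm_eq_abs, norm_mul, norm_neg, norm_mul, norm_mul,
            Complex.norm_I, mul_one, Complex.norm_real, Real.norm_eq_abs, abs_of_pos hπ,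
            Complex.norm_ofNat]
          exact mul_le_mul (ha.le l _) (by gcongr) (by positivity) hC0
      calc ‖curveSymbolDeriv a c b χ l z‖ ^ 2 ≤ (2 * 2 ^ l *
            (1 * C * (K / √(κ * 2 ^ l)) + C * (2 * Real.pi * (K' / √(κ * 2 ^ l))))) ^ 2 := by gcongr
        _ = (2 * (C * K + C * (2 * Real.pi * K')) * 2 ^ l / √(κ * 2 ^ l)) ^ 2 := by ring
        _ = (2 * (C * K + C * (2 * Real.pi * K'))) ^ 2 / κ * 2 ^ l := by
          rw [div_pow, hs2]
          field_simp
        _ ≤ _ := by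
          gcongr
          linarith
  · have h1 : HasDerivAt (fun v => curveMul (powCurve c b) χ (x, v * y)) _ v :=
      HasDerivAt.scomp (g₁ := fun w => curveMul (powCurve c b) χ (x, w)) (h := fun v => v * y) v
        (hasDerivAt_curveMul_snd hγ.continuous hχ.continuous hχi hχi' x (v * y))
        ((hasDerivAt_id v).mul_const y)
    have h2 : HasDerivAt (fun v : ℝ => (((2:ℝ) ^ l)⁻¹ * x, ((2:ℝ) ^ l)⁻¹ * (v * y)))
        (0, ((2:ℝ) ^ l)⁻¹ * y) v :=
      (hasDerivAt_const v _).prodMk ((((hasDerivAt_id v).mul_const y).const_mul _).congr_deriv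
        (by rw [one_mul]))
    have h3 : HasDerivAt (fun v => a l (((2:ℝ) ^ l)⁻¹ * x, ((2:ℝ) ^ l)⁻¹ * (v * y))) _ v :=
      ((ha.contDiff l).differentiable (by simp) _).hasFDerivAt.comp_hasDerivAt v h2
    refine (h3.ofReal_comp.mul h1).congr_deriv ?_
    have e : ((0:ℝ), ((2:ℝ) ^ l)⁻¹ * y) = (((2:ℝ) ^ l)⁻¹ * y) • ((0:ℝ), (1:ℝ)) := by simp
    have hvc : (v:ℂ) ≠ 0 := by exact_mod_cast hv
    rw [e, map_smul, curveSymbolDeriv]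
    simp only [smul_eq_mul, one_mul, Complex.real_smul]
    push_cast
    field_simp

/-- The Fourier multiplier operator with symbol `m (α ξ₁, β ξ₂)`. -/
def multOp (m : ℝ × ℝ → ℂ) (α β : ℝ) (f : ℝ × ℝ → ℂ) : ℝ × ℝ → ℂ :=
  FTinv fun ξ => m (α * ξ.1, β * ξ.2) * FT f ξ

lemma abs_le_div_of_dilate {γ t R : ℝ} (hγ : 0 < γ) (h : |γ * t| ≤ R) :
    t ∈ Icc (-(R / γ)) (R / γ) := by
  refine abs_le.1 ?_
  rwa [abs_mul, abs_of_pos hγ, mul_comm, ← le_div_iff₀ hγ] at h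

lemma integrable_dilate_mul_FT {g f : ℝ × ℝ → ℂ} (hg : Continuous g) {R : ℝ}
    (hs : ∀ z, g z ≠ 0 → |z.1| ≤ R ∧ |z.2| ≤ R) (hf : Integrable f) {α β : ℝ} (hα : 0 < α)
    (hβ : 0 < β) : Integrable fun ξ : ℝ × ℝ => g (α * ξ.1, β * ξ.2) * FT f ξ := by
  have hc := continuous_FT hf
  refine Continuous.integrable_of_hasCompactSupport (by fun_prop)
    (HasCompactSupport.intro (K := Icc (-(R / α)) (R / α) ×ˢ Icc (-(R / β)) (R / β))
      (isCompact_Icc.prod isCompact_Icc) fun ξ hξ => ?_)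
  by_contra h
  obtain ⟨h1, h2⟩ := hs _ (left_ne_zero_of_mul h)
  exact hξ ⟨abs_le_div_of_dilate hα h1, abs_le_div_of_dilate hβ h2⟩

lemma lintegral_multOp_sq_le {g f : ℝ × ℝ → ℂ} (hg : Continuous g) {R : ℝ}
    (hs : ∀ z, g z ≠ 0 → |z.1| ≤ R ∧ |z.2| ≤ R) (hf : Integrable f) {α β : ℝ} (hα : 0 < α)
    (hβ : 0 < β) : ∫⁻ x, ‖multOp g α β f x‖ₑ ^ 2 ≤
      ∫⁻ ξ : ℝ × ℝ, ‖g (α * ξ.1, β * ξ.2)‖ₑ ^ 2 * ‖FT f ξ‖ₑ ^ 2 := by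
  refine (lintegral_FTinv_sq_le (integrable_dilate_mul_FT hg hs hf hα hβ)).trans
    (lintegral_mono fun ξ => le_of_eq ?_)
  rw [enorm_mul, mul_pow]

lemma continuous_multOp {g f : ℝ × ℝ → ℂ} (hg : Continuous g) {R : ℝ}
    (hs : ∀ z, g z ≠ 0 → |z.1| ≤ R ∧ |z.2| ≤ R) (hf : Integrable f) {α β : ℝ} (hα : 0 < α)
    (hβ : 0 < β) : Continuous (multOp g α β f) := by
  have h := continuous_FT (integrable_dilate_mul_FT hg hs hf hα hβ)
  have e : multOp g α β f = fun x => FT (fun ξ => g (α * ξ.1, β * ξ.2) * FT f ξ) (-x) :=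
    funext fun x => FTinv_eq_FT_neg _ x
  rw [e]
  exact h.comp continuous_neg

lemma measurable_enorm_multOp {g f : ℝ × ℝ → ℂ} (hg : Continuous g) (hf : Integrable f)
    (α β : ℝ) : Measurable fun z : (ℝ × ℝ) × ℝ => ‖multOp g α (z.2 * β) f z.1‖ₑ := by
  have hc := continuous_FT hf
  have h : StronglyMeasurable (Function.uncurry fun (z : (ℝ × ℝ) × ℝ) (ξ : ℝ × ℝ) =>
      Complex.exp (((2 * Real.pi * (z.1.1 * ξ.1 + z.1.2 * ξ.2) : ℝ) : ℂ) * Complex.I) *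
        (g (α * ξ.1, z.2 * β * ξ.2) * FT f ξ)) := by
    refine Continuous.stronglyMeasurable ?_
    unfold Function.uncurry
    fun_prop
  exact (h.integral_prod_right (ν := volume)).measurable.enorm

lemma ShellMult.abs_le {m d : ℝ × ℝ → ℂ} {κ C : ℝ} {l : ℕ} (hm : ShellMult m d κ C l) (z : ℝ × ℝ)
    (h : m z ≠ 0) : |z.1| ≤ 2 * 2 ^ l ∧ |z.2| ≤ 2 * 2 ^ l :=
  ⟨(hm.support z h).2.1, (hm.support z h).2.2.2⟩

lemma ShellMult.abs_deriv_le {m d : ℝ × ℝ → ℂ} {κ C : ℝ} {l : ℕ} (hm : ShellMult m d κ C l)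
    (z : ℝ × ℝ) (h : d z ≠ 0) : |z.1| ≤ 2 * 2 ^ l ∧ |z.2| ≤ 2 * 2 ^ l :=
  ⟨(hm.support_deriv z h).2.1, (hm.support_deriv z h).2.2.2⟩

theorem ShellMult.enorm_multOp_le {m d : ℝ × ℝ → ℂ} {κ C : ℝ} {l : ℕ} (hm : ShellMult m d κ C l)
    {f : ℝ × ℝ → ℂ} (hf : Integrable f) {α β w u : ℝ} (hα : 0 < α) (hβ : 0 < β) (hw : 0 < w)
    (hu : 0 < u) (x : ℝ × ℝ) :
    ‖multOp m α (u * β) f x‖ₑ ≤ ‖multOp m α (w * β) f x‖ₑ +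
      ∫⁻ v in uIoc w u, ENNReal.ofReal v⁻¹ * ‖multOp d α (v * β) f x‖ₑ := by
  have hc := continuous_FT hf
  have hcd := hm.continuous_deriv
  have hmin : 0 < min w u := lt_min hw hu
  have hIpos : ∀ v ∈ uIcc w u, 0 < v := fun v hv => hmin.trans_le hv.1
  set E : ℝ × ℝ → ℂ := fun ξ =>
    Complex.exp (((2 * Real.pi * (x.1 * ξ.1 + x.2 * ξ.2) : ℝ) : ℂ) * Complex.I) with hE
  have hEn : ∀ ξ, ‖E ξ‖ = 1 := fun ξ => Complex.norm_exp_ofReal_mul_I _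
  have hEc : Continuous E := by
    rw [hE]
    fun_prop
  set s : ℝ := if w ≤ u then 1 else -1 with hs
  have hsn : ‖s‖ₑ = 1 := by
    rw [hs]
    split_ifs <;> simp
  have hitg : ∀ {t : ℝ}, 0 < t → Integrable fun ξ : ℝ × ℝ =>
      E ξ * (m (α * ξ.1, t * β * ξ.2) * FT f ξ) := fun ht =>
    (integrable_dilate_mul_FT hm.continuous hm.abs_le hf hα (mul_pos ht hβ)).bdd_mul (c := 1)
      hEc.aestronglyMeasurable (ae_of_all _ fun ξ => (hEn ξ).le)
  have hftc : ∀ ξ : ℝ × ℝ, m (α * ξ.1, u * β * ξ.2) - m (α * ξ.1, w * β * ξ.2) =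
      s • ∫ v in uIoc w u, d (α * ξ.1, v * β * ξ.2) / v := by
    intro ξ
    have h := intervalIntegral.integral_eq_sub_of_hasDerivAt (a := w) (b := u)
      (f := fun v => m (α * ξ.1, v * (β * ξ.2))) (f' := fun v => d (α * ξ.1, v * (β * ξ.2)) / v)
      (fun v hv => hm.hasDerivAt _ _ v (hIpos v hv).ne') (ContinuousOn.intervalIntegrable
        (ContinuousOn.div (by fun_prop) (by fun_prop) fun v hv => by
          exact_mod_cast (hIpos v hv).ne'))
    simp only [← mul_assoc] at h
    rw [← h, intervalIntegral.intervalIntegral_eq_integral_uIoc]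
  set R : ℝ := 2 * 2 ^ l with hR
  set K : Set (ℝ × ℝ) := Icc (-(R / α)) (R / α) ×ˢ Icc (-(R / (min w u * β))) (R / (min w u * β))
    with hK
  have hKm : MeasurableSet K := measurableSet_Icc.prod measurableSet_Icc
  have hKf : volume K ≠ ⊤ := (isCompact_Icc.prod isCompact_Icc).measure_lt_top.ne
  set M : ℝ := √(C * 2 ^ l) * (min w u)⁻¹ * ∫ y, ‖f y‖ with hM
  have hM0 : 0 ≤ M := by positivity
  set Φ : ℝ × ℝ → ℝ → ℂ := fun ξ v => E ξ * (d (α * ξ.1, v * β * ξ.2) / v * FT f ξ) with hΦ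
  have hΦi : Integrable (Function.uncurry Φ) (volume.prod (volume.restrict (uIoc w u))) := by
    have hb : Integrable (fun z : (ℝ × ℝ) × ℝ => K.indicator (fun _ => M) z.1 * (1:ℝ))
        (volume.prod (volume.restrict (uIoc w u))) := by
      have h1 : Integrable (K.indicator fun _ => M) :=
        (integrable_indicator_iff hKm).2 (integrableOn_const hKf)
      have : IsFiniteMeasure (volume.restrict (uIoc w u)) :=
        ⟨by rw [Measure.restrict_apply_univ]; exact measure_Ioc_lt_top⟩
      exact h1.mul_prod (integrable_const 1)
    refine hb.mono' ?_ ?_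
    · have hmd := hcd.measurable
      have hmE := hEc.measurable
      have hmc := hc.measurable
      refine Measurable.aestronglyMeasurable ?_
      unfold Function.uncurry
      simp only [hΦ]
      have h1 : Measurable fun z : (ℝ × ℝ) × ℝ => d (α * z.1.1, z.2 * β * z.1.2) :=
        hmd.comp (by fun_prop)
      have h2 : Measurable fun z : (ℝ × ℝ) × ℝ => (z.2 : ℂ) :=
        Complex.measurable_ofReal.comp measurable_snd
      exact (hmE.comp measurable_fst).mul ((h1.div h2).mul (hmc.comp measurable_fst))
    · have hae : ∀ᵐ z ∂((volume : Measure (ℝ × ℝ)).prod (volume.restrict (uIoc w u))),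
          z.2 ∈ uIoc w u :=
        Measure.quasiMeasurePreserving_snd.ae (ae_restrict_mem measurableSet_uIoc)
      filter_upwards [hae] with z hz
      rw [mul_one]
      change ‖E z.1 * (d (α * z.1.1, z.2 * β * z.1.2) / z.2 * FT f z.1)‖ ≤ _
      have hv : min w u ≤ z.2 := hz.1.le
      have hv0 : 0 < z.2 := hmin.trans_le hv
      by_cases hd : d (α * z.1.1, z.2 * β * z.1.2) = 0
      · rw [hd, zero_div, zero_mul, mul_zero, norm_zero]
        exact indicator_nonneg (fun _ _ => hM0) _
      · obtain ⟨h1, h2⟩ := hm.abs_deriv_le _ hd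
        have hzK : z.1 ∈ K := by
          refine ⟨abs_le_div_of_dilate hα h1, abs_le_div_of_dilate (mul_pos hmin hβ)
            (le_trans ?_ h2)⟩
          rw [abs_mul, abs_mul _ z.1.2, abs_of_pos (mul_pos hmin hβ), abs_of_pos (mul_pos hv0 hβ)]
          gcongr
        rw [indicator_of_mem hzK, norm_mul, hEn, one_mul, norm_mul, norm_div, Complex.norm_real,
          Real.norm_eq_abs, abs_of_pos hv0, div_eq_mul_inv]
        refine mul_le_mul (mul_le_mul (Real.le_sqrt_of_sq_le (hm.norm_sq_deriv_le _)) ?_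
          (by positivity) (Real.sqrt_nonneg _)) (norm_FT_le f _) (norm_nonneg _) (by positivity)
        gcongr
  have hswap : multOp m α (u * β) f x - multOp m α (w * β) f x =
      s • ∫ v in uIoc w u, (v : ℂ)⁻¹ * multOp d α (v * β) f x := by
    calc multOp m α (u * β) f x - multOp m α (w * β) f x
        = ∫ ξ, s • ∫ v in uIoc w u, Φ ξ v := by
          refine (integral_sub (hitg hu) (hitg hw)).symm.trans (integral_congr_ae
            (ae_of_all _ fun ξ => ?_))
          dsimp only
          rw [← mul_sub, ← sub_mul, hftc]
          simp only [hΦ]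
          rw [integral_const_mul, integral_mul_const, smul_mul_assoc, mul_smul_comm]
      _ = _ := by
          rw [integral_smul, integral_integral_swap hΦi]
          congr 1
          refine integral_congr_ae (ae_of_all _ fun v => ?_)
          dsimp only
          rw [multOp, FTinv, ← integral_const_mul]
          refine integral_congr_ae (ae_of_all _ fun ξ => ?_)
          simp only [hΦ, hE]
          ring
  have e : multOp m α (u * β) f x = multOp m α (w * β) f x +
      s • ∫ v in uIoc w u, (v : ℂ)⁻¹ * multOp d α (v * β) f x := by
    rw [← hswap]
    ring
  rw [e]
  refine (enorm_add_le _ _).trans (add_le_add_right ?_ _)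
  rw [enorm_smul, hsn, one_mul]
  refine (enorm_integral_le_lintegral_enorm _).trans
    (setLIntegral_mono' measurableSet_uIoc fun v hv => le_of_eq ?_)
  have hv0 : 0 < v := hmin.trans hv.1
  rw [enorm_mul, ← ofReal_norm (v : ℂ)⁻¹, norm_inv, Complex.norm_real, Real.norm_eq_abs,
    abs_of_pos hv0]

lemma Lacunary.two_pow_mul_le {w : ℤ → ℝ} (hw : Lacunary w) (n : ℤ) (k : ℕ) :
    2 ^ k * w n ≤ w (n + k) := by
  induction k with
  | zero => simp
  | succ k ih =>
    have h := hw.two_mul_le (n + k)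
    rw [pow_succ]
    push_cast
    rw [← add_assoc]
    linarith

lemma lacunary_two_zpow : Lacunary fun j : ℤ => (2:ℝ) ^ j :=
  ⟨fun j => by positivity, fun j => by
    rw [zpow_add₀ two_ne_zero, zpow_one, mul_comm]⟩

lemma Lacunary.tsum_le {w : ℤ → ℝ} (hw : Lacunary w) {y s t : ℝ} {k : ℕ} (hs : 0 < s) (hy : 0 ≤ y)
    (hst : t ≤ 2 ^ k * s) {F : ℤ → ℝ≥0∞} {M : ℝ≥0∞} (hM : ∀ n, F n ≤ M)
    (hF : ∀ n, F n ≠ 0 → s ≤ w n * y ∧ w n * y ≤ t) : ∑' n, F n ≤ (2 * k + 1 : ℕ) * M := by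
  by_cases hne : ∃ n, F n ≠ 0
  · obtain ⟨n₀, hn₀⟩ := hne
    have key : ∀ m n : ℤ, F m ≠ 0 → F n ≠ 0 → m ≤ n → n - m ≤ k := by
      intro m n h1 h2 h3
      obtain ⟨i, rfl⟩ := Int.le.dest h3
      have h4 : (2:ℝ) ^ i * s ≤ 2 ^ k * s := by
        calc (2:ℝ) ^ i * s ≤ 2 ^ i * (w m * y) := by gcongr; exact (hF m h1).1
          _ = 2 ^ i * w m * y := by ring
          _ ≤ w (m + i) * y := mul_le_mul_of_nonneg_right (hw.two_pow_mul_le m i) hy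
          _ ≤ _ := (hF _ h2).2.trans hst
      have h5 : i ≤ k := (pow_le_pow_iff_right₀ one_lt_two).1 (le_of_mul_le_mul_right h4 hs)
      omega
    rw [tsum_eq_sum (s := Finset.Icc (n₀ - k) (n₀ + k)) fun n hn => by
      by_contra h
      refine hn (Finset.mem_Icc.2 ?_)
      rcases le_total n n₀ with h1 | h1
      · have := key n n₀ h hn₀ h1
        omega
      · have := key n₀ n hn₀ h h1
        omega]
    refine (Finset.sum_le_card_nsmul _ _ M fun n _ => hM n).trans (le_of_eq ?_)
    rw [Int.card_Icc, nsmul_eq_mul]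
    congr 2
    omega
  · push Not at hne
    simp [hne]

lemma ENNReal.rpow_half_sq (x : ℝ≥0∞) : (x ^ (1 / 2 : ℝ)) ^ 2 = x := by
  rw [← ENNReal.rpow_natCast, ← ENNReal.rpow_mul]
  norm_num

lemma lintegral_sq_le_mul {μ : Measure ℝ} {F : ℝ → ℝ≥0∞} (hF : Measurable F) :
    (∫⁻ v, F v ∂μ) ^ 2 ≤ μ univ * ∫⁻ v, F v ^ 2 ∂μ := by
  have h := ENNReal.lintegral_mul_le_Lp_mul_Lq μ Real.HolderConjugate.two_two
    (f := fun _ => 1) aemeasurable_const hF.aemeasurable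
  simp only [Pi.mul_apply, one_mul, lintegral_one, ENNReal.rpow_ofNat,
    one_pow] at h
  refine (pow_le_pow_left' h 2).trans (le_of_eq ?_)
  rw [mul_pow, ENNReal.rpow_half_sq, ENNReal.rpow_half_sq]

lemma enorm_sq_le_ofReal {z : ℂ} {t : ℝ} (h : ‖z‖ ^ 2 ≤ t) : ‖z‖ₑ ^ 2 ≤ ENNReal.ofReal t := by
  rw [← ofReal_norm, ← ENNReal.ofReal_pow (norm_nonneg _)]
  exact ENNReal.ofReal_le_ofReal h

/-- The square function controlling `multOp m α (u * β)` for `u` within `δ * w` of `w`. -/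
def shellSq (m d : ℝ × ℝ → ℂ) (δ α β w : ℝ) (f : ℝ × ℝ → ℂ) (x : ℝ × ℝ) : ℝ≥0∞ :=
  2 * ‖multOp m α (w * β) f x‖ₑ ^ 2 + ENNReal.ofReal (16 * δ / w) *
    ∫⁻ v in Icc (w * (1 - δ)) (w * (1 + δ)), ‖multOp d α (v * β) f x‖ₑ ^ 2

/-- The multiplier corresponding to `shellSq` by the Plancherel theorem. -/
def shellSqSymbol (m d : ℝ × ℝ → ℂ) (δ α β w : ℝ) (ξ : ℝ × ℝ) : ℝ≥0∞ :=
  2 * ‖m (α * ξ.1, w * β * ξ.2)‖ₑ ^ 2 + ENNReal.ofReal (16 * δ / w) *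
    ∫⁻ v in Icc (w * (1 - δ)) (w * (1 + δ)), ‖d (α * ξ.1, v * β * ξ.2)‖ₑ ^ 2

lemma mem_Icc_scaled {δ w v : ℝ} (hδ : δ ≤ 1 / 2) (hw : 0 < w)
    (hv : v ∈ Icc (w * (1 - δ)) (w * (1 + δ))) : w / 2 ≤ v ∧ v ≤ 2 * w :=
  ⟨by nlinarith [hv.1], by nlinarith [hv.2]⟩

lemma volume_Icc_scaled (δ w : ℝ) :
    volume (Icc (w * (1 - δ)) (w * (1 + δ))) = ENNReal.ofReal (2 * δ * w) := by
  rw [Real.volume_Icc]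
  ring_nf

section ShellSq

variable {m d : ℝ × ℝ → ℂ} {κ C δ α β w : ℝ} {l : ℕ} {f : ℝ × ℝ → ℂ}

lemma measurable_multOp_sq (hd : Continuous d) (hf : Integrable f) (α β : ℝ) :
    Measurable fun z : (ℝ × ℝ) × ℝ => ‖multOp d α (z.2 * β) f z.1‖ₑ ^ 2 :=
  (measurable_enorm_multOp hd hf _ _).pow_const 2

lemma ShellMult.measurable_multOp (hm : ShellMult m d κ C l) (hf : Integrable f)
    (hα : 0 < α) (hβ : 0 < β) : Measurable fun x => ‖multOp m α β f x‖ₑ :=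
  (continuous_multOp hm.continuous hm.abs_le hf hα hβ).measurable.enorm

lemma ShellMult.measurable_shellSq (hm : ShellMult m d κ C l) (hf : Integrable f)
    (hα : 0 < α) (hβ : 0 < β) (hw : 0 < w) : Measurable (shellSq m d δ α β w f) :=
  (((hm.measurable_multOp hf hα (mul_pos hw hβ)).pow_const 2).const_mul _).add
    ((Measurable.lintegral_prod_right (measurable_multOp_sq hm.continuous_deriv hf α β)).const_mul _)

lemma measurable_enorm_sq_dilate (hd : Continuous d) (α β : ℝ) :
    Measurable fun z : (ℝ × ℝ) × ℝ => ‖d (α * z.1.1, z.2 * β * z.1.2)‖ₑ ^ 2 :=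
  (hd.comp (by fun_prop : Continuous fun z : (ℝ × ℝ) × ℝ =>
    (α * z.1.1, z.2 * β * z.1.2))).measurable.enorm.pow_const 2

lemma measurable_enorm_sq_dilate_left (hm : Continuous m) (α β : ℝ) :
    Measurable fun ξ : ℝ × ℝ => 2 * ‖m (α * ξ.1, β * ξ.2)‖ₑ ^ 2 :=
  ((hm.comp (by fun_prop : Continuous fun ξ : ℝ × ℝ =>
    (α * ξ.1, β * ξ.2))).measurable.enorm.pow_const 2).const_mul _

lemma ShellMult.measurable_shellSqSymbol (hm : ShellMult m d κ C l) (δ α β w : ℝ) :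
    Measurable (shellSqSymbol m d δ α β w) :=
  (measurable_enorm_sq_dilate_left hm.continuous α (w * β)).add
    ((Measurable.lintegral_prod_right
      (measurable_enorm_sq_dilate hm.continuous_deriv α β)).const_mul _)

lemma ShellMult.enorm_multOp_sq_le_shellSq (hm : ShellMult m d κ C l) (hf : Integrable f)
    (hα : 0 < α) (hβ : 0 < β) (hw : 0 < w) (hδ0 : 0 < δ) (hδ : δ ≤ 1 / 2) {u : ℝ} (hu : 0 < u)
    (huw : |u - w| ≤ δ * w) (x : ℝ × ℝ) :
    ‖multOp m α (u * β) f x‖ₑ ^ 2 ≤ shellSq m d δ α β w f x := by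
  have hmdx : Measurable fun v : ℝ => ‖multOp d α (v * β) f x‖ₑ :=
    Measurable.comp (g := fun z : (ℝ × ℝ) × ℝ => ‖multOp d α (z.2 * β) f z.1‖ₑ)
      (f := fun v : ℝ => (x, v)) (measurable_enorm_multOp hm.continuous_deriv hf α β)
      measurable_prodMk_left
  have huw' := _root_.abs_le.1 huw
  set J := Icc (w * (1 - δ)) (w * (1 + δ)) with hJ
  have hsub : uIoc w u ⊆ J := by
    intro v hv
    rcases le_total w u with h | h
    · rw [uIoc_of_le h] at hv
      exact ⟨by nlinarith [hv.1], by nlinarith [hv.2]⟩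
    · rw [uIoc_of_ge h] at hv
      exact ⟨by nlinarith [hv.1], by nlinarith [hv.2]⟩
  have h1 := hm.enorm_multOp_le hf hα hβ hw hu x
  have h2 : ∫⁻ v in uIoc w u, ENNReal.ofReal v⁻¹ * ‖multOp d α (v * β) f x‖ₑ ≤
      ENNReal.ofReal (2 / w) * ∫⁻ v in J, ‖multOp d α (v * β) f x‖ₑ := by
    refine (lintegral_mono_set hsub).trans ?_
    rw [← lintegral_const_mul _ hmdx]
    refine setLIntegral_mono' measurableSet_Icc fun v hv => mul_le_mul_left
      (ENNReal.ofReal_le_ofReal ?_) _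
    have hv' := mem_Icc_scaled hδ hw hv
    rw [inv_eq_one_div, div_le_div_iff₀ (by linarith) hw]
    linarith
  have h3 := lintegral_sq_le_mul (μ := volume.restrict J) hmdx
  rw [Measure.restrict_apply_univ, hJ, volume_Icc_scaled, ← hJ] at h3
  have h4 := ENNReal.rpow_add_le_mul_rpow_add_rpow ‖multOp m α (w * β) f x‖ₑ
    (ENNReal.ofReal (2 / w) * ∫⁻ v in J, ‖multOp d α (v * β) f x‖ₑ) one_le_two
  simp only [ENNReal.rpow_ofNat, show (2:ℝ) - 1 = 1 by norm_num, ENNReal.rpow_one] at h4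
  refine (pow_le_pow_left' (h1.trans (add_le_add_right h2 _)) 2).trans (h4.trans ?_)
  have e : 16 * δ / w = 2 * ((2 / w) ^ 2 * (2 * δ * w)) := by
    field_simp
    norm_num
  have e' : shellSq m d δ α β w f x = 2 * (‖multOp m α (w * β) f x‖ₑ ^ 2 +
      ENNReal.ofReal (2 / w) ^ 2 * (ENNReal.ofReal (2 * δ * w) *
        ∫⁻ v in J, ‖multOp d α (v * β) f x‖ₑ ^ 2)) := by
    rw [shellSq, e, ENNReal.ofReal_mul two_pos.le, ENNReal.ofReal_mul (by positivity),
      ENNReal.ofReal_pow (by positivity), ENNReal.ofReal_ofNat]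
    ring
  rw [e', mul_pow]
  exact mul_le_mul_right (add_le_add_right (mul_le_mul_right h3 _) _) _

lemma ShellMult.lintegral_shellSq_le (hm : ShellMult m d κ C l) (hf : Integrable f)
    (hα : 0 < α) (hβ : 0 < β) (hw : 0 < w) (hδ : δ ≤ 1 / 2) :
    ∫⁻ x, shellSq m d δ α β w f x ≤ ∫⁻ ξ, shellSqSymbol m d δ α β w ξ * ‖FT f ξ‖ₑ ^ 2 := by
  have hcd := hm.continuous_deriv
  have hFm : Measurable fun ξ => ‖FT f ξ‖ₑ ^ 2 := (continuous_FT hf).measurable.enorm.pow_const 2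
  set J := Icc (w * (1 - δ)) (w * (1 + δ)) with hJ
  have e1 : ∫⁻ x, shellSq m d δ α β w f x = 2 * (∫⁻ x, ‖multOp m α (w * β) f x‖ₑ ^ 2) +
      ENNReal.ofReal (16 * δ / w) * ∫⁻ v in J, ∫⁻ x, ‖multOp d α (v * β) f x‖ₑ ^ 2 := by
    have hsw := lintegral_lintegral_swap (μ := (volume : Measure (ℝ × ℝ)))
      (ν := volume.restrict J) (f := fun x v => ‖multOp d α (v * β) f x‖ₑ ^ 2)
      (measurable_multOp_sq hcd hf α β).aemeasurable
    simp only [shellSq]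
    rw [lintegral_add_left (((hm.measurable_multOp hf hα (mul_pos hw hβ)).pow_const 2).const_mul _),
      lintegral_const_mul' _ _ (by simp), lintegral_const_mul' _ _ (by simp), ← hsw]
  have e2 : ∫⁻ ξ, shellSqSymbol m d δ α β w ξ * ‖FT f ξ‖ₑ ^ 2 =
      2 * (∫⁻ ξ : ℝ × ℝ, ‖m (α * ξ.1, w * β * ξ.2)‖ₑ ^ 2 * ‖FT f ξ‖ₑ ^ 2) +
      ENNReal.ofReal (16 * δ / w) * ∫⁻ v in J, ∫⁻ ξ : ℝ × ℝ,
        ‖d (α * ξ.1, v * β * ξ.2)‖ₑ ^ 2 * ‖FT f ξ‖ₑ ^ 2 := by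
    have hdF : Measurable fun z : (ℝ × ℝ) × ℝ =>
        ‖d (α * z.1.1, z.2 * β * z.1.2)‖ₑ ^ 2 * ‖FT f z.1‖ₑ ^ 2 :=
      (measurable_enorm_sq_dilate hcd α β).mul (hFm.comp measurable_fst)
    have hsw := lintegral_lintegral_swap (μ := (volume : Measure (ℝ × ℝ)))
      (ν := volume.restrict J) (f := fun ξ v => ‖d (α * ξ.1, v * β * ξ.2)‖ₑ ^ 2 * ‖FT f ξ‖ₑ ^ 2)
      hdF.aemeasurable
    have hmF : Measurable fun ξ : ℝ × ℝ =>
        2 * (‖m (α * ξ.1, w * β * ξ.2)‖ₑ ^ 2 * ‖FT f ξ‖ₑ ^ 2) := by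
      simp only [← mul_assoc (2 : ℝ≥0∞)]
      exact (measurable_enorm_sq_dilate_left hm.continuous α (w * β)).mul hFm
    rw [← hsw, ← lintegral_const_mul' 2 _ (by simp),
      ← lintegral_const_mul' (ENNReal.ofReal (16 * δ / w)) _ (by simp), ← lintegral_add_left hmF]
    refine lintegral_congr fun ξ => ?_
    have hne : ‖FT f ξ‖ₑ ^ 2 ≠ ⊤ := ENNReal.pow_ne_top enorm_ne_top
    rw [lintegral_mul_const' _ _ hne, shellSqSymbol]
    ring
  rw [e1, e2]
  refine add_le_add (mul_le_mul_right (lintegral_multOp_sq_le hm.continuous hm.abs_le hf hα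
    (mul_pos hw hβ)) _) (mul_le_mul_right (setLIntegral_mono' measurableSet_Icc
      fun v hv => lintegral_multOp_sq_le hcd hm.abs_deriv_le hf hα (mul_pos ?_ hβ)) _)
  linarith [(mem_Icc_scaled hδ hw hv).1]

lemma ShellMult.shellSqSymbol_le (hm : ShellMult m d κ C l) (hC : 0 ≤ C) (α β : ℝ) (hw : 0 < w)
    (ξ : ℝ × ℝ) :
    shellSqSymbol m d ((2:ℝ) ^ l)⁻¹ α β w ξ ≤ ENNReal.ofReal (34 * C * ((2:ℝ) ^ l)⁻¹) := by
  set δ : ℝ := ((2:ℝ) ^ l)⁻¹ with hδ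
  have hδ0 : 0 < δ := by positivity
  have h1 : ∫⁻ v in Icc (w * (1 - δ)) (w * (1 + δ)), ‖d (α * ξ.1, v * β * ξ.2)‖ₑ ^ 2 ≤
      ENNReal.ofReal (C * 2 ^ l) * ENNReal.ofReal (2 * δ * w) := by
    refine (lintegral_mono fun v => enorm_sq_le_ofReal (hm.norm_sq_deriv_le _)).trans
      (le_of_eq ?_)
    rw [lintegral_const, Measure.restrict_apply_univ, volume_Icc_scaled]
  refine (add_le_add (mul_le_mul_right (enorm_sq_le_ofReal (hm.norm_sq_le _)) _)
    (mul_le_mul_right h1 _)).trans (le_of_eq ?_)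
  rw [← ENNReal.ofReal_mul (by positivity), ← ENNReal.ofReal_mul (by positivity),
    ← ENNReal.ofReal_ofNat 2, ← ENNReal.ofReal_mul two_pos.le,
    ← ENNReal.ofReal_add (by positivity) (by positivity)]
  congr 1
  rw [hδ]
  field_simp
  ring

lemma ShellMult.shellSqSymbol_support (hm : ShellMult m d κ C l) (hα : 0 < α) (hβ : 0 < β)
    (hw : 0 < w) (hδ : δ ≤ 1 / 2) {ξ : ℝ × ℝ} (h : shellSqSymbol m d δ α β w ξ ≠ 0) :
    (κ * 2 ^ l ≤ α * |ξ.1| ∧ α * |ξ.1| ≤ 2 * 2 ^ l) ∧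
      κ * 2 ^ l / 2 ≤ w * (β * |ξ.2|) ∧ w * (β * |ξ.2|) ≤ 4 * 2 ^ l := by
  by_contra hcon
  have habs : ∀ v : ℝ, 0 < v → |α * ξ.1| = α * |ξ.1| ∧
      |v * β * ξ.2| = v * (β * |ξ.2|) := fun v hv => by
    rw [abs_mul, abs_of_pos hα, abs_mul, abs_mul, abs_of_pos hv, abs_of_pos hβ, mul_assoc]
    exact ⟨rfl, rfl⟩
  have hX : 0 ≤ β * |ξ.2| := mul_nonneg hβ.le (abs_nonneg _)
  have hκl : 0 < κ * 2 ^ l := mul_pos hm.pos (by positivity)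
  refine h ?_
  have hm0 : m (α * ξ.1, w * β * ξ.2) = 0 := by
    by_contra h0
    obtain ⟨s1, s2, s3, s4⟩ := hm.support _ h0
    dsimp only at s1 s2 s3 s4
    rw [(habs _ hw).1] at s1 s2
    rw [(habs _ hw).2] at s3 s4
    exact hcon ⟨⟨s1, s2⟩, by linarith, by linarith⟩
  have hd0 : ∀ v ∈ Icc (w * (1 - δ)) (w * (1 + δ)), d (α * ξ.1, v * β * ξ.2) = 0 := by
    intro v hv
    by_contra h0
    obtain ⟨hv1, hv2⟩ := mem_Icc_scaled hδ hw hv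
    have hv0 : 0 < v := by linarith
    obtain ⟨s1, s2, s3, s4⟩ := hm.support_deriv _ h0
    dsimp only at s1 s2 s3 s4
    rw [(habs _ hv0).1] at s1 s2
    rw [(habs _ hv0).2] at s3 s4
    have t1 := mul_le_mul_of_nonneg_right hv1 hX
    have t2 := mul_le_mul_of_nonneg_right hv2 hX
    exact hcon ⟨⟨s1, s2⟩, by linarith, by linarith⟩
  rw [shellSqSymbol, hm0, setLIntegral_congr_fun (g := fun _ => 0) measurableSet_Icc fun v hv => by
    rw [hd0 v hv]
    simp]
  simp

end ShellSq

lemma ENNReal.iSup_sq {ι : Type} (F : ι → ℝ≥0∞) : (⨆ i, F i) ^ 2 = ⨆ i, F i ^ 2 := by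
  simpa only [ENNReal.orderIsoRpow_apply, ENNReal.rpow_ofNat] using
    (ENNReal.orderIsoRpow 2 two_pos).map_iSup F

theorem ShellMult.lintegral_iSup_multOp_sq_le {m d : ℝ × ℝ → ℂ} {κ C : ℝ} {l : ℕ}
    (hm : ShellMult m d κ C l) (hl : 1 ≤ l) (hC : 0 ≤ C) (b : ℝ) {k : ℕ} (hk : 8 ≤ 2 ^ k * κ)
    {U : Set ℝ} (hU : U ⊆ Ioi 0) {N : ℕ}
    (hN : ∀ r : ℝ, 0 < r → covN (UrSet U r) ((2:ℝ) ^ l)⁻¹ ≤ N) {f : ℝ × ℝ → ℂ}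
    (hf : Integrable f) :
    ∫⁻ x, (⨆ (u : U) (j : ℤ), ‖multOp m (2 ^ j) (u * ((2:ℝ) ^ j) ^ b) f x‖ₑ) ^ 2 ≤
      N * 2 * ((2 * k + 1 : ℕ) * ((2 * k + 1 : ℕ) * ENNReal.ofReal (34 * C * ((2:ℝ) ^ l)⁻¹))) *
        ∫⁻ x, ‖f x‖ₑ ^ 2 := by
  have h2l : (0:ℝ) < 2 ^ l := by positivity
  have hδ0 : 0 < ((2:ℝ) ^ l)⁻¹ := by positivity
  have hδ2 : ((2:ℝ) ^ l)⁻¹ ≤ 1 / 2 := by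
    rw [inv_eq_one_div]
    exact one_div_le_one_div_of_le two_pos (le_self_pow₀ one_le_two (by omega))
  obtain ⟨w, hw, hwU⟩ := exists_lacunary_net hU hδ0 hN
  have hwp : ∀ i n, 0 < w i n := fun i n => (hw i).pos n
  have hpw : ∀ j : ℤ, (0:ℝ) < ((2:ℝ) ^ j) ^ b := fun j => by positivity
  have h2j : ∀ j : ℤ, (0:ℝ) < (2:ℝ) ^ j := fun j => by positivity
  have hcf := continuous_FT hf
  set S : Fin N × Bool → ℤ → ℤ → ℝ × ℝ → ℝ≥0∞ := fun i n j =>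
    shellSq m d ((2:ℝ) ^ l)⁻¹ (2 ^ j) (((2:ℝ) ^ j) ^ b) (w i n) f with hS
  set H : Fin N × Bool → ℤ → ℤ → ℝ × ℝ → ℝ≥0∞ := fun i n j =>
    shellSqSymbol m d ((2:ℝ) ^ l)⁻¹ (2 ^ j) (((2:ℝ) ^ j) ^ b) (w i n) with hH
  have hSm : ∀ i n j, Measurable (S i n j) := fun i n j =>
    hm.measurable_shellSq hf (h2j j) (hpw j) (hwp i n)
  have hFm : Measurable fun ξ => ‖FT f ξ‖ₑ ^ 2 := hcf.measurable.enorm.pow_const 2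
  have hpt : ∀ x, (⨆ (u : U) (j : ℤ), ‖multOp m (2 ^ j) (u * ((2:ℝ) ^ j) ^ b) f x‖ₑ) ^ 2 ≤
      ∑ i, ∑' (n : ℤ) (j : ℤ), S i n j x := by
    intro x
    simp only [ENNReal.iSup_sq]
    refine iSup₂_le fun u j => ?_
    obtain ⟨i, n, hin⟩ := hwU u u.2
    refine le_trans ?_ (Finset.single_le_sum (f := fun i => ∑' (n : ℤ) (j : ℤ), S i n j x)
      (fun _ _ => zero_le) (Finset.mem_univ i))
    refine le_trans ?_ (ENNReal.le_tsum n)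
    refine le_trans ?_ (ENNReal.le_tsum j)
    exact hm.enorm_multOp_sq_le_shellSq hf (h2j j) (hpw j) (hwp i n) hδ0 hδ2 (hU u.2) hin x
  have hHs : ∀ i n j ξ, H i n j ξ ≠ 0 →
      (κ * 2 ^ l ≤ (2:ℝ) ^ j * |ξ.1| ∧ (2:ℝ) ^ j * |ξ.1| ≤ 2 * 2 ^ l) ∧
      κ * 2 ^ l / 2 ≤ w i n * (((2:ℝ) ^ j) ^ b * |ξ.2|) ∧
      w i n * (((2:ℝ) ^ j) ^ b * |ξ.2|) ≤ 4 * 2 ^ l := fun i n j ξ h =>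
    hm.shellSqSymbol_support (h2j j) (hpw j) (hwp i n) hδ2 h
  have hcount : ∀ ξ, ∑ i, ∑' (n : ℤ) (j : ℤ), H i n j ξ ≤
      N * 2 * ((2 * k + 1 : ℕ) *
        ((2 * k + 1 : ℕ) * ENNReal.ofReal (34 * C * ((2:ℝ) ^ l)⁻¹))) := by
    intro ξ
    have hk' : 8 * 2 ^ l ≤ 2 ^ k * κ * 2 ^ l := mul_le_mul_of_nonneg_right hk h2l.le
    have h : ∀ i, ∑' (n : ℤ) (j : ℤ), H i n j ξ ≤
        (2 * k + 1 : ℕ) * ((2 * k + 1 : ℕ) * ENNReal.ofReal (34 * C * ((2:ℝ) ^ l)⁻¹)) := by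
      intro i
      rw [ENNReal.tsum_comm]
      refine lacunary_two_zpow.tsum_le (y := |ξ.1|) (s := κ * 2 ^ l) (t := 2 * 2 ^ l)
        (mul_pos hm.pos h2l) (abs_nonneg _) (by linarith) (fun j => ?_) fun j hj => ?_
      · exact (hw i).tsum_le (y := ((2:ℝ) ^ j) ^ b * |ξ.2|) (s := κ * 2 ^ l / 2) (t := 4 * 2 ^ l)
          (half_pos (mul_pos hm.pos h2l)) (mul_nonneg (hpw j).le (abs_nonneg _)) (by linarith)
          (fun n => hm.shellSqSymbol_le hC _ _ (hwp i n) ξ) fun n hn => (hHs i n j ξ hn).2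
      · by_contra hcon
        refine hj (ENNReal.tsum_eq_zero.2 fun n => ?_)
        by_contra h0
        exact hcon (hHs i n j ξ h0).1
    refine (Finset.sum_le_sum fun i _ => h i).trans (le_of_eq ?_)
    rw [Finset.sum_const, Finset.card_univ, Fintype.card_prod, Fintype.card_fin,
      Fintype.card_bool, nsmul_eq_mul]
    push_cast
    ring
  have hHF : ∀ i n j, Measurable fun ξ => H i n j ξ * ‖FT f ξ‖ₑ ^ 2 := fun i n j =>
    (hm.measurable_shellSqSymbol _ _ _ _).mul hFm
  have hS_int : ∫⁻ x, ∑ i, ∑' (n : ℤ) (j : ℤ), S i n j x =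
      ∑ i, ∑' (n : ℤ) (j : ℤ), ∫⁻ x, S i n j x := by
    rw [lintegral_finsetSum _ fun i _ => Measurable.tsum fun n => Measurable.tsum (hSm i n)]
    refine Finset.sum_congr rfl fun i _ => ?_
    rw [lintegral_tsum fun n => (Measurable.tsum (hSm i n)).aemeasurable]
    exact tsum_congr fun n => lintegral_tsum fun j => (hSm i n j).aemeasurable
  have hH_int : ∑ i, ∑' (n : ℤ) (j : ℤ), ∫⁻ ξ, H i n j ξ * ‖FT f ξ‖ₑ ^ 2 =
      ∫⁻ ξ, (∑ i, ∑' (n : ℤ) (j : ℤ), H i n j ξ) * ‖FT f ξ‖ₑ ^ 2 := by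
    simp_rw [Finset.sum_mul, ← ENNReal.tsum_mul_right]
    rw [lintegral_finsetSum _ fun i _ => Measurable.tsum fun n => Measurable.tsum (hHF i n)]
    refine Finset.sum_congr rfl fun i _ => ?_
    rw [lintegral_tsum fun n => (Measurable.tsum (hHF i n)).aemeasurable]
    exact tsum_congr fun n => (lintegral_tsum fun j => (hHF i n j).aemeasurable).symm
  refine (lintegral_mono hpt).trans ?_
  rw [hS_int]
  refine (Finset.sum_le_sum fun i _ => ENNReal.tsum_le_tsum fun n => ENNReal.tsum_le_tsum fun j =>
    hm.lintegral_shellSq_le hf (h2j j) (hpw j) (hwp i n) hδ2).trans ?_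
  refine hH_int.le.trans ((lintegral_mono fun ξ => mul_le_mul_left (hcount ξ) _).trans ?_)
  rw [lintegral_const_mul _ hFm]
  exact mul_le_mul_right (lintegral_FT_sq_le hf) _

lemma lintegral_Ioi_comp_mul_left (g : ℝ → ℝ≥0∞) {k : ℝ} (hk : 0 < k) :
    ∫⁻ t in Ioi (0:ℝ), g (k * t) = ENNReal.ofReal k⁻¹ * ∫⁻ t in Ioi (0:ℝ), g t := by
  have h := (Homeomorph.mulLeft₀ k hk.ne').measurableEmbedding.lintegral_map (μ := volume)
    ((Ioi (0:ℝ)).indicator g)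
  have e : (⇑(Homeomorph.mulLeft₀ k hk.ne') : ℝ → ℝ) = fun t => k * t := rfl
  rw [e, Real.map_volume_mul_left hk.ne', lintegral_smul_measure,
    lintegral_indicator measurableSet_Ioi, abs_of_pos (inv_pos.2 hk), smul_eq_mul] at h
  rw [h, ← lintegral_indicator measurableSet_Ioi]
  refine lintegral_congr fun t => ?_
  simp only [indicator, mem_Ioi, mul_pos_iff_of_pos_left hk]

/-- The gauge interpolating between the powers `s ^ p` and `s ^ 2`. -/
def interpGauge (p t : ℝ) (s : ℝ≥0∞) : ℝ≥0∞ := min (s ^ p) (ENNReal.ofReal t * s ^ 2)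

lemma interpGauge_add_le {p : ℝ} (hp : 0 ≤ p) (hp2 : p ≤ 2) (t : ℝ) (x y : ℝ≥0∞) :
    interpGauge p t (x + y) ≤ 4 * (ENNReal.ofReal t * x ^ 2 + y ^ p) := by
  rcases le_total x y with h | h
  · have h1 : x + y ≤ 2 * y := by
      rw [two_mul]
      exact add_le_add_left h y
    refine (min_le_left _ _).trans ((ENNReal.rpow_le_rpow h1 hp).trans ?_)
    rw [ENNReal.mul_rpow_of_nonneg _ _ hp]
    refine mul_le_mul' ?_ le_add_self
    refine (ENNReal.rpow_le_rpow_of_exponent_le one_le_two hp2).trans (le_of_eq ?_)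
    rw [ENNReal.rpow_ofNat]
    norm_num
  · have h1 : x + y ≤ 2 * x := by
      rw [two_mul]
      exact add_le_add_right h x
    refine (min_le_right _ _).trans ((mul_le_mul_right (pow_le_pow_left' h1 2) _).trans ?_)
    rw [mul_pow, mul_left_comm, show (2:ℝ≥0∞) ^ 2 = 4 by norm_num]
    exact mul_le_mul_right le_self_add _

lemma interpGauge_mul (p t : ℝ) {r : ℝ} (hr : 0 < r) :
    interpGauge p t (ENNReal.ofReal r) =
      ENNReal.ofReal (r ^ p) * interpGauge p (r ^ (2 - p) * t) 1 := by
  have h2 : (r:ℝ) ^ 2 = r ^ p * r ^ (2 - p) := by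
    rw [← Real.rpow_add hr, add_sub_cancel, Real.rpow_ofNat]
  unfold interpGauge
  rw [ENNReal.one_rpow, one_pow, mul_one, mul_min, mul_one,
    ENNReal.ofReal_rpow_of_pos hr, ← ENNReal.ofReal_pow hr.le, h2,
    ENNReal.ofReal_mul (p := r ^ (2 - p)) (by positivity),
    ENNReal.ofReal_mul (p := r ^ p) (by positivity)]
  congr 1
  ring

lemma lintegral_interpGauge_one_ne_top (p : ℝ) {η : ℝ} (hη : 0 < η) (hη1 : η < 1) :
    ∫⁻ t in Ioi (0:ℝ), ENNReal.ofReal (t ^ (-η - 1)) * interpGauge p t 1 ≠ ⊤ := by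
  rw [← Ioc_union_Ioi_eq_Ioi zero_le_one, lintegral_union measurableSet_Ioi
    (Ioc_disjoint_Ioi le_rfl)]
  refine ENNReal.add_ne_top.2 ⟨?_, ?_⟩
  · have h1 : IntegrableOn (fun t : ℝ => t ^ (-η)) (Ioc 0 1) :=
      (intervalIntegrable_iff_integrableOn_Ioc_of_le zero_le_one).1
        (intervalIntegral.intervalIntegrable_rpow' (by linarith))
    refine ne_top_of_le_ne_top h1.lintegral_lt_top.ne
      (setLIntegral_mono' measurableSet_Ioc fun t ht => ?_)
    refine (mul_le_mul_right (min_le_right _ _) _).trans (le_of_eq ?_)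
    rw [one_pow, mul_one, ← ENNReal.ofReal_mul (Real.rpow_nonneg ht.1.le _),
      ← Real.rpow_add_one ht.1.ne', sub_add_cancel]
  · have h1 : IntegrableOn (fun t : ℝ => t ^ (-η - 1)) (Ioi 1) :=
      integrableOn_Ioi_rpow_of_lt (by linarith) one_pos
    refine ne_top_of_le_ne_top h1.lintegral_lt_top.ne
      (setLIntegral_mono' measurableSet_Ioi fun t ht => ?_)
    refine (mul_le_mul_right (min_le_left _ _) _).trans (le_of_eq ?_)
    rw [ENNReal.one_rpow, mul_one]

lemma lintegral_interpGauge_one_ne_zero (p η : ℝ) :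
    ∫⁻ t in Ioi (0:ℝ), ENNReal.ofReal (t ^ (-η - 1)) * interpGauge p t 1 ≠ 0 := by
  have hm : Measurable fun t : ℝ => ENNReal.ofReal (t ^ (-η - 1)) * interpGauge p t 1 := by
    unfold interpGauge
    fun_prop
  refine ((setLIntegral_pos_iff hm).2 ?_).ne'
  refine lt_of_lt_of_le (b := volume (Ioi (0:ℝ))) (by simp) (measure_mono fun t ht => ⟨?_, ht⟩)
  have h1 : 0 < t ^ (-η - 1) := Real.rpow_pos_of_pos ht _
  have h2 : interpGauge p t 1 ≠ 0 := by
    unfold interpGauge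
    have ht' : (0:ℝ≥0∞) < ENNReal.ofReal t := ENNReal.ofReal_pos.2 ht
    rw [ENNReal.one_rpow, one_pow, mul_one]
    exact (lt_min one_pos ht').ne'
  exact mul_ne_zero (ENNReal.ofReal_pos.2 h1).ne' h2

lemma lintegral_interpGauge {p₀ p η : ℝ} (hp₀ : 0 < p₀)
    (hp : p = (1 - η) * p₀ + 2 * η) (hp0 : 0 < p) (s : ℝ≥0∞) :
    ∫⁻ t in Ioi (0:ℝ), ENNReal.ofReal (t ^ (-η - 1)) * interpGauge p₀ t s =
      (∫⁻ t in Ioi (0:ℝ), ENNReal.ofReal (t ^ (-η - 1)) * interpGauge p₀ t 1) * s ^ p := by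
  rcases eq_or_ne s 0 with rfl | hs0
  · simp [interpGauge, ENNReal.zero_rpow_of_pos hp0, ENNReal.zero_rpow_of_pos hp₀]
  rcases eq_or_ne s ⊤ with rfl | hst
  · rw [ENNReal.top_rpow_of_pos hp0, ENNReal.mul_top (lintegral_interpGauge_one_ne_zero p₀ η)]
    refine top_le_iff.1 ?_
    calc (⊤:ℝ≥0∞) = ∫⁻ t in Ioi (0:ℝ), (⊤:ℝ≥0∞) := by simp
      _ ≤ _ := setLIntegral_mono' measurableSet_Ioi fun t ht => by
        have h1 : ENNReal.ofReal (t ^ (-η - 1)) ≠ 0 :=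
          (ENNReal.ofReal_pos.2 (Real.rpow_pos_of_pos ht _)).ne'
        have h2 : ENNReal.ofReal t ≠ 0 := (ENNReal.ofReal_pos.2 ht).ne'
        simp [interpGauge, ENNReal.top_rpow_of_pos hp₀, ENNReal.mul_top, h1, h2]
  obtain ⟨r, hr, rfl⟩ : ∃ r : ℝ, 0 < r ∧ s = ENNReal.ofReal r :=
    ⟨s.toReal, ENNReal.toReal_pos hs0 hst, (ENNReal.ofReal_toReal hst).symm⟩
  have hk : 0 < r ^ (2 - p₀) := Real.rpow_pos_of_pos hr _
  have h := lintegral_Ioi_comp_mul_left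
    (fun t => ENNReal.ofReal (t ^ (-η - 1)) * interpGauge p₀ t 1) hk
  set c := ∫⁻ t in Ioi (0:ℝ), ENNReal.ofReal (t ^ (-η - 1)) * interpGauge p₀ t 1 with hc
  have e : ∀ t ∈ Ioi (0:ℝ), ENNReal.ofReal (t ^ (-η - 1)) * interpGauge p₀ t (ENNReal.ofReal r) =
      ENNReal.ofReal (r ^ p₀ * (r ^ (2 - p₀)) ^ (η + 1)) *
        (ENNReal.ofReal ((r ^ (2 - p₀) * t) ^ (-η - 1)) *
          interpGauge p₀ (r ^ (2 - p₀) * t) 1) := by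
    intro t ht
    rw [interpGauge_mul p₀ t hr, ← mul_assoc, ← mul_assoc, ← ENNReal.ofReal_mul
      (Real.rpow_nonneg (le_of_lt ht) _), ← ENNReal.ofReal_mul (by positivity),
      Real.mul_rpow hk.le (le_of_lt ht)]
    congr 2
    have e1 : (r ^ (2 - p₀)) ^ (η + 1) * (r ^ (2 - p₀)) ^ (-η - 1) = 1 := by
      rw [← Real.rpow_add hk, show η + 1 + (-η - 1) = 0 by ring, Real.rpow_zero]
    linear_combination (-(r ^ p₀ * t ^ (-η - 1))) * e1
  rw [setLIntegral_congr_fun measurableSet_Ioi e, lintegral_const_mul' _ _ ENNReal.ofReal_ne_top,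
    h, ← mul_assoc, ← ENNReal.ofReal_mul (by positivity), mul_comm,
    ENNReal.ofReal_rpow_of_pos hr]
  congr 2
  rw [← Real.rpow_neg_one, mul_assoc, ← Real.rpow_add hk, ← Real.rpow_mul hr.le,
    ← Real.rpow_add hr, hp]
  congr 1
  ring

/-- Real interpolation of a sublinear operator between `L^p₀` and `L^2`, with a constant that does
not depend on the exponents. -/
theorem lintegral_rpow_le_of_interpolation {T : (ℝ × ℝ → ℂ) → ℝ × ℝ → ℝ≥0∞} {p₀ p η A₀ A₁ : ℝ}
    (hp₀ : 0 < p₀) (hp₀2 : p₀ < 2) (hη : 0 < η) (hη1 : η < 1) (hp : p = (1 - η) * p₀ + 2 * η)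
    (hA₀ : 0 < A₀) (hA₁ : 0 < A₁) (hTm : ∀ g, Integrable g → Measurable (T g))
    (hadd : ∀ g h, Integrable g → Integrable h → ∀ x, T (g + h) x ≤ T g x + T h x)
    (h₀ : ∀ g, Measurable g → Integrable g →
      ∫⁻ x, T g x ^ p₀ ≤ ENNReal.ofReal A₀ * ∫⁻ x, ‖g x‖ₑ ^ p₀)
    (h₁ : ∀ g, Integrable g → ∫⁻ x, T g x ^ 2 ≤ ENNReal.ofReal A₁ * ∫⁻ x, ‖g x‖ₑ ^ 2)
    {f : ℝ × ℝ → ℂ} (hf : Measurable f) (hfi : Integrable f) :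
    ∫⁻ x, T f x ^ p ≤ ENNReal.ofReal (4 * (A₀ ^ (1 - η) * A₁ ^ η)) * ∫⁻ x, ‖f x‖ₑ ^ p := by
  have hp0 : 0 < p := by
    rw [hp]
    have := mul_pos (sub_pos.2 hη1) hp₀
    linarith
  have hTf := hTm f hfi
  have hfe : Measurable fun x => ‖f x‖ₑ := hf.enorm
  set k := A₀ / A₁ with hk
  have hk0 : 0 < k := div_pos hA₀ hA₁
  set c := ∫⁻ t in Ioi (0:ℝ), ENNReal.ofReal (t ^ (-η - 1)) * interpGauge p₀ t 1 with hc
  have hkey : ∀ t ∈ Ioi (0:ℝ), ∫⁻ x, interpGauge p₀ (k * t) (T f x) ≤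
      ENNReal.ofReal (4 * A₀) * ∫⁻ x, interpGauge p₀ t ‖f x‖ₑ := by
    intro t ht
    set s : Set (ℝ × ℝ) := {x | ENNReal.ofReal t * ‖f x‖ₑ ^ 2 ≤ ‖f x‖ₑ ^ p₀} with hs
    have hsm : MeasurableSet s :=
      measurableSet_le ((hfe.pow_const 2).const_mul _) (hfe.pow_const p₀)
    have hg := hfi.indicator hsm
    have hh := hfi.indicator hsm.compl
    have e : s.indicator f + sᶜ.indicator f = f := indicator_self_add_compl s f
    have hpt : ∀ x, interpGauge p₀ (k * t) (T f x) ≤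
        4 * (ENNReal.ofReal (k * t) * T (s.indicator f) x ^ 2 + T (sᶜ.indicator f) x ^ p₀) :=
      fun x => by
        have h := hadd _ _ hg hh x
        rw [e] at h
        refine le_trans ?_ (interpGauge_add_le hp₀.le hp₀2.le (k * t) _ _)
        exact min_le_min (ENNReal.rpow_le_rpow h hp₀.le)
          (mul_le_mul_right (pow_le_pow_left' h 2) _)
    have hgm : Measurable fun x => ENNReal.ofReal (k * t) * T (s.indicator f) x ^ 2 :=
      ((hTm _ hg).pow_const 2).const_mul _
    have hsplit : ∀ x, ENNReal.ofReal t * ‖s.indicator f x‖ₑ ^ 2 + ‖sᶜ.indicator f x‖ₑ ^ p₀ =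
        interpGauge p₀ t ‖f x‖ₑ := fun x => by
      by_cases hx : x ∈ s
      · have hx' : x ∉ sᶜ := fun h => h hx
        rw [indicator_of_mem hx, indicator_of_notMem hx', interpGauge, min_eq_right hx]
        simp [ENNReal.zero_rpow_of_pos hp₀]
      · have hx' : x ∈ sᶜ := hx
        rw [indicator_of_notMem hx, indicator_of_mem hx', interpGauge,
          min_eq_left (le_of_lt (not_le.1 hx))]
        simp
    have hgs : Measurable fun x => ENNReal.ofReal t * ‖s.indicator f x‖ₑ ^ 2 :=
      (((hf.indicator hsm).enorm).pow_const 2).const_mul _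
    refine (lintegral_mono hpt).trans ?_
    rw [lintegral_const_mul' _ _ (by simp), lintegral_add_left hgm,
      lintegral_const_mul' _ _ ENNReal.ofReal_ne_top]
    refine (mul_le_mul_right (add_le_add (mul_le_mul_right (h₁ _ hg) _)
      (h₀ _ (hf.indicator hsm.compl) hh)) _).trans (le_of_eq ?_)
    rw [← lintegral_congr hsplit, lintegral_add_left hgs,
      lintegral_const_mul' _ _ ENNReal.ofReal_ne_top, ← mul_assoc (ENNReal.ofReal (k * t)),
      ← ENNReal.ofReal_mul (mul_pos hk0 ht).le, ENNReal.ofReal_mul (p := 4) (by norm_num),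
      ENNReal.ofReal_ofNat, show k * t * A₁ = A₀ * t by rw [hk]; field_simp,
      ENNReal.ofReal_mul hA₀.le]
    ring
  have hswap : ∀ (τ : ℝ) (g : ℝ × ℝ → ℝ≥0∞), Measurable g →
      ∫⁻ t in Ioi (0:ℝ), ENNReal.ofReal (t ^ (-η - 1)) * ∫⁻ x, interpGauge p₀ (τ * t) (g x) =
        ∫⁻ x, ∫⁻ t in Ioi (0:ℝ), ENNReal.ofReal (t ^ (-η - 1)) *
          interpGauge p₀ (τ * t) (g x) := fun τ g hg => by
    have hmeas : Measurable fun z : ℝ × (ℝ × ℝ) =>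
        ENNReal.ofReal (z.1 ^ (-η - 1)) * interpGauge p₀ (τ * z.1) (g z.2) := by
      unfold interpGauge
      fun_prop
    rw [← lintegral_lintegral_swap (μ := volume.restrict (Ioi (0:ℝ))) (ν := volume)
      (f := fun t x => ENNReal.ofReal (t ^ (-η - 1)) * interpGauge p₀ (τ * t) (g x))
      hmeas.aemeasurable]
    exact lintegral_congr fun t => (lintegral_const_mul' _ _ ENNReal.ofReal_ne_top).symm
  have hleft : ∀ s : ℝ≥0∞, ∫⁻ t in Ioi (0:ℝ), ENNReal.ofReal (t ^ (-η - 1)) *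
      interpGauge p₀ (k * t) s = ENNReal.ofReal (k ^ η) * (c * s ^ p) := fun s => by
    have h := lintegral_Ioi_comp_mul_left
      (fun t => ENNReal.ofReal (t ^ (-η - 1)) * interpGauge p₀ t s) hk0
    have e : ∀ t ∈ Ioi (0:ℝ), ENNReal.ofReal (t ^ (-η - 1)) * interpGauge p₀ (k * t) s =
        ENNReal.ofReal (k ^ (η + 1)) *
          (ENNReal.ofReal ((k * t) ^ (-η - 1)) * interpGauge p₀ (k * t) s) := fun t ht => by
      rw [← mul_assoc, ← ENNReal.ofReal_mul (by positivity), Real.mul_rpow hk0.le (le_of_lt ht),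
        ← mul_assoc, ← Real.rpow_add hk0, show η + 1 + (-η - 1) = 0 by ring, Real.rpow_zero,
        one_mul]
    rw [setLIntegral_congr_fun measurableSet_Ioi e, lintegral_const_mul' _ _ ENNReal.ofReal_ne_top,
      h, lintegral_interpGauge hp₀ hp hp0, ← mul_assoc,
      ← ENNReal.ofReal_mul (by positivity), ← Real.rpow_neg_one, ← Real.rpow_add hk0,
      show η + 1 + -1 = η by ring]
  have hright : ∫⁻ t in Ioi (0:ℝ), ENNReal.ofReal (t ^ (-η - 1)) *
      ∫⁻ x, interpGauge p₀ t ‖f x‖ₑ = ∫⁻ x, c * ‖f x‖ₑ ^ p := by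
    have h := hswap 1 (fun x => ‖f x‖ₑ) hfe
    simp only [one_mul] at h
    exact h.trans (lintegral_congr fun x => lintegral_interpGauge hp₀ hp hp0 _)
  have hmain : ENNReal.ofReal (k ^ η) * (c * ∫⁻ x, T f x ^ p) ≤
      ENNReal.ofReal (4 * A₀) * (c * ∫⁻ x, ‖f x‖ₑ ^ p) := by
    have hcT : c ≠ ⊤ := lintegral_interpGauge_one_ne_top p₀ hη hη1
    rw [← lintegral_const_mul' c _ hcT, ← lintegral_const_mul' c _ hcT,
      ← lintegral_const_mul' (ENNReal.ofReal (k ^ η)) _ ENNReal.ofReal_ne_top,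
      ← lintegral_congr fun x => hleft (T f x), ← hswap k _ hTf, ← hright,
      ← lintegral_const_mul' (ENNReal.ofReal (4 * A₀)) _ ENNReal.ofReal_ne_top]
    refine setLIntegral_mono' measurableSet_Ioi fun t ht =>
      (mul_le_mul_right (hkey t ht) _).trans (le_of_eq ?_)
    rw [mul_left_comm]
  have hc0 : c ≠ 0 := lintegral_interpGauge_one_ne_zero p₀ η
  have hcT : c ≠ ⊤ := lintegral_interpGauge_one_ne_top p₀ hη hη1
  have hm2 : c * (ENNReal.ofReal (k ^ η) * ∫⁻ x, T f x ^ p) ≤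
      c * (ENNReal.ofReal (4 * A₀) * ∫⁻ x, ‖f x‖ₑ ^ p) := by
    rw [mul_left_comm c, mul_left_comm c]
    exact hmain
  have hm3 := (ENNReal.mul_le_mul_iff_right hc0 hcT).1 hm2
  have e1 : 4 * (A₀ ^ (1 - η) * A₁ ^ η) = (k ^ η)⁻¹ * (4 * A₀) := by
    rw [hk, Real.div_rpow hA₀.le hA₁.le, Real.rpow_sub hA₀, Real.rpow_one]
    field_simp
  have e2 : ENNReal.ofReal (k ^ η)⁻¹ * ENNReal.ofReal (k ^ η) = 1 := by
    rw [← ENNReal.ofReal_mul (by positivity), inv_mul_cancel₀ (by positivity), ENNReal.ofReal_one]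
  calc ∫⁻ x, T f x ^ p
      = ENNReal.ofReal (k ^ η)⁻¹ * (ENNReal.ofReal (k ^ η) * ∫⁻ x, T f x ^ p) := by
        rw [← mul_assoc, e2, one_mul]
    _ ≤ ENNReal.ofReal (k ^ η)⁻¹ * (ENNReal.ofReal (4 * A₀) * ∫⁻ x, ‖f x‖ₑ ^ p) :=
        mul_le_mul_right hm3 _
    _ = _ := by rw [← mul_assoc, ← ENNReal.ofReal_mul (by positivity), e1]

lemma curveOp_eq_multOp (a : ℕ → ℝ × ℝ → ℝ) (c b : ℝ) (χ : ℝ → ℝ) (l : ℕ) (j : ℤ) (u : ℝ)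
    (f : ℝ × ℝ → ℂ) :
    curveOp a c b χ l j u f =
      multOp (curveSymbol a c b χ l) (2 ^ j) (u * ((2:ℝ) ^ j) ^ b) f := by
  unfold curveOp multOp curveSymbol shell
  simp only [mul_assoc]

lemma FT_add {f g : ℝ × ℝ → ℂ} (hf : Integrable f) (hg : Integrable g) (ξ : ℝ × ℝ) :
    FT (f + g) ξ = FT f ξ + FT g ξ := by
  have h : ∀ {k : ℝ × ℝ → ℂ}, Integrable k → Integrable fun x : ℝ × ℝ =>
      Complex.exp (((-(2 * Real.pi * (x.1 * ξ.1 + x.2 * ξ.2)) : ℝ) : ℂ) * Complex.I) * k x :=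
    fun hk => hk.bdd_mul (c := 1) (by fun_prop)
      (ae_of_all _ fun x => (Complex.norm_exp_ofReal_mul_I _).le)
  refine Eq.trans ?_ (integral_add (h hf) (h hg))
  simp only [FT, Pi.add_apply, mul_add]

lemma multOp_add {m f g : ℝ × ℝ → ℂ} (hm : Continuous m) {R : ℝ}
    (hs : ∀ z, m z ≠ 0 → |z.1| ≤ R ∧ |z.2| ≤ R) (hf : Integrable f) (hg : Integrable g)
    {α β : ℝ} (hα : 0 < α) (hβ : 0 < β) (x : ℝ × ℝ) :
    multOp m α β (f + g) x = multOp m α β f x + multOp m α β g x := by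
  simp only [multOp, FTinv_eq_FT_neg]
  rw [← FT_add (integrable_dilate_mul_FT hm hs hf hα hβ) (integrable_dilate_mul_FT hm hs hg hα hβ)]
  congr 1
  funext ξ
  rw [Pi.add_apply, FT_add hf hg, mul_add]

section CurveMax

variable {a : ℕ → ℝ × ℝ → ℝ} {c b κ C : ℝ} {χ : ℝ → ℝ} {l : ℕ} {U : Set ℝ}
  {d : ℝ × ℝ → ℂ} {f g : ℝ × ℝ → ℂ}

lemma measurable_curveMax (hm : ShellMult (curveSymbol a c b χ l) d κ C l) (hU : U ⊆ Ioi 0)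
    (hf : Integrable f) : Measurable (curveMax a c b χ l U f) := by
  refine LowerSemicontinuous.measurable (lowerSemicontinuous_iSup fun u =>
    lowerSemicontinuous_iSup fun j => Continuous.lowerSemicontinuous ?_)
  have hu : 0 < (u : ℝ) := hU u.2
  rw [curveOp_eq_multOp]
  exact (continuous_multOp hm.continuous hm.abs_le hf (by positivity) (by positivity)).enorm

lemma curveMax_add_le (hm : ShellMult (curveSymbol a c b χ l) d κ C l) (hU : U ⊆ Ioi 0)
    (hf : Integrable f) (hg : Integrable g) (x : ℝ × ℝ) :
    curveMax a c b χ l U (f + g) x ≤ curveMax a c b χ l U f x + curveMax a c b χ l U g x := by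
  refine iSup₂_le fun u j => ?_
  have hu : 0 < (u : ℝ) := hU u.2
  have h : curveOp a c b χ l j u (f + g) x =
      curveOp a c b χ l j u f x + curveOp a c b χ l j u g x := by
    simp only [curveOp_eq_multOp]
    exact multOp_add hm.continuous hm.abs_le hf hg (by positivity) (by positivity) x
  rw [h]
  exact (enorm_add_le _ _).trans (add_le_add
    (le_iSup₂ (f := fun (u : U) (j : ℤ) => ‖curveOp a c b χ l j u f x‖ₑ) u j)
    (le_iSup₂ (f := fun (u : U) (j : ℤ) => ‖curveOp a c b χ l j u g x‖ₑ) u j))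

end CurveMax

theorem AmpBound.lintegral_curveMax_sq_le {a : ℕ → ℝ × ℝ → ℝ} {κ C : ℝ} (ha : AmpBound a κ C)
    {c b : ℝ} (hc : c ≠ 0) (hb : 1 < b) {χ : ℝ → ℝ} (hχ : ContDiff ℝ 1 χ)
    (hχs : ∀ t, t ∉ Ioo (1 / 2 : ℝ) 2 → χ t = 0) :
    ∃ A : ℝ, 0 ≤ A ∧ ∀ l : ℕ, 1 ≤ l → ∀ U : Set ℝ, U ⊆ Ioi (0:ℝ) → ∀ N : ℕ,
      (∀ r : ℝ, 0 < r → covN (UrSet U r) ((2:ℝ) ^ l)⁻¹ ≤ N) →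
      ∀ f : ℝ × ℝ → ℂ, Integrable f →
      ∫⁻ x, curveMax a c b χ l U f x ^ 2 ≤
        ENNReal.ofReal (A * ((2:ℝ) ^ l)⁻¹ * N) * ∫⁻ x, ‖f x‖ₑ ^ 2 := by
  obtain ⟨C', hC', hm⟩ := ha.exists_shellMult hc hb hχ hχs
  obtain ⟨k, hk⟩ := pow_unbounded_of_one_lt (8 / κ) (one_lt_two (α := ℝ))
  have hκ : 0 < κ := (hm 0).pos
  have hk' : 8 ≤ 2 ^ k * κ := ((div_lt_iff₀ hκ).1 hk).le
  refine ⟨2 * ((2 * k + 1 : ℕ) * ((2 * k + 1 : ℕ) * (34 * C'))), by positivity, ?_⟩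
  intro l hl U hU N hN f hf
  have h := (hm l).lintegral_iSup_multOp_sq_le hl hC' b hk' hU hN hf
  unfold curveMax
  simp only [curveOp_eq_multOp]
  refine h.trans (le_of_eq ?_)
  congr 1
  rw [← ENNReal.ofReal_natCast, ← ENNReal.ofReal_natCast, ← ENNReal.ofReal_ofNat,
    ← ENNReal.ofReal_mul (by positivity), ← ENNReal.ofReal_mul (by positivity),
    ← ENNReal.ofReal_mul (by positivity), ← ENNReal.ofReal_mul (by positivity)]
  congr 1
  ring

lemma thickConst_le {A q : ℝ} {l : ℕ} (hA : 1 ≤ A) (hq : 0 < q) (hq1 : q ≤ 1) (hl : 1 ≤ l)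
    (hlq : l * q ≤ 1) :
    64 * (A * (l + 1) ^ (4 / 3 : ℝ) / (1 - 1 / (1 + q)) ^ 2 *
      2 ^ (4 * l * (1 - 1 / (1 + q)))) ^ 2 + (160 / q) ^ 2 ≤
      (64 * (256 * A) ^ 2 + 160 ^ 2) * q ^ (-(20 / 3) : ℝ) := by
  have hl' : (1:ℝ) ≤ l := by exact_mod_cast hl
  have h1 : 1 - 1 / (1 + q) = q / (1 + q) := by field_simp; ring
  have h2 : q / 2 ≤ q / (1 + q) := by gcongr; linarith
  have h3 : q / (1 + q) ≤ q := div_le_self hq.le (by linarith)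
  have h4 : ((l:ℝ) + 1) ^ (4 / 3 : ℝ) ≤ 4 * q ^ (-(4 / 3) : ℝ) := by
    have : (l:ℝ) + 1 ≤ 2 * q⁻¹ := by
      rw [← div_eq_mul_inv, le_div_iff₀ hq]
      linarith
    calc ((l:ℝ) + 1) ^ (4 / 3 : ℝ) ≤ (2 * q⁻¹) ^ (4 / 3 : ℝ) := by gcongr
      _ = 2 ^ (4 / 3 : ℝ) * q ^ (-(4 / 3) : ℝ) := by
        rw [Real.mul_rpow two_pos.le (by positivity), Real.inv_rpow hq.le, ← Real.rpow_neg hq.le]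
      _ ≤ 2 ^ (2 : ℝ) * q ^ (-(4 / 3) : ℝ) := by
        gcongr
        · norm_num
        · norm_num
      _ = _ := by norm_num
  have h5 : (2:ℝ) ^ (4 * l * (q / (1 + q))) ≤ 16 := by
    calc (2:ℝ) ^ (4 * l * (q / (1 + q))) ≤ 2 ^ (4 : ℝ) := by
          refine Real.rpow_le_rpow_of_exponent_le one_le_two ?_
          have : (l:ℝ) * (q / (1 + q)) ≤ l * q := by gcongr
          linarith
      _ = 16 := by norm_num
  have h6 : A * (l + 1) ^ (4 / 3 : ℝ) / (q / (1 + q)) ^ 2 * 2 ^ (4 * l * (q / (1 + q))) ≤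
      256 * A * q ^ (-(10 / 3) : ℝ) := by
    calc A * (l + 1) ^ (4 / 3 : ℝ) / (q / (1 + q)) ^ 2 * 2 ^ (4 * l * (q / (1 + q)))
        ≤ A * (4 * q ^ (-(4 / 3) : ℝ)) / (q / 2) ^ 2 * 16 := by gcongr
      _ = 256 * A * (q ^ (-(4 / 3) : ℝ) * q ^ (-2 : ℝ)) := by
        rw [Real.rpow_neg hq.le 2, Real.rpow_two]
        field_simp
        ring
      _ = _ := by
        rw [← Real.rpow_add hq]
        norm_num
  have h7 : (160 / q) ^ 2 ≤ 160 ^ 2 * q ^ (-(20 / 3) : ℝ) := by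
    rw [div_pow, div_eq_mul_inv, ← Real.rpow_two q, ← Real.rpow_neg hq.le]
    exact mul_le_mul_of_nonneg_left
      (Real.rpow_le_rpow_of_exponent_ge hq hq1 (by norm_num)) (by norm_num)
  rw [h1]
  calc _ ≤ 64 * (256 * A * q ^ (-(10 / 3) : ℝ)) ^ 2 + 160 ^ 2 * q ^ (-(20 / 3) : ℝ) := by gcongr
    _ = _ := by
      rw [mul_pow, ← Real.rpow_mul_natCast hq.le]
      norm_num
      ring

lemma rpow_neg_le_theta_rpow {p : ℝ} {l : ℕ} (hp : 1 < p) (hp2 : p ≤ 2)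
    (hl : (l : ℝ) ≤ (p - 1)⁻¹) :
    (p - 1) ^ (-(20 / 3) : ℝ) ≤ 1458 * (theta p l ^ p * ((2:ℝ) ^ l)⁻¹ ^ (p - 1)) := by
  have hq : 0 < p - 1 := by linarith
  have h1 : theta p l ^ p = (p - 1) ^ (3 * p - 10) := by
    rw [theta, if_pos hl, ← Real.rpow_mul hq.le]
    congr 1
    field_simp
  have h2 : 1 / 2 ≤ ((2:ℝ) ^ l)⁻¹ ^ (p - 1) := by
    rw [← Real.rpow_natCast, ← Real.rpow_neg two_pos.le, ← Real.rpow_mul two_pos.le]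
    calc (1:ℝ) / 2 = 2 ^ (-1 : ℝ) := by norm_num [Real.rpow_neg_one]
      _ ≤ _ := by
        refine Real.rpow_le_rpow_of_exponent_le one_le_two ?_
        have := mul_le_mul_of_nonneg_right hl hq.le
        rw [inv_mul_cancel₀ hq.ne'] at this
        linarith
  have h3 : 1 / 729 ≤ (p - 1) ^ (3 * (p - 1) - 1 / 3) := by
    by_cases h : p - 1 ≤ 1 / 9
    · exact le_trans (by norm_num) (Real.one_le_rpow_of_pos_of_le_one_of_nonpos hq (by linarith)
        (by linarith))
    · push Not at h
      calc (1:ℝ) / 729 = (1 / 9) ^ (3:ℝ) := by norm_num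
        _ ≤ (p - 1) ^ (3:ℝ) := by gcongr
        _ ≤ _ := Real.rpow_le_rpow_of_exponent_ge hq (by linarith) (by linarith)
  have h4 : (p - 1) ^ (3 * p - 10) =
      (p - 1) ^ (-(20 / 3) : ℝ) * (p - 1) ^ (3 * (p - 1) - 1 / 3) := by
    rw [← Real.rpow_add hq]
    congr 1
    ring
  rw [h1, h4]
  have h5 : 0 ≤ (p - 1) ^ (-(20 / 3) : ℝ) := by positivity
  calc (p - 1) ^ (-(20 / 3) : ℝ) =
      1458 * ((p - 1) ^ (-(20 / 3) : ℝ) * (1 / 729) * (1 / 2)) := by ring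
    _ ≤ _ := by gcongr

lemma rpow_interpolate_le_theta_rpow {p η : ℝ} {l : ℕ} (hl2 : 2 ≤ l) (hη : 0 < η) (hη1 : η < 1)
    (hp : p = (1 - η) * (1 + 1 / l) + 2 * η) (hl : ¬ (l : ℝ) ≤ (p - 1)⁻¹) :
    ((l : ℝ) ^ (20 / 3 : ℝ)) ^ (1 - η) * ((2:ℝ) ^ l)⁻¹ ^ η ≤
      2 * 21 ^ 7 * (theta p l ^ p * ((2:ℝ) ^ l)⁻¹ ^ (p - 1)) := by
  have hl0 : (2:ℝ) ≤ l := by exact_mod_cast hl2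
  have hl1 : (1:ℝ) ≤ l := by linarith
  have hlpos : (0:ℝ) < l := by linarith
  have hp1 : 1 < p := by
    have h : 0 < 1 / (l:ℝ) := by positivity
    have : p = 1 + (1 - η) * (1 / l) + η := by rw [hp]; ring
    nlinarith
  have h1 : theta p l ^ p = (l : ℝ) ^ (7 * ((1 - η) * (1 - 1 / l))) := by
    rw [theta, if_neg hl, ← Real.rpow_mul hlpos.le]
    congr 1
    have : 7 * (2 / p - 1) * p = 7 * (2 - p) := by field_simp
    rw [this, hp]
    ring
  have h2 : ((2:ℝ) ^ l)⁻¹ ^ (p - 1) = ((2:ℝ) ^ l)⁻¹ ^ η * 2 ^ (-(1 - η)) := by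
    rw [← Real.rpow_natCast, ← Real.rpow_neg two_pos.le, ← Real.rpow_mul two_pos.le,
      ← Real.rpow_mul two_pos.le, ← Real.rpow_add two_pos]
    congr 1
    rw [hp]
    field_simp
    ring
  have h3 : (1 / 2 : ℝ) ≤ 2 ^ (-(1 - η)) := by
    calc (1:ℝ) / 2 = 2 ^ (-1 : ℝ) := by norm_num [Real.rpow_neg_one]
      _ ≤ _ := Real.rpow_le_rpow_of_exponent_le one_le_two (by linarith)
  have h4 : ((l : ℝ) ^ (20 / 3 : ℝ)) ^ (1 - η) ≤
      21 ^ 7 * (l : ℝ) ^ (7 * ((1 - η) * (1 - 1 / l))) := by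
    have hη0 : 0 ≤ 1 - η := by linarith
    have hi : 1 / (l:ℝ) ≤ 1 := by rw [div_le_one hlpos]; exact hl1
    have hge : 1 ≤ (l : ℝ) ^ (7 * ((1 - η) * (1 - 1 / l))) :=
      Real.one_le_rpow hl1 (mul_nonneg (by norm_num) (mul_nonneg hη0 (by linarith)))
    rw [← Real.rpow_mul hlpos.le]
    by_cases h : l ≤ 21
    · have hl21 : (l:ℝ) ≤ 21 := by exact_mod_cast h
      calc (l : ℝ) ^ (20 / 3 * (1 - η)) ≤ (l : ℝ) ^ (7 : ℝ) :=
            Real.rpow_le_rpow_of_exponent_le hl1 (by linarith)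
        _ ≤ 21 ^ (7 : ℝ) := by gcongr
        _ = 21 ^ 7 * 1 := by norm_num
        _ ≤ _ := by gcongr
    · have hl21 : (21:ℝ) ≤ l := by exact_mod_cast (not_le.1 h).le
      have hi' : 1 / (l:ℝ) ≤ 1 / 21 := by gcongr
      calc (l : ℝ) ^ (20 / 3 * (1 - η)) ≤ (l : ℝ) ^ (7 * ((1 - η) * (1 - 1 / l))) := by
            refine Real.rpow_le_rpow_of_exponent_le hl1 ?_
            nlinarith
        _ ≤ _ := le_mul_of_one_le_left (by positivity) (by norm_num)
  rw [h1, h2]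
  calc ((l : ℝ) ^ (20 / 3 : ℝ)) ^ (1 - η) * ((2:ℝ) ^ l)⁻¹ ^ η
      ≤ 21 ^ 7 * (l : ℝ) ^ (7 * ((1 - η) * (1 - 1 / l))) * ((2:ℝ) ^ l)⁻¹ ^ η := by gcongr
    _ = 2 * 21 ^ 7 * ((l : ℝ) ^ (7 * ((1 - η) * (1 - 1 / l))) *
        (((2:ℝ) ^ l)⁻¹ ^ η * (1 / 2))) := by ring
    _ ≤ _ := by gcongr

theorem AmpBound.exists_curveMax_bounds {a : ℕ → ℝ × ℝ → ℝ} {κ C : ℝ} (ha : AmpBound a κ C)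
    {c b : ℝ} (hc : c ≠ 0) (hb : 1 < b) {χ : ℝ → ℝ} (hχ : ContDiff ℝ 1 χ)
    (hχs : ∀ t, t ∉ Ioo (1 / 2 : ℝ) 2 → χ t = 0) :
    ∃ K : ℝ, 1 ≤ K ∧ ∀ l : ℕ, 1 ≤ l → ∀ U : Set ℝ, U ⊆ Ioi (0:ℝ) → ∀ N : ℕ,
      (∀ r : ℝ, 0 < r → covN (UrSet U r) ((2:ℝ) ^ l)⁻¹ ≤ N) →
      (∀ f : ℝ × ℝ → ℂ, Integrable f → ∫⁻ x, curveMax a c b χ l U f x ^ 2 ≤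
        ENNReal.ofReal (K * ((2:ℝ) ^ l)⁻¹ * N) * ∫⁻ x, ‖f x‖ₑ ^ 2) ∧
      ∀ p : ℝ, 1 < p → p ≤ 2 → (l : ℝ) * (p - 1) ≤ 1 → ∀ f : ℝ × ℝ → ℂ, Measurable f →
        Integrable f → ∫⁻ x, curveMax a c b χ l U f x ^ p ≤
          ENNReal.ofReal (K * (p - 1) ^ (-(20 / 3) : ℝ) * N) * ∫⁻ x, ‖f x‖ₑ ^ p := by
  obtain ⟨A₁, hA₁, h₁⟩ := ha.lintegral_curveMax_sq_le hc hb hχ hχs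
  have hcs : HasCompactSupport χ := HasCompactSupport.intro (K := Icc (1 / 2) 2) isCompact_Icc
    fun t ht => hχs t fun h => ht (Ioo_subset_Icc_self h)
  obtain ⟨X, hX⟩ := hcs.exists_bound_of_continuous hχ.continuous
  obtain ⟨A₂, hA₂, h₂⟩ := ha.lintegral_curveMax_rpow_le c hb hχ.continuous.measurable hχs
    (X := X) fun t => by simpa using hX t
  obtain ⟨A, hA, hthick⟩ := exists_thickBound hc hb
  set L : ℝ := 64 * (256 * A) ^ 2 + 160 ^ 2 with hL
  have hL0 : 0 ≤ L := by positivity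
  have hK0 : 0 ≤ A₂ * L := by positivity
  refine ⟨A₁ + A₂ * L + 1, by linarith, ?_⟩
  intro l hl U hU N hN
  refine ⟨fun f hf => (h₁ l hl U hU N hN f hf).trans ?_, ?_⟩
  · refine mul_le_mul_left (ENNReal.ofReal_le_ofReal ?_) _
    gcongr
    linarith
  · intro p hp hp2 hlp f hfm hf
    refine (h₂ l hl p hp hp2 _ (hthick l p hp hp2) U hU N hN f hfm hf).trans
      (mul_le_mul_left ?_ _)
    have hq : 0 < p - 1 := by linarith
    have hB := thickConst_le hA hq (by linarith) hl hlp
    rw [add_sub_cancel] at hB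
    have e : 64 * ENNReal.ofReal ((A * (l + 1) ^ (4 / 3 : ℝ) / (1 - 1 / p) ^ 2 *
        2 ^ (4 * l * (1 - 1 / p))) ^ 2) + (160 / ENNReal.ofReal (p - 1)) ^ 2 =
        ENNReal.ofReal (64 * (A * (l + 1) ^ (4 / 3 : ℝ) / (1 - 1 / p) ^ 2 *
          2 ^ (4 * l * (1 - 1 / p))) ^ 2 + (160 / (p - 1)) ^ 2) := by
      rw [ENNReal.ofReal_add (by positivity) (by positivity), ENNReal.ofReal_mul (by norm_num),
        ENNReal.ofReal_pow (by positivity) 2, ENNReal.ofReal_pow (p := 160 / (p - 1))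
        (by positivity) 2, ENNReal.ofReal_div_of_pos hq]
      simp
    rw [e, ← ENNReal.ofReal_natCast, ← ENNReal.ofReal_mul hA₂, ← ENNReal.ofReal_mul (by positivity)]
    refine ENNReal.ofReal_le_ofReal ?_
    have hr : 0 ≤ (p - 1) ^ (-(20 / 3) : ℝ) := by positivity
    calc _ ≤ A₂ * N * (L * (p - 1) ^ (-(20 / 3) : ℝ)) := by gcongr
      _ = A₂ * L * (p - 1) ^ (-(20 / 3) : ℝ) * N := by ring
      _ ≤ _ := by
        gcongr
        linarith

theorem AmpBound.exists_curveMax_bound {a : ℕ → ℝ × ℝ → ℝ} {κ C : ℝ} (ha : AmpBound a κ C)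
    {c b : ℝ} (hc : c ≠ 0) (hb : 1 < b) {χ : ℝ → ℝ} (hχ : ContDiff ℝ 1 χ)
    (hχs : ∀ t, t ∉ Ioo (1 / 2 : ℝ) 2 → χ t = 0) :
    ∃ M : ℝ, 1 ≤ M ∧ ∀ l : ℕ, 1 ≤ l → ∀ p : ℝ, 1 < p → p ≤ 2 → ∀ U : Set ℝ, U ⊆ Ioi (0:ℝ) →
      ∀ N : ℕ, (∀ r : ℝ, 0 < r → covN (UrSet U r) ((2:ℝ) ^ l)⁻¹ ≤ N) →
      ∀ f : ℝ × ℝ → ℂ, Measurable f → Integrable f →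
      ∫⁻ x, curveMax a c b χ l U f x ^ p ≤
        ENNReal.ofReal (M * (theta p l ^ p * ((2:ℝ) ^ l)⁻¹ ^ (p - 1) * N)) *
          ∫⁻ x, ‖f x‖ₑ ^ p := by
  obtain ⟨C', -, hm⟩ := ha.exists_shellMult hc hb hχ hχs
  obtain ⟨K, hK, h⟩ := ha.exists_curveMax_bounds hc hb hχ hχs
  refine ⟨8 * 21 ^ 7 * K, by linarith, ?_⟩
  intro l hl p hp hp2 U hU N hN f hfm hf
  obtain ⟨h₁, h₀⟩ := h l hl U hU N hN
  have hl1 : (1:ℝ) ≤ l := by exact_mod_cast hl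
  have hlpos : (0:ℝ) < l := by linarith
  have hq : 0 < p - 1 := by linarith
  have hθ : 0 ≤ theta p l ^ p * ((2:ℝ) ^ l)⁻¹ ^ (p - 1) := by
    have : 0 ≤ theta p l := by
      unfold theta
      split_ifs <;> positivity
    positivity
  by_cases hlp : (l : ℝ) ≤ (p - 1)⁻¹
  · refine (h₀ p hp hp2 ((le_div_iff₀ hq).1 (by rwa [one_div])) f hfm hf).trans
      (mul_le_mul_left (ENNReal.ofReal_le_ofReal ?_) _)
    have := rpow_neg_le_theta_rpow hp hp2 hlp
    calc K * (p - 1) ^ (-(20 / 3) : ℝ) * N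
        ≤ K * (1458 * (theta p l ^ p * ((2:ℝ) ^ l)⁻¹ ^ (p - 1))) * N := by gcongr
      _ = 1458 * K * (theta p l ^ p * ((2:ℝ) ^ l)⁻¹ ^ (p - 1) * N) := by ring
      _ ≤ _ := by
        gcongr
        norm_num
  have hl2 : 2 ≤ l := by
    rcases hl.eq_or_lt with h' | h'
    · refine absurd ((one_le_inv₀ hq).2 (by linarith)) ?_
      rwa [← h', Nat.cast_one] at hlp
    · exact h'
  rcases hp2.eq_or_lt with rfl | hp2
  · have e : theta 2 l = 1 := by
      rw [theta, if_neg hlp]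
      norm_num
    have h2 := h₁ f hf
    simp only [ENNReal.rpow_ofNat]
    refine h2.trans (mul_le_mul_left (ENNReal.ofReal_le_ofReal ?_) _)
    rw [e, Real.one_rpow, one_mul, show (2:ℝ) - 1 = 1 by norm_num, Real.rpow_one, mul_assoc]
    gcongr
    linarith
  rcases Nat.eq_zero_or_pos N with rfl | hN0
  · have h2 : ∫⁻ x, curveMax a c b χ l U f x ^ 2 = 0 := by
      have := h₁ f hf
      rwa [Nat.cast_zero, mul_zero, ENNReal.ofReal_zero, zero_mul, nonpos_iff_eq_zero] at this
    rw [lintegral_eq_zero_iff ((measurable_curveMax (hm l) hU hf).pow_const 2)] at h2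
    refine le_of_eq_of_le ((lintegral_congr_ae ?_).trans lintegral_zero) zero_le
    filter_upwards [h2] with x hx
    rw [pow_eq_zero_iff two_ne_zero |>.1 hx, ENNReal.zero_rpow_of_pos (by linarith)]
  have hN1 : (0:ℝ) < N := by exact_mod_cast hN0
  have hl2' : (2:ℝ) ≤ l := by exact_mod_cast hl2
  have hi : 1 / (l:ℝ) ≤ 1 / 2 := by gcongr
  have hi0 : 0 < 1 / (l:ℝ) := by positivity
  have hip : 1 / (l:ℝ) < p - 1 := by
    rw [one_div]
    exact inv_lt_of_inv_lt₀ hq (not_le.1 hlp)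
  have hd : 0 < 1 - 1 / (l:ℝ) := by linarith
  set η : ℝ := (p - (1 + 1 / l)) / (1 - 1 / l) with hη
  have hη0 : 0 < η := div_pos (by linarith) hd
  have hη1 : η < 1 := (div_lt_one hd).2 (by linarith)
  have hpη : p = (1 - η) * (1 + 1 / l) + 2 * η := by
    have : η * (1 - 1 / l) = p - (1 + 1 / l) := div_mul_cancel₀ _ hd.ne'
    linarith
  have e0 : ((1 + 1 / (l:ℝ)) - 1) ^ (-(20 / 3) : ℝ) = (l:ℝ) ^ (20 / 3 : ℝ) := by
    rw [add_sub_cancel_left, one_div, Real.inv_rpow hlpos.le, Real.rpow_neg hlpos.le, inv_inv]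
  have hfin := lintegral_rpow_le_of_interpolation (T := curveMax a c b χ l U)
    (p₀ := 1 + 1 / l) (A₀ := K * (l:ℝ) ^ (20 / 3 : ℝ) * N) (A₁ := K * ((2:ℝ) ^ l)⁻¹ * N)
    (by linarith) (by linarith) hη0 hη1 hpη (by positivity) (by positivity)
    (fun g hg => measurable_curveMax (hm l) hU hg)
    (fun g k hg hk x => curveMax_add_le (hm l) hU hg hk x)
    (fun g hgm hg => by
      have := h₀ (1 + 1 / l) (by linarith) (by linarith)
        (by rw [add_sub_cancel_left, mul_one_div, div_self hlpos.ne']) g hgm hg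
      rwa [e0] at this)
    h₁ hfm hf
  refine hfin.trans (mul_le_mul_left (ENNReal.ofReal_le_ofReal ?_) _)
  have hη' : 0 ≤ 1 - η := by linarith
  have e1 : (K * (l:ℝ) ^ (20 / 3 : ℝ) * N) ^ (1 - η) * (K * ((2:ℝ) ^ l)⁻¹ * N) ^ η =
      K * N * (((l : ℝ) ^ (20 / 3 : ℝ)) ^ (1 - η) * ((2:ℝ) ^ l)⁻¹ ^ η) := by
    rw [mul_right_comm K _ (N:ℝ), mul_right_comm K _ (N:ℝ), Real.mul_rpow (by positivity) (by positivity),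
      Real.mul_rpow (x := K * N) (y := ((2:ℝ) ^ l)⁻¹) (by positivity) (by positivity),
      mul_mul_mul_comm, ← Real.rpow_add (by positivity), sub_add_cancel, Real.rpow_one]
  rw [e1]
  calc 4 * (K * N * (((l : ℝ) ^ (20 / 3 : ℝ)) ^ (1 - η) * ((2:ℝ) ^ l)⁻¹ ^ η))
      ≤ 4 * (K * N * (2 * 21 ^ 7 * (theta p l ^ p * ((2:ℝ) ^ l)⁻¹ ^ (p - 1)))) :=
        mul_le_mul_of_nonneg_left (mul_le_mul_of_nonneg_left
          (rpow_interpolate_le_theta_rpow hl2 hη0 hη1 hpη hlp) (by positivity)) (by norm_num)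
    _ = _ := by ring

lemma tauHat_eq_curveMul (b cp cm : ℝ) {χ : ℝ → ℝ}
    (hχs : ∀ t : ℝ, t ∉ Ioo (1 / 2 : ℝ) 2 → χ t = 0) (ξ : ℝ × ℝ) :
    tauHat b cp cm χ ξ = curveMul (powCurve cp b) χ ξ := by
  refine integral_congr_ae (ae_of_all _ fun t => ?_)
  dsimp only
  by_cases ht : t ∈ Ioo (1 / 2 : ℝ) 2
  · have h0 : 0 < t := by linarith [ht.1]
    rw [curve, if_pos h0, powCurve]
  · rw [hχs t ht, Complex.ofReal_zero, mul_zero, mul_zero]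

lemma Ajl_eq_curveOp (b cp cm : ℝ) {χ : ℝ → ℝ}
    (hχs : ∀ t : ℝ, t ∉ Ioo (1 / 2 : ℝ) 2 → χ t = 0) (η : ℝ × ℝ → ℝ) (ς : ℝ → ℝ)
    (ζ : ℝ × ℝ → ℝ) (j : ℤ) (l : ℕ) (u : ℝ) (f : ℝ × ℝ → ℝ) :
    Ajl b cp cm χ η ς ζ j l u f =
      curveOp (amp cp η ς ζ) cp b χ l (-j) u fun x => ((f x : ℝ) : ℂ) := by
  have h2 : (2:ℝ) ^ (-(j:ℝ)) = (2:ℝ) ^ (-j) := by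
    rw [← Int.cast_neg, Real.rpow_intCast]
  have hd : ∀ ξ, dil b j u ξ = ((2:ℝ) ^ (-j) * ξ.1, u * ((2:ℝ) ^ (-j)) ^ b * ξ.2) := by
    intro ξ
    rw [dil, ← neg_mul, Real.rpow_mul zero_le_two, h2]
    congr 1
    ring
  unfold Ajl curveOp
  congr 1
  funext ξ
  congr 1
  rw [rhoHat, ← mul_assoc, ← Complex.ofReal_mul, zl_mul_eq_amp, tauHat_eq_curveMul b cp cm hχs, hd,
    shell]
  simp only [Prod.smul_mk, smul_eq_mul, mul_assoc]

lemma exists_covN_le_Kp (U : Set ℝ) {δ p : ℝ} (hδ : 0 < δ) (hp : 0 ≤ p) :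
    ∃ N : ℕ, (∀ r : ℝ, 0 < r → covN (UrSet U r) δ ≤ N) ∧
      δ ^ (1 - 1 / p) * (N : ℝ) ^ (1 / p) ≤ Kp U δ p := by
  have hb : ∀ r, covN (UrSet U r) δ ≤ ⌊δ⁻¹⌋₊ + 1 := fun r => covN_le (UrSet_subset U r) hδ
  have hbdd : BddAbove (range fun r : {r : ℝ // 0 < r} => covN (UrSet U r) δ) :=
    ⟨_, forall_mem_range.2 fun r => hb r⟩
  have : Nonempty {r : ℝ // 0 < r} := ⟨⟨1, one_pos⟩⟩
  obtain ⟨r₀, hr₀⟩ := Nat.sSup_mem (range_nonempty _) hbdd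
  refine ⟨covN (UrSet U r₀) δ, fun r hr => ?_, mul_le_mul_of_nonneg_left
    (le_ciSup (f := fun r : {r : ℝ // 0 < r} => (covN (UrSet U r) δ : ℝ) ^ (1 / p)) ?_ r₀)
    (by positivity)⟩
  · exact (le_csSup hbdd ⟨⟨r, hr⟩, rfl⟩).trans hr₀.ge
  · refine ⟨((⌊δ⁻¹⌋₊ + 1 : ℕ) : ℝ) ^ (1 / p), forall_mem_range.2 fun r => ?_⟩
    have : (covN (UrSet U r) δ : ℝ) ≤ (⌊δ⁻¹⌋₊ + 1 : ℕ) := by exact_mod_cast hb r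
    exact Real.rpow_le_rpow (by positivity) this (by positivity)

lemma theta_nonneg {p : ℝ} (hp : 1 ≤ p) (l : ℕ) : 0 ≤ theta p l := by
  have : 0 ≤ p - 1 := by linarith
  unfold theta
  split_ifs <;> positivity

theorem statement10 (b cp cm : ℝ) (hb : 1 < b) (hcp : cp ≠ 0) (hcm : cm ≠ 0)
    (χp : ℝ → ℝ) (hχsm : ContDiff ℝ (⊤ : ℕ∞) χp)
    (hχsupp : ∀ t : ℝ, t ∉ Ioo (1/2 : ℝ) 2 → χp t = 0)
    (hχsum : ∀ t : ℝ, 0 < t → HasSum (fun j : ℤ => χp ((2:ℝ) ^ j * t)) 1)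
    (η : ℝ × ℝ → ℝ) (hηsm : ContDiff ℝ (⊤ : ℕ∞) η)
    (hηsupp : ∀ ξ : ℝ × ℝ, (100:ℝ)^2 < ξ.1^2 + ξ.2^2 → η ξ = 0)
    (hηone : ∀ ξ : ℝ × ℝ, ξ.1^2 + ξ.2^2 ≤ (50:ℝ)^2 → η ξ = 1)
    (ςm : ℝ → ℝ) (hςmsm : ContDiff ℝ (⊤ : ℕ∞) ςm)
    (hςmsupp : ∀ v : ℝ, v ∉ Ioo (-(b * (4:ℝ) ^ (b-1))) (-(b * (4:ℝ)⁻¹ ^ (b-1))) → ςm v = 0)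
    (hςmone : ∀ v ∈ Icc (-(b * ((7:ℝ)/2) ^ (b-1))) (-(b * ((2:ℝ)/7) ^ (b-1))), ςm v = 1)
    (ζ : ℝ × ℝ → ℝ) (hζsm : ContDiff ℝ (⊤ : ℕ∞) ζ)
    (hζsupp : ∀ ξ : ℝ × ℝ, (4:ℝ) ≤ ξ.1^2 + ξ.2^2 → ζ ξ = 0)
    (hζone : ∀ ξ : ℝ × ℝ, ξ.1^2 + ξ.2^2 ≤ ((5:ℝ)/4)^2 → ζ ξ = 1) :
    ∃ C : ℝ, ∀ l : ℕ, 1 ≤ l → ∀ p : ℝ, 1 < p → p ≤ 2 →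
      ∀ U : Set ℝ, U.Nonempty → U ⊆ Ioi (0:ℝ) →
      ∀ f : SchwartzMap (ℝ × ℝ) ℝ,
        lpN (fun x => ⨆ (u : U) (j : ℤ),
            ((‖Ajl b cp cm χp η ςm ζ j l (u : ℝ) ⇑f x‖₊ : ℝ≥0∞))) p
          ≤ ENNReal.ofReal (C * theta p l * Kp U ((2:ℝ) ^ (-(l : ℝ))) p)
              * eLpNorm ⇑f (eN p) volume := by

  have hχ1 : ContDiff ℝ 1 χp := hχsm.of_le (by exact_mod_cast le_top)
  obtain ⟨κ, C, ha⟩ := exists_ampBound hb hcp hηsm hηsupp hςmsm hςmsupp hζsm hζsupp hζone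
  obtain ⟨M, hM, h⟩ := ha.exists_curveMax_bound hcp hb hχ1 hχsupp
  refine ⟨M, fun l hl p hp hp2 U _ hU f => ?_⟩
  have hp0 : 0 < p := by linarith
  have hδ : (2:ℝ) ^ (-(l:ℝ)) = ((2:ℝ) ^ l)⁻¹ := by
    rw [Real.rpow_neg zero_le_two, Real.rpow_natCast]
  have hδ0 : 0 < ((2:ℝ) ^ l)⁻¹ := by positivity
  obtain ⟨N, hN, hK⟩ := exists_covN_le_Kp U hδ0 hp0.le
  have hθ := theta_nonneg hp.le l
  set F : ℝ × ℝ → ℂ := fun x => ((f x : ℝ) : ℂ) with hF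
  have hFm : Measurable F := Complex.measurable_ofReal.comp f.continuous.measurable
  have hFi : Integrable F := f.integrable.ofReal
  have hsup : ∀ x, (⨆ (u : U) (j : ℤ), ((‖Ajl b cp cm χp η ςm ζ j l (u : ℝ) ⇑f x‖₊ : ℝ≥0∞))) =
      curveMax (amp cp η ςm ζ) cp b χp l U F x := by
    intro x
    refine iSup_congr fun u => ?_
    rw [← (Equiv.neg ℤ).iSup_comp]
    refine iSup_congr fun j => ?_
    rw [Ajl_eq_curveOp b cp cm hχsupp, Equiv.neg_apply, neg_neg]
    rfl
  have hmain := h l hl p hp hp2 U hU N hN F hFm hFi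
  have hnorm : eLpNorm (⇑f) (eN p) volume = (∫⁻ x, ‖F x‖ₑ ^ p) ^ (1 / p) := by
    rw [eN, eLpNorm_eq_lintegral_rpow_enorm_toReal (by simpa using hp0) ENNReal.ofReal_ne_top,
      ENNReal.toReal_ofReal hp0.le]
    refine congrArg (· ^ (1 / p)) (lintegral_congr fun x => ?_)
    rw [← ofReal_norm, ← ofReal_norm, Complex.norm_real]
  rw [lpN, hδ, hnorm]
  simp only [hsup]
  refine (ENNReal.rpow_le_rpow hmain (by positivity)).trans ?_
  rw [ENNReal.mul_rpow_of_nonneg _ _ (by positivity),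
    ENNReal.ofReal_rpow_of_nonneg (by positivity) (by positivity)]
  refine mul_le_mul_left (ENNReal.ofReal_le_ofReal ?_) _
  have e : (M * (theta p l ^ p * ((2:ℝ) ^ l)⁻¹ ^ (p - 1) * N)) ^ (1 / p) =
      M ^ (1 / p) * theta p l * (((2:ℝ) ^ l)⁻¹ ^ (1 - 1 / p) * (N : ℝ) ^ (1 / p)) := by
    rw [Real.mul_rpow (by positivity) (by positivity), Real.mul_rpow (by positivity) (by positivity),
      Real.mul_rpow (by positivity) (by positivity), ← Real.rpow_mul hθ, ← Real.rpow_mul hδ0.le,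
      mul_one_div, mul_one_div, div_self hp0.ne', Real.rpow_one, sub_div, div_self hp0.ne']
    ring
  rw [e]
  have hM1 : M ^ (1 / p) ≤ M := by
    calc M ^ (1 / p) ≤ M ^ (1 : ℝ) := Real.rpow_le_rpow_of_exponent_le hM
          ((div_le_one hp0).2 hp.le)
      _ = M := Real.rpow_one M
  gcongr

end
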